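/- Let ε > 0, X ≥ 2, 1 ≤ Y ≤ X^{100}, and 1 ≤ M ≤ X^{100}. Then 𝒮_R(|𝓜(q) A₁(q)|; F) ≪ X^ε ( X/Y^{5/6} + X^{13/18} + X^{5/6} M^{1/3}/Y^{1/2} + X^{2/3} M^{1/3} + X^{7/12} M^{1/2} ), where the implied constant depends only on ε, on F, and on the implied constants in the bound λ(𝔟) ≪_ε N(𝔟)^{−1+ε} on the mollifier coefficients. -/

import Mathlib

noncomputable section

open Complex

namespace CubicPaper

/-- `ω = e^{2πi/3}`. -/
def ωc : ℂ := Complex.exp (2 * Real.pi * Complex.I / 3)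

/-- The ring of Eisenstein integers `ℤ[ω]`, realized as a subring of `ℂ`. -/
def Eis : Subring ℂ := Subring.closure {ωc}

/-- `ω` as an Eisenstein integer. -/
def ωE : Eis := ⟨ωc, Subring.subset_closure (Set.mem_singleton _)⟩

/-- The ramified prime `λ = 1 + 2ω`. -/
def lam : Eis := 1 + 2 * ωE

/-- The norm `N(x) = |x|²`. -/
def Nm (x : Eis) : ℝ := Complex.normSq (x : ℂ)

/-- The norm as a natural number. -/
def NmN (x : Eis) : ℕ := ⌊Nm x⌋₊

/-- `Rep x` : `x` is the canonical generator `λ^k c`, `c ≡ 1 (mod 3)`, of a nonzero ideal;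
nonzero ideals of `ℤ[ω]` are in bijection with elements satisfying `Rep`. -/
def Rep (x : Eis) : Prop := ∃ (k : ℕ) (c : Eis), (3 : Eis) ∣ (c - 1) ∧ x = lam ^ k * c

/-- `ě(z) = e^{2πi(z + z̄)}`. -/
def eE (z : ℂ) : ℂ := Complex.exp (2 * Real.pi * Complex.I * (z + (starRingEnd ℂ) z))

/-- Characterizing axioms of the cubic residue symbol; `χ b a` denotes `(a/b)₃`
(the lower entry `b ≡ 1 (mod 3)` comes first). -/
structure IsCubicSymbol (χ : Eis → Eis → Eis) : Prop where
  one_bot : ∀ a, χ 1 a = 1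
  mul_bot : ∀ b₁ b₂ a, (3 : Eis) ∣ (b₁ - 1) → (3 : Eis) ∣ (b₂ - 1) →
    χ (b₁ * b₂) a = χ b₁ a * χ b₂ a
  prime_vals : ∀ π a, Prime π → (3 : Eis) ∣ (π - 1) →
    χ π a = 0 ∨ χ π a = 1 ∨ χ π a = ωE ∨ χ π a = ωE ^ 2
  prime_congr : ∀ π a, Prime π → (3 : Eis) ∣ (π - 1) →
    π ∣ (a ^ ((NmN π - 1) / 3) - χ π a)
  prime_eq_zero : ∀ π a, Prime π → (3 : Eis) ∣ (π - 1) → (χ π a = 0 ↔ π ∣ a)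

/-- Characterizing axioms of the Möbius function on `ℤ[ω]`. -/
structure IsMoebius (μ : Eis → ℤ) : Prop where
  isUnit : ∀ u : Eis, IsUnit u → μ u = 1
  prime_mul : ∀ p x, Prime p → ¬ p ∣ x → μ (p * x) = - μ x
  eq_zero : ∀ x : Eis, ¬ Squarefree x → μ x = 0

/-- The cubic Gauss sum `g₃(m, c) = ∑_{d mod c} χ_c(d) ě(md/c)`. -/
def g₃ (χ : Eis → Eis → Eis) (m c : Eis) : ℂ :=
  ∑ᶠ d : Eis ⧸ Ideal.span {c}, ((χ c d.out : Eis) : ℂ) * eE (((m * d.out : Eis) : ℂ) / (c : ℂ))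

/-- The normalized cubic Gauss sum `g̃₃(m, c) = N(c)^{-1/2} g₃(m, c)`. -/
def g₃n (χ : Eis → Eis → Eis) (m c : Eis) : ℂ :=
  ((Real.sqrt (Nm c) : ℂ))⁻¹ * g₃ χ m c

/-- Euler's totient on `ℤ[ω]`. -/
def phiE (b : Eis) : ℕ := Nat.card {x : Eis ⧸ Ideal.span {b} // IsUnit x}

/-- The kernel `Φ_j(y) = (1/2πi)∫_{(2)} (2π)^{-jw} y^{-w} (Γ(1/2+w)/Γ(1/2))^j dw/w`. -/
def Φ (j : ℕ) (y : ℝ) : ℂ :=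
  (1 / (2 * Real.pi)) * ∫ t : ℝ,
    (2 * Real.pi : ℂ) ^ (-((j : ℂ) * (2 + t * Complex.I))) *
    (y : ℂ) ^ (-(2 + t * Complex.I)) *
    (Complex.Gamma (1 / 2 + (2 + t * Complex.I)) / Complex.Gamma (1 / 2)) ^ j /
    (2 + t * Complex.I)

/-- `A₁(q)`, the sum appearing in the approximate functional equation for `L(1/2, χ_q)`. -/
def A₁ (χ : Eis → Eis → Eis) (q : Eis) : ℂ :=
  ∑' n : {x : Eis // Rep x},
    ((χ q n.1 : Eis) : ℂ) * (Nm n.1 : ℂ) ^ (-(1/2 : ℂ)) *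
      Φ 1 (Nm n.1 / Real.sqrt (3 * Nm q))

/-- `A₂(q)`, the double sum appearing in the approximate functional equation for
`|L(1/2, χ_q)|²`. -/
def A₂ (χ : Eis → Eis → Eis) (q : Eis) : ℂ :=
  ∑' p : {x : Eis // Rep x} × {x : Eis // Rep x},
    ((χ q p.1.1 : Eis) : ℂ) * (starRingEnd ℂ) ((χ q p.2.1 : Eis) : ℂ) *
      ((Nm p.1.1 * Nm p.2.1 : ℝ) : ℂ) ^ (-(1/2 : ℂ)) *
      Φ 2 (Nm p.1.1 * Nm p.2.1 / (3 * Nm q))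

/-- `M_Y(q) = ∑_{𝔩² ∣ q, N(𝔩) ≤ Y} μ(𝔩)` (sum over nonzero ideals `𝔩`, i.e. over
canonical generators). -/
def MY (μ : Eis → ℤ) (Y : ℝ) (q : Eis) : ℤ :=
  ∑ᶠ l ∈ {l : Eis | Rep l ∧ l ^ 2 ∣ q ∧ Nm l ≤ Y}, μ l

/-- `R_Y(q) = ∑_{𝔩² ∣ q, N(𝔩) > Y} μ(𝔩)`. -/
def RY (μ : Eis → ℤ) (Y : ℝ) (q : Eis) : ℤ :=
  ∑ᶠ l ∈ {l : Eis | Rep l ∧ l ^ 2 ∣ q ∧ Y < Nm l}, μ l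

/-- The mollifier `𝓜(q) = ∑_𝔟 λ(𝔟) √N(𝔟) χ_q(𝔟)` attached to coefficients `lm`
(supported on canonical generators of squarefree ideals coprime to 3). -/
def Moll (χ : Eis → Eis → Eis) (lm : Eis → ℂ) (q : Eis) : ℂ :=
  ∑ᶠ b : Eis, lm b * (Real.sqrt (Nm b) : ℂ) * ((χ q b : Eis) : ℂ)

/-- `𝒮_M(β; F) = ∑_{q ≡ 1 (9)} M_Y(q) β_q F(N(q)/X)`. -/
def SM (μ : Eis → ℤ) (Y X : ℝ) (F : ℝ → ℝ) (β : Eis → ℂ) : ℂ :=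
  ∑ᶠ q ∈ {q : Eis | (9 : Eis) ∣ (q - 1)}, (MY μ Y q : ℂ) * β q * (F (Nm q / X) : ℂ)

/-- `𝒮_R(|β|; F) = ∑_{q ≡ 1 (9)} |R_Y(q)| ‖β_q‖ F(N(q)/X)`. -/
def SR (μ : Eis → ℤ) (Y X : ℝ) (F : ℝ → ℝ) (β : Eis → ℂ) : ℝ :=
  ∑ᶠ q ∈ {q : Eis | (9 : Eis) ∣ (q - 1)}, |(RY μ Y q : ℝ)| * ‖β q‖ * F (Nm q / X)

/-- A test function: Schwartz (here: smooth), compactly supported in `(1,2)`,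
with `0 ≤ F ≤ 1`. -/
structure IsTestFn (F : ℝ → ℝ) : Prop where
  smooth : ContDiff ℝ (⊤ : ℕ∞) F
  supp : ∀ t, F t ≠ 0 → 1 < t ∧ t < 2
  nonneg : ∀ t, 0 ≤ F t
  le_one : ∀ t, F t ≤ 1

/-- `F̌(0) = ∫₀^∞ F(t) dt`. -/
def Fcheck0 (F : ℝ → ℝ) : ℝ := ∫ t in Set.Ioi (0:ℝ), F t

/-- `F̌'(0) = ∫₀^∞ F(t) log t dt`. -/
def Fcheck'0 (F : ℝ → ℝ) : ℝ := ∫ t in Set.Ioi (0:ℝ), F t * Real.log t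

/-- The Dedekind zeta function of `ℚ(ω)` (at real `s > 1`). -/
def zetaK (s : ℝ) : ℝ := ∑' n : {x : Eis // Rep x}, (Nm n.1) ^ (-s)

/-- Product of `f(N(𝔭))` over the prime ideals `𝔭 ∤ 3` of `ℤ[ω]`, i.e. over primes
`π ≡ 1 (mod 3)` (one in each associate class). -/
def primeProd (f : ℝ → ℝ) : ℝ :=
  ∏' π : {p : Eis // Prime p ∧ (3 : Eis) ∣ (p - 1)}, f (Nm π.1)

/-- Product of `f(N(𝔭))` over the prime ideals `𝔭 ∤ 3` dividing `x` (a finite product). -/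
def primeDivProd (f : ℝ → ℝ) (x : Eis) : ℝ :=
  ∏ᶠ π ∈ {p : Eis | Prime p ∧ (3 : Eis) ∣ (p - 1) ∧ p ∣ x}, f (Nm π)

/-- The Hecke `L`-series `∑_𝔫 χ_q(𝔫) N(𝔫)^{-s}` (convergent for `Re(s) > 1`). -/
def heckeSeries (χ : Eis → Eis → Eis) (q : Eis) (s : ℂ) : ℂ :=
  ∑' n : {x : Eis // Rep x}, ((χ q n.1 : Eis) : ℂ) * (Nm n.1 : ℂ) ^ (-s)

/-- `L` is the (unique) entire continuation of the Hecke `L`-series of `χ_q`. -/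
def IsHeckeL (χ : Eis → Eis → Eis) (q : Eis) (L : ℂ → ℂ) : Prop :=
  Differentiable ℂ L ∧ ∀ s : ℂ, 1 < s.re → L s = heckeSeries χ q s

/-- Membership in the family `F₃` of conductors of primitive cubic Hecke characters
congruent to `1 (mod 9)`. -/
def memF₃ (q : Eis) : Prop :=
  ∃ q₁ q₂ : Eis, (3 : Eis) ∣ (q₁ - 1) ∧ (3 : Eis) ∣ (q₂ - 1) ∧ Squarefree (q₁ * q₂) ∧
    NmN (q₁ * q₂ ^ 2) % 9 = 1 ∧ q = q₁ * q₂ ^ 2 ∧ (9 : Eis) ∣ (q - 1) ∧ q ≠ 1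

/-- `ψ_α(r, s) = ∑_{c ≡ 1 (3), (c, α) = 1} g₃(r, c) N(c)^{-s}`. -/
def ψa (χ : Eis → Eis → Eis) (α r : Eis) (s : ℂ) : ℂ :=
  ∑' c : {c : Eis // (3 : Eis) ∣ (c - 1) ∧ IsCoprime c α},
    g₃ χ r c.1 * (Nm c.1 : ℂ) ^ (-s)

/-- `ψ(r, s) = ∑_{c ≡ 1 (3)} g₃(r, c) N(c)^{-s}`. -/
def ψ₀ (χ : Eis → Eis → Eis) (r : Eis) (s : ℂ) : ℂ :=
  ∑' c : {c : Eis // (3 : Eis) ∣ (c - 1)}, g₃ χ r c.1 * (Nm c.1 : ℂ) ^ (-s)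

/-- `Δ_α(s) = ∏_{π ≡ 1 (3) prime, π ∣ α} (1 - N(π)^{2-3s})`. -/
def Δprod (α : Eis) (s : ℂ) : ℂ :=
  ∏ᶠ π ∈ {p : Eis | Prime p ∧ (3 : Eis) ∣ (p - 1) ∧ p ∣ α},
    (1 - (Nm π : ℂ) ^ ((2 : ℂ) - 3 * s))

/-- `Ψ` is the (unique) continuation of `ψ(r, ·)` to the strip `1 < Re(s) < 2`,
holomorphic away from `s = 4/3`. -/
def IsPsiContinuation (χ : Eis → Eis → Eis) (r : Eis) (Ψ : ℂ → ℂ) : Prop :=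
  (∀ s : ℂ, 1 < s.re → s.re < 2 → s ≠ 4/3 → DifferentiableAt ℂ Ψ s) ∧
  (∀ s : ℂ, 3/2 < s.re → s.re < 2 → Ψ s = ψ₀ χ r s)


section P1

lemma ωc_eq : ωc = -1/2 + (Real.sqrt 3 / 2 : ℝ) * Complex.I := by
  unfold ωc
  have h : (2 * Real.pi * Complex.I / 3 : ℂ) = ((2 * Real.pi / 3 : ℝ) : ℂ) * Complex.I := by
    push_cast; ring
  rw [h, Complex.exp_mul_I, ← Complex.ofReal_cos, ← Complex.ofReal_sin]
  have h1 : (2 * Real.pi / 3 : ℝ) = Real.pi - Real.pi / 3 := by ring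
  rw [h1, Real.cos_pi_sub, Real.sin_pi_sub, Real.cos_pi_div_three, Real.sin_pi_div_three]
  push_cast; ring

lemma ωc_sq : ωc ^ 2 = -1 - ωc := by
  rw [ωc_eq]
  have h3 : ((Real.sqrt 3 : ℝ) : ℂ) ^ 2 = 3 := by
    rw [← Complex.ofReal_pow, Real.sq_sqrt (by norm_num)]; norm_num
  have hI : Complex.I ^ 2 = -1 := Complex.I_sq
  push_cast
  ring_nf
  rw [h3, hI]; ring

lemma ωc_re : ωc.re = -1/2 := by rw [ωc_eq]; simp
lemma ωc_im : ωc.im = Real.sqrt 3 / 2 := by rw [ωc_eq]; simp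

/-- `a + b ω`. -/
def mkE (a b : ℤ) : Eis := (a : Eis) + (b : Eis) * ωE

lemma mkE_coe (a b : ℤ) : ((mkE a b : Eis) : ℂ) = a + b * ωc := by
  simp [mkE, ωE]

lemma mkE_re (a b : ℤ) : ((mkE a b : Eis) : ℂ).re = a - b / 2 := by
  rw [mkE_coe]; simp [ωc_re]; ring
lemma mkE_im (a b : ℤ) : ((mkE a b : Eis) : ℂ).im = b * (Real.sqrt 3 / 2) := by
  rw [mkE_coe]; simp [ωc_im]

lemma exists_mkE (x : Eis) : ∃ a b : ℤ, x = mkE a b := by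
  obtain ⟨x, hx⟩ := x
  have : ∃ a b : ℤ, x = a + b * ωc := by
    refine Subring.closure_induction (p := fun x _ => ∃ a b : ℤ, x = a + b * ωc) ?_ ?_ ?_ ?_ ?_ ?_ hx
    · intro x hx; rw [Set.mem_singleton_iff] at hx; exact ⟨0, 1, by simp [hx]⟩
    · exact ⟨0, 0, by simp⟩
    · exact ⟨1, 0, by simp⟩
    · rintro x y _ _ ⟨a, b, rfl⟩ ⟨c, d, rfl⟩; exact ⟨a + c, b + d, by push_cast; ring⟩
    · rintro x _ ⟨a, b, rfl⟩; exact ⟨-a, -b, by push_cast; ring⟩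
    · rintro x y _ _ ⟨a, b, rfl⟩ ⟨c, d, rfl⟩
      refine ⟨a * c - b * d, a * d + b * c - b * d, ?_⟩
      push_cast
      linear_combination (b * d : ℂ) * ωc_sq
  obtain ⟨a, b, h⟩ := this
  exact ⟨a, b, Subtype.ext (by rw [mkE_coe]; exact h)⟩

lemma mkE_inj {a b c d : ℤ} (h : mkE a b = mkE c d) : a = c ∧ b = d := by
  have h2 := congrArg (fun x : Eis => (x : ℂ).im) h
  have h1 := congrArg (fun x : Eis => (x : ℂ).re) h
  simp only [mkE_im, mkE_re] at h1 h2
  have hs : (Real.sqrt 3 / 2) ≠ 0 := by positivity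
  have h3 := mul_right_cancel₀ hs h2
  have h4 : b = d := by exact_mod_cast h3
  subst h4
  refine ⟨?_, rfl⟩
  have : (a : ℝ) = c := by linarith
  exact_mod_cast this

/-- coordinates -/
def eisEquiv : ℤ × ℤ ≃ Eis :=
  Equiv.ofBijective (fun p => mkE p.1 p.2)
    ⟨fun p q h => by obtain ⟨h1, h2⟩ := mkE_inj h; exact Prod.ext h1 h2,
     fun x => by obtain ⟨a, b, h⟩ := exists_mkE x; exact ⟨(a, b), h.symm⟩⟩

lemma eisEquiv_apply (p : ℤ × ℤ) : eisEquiv p = mkE p.1 p.2 := rfl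

lemma mkE_mul (a b c d : ℤ) : mkE a b * mkE c d = mkE (a * c - b * d) (a * d + b * c - b * d) := by
  apply Subtype.ext
  rw [Subring.coe_mul, mkE_coe, mkE_coe, mkE_coe]
  push_cast
  linear_combination (b * d : ℂ) * ωc_sq
lemma mkE_add (a b c d : ℤ) : mkE a b + mkE c d = mkE (a + c) (b + d) := by
  simp [mkE]; ring
lemma mkE_sub (a b c d : ℤ) : mkE a b - mkE c d = mkE (a - c) (b - d) := by
  simp [mkE]; ring
lemma mkE_neg (a b : ℤ) : -mkE a b = mkE (-a) (-b) := by
  simp [mkE]; ring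
lemma one_eq_mkE : (1 : Eis) = mkE 1 0 := by simp [mkE]
lemma zero_eq_mkE : (0 : Eis) = mkE 0 0 := by simp [mkE]
lemma ωE_eq_mkE : ωE = mkE 0 1 := by simp [mkE]
lemma lam_eq_mkE : lam = mkE 1 2 := by simp [mkE, lam]
lemma intCast_eq_mkE (n : ℤ) : (n : Eis) = mkE n 0 := by simp [mkE]
lemma three_eq_mkE : (3 : Eis) = mkE 3 0 := by simp [mkE]

lemma ωE_sq : ωE ^ 2 = -1 - ωE := by
  apply Subtype.ext; simpa [ωE] using ωc_sq
lemma ωE_cube : ωE ^ 3 = 1 := by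
  linear_combination (ωE - 1) * ωE_sq

lemma lam_sq : lam ^ 2 = -3 := by
  unfold lam; linear_combination 4 * ωE_sq

lemma Nm_mkE (a b : ℤ) : Nm (mkE a b) = ((a ^ 2 - a * b + b ^ 2 : ℤ) : ℝ) := by
  unfold Nm
  rw [Complex.normSq_apply, mkE_re, mkE_im]
  have h3 : Real.sqrt 3 * Real.sqrt 3 = 3 := Real.mul_self_sqrt (by norm_num)
  push_cast
  linear_combination (b ^ 2 / 4 : ℝ) * h3

lemma Nm_nonneg (x : Eis) : 0 ≤ Nm x := Complex.normSq_nonneg _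
lemma Nm_mul (x y : Eis) : Nm (x * y) = Nm x * Nm y := by simp [Nm]
lemma Nm_zero : Nm 0 = 0 := by simp [Nm]
lemma Nm_one : Nm 1 = 1 := by simp [Nm]
lemma Nm_pow (x : Eis) (k : ℕ) : Nm (x ^ k) = Nm x ^ k := by simp [Nm]
lemma Nm_neg (x : Eis) : Nm (-x) = Nm x := by simp [Nm]
lemma Nm_eq_zero {x : Eis} : Nm x = 0 ↔ x = 0 := by simp [Nm]
lemma Nm_lam : Nm lam = 3 := by rw [lam_eq_mkE, Nm_mkE]; norm_num
lemma Nm_ω : Nm ωE = 1 := by rw [ωE_eq_mkE, Nm_mkE]; norm_num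
lemma Nm_eq_norm_sq (x : Eis) : Nm x = ‖(x : ℂ)‖ ^ 2 := Complex.normSq_eq_norm_sq _

lemma Nm_int (x : Eis) : ∃ n : ℕ, Nm x = n := by
  obtain ⟨a, b, rfl⟩ := exists_mkE x
  have h : 0 ≤ a ^ 2 - a * b + b ^ 2 := by nlinarith [sq_nonneg (a - b), sq_nonneg a, sq_nonneg b]
  obtain ⟨n, hn⟩ := Int.eq_ofNat_of_zero_le h
  exact ⟨n, by rw [Nm_mkE, hn]; simp⟩

lemma NmN_cast (x : Eis) : (NmN x : ℝ) = Nm x := by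
  obtain ⟨n, hn⟩ := Nm_int x
  simp [NmN, hn]

lemma Nm_pos {x : Eis} (hx : x ≠ 0) : 0 < Nm x :=
  lt_of_le_of_ne (Nm_nonneg x) (fun h => hx (Nm_eq_zero.1 h.symm))

lemma one_le_Nm {x : Eis} (hx : x ≠ 0) : 1 ≤ Nm x := by
  have := Nm_pos hx
  obtain ⟨n, hn⟩ := Nm_int x
  rw [hn] at this ⊢
  have h : 0 < n := by exact_mod_cast this
  exact_mod_cast h

lemma NmN_mul (x y : Eis) : NmN (x * y) = NmN x * NmN y := by
  have : (NmN (x * y) : ℝ) = (NmN x * NmN y : ℕ) := by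
    push_cast; rw [NmN_cast, NmN_cast, NmN_cast, Nm_mul]
  exact_mod_cast this

/-- Complex conjugation on Eis. -/
lemma conj_mem (x : Eis) : (starRingEnd ℂ) (x : ℂ) ∈ Eis := by
  obtain ⟨a, b, rfl⟩ := exists_mkE x
  have : (starRingEnd ℂ) ((mkE a b : Eis) : ℂ) = ((mkE (a - b) (-b) : Eis) : ℂ) := by
    apply Complex.ext
    · rw [Complex.conj_re, mkE_re, mkE_re]; push_cast; ring
    · rw [Complex.conj_im, mkE_im, mkE_im]; push_cast; ring
  rw [this]; exact Subtype.mem _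

def conjE : Eis →+* Eis where
  toFun x := ⟨(starRingEnd ℂ) (x : ℂ), conj_mem x⟩
  map_one' := by apply Subtype.ext; simp
  map_zero' := by apply Subtype.ext; simp
  map_add' x y := by apply Subtype.ext; simp
  map_mul' x y := by apply Subtype.ext; simp

lemma conjE_coe (x : Eis) : ((conjE x : Eis) : ℂ) = (starRingEnd ℂ) (x : ℂ) := rfl
lemma conjE_conjE (x : Eis) : conjE (conjE x) = x := by
  apply Subtype.ext; simp [conjE_coe]
lemma mul_conjE (x : Eis) : x * conjE x = (NmN x : Eis) := by
  apply Subtype.ext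
  rw [Subring.coe_mul, conjE_coe, Complex.mul_conj]
  have : ((NmN x : Eis) : ℂ) = ((NmN x : ℝ) : ℂ) := by simp
  rw [this, NmN_cast]; rfl
lemma Nm_conjE (x : Eis) : Nm (conjE x) = Nm x := by
  simp [Nm, conjE_coe]
lemma NmN_conjE (x : Eis) : NmN (conjE x) = NmN x := by
  simp [NmN, Nm_conjE]

lemma exists_quot (x y : Eis) (hy : y ≠ 0) : ∃ q, Nm (x - y * q) < Nm y := by
  have hyc : (y : ℂ) ≠ 0 := fun h => hy (Subtype.ext h)
  set z : ℂ := (x : ℂ) / y with hz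
  set b : ℤ := round (z.im / (Real.sqrt 3 / 2)) with hb
  set a : ℤ := round (z.re + b / 2) with ha
  have hs : 0 < Real.sqrt 3 / 2 := by positivity
  have h1 := abs_sub_round (z.im / (Real.sqrt 3 / 2))
  have h2 := abs_sub_round (z.re + b / 2)
  rw [← hb] at h1; rw [← ha] at h2
  refine ⟨mkE a b, ?_⟩
  have key : Complex.normSq (z - (mkE a b : Eis)) < 1 := by
    rw [Complex.normSq_apply, Complex.sub_re, Complex.sub_im, mkE_re, mkE_im]
    have e1 : |z.re - (a - b / 2)| ≤ 1 / 2 := by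
      have : z.re - (a - b / 2 : ℝ) = z.re + b / 2 - a := by ring
      rw [this]; exact h2
    have e2 : |z.im - b * (Real.sqrt 3 / 2)| ≤ 1 / 2 * (Real.sqrt 3 / 2) := by
      have : z.im - b * (Real.sqrt 3 / 2) = (z.im / (Real.sqrt 3 / 2) - b) * (Real.sqrt 3 / 2) := by
        field_simp
      rw [this, abs_mul, abs_of_pos hs]
      exact mul_le_mul_of_nonneg_right h1 hs.le
    have h3 : Real.sqrt 3 * Real.sqrt 3 = 3 := Real.mul_self_sqrt (by norm_num)
    have f1 := abs_le.1 e1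
    have f2 := abs_le.1 e2
    nlinarith [f1.1, f1.2, f2.1, f2.2]
  have : ((x - y * mkE a b : Eis) : ℂ) = y * (z - (mkE a b : Eis)) := by
    rw [hz]; push_cast; field_simp
  unfold Nm
  rw [this, map_mul]
  have := Complex.normSq_pos.2 hyc
  nlinarith

lemma NmN_lt {x y : Eis} : NmN x < NmN y ↔ Nm x < Nm y := by
  rw [← NmN_cast, ← NmN_cast]; exact_mod_cast Iff.rfl

instance : IsPrincipalIdealRing Eis := by
  refine ⟨fun S => ?_⟩
  by_cases hS : S = ⊥
  · subst hS; exact ⟨0, by simp⟩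
  obtain ⟨x0, hx0, hx0'⟩ := Submodule.exists_mem_ne_zero_of_ne_bot hS
  have hne : {n : ℕ | ∃ x ∈ S, x ≠ 0 ∧ NmN x = n}.Nonempty := ⟨_, x0, hx0, hx0', rfl⟩
  obtain ⟨m, hm, hm0, hmn⟩ := Nat.sInf_mem hne
  refine ⟨m, le_antisymm ?_ ?_⟩
  · intro x hx
    obtain ⟨q, hq⟩ := exists_quot x m hm0
    have hr : x - m * q ∈ S := S.sub_mem hx (S.mul_mem_right q hm)
    by_cases h0 : x - m * q = 0
    · rw [Submodule.mem_span_singleton]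
      exact ⟨q, by rw [smul_eq_mul, mul_comm]; exact (sub_eq_zero.1 h0).symm⟩
    · exfalso
      have := Nat.sInf_le (s := {n : ℕ | ∃ x ∈ S, x ≠ 0 ∧ NmN x = n}) ⟨_, hr, h0, rfl⟩
      rw [← hmn] at this
      exact absurd (NmN_lt.2 hq) (not_lt.2 this)
  · rw [Submodule.span_singleton_le_iff_mem]; exact hm


lemma isUnit_iff_Nm {x : Eis} : IsUnit x ↔ Nm x = 1 := by
  constructor
  · intro h
    obtain ⟨y, hy⟩ := h.exists_right_inv
    have h1 : Nm x * Nm y = 1 := by rw [← Nm_mul, hy, Nm_one]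
    have hx : x ≠ 0 := h.ne_zero
    have hy0 : y ≠ 0 := by rintro rfl; simp at hy
    nlinarith [one_le_Nm hx, one_le_Nm hy0]
  · intro h
    refine IsUnit.of_mul_eq_one (conjE x) ?_
    rw [mul_conjE]
    have : NmN x = 1 := by have := NmN_cast x; rw [h] at this; exact_mod_cast this
    simp [this]

lemma unit_cases {u : Eis} (h : IsUnit u) :
    u = 1 ∨ u = -1 ∨ u = ωE ∨ u = -ωE ∨ u = ωE ^ 2 ∨ u = -ωE ^ 2 := by
  rw [isUnit_iff_Nm] at h
  obtain ⟨a, b, rfl⟩ := exists_mkE u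
  rw [Nm_mkE] at h
  have h : a ^ 2 - a * b + b ^ 2 = 1 := by exact_mod_cast h
  have ha : a ≤ 1 := by nlinarith [sq_nonneg (2 * b - a)]
  have ha' : -1 ≤ a := by nlinarith [sq_nonneg (2 * b - a)]
  have hb : b ≤ 1 := by nlinarith [sq_nonneg (2 * a - b)]
  have hb' : -1 ≤ b := by nlinarith [sq_nonneg (2 * a - b)]
  rw [ωE_sq]
  interval_cases a <;> interval_cases b <;> first | (exfalso; revert h; norm_num; done) | skip
  all_goals simp [mkE, sub_eq_add_neg, add_comm]

lemma isUnit_ω : IsUnit ωE := isUnit_iff_Nm.2 Nm_ω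

/-- Primary: `x ≡ 1 mod 3`. -/
def Pri (x : Eis) : Prop := (3 : Eis) ∣ (x - 1)

lemma three_dvd_mkE {a b : ℤ} : (3 : Eis) ∣ mkE a b ↔ 3 ∣ a ∧ 3 ∣ b := by
  constructor
  · rintro ⟨c, hc⟩
    obtain ⟨c1, c2, rfl⟩ := exists_mkE c
    rw [three_eq_mkE, mkE_mul] at hc
    obtain ⟨h1, h2⟩ := mkE_inj hc
    exact ⟨⟨c1, by linarith⟩, ⟨c2, by linarith⟩⟩
  · rintro ⟨⟨c, rfl⟩, ⟨d, rfl⟩⟩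
    exact ⟨mkE c d, by rw [three_eq_mkE, mkE_mul]; congr 1 <;> ring⟩

lemma pri_mkE {a b : ℤ} : Pri (mkE a b) ↔ 3 ∣ a - 1 ∧ 3 ∣ b := by
  unfold Pri; rw [one_eq_mkE, mkE_sub, three_dvd_mkE]; simp

lemma lam_dvd_mkE {a b : ℤ} : lam ∣ mkE a b ↔ 3 ∣ a + b := by
  constructor
  · rintro ⟨c, hc⟩
    obtain ⟨c1, c2, rfl⟩ := exists_mkE c
    rw [lam_eq_mkE, mkE_mul] at hc
    obtain ⟨h1, h2⟩ := mkE_inj hc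
    exact ⟨c1 - c2, by rw [h1, h2]; ring⟩
  · rintro ⟨k, hk⟩
    refine ⟨mkE (-a + 2 * k) (k - a), ?_⟩
    rw [lam_eq_mkE, mkE_mul]
    congr 1
    · ring
    · linarith

lemma prime_lam : Prime lam := by
  refine ⟨?_, ?_, ?_⟩
  · intro h; have := Nm_lam; rw [h, Nm_zero] at this; norm_num at this
  · intro h; rw [isUnit_iff_Nm, Nm_lam] at h; norm_num at h
  · intro x y h
    obtain ⟨a, b, rfl⟩ := exists_mkE x
    obtain ⟨c, d, rfl⟩ := exists_mkE y
    rw [mkE_mul] at h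
    rw [lam_dvd_mkE] at h ⊢
    rw [lam_dvd_mkE]
    have : (3 : ℤ) ∣ (a + b) * (c + d) := by
      have h2 : (a + b) * (c + d) = (a * c - b * d + (a * d + b * c - b * d)) + 3 * (b * d) := by ring
      rw [h2]; exact dvd_add h (Dvd.intro _ rfl)
    exact (Int.prime_iff_natAbs_prime.2 (by norm_num)).dvd_or_dvd this

lemma lam_dvd_three : lam ∣ (3 : Eis) := ⟨-lam, by linear_combination lam_sq⟩

lemma Pri.one : Pri 1 := by simp [Pri]
lemma Pri.mul {x y : Eis} (hx : Pri x) (hy : Pri y) : Pri (x * y) := by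
  have : x * y - 1 = (x - 1) * y + (y - 1) := by ring
  unfold Pri; rw [this]; exact dvd_add (hx.mul_right _) hy
lemma Pri.pow {x : Eis} (hx : Pri x) (k : ℕ) : Pri (x ^ k) := by
  induction k with
  | zero => simpa using Pri.one
  | succ k ih => rw [pow_succ]; exact ih.mul hx
lemma not_three_dvd_one : ¬ lam ∣ (1 : Eis) := fun h => prime_lam.not_isUnit (isUnit_of_dvd_one h)
lemma Pri.not_lam_dvd {x : Eis} (hx : Pri x) : ¬ lam ∣ x := by
  intro h
  have : lam ∣ x - (x - 1) := dvd_sub h (lam_dvd_three.trans hx)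
  rw [sub_sub_cancel] at this
  exact not_three_dvd_one this
lemma Pri.ne_zero {x : Eis} (hx : Pri x) : x ≠ 0 := by
  rintro rfl; exact hx.not_lam_dvd (dvd_zero _)
lemma Pri.isCoprime_three {x : Eis} (hx : Pri x) : IsCoprime x 3 := by
  obtain ⟨c, hc⟩ := hx
  exact ⟨1, -c, by linear_combination hc⟩

lemma exists_pri_assoc {x : Eis} (hx : ¬ lam ∣ x) : ∃ u : Eis, IsUnit u ∧ Pri (u * x) := by
  obtain ⟨a, b, rfl⟩ := exists_mkE x
  rw [lam_dvd_mkE] at hx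
  have cases : (3 ∣ a - 1 ∧ 3 ∣ b) ∨ (3 ∣ a + 1 ∧ 3 ∣ b) ∨ (3 ∣ a ∧ 3 ∣ b - 1) ∨ (3 ∣ a ∧ 3 ∣ b + 1) ∨
    (3 ∣ a - 1 ∧ 3 ∣ b - 1) ∨ (3 ∣ a + 1 ∧ 3 ∣ b + 1) := by omega
  have U : ∀ c d : ℤ, c ^ 2 - c * d + d ^ 2 = 1 → IsUnit (mkE c d) := fun c d h =>
    isUnit_iff_Nm.2 (by rw [Nm_mkE, h]; norm_num)
  rcases cases with h | h | h | h | h | h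
  · exact ⟨mkE 1 0, U _ _ (by norm_num), by rw [mkE_mul, pri_mkE]; omega⟩
  · exact ⟨mkE (-1) 0, U _ _ (by norm_num), by rw [mkE_mul, pri_mkE]; omega⟩
  · exact ⟨mkE (-1) (-1), U _ _ (by norm_num), by rw [mkE_mul, pri_mkE]; omega⟩
  · exact ⟨mkE 1 1, U _ _ (by norm_num), by rw [mkE_mul, pri_mkE]; omega⟩
  · exact ⟨mkE 0 (-1), U _ _ (by norm_num), by rw [mkE_mul, pri_mkE]; omega⟩
  · exact ⟨mkE 0 1, U _ _ (by norm_num), by rw [mkE_mul, pri_mkE]; omega⟩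

lemma pri_unit_eq_one {u : Eis} (hu : IsUnit u) (hp : Pri u) : u = 1 := by
  rw [isUnit_iff_Nm] at hu
  obtain ⟨a, b, rfl⟩ := exists_mkE u
  rw [Nm_mkE] at hu
  have h : a ^ 2 - a * b + b ^ 2 = 1 := by exact_mod_cast hu
  rw [pri_mkE] at hp
  have ha : a ≤ 1 := by nlinarith [sq_nonneg (2 * b - a)]
  have ha' : -1 ≤ a := by nlinarith [sq_nonneg (2 * b - a)]
  have hb : b ≤ 1 := by nlinarith [sq_nonneg (2 * a - b)]
  have hb' : -1 ≤ b := by nlinarith [sq_nonneg (2 * a - b)]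
  have : b = 0 := by omega
  have : a = 1 := by omega
  subst a b; exact one_eq_mkE.symm

lemma Pri.eq_of_mul {u x : Eis} (hu : IsUnit u) (hx : Pri x) (hux : Pri (u * x)) : u = 1 := by
  apply pri_unit_eq_one hu
  obtain ⟨c, hc⟩ := hx
  obtain ⟨d, hd⟩ := hux
  exact ⟨d - u * c, by linear_combination hd - u * hc⟩

lemma Pri.associated_eq {x y : Eis} (hx : Pri x) (hy : Pri y) (h : Associated x y) : x = y := by
  obtain ⟨u, hu⟩ := h
  have : (u : Eis) = 1 := Pri.eq_of_mul u.isUnit hx (by rw [mul_comm, hu]; exact hy)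
  rw [← hu, this, mul_one]

/-- cancelling -/
lemma Pri.of_mul_left {x y : Eis} (hx : Pri x) (hxy : Pri (x * y)) : Pri y := by
  obtain ⟨c, hc⟩ := hx
  obtain ⟨d, hd⟩ := hxy
  exact ⟨d - y * c, by linear_combination hd - y * hc⟩

lemma exists_factor {x : Eis} (hx : x ≠ 0) :
    ∃ (u : Eis) (j : ℕ) (c : Eis), IsUnit u ∧ Pri c ∧ x = u * lam ^ j * c := by
  obtain ⟨j, c, hc, h⟩ := WfDvdMonoid.max_power_factor hx prime_lam.irreducible
  obtain ⟨u, hu, hp⟩ := exists_pri_assoc hc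
  obtain ⟨v, hv⟩ := hu.exists_right_inv
  refine ⟨v, j, u * c, IsUnit.of_mul_eq_one u (by rw [mul_comm]; exact hv), hp, ?_⟩
  rw [h]; linear_combination (-lam ^ j * c) * hv

end P1

section P1b
open scoped Classical

lemma Nm_coord (a b : ℤ) : (3/4 : ℝ) * (a:ℝ)^2 ≤ Nm (mkE a b) ∧ (3/4 : ℝ) * (b:ℝ)^2 ≤ Nm (mkE a b) := by
  rw [Nm_mkE]; push_cast
  constructor
  · nlinarith [sq_nonneg ((b:ℝ) - a/2)]
  · nlinarith [sq_nonneg ((a:ℝ) - b/2)]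

lemma ball_subset (Z : ℝ) : {x : Eis | Nm x ≤ Z} ⊆
    (fun p : ℤ × ℤ => mkE p.1 p.2) '' ((Finset.Icc (-⌊2 * Real.sqrt Z⌋) ⌊2 * Real.sqrt Z⌋ ×ˢ
      Finset.Icc (-⌊2 * Real.sqrt Z⌋) ⌊2 * Real.sqrt Z⌋ : Finset (ℤ × ℤ)) : Set (ℤ × ℤ)) := by
  intro x hx
  obtain ⟨a, b, rfl⟩ := exists_mkE x
  simp only [Set.mem_ofPred_eq] at hx
  obtain ⟨h1, h2⟩ := Nm_coord a b
  have key : ∀ a : ℤ, (3/4 : ℝ) * (a:ℝ)^2 ≤ Z → -⌊2 * Real.sqrt Z⌋ ≤ a ∧ a ≤ ⌊2 * Real.sqrt Z⌋ := by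
    intro a ha
    have hZ : 0 ≤ Z := le_trans (by positivity) ha
    have : |(a:ℝ)| ≤ 2 * Real.sqrt Z := by
      apply abs_le_of_sq_le_sq _ (by positivity)
      rw [mul_pow, Real.sq_sqrt hZ]; nlinarith
    rw [abs_le] at this
    constructor
    · rw [neg_le, Int.le_floor]; push_cast; linarith
    · rw [Int.le_floor]; linarith
  refine ⟨(a, b), ?_, rfl⟩
  simp only [Finset.coe_product, Set.mem_prod, Finset.coe_Icc, Set.mem_Icc]
  exact ⟨key a (h1.trans hx), key b (h2.trans hx)⟩

lemma ball_finite (Z : ℝ) : {x : Eis | Nm x ≤ Z}.Finite :=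
  ((Finset.finite_toSet _).image _).subset (ball_subset Z)

/-- The finite set of Eisenstein integers of norm at most `Z`. -/
def ball (Z : ℝ) : Finset Eis := (ball_finite Z).toFinset

@[simp] lemma mem_ball {Z : ℝ} {x : Eis} : x ∈ ball Z ↔ Nm x ≤ Z := by simp [ball]

lemma card_ball {Z : ℝ} (hZ : 1 ≤ Z) : ((ball Z).card : ℝ) ≤ 25 * Z := by
  classical
  set f := ⌊2 * Real.sqrt Z⌋ with hf
  have hs : 1 ≤ Real.sqrt Z := Real.one_le_sqrt.2 hZ
  have hf0 : 0 ≤ f := Int.floor_nonneg.2 (by positivity)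
  have h1 : (ball Z).card ≤ ((Finset.Icc (-f) f ×ˢ Finset.Icc (-f) f).image
      (fun p : ℤ × ℤ => mkE p.1 p.2)).card := by
    apply Finset.card_le_card
    intro x hx
    rw [mem_ball] at hx
    have := ball_subset Z hx
    rw [← Finset.coe_image] at this
    exact_mod_cast this
  have h2 := h1.trans Finset.card_image_le
  rw [Finset.card_product, Int.card_Icc] at h2
  have h3 : ((f + 1 - -f).toNat : ℝ) = 2 * f + 1 := by
    have : ((f + 1 - -f).toNat : ℤ) = 2 * f + 1 := by omega
    exact_mod_cast this
  have h4 : ((ball Z).card : ℝ) ≤ (2 * f + 1) * (2 * f + 1) := by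
    rw [← h3]; exact_mod_cast h2
  have h5 : (f : ℝ) ≤ 2 * Real.sqrt Z := Int.floor_le _
  have h6 : Real.sqrt Z * Real.sqrt Z = Z := Real.mul_self_sqrt (by linarith)
  have h7 : (0:ℝ) ≤ f := by exact_mod_cast hf0
  nlinarith

lemma summable_Nm {s : ℝ} (hs : 1 < s) : Summable (fun x : Eis => Nm x ^ (-s)) := by
  -- dyadic: use comparison with sup norm
  have h0 : Summable (fun x : Fin 2 → ℤ => ‖x‖ ^ (-(2*s))) := by
    simpa using (EisensteinSeries.summable_one_div_norm_rpow (k := 2*s) (by linarith))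
  have e : (Fin 2 → ℤ) ≃ Eis := (finTwoArrowEquiv ℤ).trans eisEquiv
  rw [← ((finTwoArrowEquiv ℤ).trans eisEquiv).summable_iff]
  refine Summable.of_nonneg_of_le (fun x => Real.rpow_nonneg (Nm_nonneg _) _) ?_ (h0.mul_left ((3/4)^(-s)))
  intro x
  change Nm (mkE (x 0) (x 1)) ^ (-s) ≤ _
  by_cases hx : x = 0
  · subst hx; 
    have : mkE ((0 : Fin 2 → ℤ) 0) ((0 : Fin 2 → ℤ) 1) = 0 := by simp [mkE]
    rw [this, Nm_zero, Real.zero_rpow (by linarith)]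
    positivity
  have hn : 0 < ‖x‖ := norm_pos_iff.2 hx
  have h1 : (3/4) * ‖x‖^2 ≤ Nm (mkE (x 0) (x 1)) := by
    obtain ⟨h1, h2⟩ := Nm_coord (x 0) (x 1)
    have : ‖x‖ = |(x 0 : ℝ)| ∨ ‖x‖ = |(x 1 : ℝ)| := by
      rw [EisensteinSeries.norm_eq_max_natAbs]
      rcases max_choice (x 0).natAbs (x 1).natAbs with h | h <;> rw [h]
      · left; simp [Nat.cast_natAbs]
      · right; simp [Nat.cast_natAbs]
    rcases this with h | h <;> rw [h, sq_abs] <;> assumption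
  calc _ ≤ ((3/4) * ‖x‖^2) ^ (-s) := Real.rpow_le_rpow_of_nonpos (by positivity) h1 (by linarith)
    _ = _ := by
      rw [Real.mul_rpow (by norm_num) (by positivity), ← Real.rpow_natCast, ← Real.rpow_mul hn.le]
      congr 2; push_cast; ring

/-! ### divisors -/

lemma Pri.of_dvd_not_lam {x d : Eis} (hx : Pri x) (h : d ∣ x) : ¬ lam ∣ d :=
  fun h' => hx.not_lam_dvd (h'.trans h)

lemma Nm_le_of_dvd {d x : Eis} (hx : x ≠ 0) (h : d ∣ x) : Nm d ≤ Nm x := by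
  obtain ⟨c, rfl⟩ := h
  rw [Nm_mul]
  have hc : c ≠ 0 := right_ne_zero_of_mul hx
  nlinarith [one_le_Nm hc, Nm_nonneg d]

/-- primary divisors -/
def pd (x : Eis) : Finset Eis := by
  classical exact (ball (Nm x)).filter (fun d => Pri d ∧ d ∣ x)

lemma mem_pd {x d : Eis} (hx : x ≠ 0) : d ∈ pd x ↔ Pri d ∧ d ∣ x := by
  simp only [pd, Finset.mem_filter, mem_ball]
  exact ⟨fun h => h.2, fun h => ⟨Nm_le_of_dvd hx h.2, h⟩⟩

lemma Pri.induction {P : Eis → Prop} (h1 : P 1)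
    (hp : ∀ p x, Prime p → Pri p → Pri x → P x → P (p * x)) : ∀ x, Pri x → P x := by
  have key : ∀ n : ℕ, ∀ x, NmN x ≤ n → Pri x → P x := by
    intro n
    induction n with
    | zero =>
      intro x hx hpx
      have := NmN_cast x
      rw [Nat.le_zero.1 hx] at this
      exact absurd (Nm_eq_zero.1 (by simpa using this.symm)) hpx.ne_zero
    | succ n ih =>
      intro x hx hpx
      by_cases hu : IsUnit x
      · rw [pri_unit_eq_one hu hpx]; exact h1
      obtain ⟨q, hq, hqx⟩ := WfDvdMonoid.exists_irreducible_factor hu hpx.ne_zero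
      obtain ⟨u, hu1, hu2⟩ := exists_pri_assoc (hpx.of_dvd_not_lam hqx)
      have hqp : Prime q := hq.prime
      have hass : Associated q (u * q) := ⟨hu1.unit, by simp [mul_comm]⟩
      have hpr : Prime (u * q) := hass.prime hqp
      obtain ⟨y, hy⟩ := (hass.dvd_iff_dvd_left).1 hqx
      have hyp : Pri y := hu2.of_mul_left (hy ▸ hpx)
      rw [hy]
      refine hp _ _ hpr hu2 hyp (ih y ?_ hyp)
      have h2 : 1 < NmN (u * q) := by
        have : Nm (1:Eis) < Nm (u * q) := by
          rw [Nm_one]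
          refine lt_of_le_of_ne (one_le_Nm hpr.ne_zero) (fun h => hpr.not_isUnit (isUnit_iff_Nm.2 h.symm))
        have := NmN_lt.2 this
        simpa [NmN, Nm_one] using this
      have h3 : 0 < NmN y := by
        have : Nm (0:Eis) < Nm y := by rw [Nm_zero]; exact Nm_pos hyp.ne_zero
        exact lt_of_le_of_lt (Nat.zero_le _) (NmN_lt.2 this)
      rw [hy, NmN_mul] at hx
      nlinarith
  intro x hx; exact key _ x le_rfl hx

lemma not_sqfree_mul_self {p x : Eis} (hp : Prime p) (h : p ∣ x) : ¬ Squarefree (p * x) := by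
  intro hs
  exact hp.not_isUnit (hs p (mul_dvd_mul_left p h))

lemma squarefree_prime_mul {p x : Eis} (hp : Prime p) (h : ¬ p ∣ x) (hx : Squarefree x) :
    Squarefree (p * x) := by
  have hc : IsRelPrime p x := hp.irreducible.isRelPrime_iff_not_dvd.2 h
  exact squarefree_mul_iff.2 ⟨hc, hp.irreducible.squarefree, hx⟩

lemma exists_abc : ∀ x : Eis, Pri x → ∃ a b c : Eis, Pri a ∧ Pri b ∧ Pri c ∧ Squarefree (a * b) ∧
    x = a * b ^ 2 * c ^ 3 := by
  refine Pri.induction ⟨1, 1, 1, .one, .one, .one, by simp, by simp⟩ ?_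
  rintro p x hp hpp hx ⟨a, b, c, ha, hb, hc, hs, rfl⟩
  by_cases h : p ∣ a * b
  · rcases hp.dvd_or_dvd h with ⟨a', rfl⟩ | ⟨b', rfl⟩
    · exact ⟨a', p * b, c, hpp.of_mul_left ha, hpp.mul hb, hc, by convert hs using 1; ring, by ring⟩
    · exact ⟨a, b', p * c, ha, hpp.of_mul_left hb, hpp.mul hc,
        hs.squarefree_of_dvd ⟨p, by ring⟩, by ring⟩
  · exact ⟨p * a, b, c, hpp.mul ha, hb, hc, by
      rw [mul_assoc]; exact squarefree_prime_mul hp h hs, by ring⟩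

lemma exists_radical : ∀ x : Eis, Pri x → ∃ y, Pri y ∧ Squarefree y ∧ y ∣ x ∧
    ∀ m, IsCoprime m x ↔ IsCoprime m y := by
  refine Pri.induction ⟨1, .one, by simp, by simp, fun m => Iff.rfl⟩ ?_
  rintro p x hp hpp hx ⟨y, hy, hys, hyx, H⟩
  by_cases h : p ∣ y
  · refine ⟨y, hy, hys, hyx.mul_left p, fun m => ?_⟩
    rw [← H m, IsCoprime.mul_right_iff]
    refine ⟨fun h => h.2, fun h' => ⟨?_, h'⟩⟩
    exact h'.of_isCoprime_of_dvd_right (h.trans hyx)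
  · refine ⟨p * y, hpp.mul hy, squarefree_prime_mul hp h hys, mul_dvd_mul_left p hyx, fun m => ?_⟩
    rw [IsCoprime.mul_right_iff, IsCoprime.mul_right_iff, H m]

lemma pd_one : pd 1 = {1} := by
  ext d; rw [mem_pd one_ne_zero, Finset.mem_singleton]
  constructor
  · rintro ⟨h1, h2⟩; exact pri_unit_eq_one (isUnit_of_dvd_one h2) h1
  · rintro rfl; exact ⟨.one, dvd_rfl⟩

/-- a primary divisor of a product of coprime -/
lemma pd_mul_split {x y d : Eis} (hd : Pri d) (h : d ∣ x * y) :
    ∃ d1 d2, Pri d1 ∧ Pri d2 ∧ d1 ∣ x ∧ d2 ∣ y ∧ d = d1 * d2 := by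
  obtain ⟨d1, d2, h1, h2, rfl⟩ := exists_dvd_and_dvd_of_dvd_mul h
  have hl : ¬ lam ∣ d1 := hd.of_dvd_not_lam (Dvd.intro _ rfl)
  obtain ⟨u, hu, hp⟩ := exists_pri_assoc hl
  obtain ⟨v, hv⟩ := hu.exists_right_inv
  have hv' : IsUnit v := IsUnit.of_mul_eq_one u (by rw [mul_comm]; exact hv)
  have he : d1 * d2 = (u * d1) * (v * d2) := by linear_combination (- d1 * d2) * hv
  refine ⟨u * d1, v * d2, hp, hp.of_mul_left (he ▸ hd), ?_, ?_, he⟩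
  · exact (hu.mul_left_dvd).2 h1
  · exact (hv'.mul_left_dvd).2 h2

lemma card_pd_mul {x y : Eis} (hx : x ≠ 0) (hy : y ≠ 0) : (pd (x * y)).card ≤ (pd x).card * (pd y).card := by
  classical
  rw [← Finset.card_product]
  refine (Finset.card_le_card (t := (pd x ×ˢ pd y).image (fun p => p.1 * p.2)) ?_).trans Finset.card_image_le
  intro d hd
  rw [mem_pd (mul_ne_zero hx hy)] at hd
  obtain ⟨d1, d2, h1, h2, h3, h4, rfl⟩ := pd_mul_split hd.1 hd.2
  exact Finset.mem_image.2 ⟨(d1, d2), by simp [mem_pd hx, mem_pd hy, *], rfl⟩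

lemma card_pd_prime_pow {p : Eis} (hp : Prime p) (e : ℕ) : (pd (p ^ e)).card ≤ e + 1 := by
  classical
  have : ∀ i : ℕ, ∃ y, ∀ d, Pri d → Associated d (p ^ i) → d = y := by
    intro i
    by_cases h : ∃ d, Pri d ∧ Associated d (p ^ i)
    · obtain ⟨y, hy, hy'⟩ := h
      exact ⟨y, fun d hd hd' => hd.associated_eq hy (hd'.trans hy'.symm)⟩
    · exact ⟨0, fun d hd hd' => absurd ⟨d, hd, hd'⟩ h⟩
  choose f hf using this
  rw [← Finset.card_range (e + 1)]
  refine (Finset.card_le_card (t := (Finset.range (e+1)).image f) ?_).trans Finset.card_image_le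
  intro d hd
  rw [mem_pd (pow_ne_zero _ hp.ne_zero)] at hd
  obtain ⟨i, hi, hd2⟩ := (dvd_prime_pow hp e).1 hd.2
  exact Finset.mem_image.2 ⟨i, Finset.mem_range.2 (by omega), (hf i d hd.1 hd2).symm⟩

/-- divisor bound -/
lemma divisor_bound (ε : ℝ) (hε : 0 < ε) : ∃ C : ℝ, 0 < C ∧ ∀ x : Eis, x ≠ 0 →
    ((pd x).card : ℝ) ≤ C * Nm x ^ ε := by
  classical
  set C0 : ℝ := 1 + 1 / (ε * Real.log 2) with hC0
  have hl2 : 0 < Real.log 2 := Real.log_pos (by norm_num)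
  have hC01 : 1 ≤ C0 := by rw [hC0]; have : 0 < 1 / (ε * Real.log 2) := by positivity
                           linarith
  set SP : Finset Eis := (ball ((2:ℝ) ^ (1/ε))) with hSP
  have key : ∀ x : Eis, x ≠ 0 → ((pd x).card : ℝ) ≤ C0 ^ (SP.filter (fun p => Prime p ∧ p ∣ x)).card * Nm x ^ ε := by
    intro x
    induction x using UniqueFactorizationMonoid.induction_on_coprime with
    | h0 => intro h; exact absurd rfl h
    | @h1 x hu =>
      intro _
      have h1 : (pd x).card ≤ 1 := by
        refine Finset.card_le_one.2 ?_
        intro a ha b hb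
        rw [mem_pd hu.ne_zero] at ha hb
        rw [pri_unit_eq_one (isUnit_of_dvd_unit ha.2 hu) ha.1, pri_unit_eq_one (isUnit_of_dvd_unit hb.2 hu) hb.1]
      rw [isUnit_iff_Nm.1 hu, Real.one_rpow, mul_one]
      exact le_trans (by exact_mod_cast h1) (one_le_pow₀ hC01)
    | @hpr p e hp =>
      intro _
      have hN2 : 2 ≤ Nm p := by
        rw [← NmN_cast]
        have : Nm (1:Eis) < Nm p := by
          rw [Nm_one]
          refine lt_of_le_of_ne (one_le_Nm hp.ne_zero) (fun h => hp.not_isUnit (isUnit_iff_Nm.2 h.symm))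
        have := NmN_lt.2 this
        have h1 : NmN (1:Eis) = 1 := by simp [NmN, Nm_one]
        rw [h1] at this
        exact_mod_cast this
      have hN0 : 0 < Nm p := by linarith
      have hcard : ((pd (p ^ e)).card : ℝ) ≤ e + 1 := by exact_mod_cast card_pd_prime_pow hp e
      rcases Nat.eq_zero_or_pos e with rfl | he
      · simp only [pow_zero, Nm_one, Real.one_rpow, mul_one] 
        refine le_trans ?_ (one_le_pow₀ hC01)
        rw [pd_one]; simp
      have hpow : Nm (p ^ e) ^ ε = (Nm p ^ ε) ^ e := by
        rw [Nm_pow, ← Real.rpow_natCast, ← Real.rpow_natCast, ← Real.rpow_mul hN0.le, ← Real.rpow_mul hN0.le, mul_comm]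
      rw [hpow]
      by_cases hs : Nm p ≤ (2:ℝ) ^ (1/ε)
      · have hmem : p ∈ SP.filter (fun q => Prime q ∧ q ∣ p ^ e) := by
          simp only [Finset.mem_filter, hSP, mem_ball]
          exact ⟨hs, hp, dvd_pow_self p (by omega)⟩
        have h1 : C0 ≤ C0 ^ (SP.filter (fun q => Prime q ∧ q ∣ p ^ e)).card :=
          le_self_pow₀ hC01 (Finset.card_ne_zero_of_mem hmem)
        have h2 : (e + 1 : ℝ) ≤ C0 * (Nm p ^ ε) ^ e := by
          have h3 : 1 + e * (ε * Real.log 2) ≤ (Nm p ^ ε) ^ e := by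
            calc 1 + e * (ε * Real.log 2) ≤ Real.exp (e * (ε * Real.log 2)) := by
                  rw [add_comm]; exact Real.add_one_le_exp _
              _ = ((2:ℝ) ^ ε) ^ e := by
                  rw [Real.rpow_def_of_pos (by norm_num), ← Real.exp_nat_mul]; ring_nf
              _ ≤ _ := by gcongr
          have h4 : (e + 1 : ℝ) ≤ C0 * (1 + e * (ε * Real.log 2)) := by
            rw [hC0]
            have : 1 / (ε * Real.log 2) * (e * (ε * Real.log 2)) = e := by field_simp
            have h5 : 0 < 1 / (ε * Real.log 2) := by positivity
            have h6 : 0 ≤ e * (ε * Real.log 2) := by positivity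
            nlinarith
          exact h4.trans (by gcongr)
        refine hcard.trans (h2.trans ?_)
        gcongr
      · push Not at hs
        have h2 : 2 ≤ Nm p ^ ε := by
          calc (2:ℝ) = ((2:ℝ) ^ (1/ε)) ^ ε := by rw [← Real.rpow_mul (by norm_num)]; field_simp; simp
            _ ≤ _ := by gcongr
        have h3 : (e + 1 : ℝ) ≤ (Nm p ^ ε) ^ e := by
          calc (e + 1 : ℝ) ≤ 2 ^ e := by exact_mod_cast Nat.lt_two_pow_self (n := e)
            _ ≤ _ := by gcongr
        have h4 := one_le_pow₀ (n := (SP.filter (fun q => Prime q ∧ q ∣ p ^ e)).card) hC01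
        nlinarith
    | @hcp x y hxy hx hy =>
      intro h0
      have hx0 := left_ne_zero_of_mul h0
      have hy0 := right_ne_zero_of_mul h0
      have h1 : (SP.filter (fun p => Prime p ∧ p ∣ x)).card + (SP.filter (fun p => Prime p ∧ p ∣ y)).card
          ≤ (SP.filter (fun p => Prime p ∧ p ∣ x * y)).card := by
        rw [← Finset.card_union_of_disjoint]
        · apply Finset.card_le_card
          intro p hp
          simp only [Finset.mem_union, Finset.mem_filter] at hp ⊢
          rcases hp with ⟨h1, h2, h3⟩ | ⟨h1, h2, h3⟩
          · exact ⟨h1, h2, h3.mul_right _⟩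
          · exact ⟨h1, h2, h3.mul_left _⟩
        · rw [Finset.disjoint_left]
          intro p hp hp'
          simp only [Finset.mem_filter] at hp hp'
          exact hp.2.1.not_isUnit (hxy hp.2.2 hp'.2.2)
      calc ((pd (x*y)).card : ℝ) ≤ (pd x).card * (pd y).card := by exact_mod_cast card_pd_mul hx0 hy0
        _ ≤ _ := mul_le_mul (hx hx0) (hy hy0) (by positivity) (mul_nonneg (by positivity) (Real.rpow_nonneg (Nm_nonneg _) _))
        _ = C0 ^ ((SP.filter (fun p => Prime p ∧ p ∣ x)).card + (SP.filter (fun p => Prime p ∧ p ∣ y)).card) * Nm (x * y) ^ ε := by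
          rw [Nm_mul, Real.mul_rpow (Nm_nonneg _) (Nm_nonneg _), pow_add]; ring
        _ ≤ _ := by
          have := Real.rpow_nonneg (Nm_nonneg (x*y)) ε
          gcongr
  refine ⟨C0 ^ SP.card, by positivity, fun x hx => (key x hx).trans ?_⟩
  have := Real.rpow_nonneg (Nm_nonneg x) ε
  gcongr
  exact Finset.filter_subset _ _

/-! ### Moebius -/
lemma moebius_abs {μ : Eis → ℤ} (hμ : IsMoebius μ) {x : Eis} (hx : Pri x) : |μ x| ≤ 1 := by
  refine Pri.induction (P := fun x => |μ x| ≤ 1) ?_ ?_ x hx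
  · rw [hμ.isUnit 1 isUnit_one]; simp
  · intro p x hp _ _ ih
    by_cases h : p ∣ x
    · rw [hμ.eq_zero _ (not_sqfree_mul_self hp h)]; simp
    · rw [hμ.prime_mul p x hp h, abs_neg]; exact ih

lemma moebius_sum {μ : Eis → ℤ} (hμ : IsMoebius μ) (m : Eis) {g : Eis} (hg : Pri g) (hs : Squarefree g) :
    ∑ d ∈ pd g, (if d ∣ m then μ d else 0) = if IsCoprime m g then 1 else 0 := by
  classical
  revert hs
  refine Pri.induction (P := fun g => Squarefree g → ∑ d ∈ pd g, (if d ∣ m then μ d else 0) = if IsCoprime m g then 1 else 0) ?_ ?_ g hg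
  · intro _
    rw [pd_one]; simp [hμ.isUnit 1 isUnit_one, isCoprime_one_right]
  · intro p x hp hpp hx ih hs
    have hpx : ¬ p ∣ x := fun h => not_sqfree_mul_self hp h hs
    have hsx : Squarefree x := hs.squarefree_of_dvd ⟨p, by ring⟩
    have hpx0 := mul_ne_zero hp.ne_zero hx.ne_zero
    have hdec : pd (p * x) = pd x ∪ (pd x).image (fun d => p * d) := by
      ext d
      simp only [Finset.mem_union, Finset.mem_image, mem_pd hpx0, mem_pd hx.ne_zero]
      constructor
      · rintro ⟨h1, h2⟩
        by_cases h : p ∣ d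
        · obtain ⟨e, rfl⟩ := h
          right
          exact ⟨e, ⟨hpp.of_mul_left h1, (mul_dvd_mul_iff_left hp.ne_zero).1 h2⟩, rfl⟩
        · left
          exact ⟨h1, ((hp.irreducible.coprime_iff_not_dvd.2 h).symm).dvd_of_dvd_mul_left h2⟩
      · rintro (⟨h1, h2⟩ | ⟨e, ⟨h1, h2⟩, rfl⟩)
        · exact ⟨h1, h2.mul_left p⟩
        · exact ⟨hpp.mul h1, mul_dvd_mul_left p h2⟩
    have hnd : ∀ d ∈ pd x, ¬ p ∣ d := fun d hd h => hpx (h.trans ((mem_pd hx.ne_zero).1 hd).2)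
    rw [hdec, Finset.sum_union, Finset.sum_image]
    · rw [ih hsx]
      by_cases hpm : p ∣ m
      · have h1 : ∑ d ∈ pd x, (if p * d ∣ m then μ (p * d) else 0) = - ∑ d ∈ pd x, (if d ∣ m then μ d else 0) := by
          rw [← Finset.sum_neg_distrib]
          refine Finset.sum_congr rfl fun d hd => ?_
          have hc : IsCoprime p d := hp.irreducible.coprime_iff_not_dvd.2 (hnd d hd)
          have : p * d ∣ m ↔ d ∣ m := ⟨fun h => (Dvd.intro_left _ rfl).trans h, fun h => hc.mul_dvd hpm h⟩
          rw [hμ.prime_mul p d hp (hnd d hd)]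
          simp only [this]; split_ifs <;> simp
        rw [h1, ih hsx, if_neg (c := IsCoprime m (p * x))]
        · ring
        · intro h
          have := (IsCoprime.mul_right_iff.1 h).1
          exact hp.not_isUnit (this.isUnit_of_dvd' hpm dvd_rfl)
      · have h1 : ∑ d ∈ pd x, (if p * d ∣ m then μ (p * d) else 0) = 0 :=
          Finset.sum_eq_zero fun d _ => if_neg fun h => hpm ((Dvd.intro _ rfl).trans h)
        rw [h1, add_zero]
        have : IsCoprime m (p * x) ↔ IsCoprime m x := by
          rw [IsCoprime.mul_right_iff]
          exact ⟨fun h => h.2, fun h => ⟨(hp.irreducible.coprime_iff_not_dvd.2 hpm).symm, h⟩⟩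
        simp only [this]
    · intro a _ b _ h; exact mul_left_cancel₀ hp.ne_zero h
    · rw [Finset.disjoint_left]
      intro d hd hd'
      obtain ⟨e, _, rfl⟩ := Finset.mem_image.1 hd'
      exact hnd _ hd (Dvd.intro _ rfl)

end P1b

section P1c
open scoped Classical

/-- coordinates as linear equiv -/
def eisLin : Eis ≃ₗ[ℤ] (Fin 2 → ℤ) :=
  LinearEquiv.symm
  { ((finTwoArrowEquiv ℤ).trans eisEquiv) with
    map_add' := fun x y => (mkE_add (x 0) (x 1) (y 0) (y 1)).symm
    map_smul' := fun c x => by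
      change mkE (c * x 0) (c * x 1) = c • mkE (x 0) (x 1)
      rw [zsmul_eq_mul, intCast_eq_mkE, mkE_mul]; congr 1 <;> ring }

lemma eisLin_symm (v : Fin 2 → ℤ) : eisLin.symm v = mkE (v 0) (v 1) := rfl
lemma eisLin_mkE (a b : ℤ) : eisLin (mkE a b) = ![a, b] := by
  apply eisLin.symm.injective; rw [LinearEquiv.symm_apply_apply, eisLin_symm]; simp

/-- basis `1, ω` -/
def eisBasis : Module.Basis (Fin 2) ℤ Eis := Module.Basis.ofEquivFun eisLin

instance : Module.Free ℤ Eis := Module.Free.of_basis eisBasis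
instance : Module.Finite ℤ Eis := Module.Finite.of_basis eisBasis

lemma norm_mkE (a b : ℤ) : Algebra.norm ℤ (mkE a b) = a ^ 2 - a * b + b ^ 2 := by
  rw [Algebra.norm_eq_matrix_det eisBasis, Matrix.det_fin_two]
  have h0 : eisBasis 0 = mkE 1 0 := by
    simp [eisBasis, Module.Basis.coe_ofEquivFun, eisLin_symm]
  have h1 : eisBasis 1 = mkE 0 1 := by
    simp [eisBasis, Module.Basis.coe_ofEquivFun, eisLin_symm]
  have hr : ∀ x i, eisBasis.repr x i = eisLin x i := fun x i => rfl
  simp only [Algebra.leftMulMatrix_eq_repr_mul, h0, h1, mkE_mul, hr, eisLin_mkE]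
  simp; ring

lemma card_quot (n : Eis) : Nat.card (Eis ⧸ Ideal.span {n}) = NmN n := by
  have h := Ideal.absNorm_span_singleton n
  rw [Ideal.absNorm_apply, Submodule.cardQuot_apply] at h
  rw [h]
  obtain ⟨a, b, rfl⟩ := exists_mkE n
  rw [norm_mkE]
  have h2 : 0 ≤ a ^ 2 - a * b + b ^ 2 := by nlinarith [sq_nonneg (a - b), sq_nonneg a, sq_nonneg b]
  have : (((a ^ 2 - a * b + b ^ 2).natAbs : ℤ) : ℝ) = (NmN (mkE a b) : ℝ) := by
    rw [NmN_cast, Nm_mkE, Int.natAbs_of_nonneg h2]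
  exact_mod_cast this

lemma NmN_pos {n : Eis} (hn : n ≠ 0) : 0 < NmN n := by
  have := Nm_pos hn
  rw [← NmN_cast] at this
  exact_mod_cast this

lemma finite_quot {n : Eis} (hn : n ≠ 0) : Finite (Eis ⧸ Ideal.span {n}) :=
  Nat.finite_of_card_ne_zero (by rw [card_quot]; exact (NmN_pos hn).ne')

end P1c

section P2
open scoped Classical

/-- values -/
def CV (x : Eis) : Prop := x = 1 ∨ x = ωE ∨ x = ωE ^ 2

lemma CV.mul {x y : Eis} (hx : CV x) (hy : CV y) : CV (x * y) := by
  have h3 := ωE_cube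
  have h4 : ωE ^ 2 * ωE ^ 2 = ωE := by linear_combination ωE * h3
  rcases hx with rfl | rfl | rfl <;> rcases hy with rfl | rfl | rfl <;> unfold CV
  · simp
  · simp
  · simp
  · simp
  · right; right; ring
  · left; linear_combination h3
  · simp
  · left; linear_combination h3
  · right; left; linear_combination h4

lemma CV.cube {x : Eis} (hx : CV x) : x ^ 3 = 1 := by
  have h3 := ωE_cube
  rcases hx with rfl | rfl | rfl
  · simp
  · exact h3
  · linear_combination (ωE ^ 3 + 1) * h3

lemma CV.norm {x : Eis} (hx : CV x) : ‖(x : ℂ)‖ = 1 := by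
  have := congrArg (fun z : Eis => ‖(z : ℂ)‖) hx.cube
  simp only [Subring.coe_pow, norm_pow, Subring.coe_one, norm_one] at this
  exact (pow_eq_one_iff_of_nonneg (norm_nonneg _) (by norm_num)).1 this

lemma CV.ne_zero {x : Eis} (hx : CV x) : x ≠ 0 := by
  rintro rfl; have := hx.cube; simp at this

lemma one_sub_ω_assoc : (1 - ωE) = lam * (ωE ^ 2) := by
  unfold lam; linear_combination (-1 : Eis) * ωE_sq - (2 : Eis) * ωE_cube

lemma not_dvd_one_sub_ω {π : Eis} (hp : Prime π) (hpp : Pri π) : ¬ π ∣ (1 - ωE) := by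
  intro h
  rw [one_sub_ω_assoc] at h
  have hu : IsUnit (ωE ^ 2 : Eis) := isUnit_ω.pow 2
  rw [hu.dvd_mul_right] at h
  have := (hp.irreducible.associated_of_dvd prime_lam.irreducible h)
  exact hpp.not_lam_dvd this.symm.dvd

lemma CV.eq_of_dvd {π x y : Eis} (hp : Prime π) (hpp : Pri π) (hx : CV x) (hy : CV y) (h : π ∣ x - y) : x = y := by
  have h1 := not_dvd_one_sub_ω hp hpp
  have hω := isUnit_ω
  have h3 := ωE_cube
  rcases hx with rfl | rfl | rfl <;> rcases hy with rfl | rfl | rfl <;> try rfl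
  all_goals exfalso
  · exact h1 h
  · apply h1; 
    have : (1 - ωE : Eis) = (1 - ωE^2) * (-ωE) := by linear_combination h3 * (-1) 
    rw [this]; exact h.mul_right _
  · apply h1; rw [← dvd_neg]; simpa using h
  · apply h1; rw [← hω.dvd_mul_left (a := π) (u := ωE)]; convert h using 1; ring
  · apply h1
    have : (1 - ωE : Eis) = (ωE ^ 2 - 1) * (ωE) := by linear_combination (-1:Eis) * h3 
    rw [this]; exact h.mul_right _
  · apply h1; rw [← hω.dvd_mul_left (a := π) (u := ωE)]; rw [← dvd_neg]; convert h using 1; ring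

variable {χ : Eis → Eis → Eis}

lemma chi_prime_ne {π a : Eis} (hχ : IsCubicSymbol χ) (hp : Prime π) (hpp : Pri π) (h : ¬ π ∣ a) : CV (χ π a) := by
  rcases hχ.prime_vals π a hp hpp with h0 | h1
  · exact absurd ((hχ.prime_eq_zero π a hp hpp).1 h0) h
  · exact h1

/-- uniqueness -/
lemma chi_prime_unique {π a x : Eis} (hχ : IsCubicSymbol χ) (hp : Prime π) (hpp : Pri π) (ha : ¬ π ∣ a)
    (hx : CV x) (h : π ∣ a ^ ((NmN π - 1) / 3) - x) : χ π a = x := by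
  apply CV.eq_of_dvd hp hpp (chi_prime_ne hχ hp hpp ha) hx
  have := dvd_sub h (hχ.prime_congr π a hp hpp)
  simpa using this

lemma chi_prime_mul {π : Eis} (hχ : IsCubicSymbol χ) (hp : Prime π) (hpp : Pri π) (a b : Eis) :
    χ π (a * b) = χ π a * χ π b := by
  by_cases ha : π ∣ a
  · rw [(hχ.prime_eq_zero π a hp hpp).2 ha, (hχ.prime_eq_zero π _ hp hpp).2 (ha.mul_right b), zero_mul]
  by_cases hb : π ∣ b
  · rw [(hχ.prime_eq_zero π b hp hpp).2 hb, (hχ.prime_eq_zero π _ hp hpp).2 (hb.mul_left a), mul_zero]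
  apply chi_prime_unique hχ hp hpp
  · intro h; exact (hp.dvd_or_dvd h).elim ha hb
  · exact (chi_prime_ne hχ hp hpp ha).mul (chi_prime_ne hχ hp hpp hb)
  · rw [mul_pow]
    have h1 := hχ.prime_congr π a hp hpp
    have h2 := hχ.prime_congr π b hp hpp
    set A := a ^ ((NmN π - 1) / 3)
    set B := b ^ ((NmN π - 1) / 3)
    have : A * B - χ π a * χ π b = (A - χ π a) * B + (B - χ π b) * χ π a := by ring
    rw [this]; exact dvd_add (h1.mul_right _) (h2.mul_right _)

lemma chi_prime_congr {π : Eis} (hχ : IsCubicSymbol χ) (hp : Prime π) (hpp : Pri π) {a b : Eis} (h : π ∣ a - b) :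
    χ π a = χ π b := by
  by_cases hb : π ∣ b
  · have ha : π ∣ a := by have := dvd_add h hb; simpa using this
    rw [(hχ.prime_eq_zero π a hp hpp).2 ha, (hχ.prime_eq_zero π b hp hpp).2 hb]
  have ha : ¬ π ∣ a := fun ha => hb (by have := dvd_sub ha h; simpa using this)
  apply chi_prime_unique hχ hp hpp ha (chi_prime_ne hχ hp hpp hb)
  have h1 := hχ.prime_congr π b hp hpp
  have h2 : π ∣ a ^ ((NmN π - 1) / 3) - b ^ ((NmN π - 1) / 3) := h.trans (sub_dvd_pow_sub_pow a b _)
  have := dvd_add h2 h1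
  simpa using this

lemma chi_prime_one {π : Eis} (hχ : IsCubicSymbol χ) (hp : Prime π) (hpp : Pri π) : χ π 1 = 1 := by
  apply chi_prime_unique hχ hp hpp
  · exact fun h => hp.not_isUnit (isUnit_of_dvd_one h)
  · left; rfl
  · simp

lemma NmN_mod_three {π : Eis} (hpp : Pri π) : NmN π % 3 = 1 := by
  obtain ⟨a, b, rfl⟩ := exists_mkE π
  rw [pri_mkE] at hpp
  have h : (NmN (mkE a b) : ℤ) = a ^ 2 - a * b + b ^ 2 := by
    have := NmN_cast (mkE a b); rw [Nm_mkE] at this; exact_mod_cast this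
  obtain ⟨⟨c, hc⟩, ⟨d, hd⟩⟩ := hpp
  have ha : a = 3 * c + 1 := by linarith
  have : (NmN (mkE a b) : ℤ) = 3 * (3 * c ^ 2 + 2 * c - (3*c+1) * d + 3 * d ^ 2) + 1 := by
    rw [h, ha, hd]; ring
  omega

lemma isMax {π : Eis} (hp : Prime π) : (Ideal.span {π}).IsMaximal :=
  PrincipalIdealRing.isMaximal_of_irreducible hp.irreducible

lemma one_lt_NmN {π : Eis} (hp : Prime π) : 1 < NmN π := by
  have h : Nm (1:Eis) < Nm π := by
    rw [Nm_one]
    refine lt_of_le_of_ne (one_le_Nm hp.ne_zero) (fun h => hp.not_isUnit (isUnit_iff_Nm.2 h.symm))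
  have := NmN_lt.2 h
  have h1 : NmN (1:Eis) = 1 := by simp [NmN, Nm_one]
  rwa [h1] at this

lemma chi_prime_nontrivial {π : Eis} (hχ : IsCubicSymbol χ) (hp : Prime π) (hpp : Pri π) :
    ∃ a, ¬ π ∣ a ∧ χ π a ≠ 1 := by
  by_contra hcon
  push Not at hcon
  have := isMax hp
  let : Field (Eis ⧸ Ideal.span {π}) := Ideal.Quotient.field _
  have := finite_quot hp.ne_zero
  let : Fintype (Eis ⧸ Ideal.span {π}) := Fintype.ofFinite _
  set m := (NmN π - 1) / 3 with hm
  have h3 := NmN_mod_three hpp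
  have h1 := one_lt_NmN hp
  have hm0 : 0 < m := by omega
  have hc : Fintype.card (Eis ⧸ Ideal.span {π}) = NmN π := by
    rw [← Nat.card_eq_fintype_card, card_quot]
  -- generator
  have hall : ∀ x : (Eis ⧸ Ideal.span {π})ˣ, x ^ m = 1 := by
    intro x
    obtain ⟨a, ha⟩ := Ideal.Quotient.mk_surjective (x : Eis ⧸ Ideal.span {π})
    have hna : ¬ π ∣ a := by
      intro h
      have : Ideal.Quotient.mk (Ideal.span {π}) a = 0 :=
        Ideal.Quotient.eq_zero_iff_mem.2 (Ideal.mem_span_singleton.2 h)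
      rw [this] at ha; exact x.ne_zero ha.symm
    have h2 := hχ.prime_congr π a hp hpp
    rw [hcon a hna] at h2
    have h4 : Ideal.Quotient.mk (Ideal.span {π}) (a ^ m - 1) = 0 :=
        Ideal.Quotient.eq_zero_iff_mem.2 (Ideal.mem_span_singleton.2 h2)
    rw [map_sub, map_pow, map_one, ha, sub_eq_zero] at h4
    exact Units.ext (by push_cast; exact h4)
  obtain ⟨g, hg⟩ := IsCyclic.exists_generator (α := (Eis ⧸ Ideal.span {π})ˣ)
  have ho : orderOf g = NmN π - 1 := by
    rw [orderOf_eq_card_of_forall_mem_zpowers hg, Nat.card_units, Nat.card_eq_fintype_card, hc]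
  have := orderOf_dvd_of_pow_eq_one (hall g)
  rw [ho] at this
  have := Nat.le_of_dvd hm0 this
  omega

/-! general lower entry -/
lemma chi_ne {n a : Eis} (hχ : IsCubicSymbol χ) (hn : Pri n) : (IsCoprime a n → CV (χ n a)) ∧ (¬ IsCoprime a n → χ n a = 0) := by
  refine Pri.induction (P := fun n => (IsCoprime a n → CV (χ n a)) ∧ (¬ IsCoprime a n → χ n a = 0)) ?_ ?_ n hn
  · exact ⟨fun _ => Or.inl (hχ.one_bot a), fun h => absurd isCoprime_one_right h⟩
  · intro p x hp hpp hx ih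
    rw [hχ.mul_bot p x a hpp hx, IsCoprime.mul_right_iff, isCoprime_comm (x := a) (y := p),
      hp.irreducible.coprime_iff_not_dvd]
    constructor
    · rintro ⟨h1, h2⟩; exact (chi_prime_ne hχ hp hpp h1).mul (ih.1 h2)
    · intro h
      by_cases hpa : p ∣ a
      · rw [(hχ.prime_eq_zero p a hp hpp).2 hpa, zero_mul]
      · rw [ih.2 (fun h' => h ⟨hpa, h'⟩), mul_zero]

lemma chi_mul {n : Eis} (hχ : IsCubicSymbol χ) (hn : Pri n) (a b : Eis) : χ n (a * b) = χ n a * χ n b := by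
  refine Pri.induction (P := fun n => χ n (a * b) = χ n a * χ n b) ?_ ?_ n hn
  · simp [hχ.one_bot]
  · intro p x hp hpp hx ih
    rw [hχ.mul_bot p x _ hpp hx, hχ.mul_bot p x _ hpp hx, hχ.mul_bot p x _ hpp hx, ih, chi_prime_mul hχ hp hpp]; ring

lemma chi_one {n : Eis} (hχ : IsCubicSymbol χ) (hn : Pri n) : χ n 1 = 1 := by
  refine Pri.induction (P := fun n => χ n 1 = 1) ?_ ?_ n hn
  · simp [hχ.one_bot]
  · intro p x hp hpp hx ih
    rw [hχ.mul_bot p x _ hpp hx, ih, chi_prime_one hχ hp hpp, mul_one]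

lemma chi_congr {n : Eis} (hχ : IsCubicSymbol χ) (hn : Pri n) {a b : Eis} (h : n ∣ a - b) : χ n a = χ n b := by
  revert h
  refine Pri.induction (P := fun n => n ∣ a - b → χ n a = χ n b) ?_ ?_ n hn
  · simp [hχ.one_bot]
  · intro p x hp hpp hx ih h
    rw [hχ.mul_bot p x _ hpp hx, hχ.mul_bot p x _ hpp hx, ih ((Dvd.intro_left _ rfl).trans h),
      chi_prime_congr hχ hp hpp ((Dvd.intro _ rfl).trans h)]

lemma chi_pow {n : Eis} (hχ : IsCubicSymbol χ) (hn : Pri n) (a : Eis) (k : ℕ) : χ n (a ^ k) = χ n a ^ k := by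
  induction k with
  | zero => simp [chi_one hχ hn]
  | succ k ih => rw [pow_succ, chi_mul hχ hn, ih, pow_succ]

lemma chi_neg_one {n : Eis} (hχ : IsCubicSymbol χ) (hn : Pri n) : χ n (-1) = 1 := by
  have h1 : χ n ((-1) ^ 2) = χ n (-1) ^ 2 := chi_pow hχ hn _ _
  rw [neg_one_sq, chi_one hχ hn] at h1
  have h3 : CV (χ n (-1)) := (chi_ne hχ hn).1 (by
    exact ⟨-1, 0, by ring⟩)
  have := h3.cube
  calc χ n (-1) = χ n (-1) ^ 3 := by rw [pow_succ, ← h1, one_mul]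
    _ = 1 := this

end P2

section P2b
open scoped Classical
variable {χ : Eis → Eis → Eis}

/-- residue field multiplicative character -/
def chiMC (hχ : IsCubicSymbol χ) {π : Eis} (hp : Prime π) (hpp : Pri π) :
    MulChar (Eis ⧸ Ideal.span {π}) Eis where
  toFun x := χ π (Quotient.out x)
  map_one' := by
    rw [← chi_prime_one hχ hp hpp]
    apply chi_prime_congr hχ hp hpp
    rw [← Ideal.mem_span_singleton, ← Ideal.Quotient.eq]
    exact Quotient.out_eq (s := Submodule.quotientRel _) (1 : Eis ⧸ Ideal.span {π})
  map_mul' x y := by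
    change _ = χ π _ * χ π _
    rw [← chi_prime_mul hχ hp hpp]
    apply chi_prime_congr hχ hp hpp
    rw [← Ideal.mem_span_singleton, ← Ideal.Quotient.eq, map_mul]
    have h := fun x : Eis ⧸ Ideal.span {π} => Quotient.out_eq (s := Submodule.quotientRel _) x
    exact (h (x * y)).trans (congrArg₂ (· * ·) (h x).symm (h y).symm)
  map_nonunit' x hx := by
    change χ π _ = 0
    rw [hχ.prime_eq_zero π _ hp hpp]
    by_contra h
    apply hx
    have h1 : IsCoprime π (Quotient.out x) := hp.irreducible.coprime_iff_not_dvd.2 h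
    obtain ⟨u, v, huv⟩ := h1
    refine IsUnit.of_mul_eq_one (Ideal.Quotient.mk _ v) ?_
    have h2 : Ideal.Quotient.mk (Ideal.span {π}) (Quotient.out x) = x := Quotient.out_eq (s := Submodule.quotientRel _) x
    have h3 : x * Ideal.Quotient.mk (Ideal.span {π}) v = Ideal.Quotient.mk (Ideal.span {π}) (Quotient.out x * v) := by
      rw [map_mul, h2]
    rw [h3, ← map_one (Ideal.Quotient.mk (Ideal.span {π})), Ideal.Quotient.eq, Ideal.mem_span_singleton]
    exact ⟨-u, by linear_combination huv⟩

lemma chiMC_mk (hχ : IsCubicSymbol χ) {π : Eis} (hp : Prime π) (hpp : Pri π) (a : Eis) :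
    chiMC hχ hp hpp (Ideal.Quotient.mk _ a) = χ π a := by
  change χ π _ = _
  apply chi_prime_congr hχ hp hpp
  rw [← Ideal.mem_span_singleton, ← Ideal.Quotient.eq]
  exact Quotient.out_eq (s := Submodule.quotientRel _) _

lemma chiMC_cube (hχ : IsCubicSymbol χ) {π : Eis} (hp : Prime π) (hpp : Pri π) : chiMC hχ hp hpp ^ 3 = 1 := by
  apply MulChar.ext
  intro x
  obtain ⟨a, ha⟩ := Ideal.Quotient.mk_surjective (x : Eis ⧸ Ideal.span {π})
  rw [MulChar.pow_apply_coe, MulChar.one_apply_coe, ← ha, chiMC_mk]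
  apply CV.cube
  apply chi_prime_ne hχ hp hpp
  intro h
  have : Ideal.Quotient.mk (Ideal.span {π}) a = 0 := Ideal.Quotient.eq_zero_iff_mem.2 (Ideal.mem_span_singleton.2 h)
  rw [this] at ha
  have h2 := x.isUnit
  rw [← ha, isUnit_zero_iff] at h2
  have h3 : Ideal.Quotient.mk (Ideal.span {π}) 0 = Ideal.Quotient.mk (Ideal.span {π}) 1 := by simpa using h2
  rw [Ideal.Quotient.eq, Ideal.mem_span_singleton] at h3
  exact hp.not_isUnit (isUnit_of_dvd_one (by simpa using h3))

lemma exists_ne (hχ : IsCubicSymbol χ) {π : Eis} (hp : Prime π) (hpp : Pri π) :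
    ∃ u : (Eis ⧸ Ideal.span {π})ˣ, CV (chiMC hχ hp hpp u) ∧ chiMC hχ hp hpp u ≠ 1 := by
  obtain ⟨a, ha, ha'⟩ := chi_prime_nontrivial hχ hp hpp
  have hu : IsUnit (Ideal.Quotient.mk (Ideal.span {π}) a) := by
    by_contra h
    have := (chiMC hχ hp hpp).map_nonunit h
    rw [chiMC_mk, hχ.prime_eq_zero π _ hp hpp] at this
    exact ha this
  refine ⟨hu.unit, ?_, ?_⟩
  · rw [IsUnit.unit_spec, chiMC_mk]; exact chi_prime_ne hχ hp hpp ha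
  · rw [IsUnit.unit_spec, chiMC_mk]; exact ha'

lemma ωE_ne_one : ωE ≠ 1 := by
  intro h
  have h1 := ωE_sq
  rw [h] at h1
  have h2 : ((3 : ℕ) : Eis) = 0 := by push_cast; linear_combination h1
  have h3 : (((3 : ℕ) : Eis) : ℂ) = 0 := by rw [h2]; rfl
  push_cast at h3
  norm_num at h3

lemma prim_ω : IsPrimitiveRoot ωE 3 := by
  have : Fact (Nat.Prime 3) := ⟨by norm_num⟩
  rw [IsPrimitiveRoot.iff_orderOf]
  exact orderOf_eq_prime ωE_cube ωE_ne_one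

/-- iterated Frobenius on Gauss sums -/
lemma gauss_frob_iter {R R' : Type*} [CommRing R] [Fintype R] [CommRing R'] (p : ℕ) [Fact p.Prime] [CharP R' p]
    (χ : MulChar R R') (ψ : AddChar R R') (n : ℕ) :
    gaussSum χ ψ ^ p ^ n = gaussSum (χ ^ p ^ n) (ψ ^ p ^ n) := by
  induction n with
  | zero => simp
  | succ n ih => rw [pow_succ, pow_mul, ih, gaussSum_frob, ← pow_mul, ← pow_mul]

lemma cubic_gauss {F F' : Type} [Field F] [Fintype F] [Field F'] [Fintype F'] (χ : MulChar F F')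
    (h3 : orderOf χ = 3) (hc0 : (Fintype.card F : F') ≠ 0) (hq : Fintype.card F' % 3 = 1)
    (hq0 : (Fintype.card F' : F) ≠ 0) :
    (χ (-1) * Fintype.card F * jacobiSum χ χ) ^ ((Fintype.card F' - 1) / 3) * χ (Fintype.card F') = 1 := by
  obtain ⟨n, hp, hcard⟩ := FiniteField.card F (ringChar F)
  obtain ⟨m, hl, hcard'⟩ := FiniteField.card F' (ringChar F')
  have hne : ringChar F' ≠ ringChar F := by
    intro h
    apply hc0
    rw [hcard, ← h]
    simp
  let P := AddChar.FiniteField.primitiveChar F F' hne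
  let K := CyclotomicField P.n F'
  let f := algebraMap F' K
  have hf : Function.Injective f := f.injective
  let χ' := χ.ringHomComp f
  have hχ' : orderOf χ' = 3 := by
    have : Fact (Nat.Prime 3) := ⟨by norm_num⟩
    apply orderOf_eq_prime
    · change (χ.ringHomComp f) ^ 3 = 1
      rw [MulChar.ringHomComp_pow, ← h3, pow_orderOf_eq_one, MulChar.ringHomComp_one]
    · change χ.ringHomComp f ≠ 1
      rw [MulChar.ringHomComp_ne_one_iff hf]
      intro h
      rw [h] at h3
      simp at h3
  have hg3 := gaussSum_pow_eq_prod_jacobiSum (χ := χ') (ψ := P.char) (by omega) P.prim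
  rw [hχ'] at hg3
  have hI : Finset.Ico 1 (3 - 1) = {1} := by rfl
  rw [hI, Finset.prod_singleton, pow_one, jacobiSum_ringHomComp] at hg3
  have hcharK : CharP K (ringChar F') := charP_of_injective_algebraMap hf _
  have : Fact (ringChar F').Prime := ⟨hl⟩
  have hfr := gauss_frob_iter (ringChar F') χ' P.char m
  rw [← hcard', AddChar.pow_mulShift] at hfr
  have hχq : χ' ^ Fintype.card F' = χ' := by
    conv_lhs => rw [← Nat.div_add_mod (Fintype.card F') 3, hq, pow_succ, pow_mul, ← hχ', pow_orderOf_eq_one,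
      one_pow, one_mul]
  rw [hχq] at hfr
  have hms := gaussSum_mulShift χ' P.char (Units.mk0 _ hq0)
  rw [Units.val_mk0, ← hfr] at hms
  have hχ1 : χ' ≠ 1 := by
    intro h; rw [h] at hχ'; simp at hχ'
  have hg0 : gaussSum χ' P.char ≠ 0 := by
    apply gaussSum_ne_zero_of_nontrivial _ hχ1 P.prim
    intro h
    apply hc0
    apply hf
    rw [map_natCast, map_zero]
    exact h
  apply hf
  have e1 : χ' (Fintype.card F') = f (χ (Fintype.card F')) := rfl
  have e2 : χ' (-1) = f (χ (-1)) := rfl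
  have hcq : Fintype.card F' = 3 * ((Fintype.card F' - 1) / 3) + 1 := by omega
  rw [map_mul, map_pow, map_mul, map_mul, map_natCast, map_one, ← e1, ← e2, ← hg3, ← pow_mul]
  apply mul_right_cancel₀ hg0
  rw [one_mul, mul_right_comm, ← pow_succ, ← hcq, mul_comm]
  exact hms

lemma exists_model (hχ : IsCubicSymbol χ) {π : Eis} (hp : Prime π) (hpp : Pri π) :
    ∃ (F : Type) (_ : Field F) (_ : Fintype F) (mk : Eis →+* F) (ψ : MulChar F Eis),
      Function.Surjective mk ∧ (∀ a, mk a = 0 ↔ π ∣ a) ∧ Fintype.card F = NmN π ∧ (∀ a, ψ (mk a) = χ π a) ∧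
      orderOf ψ = 3 := by
  have := isMax hp
  let : Field (Eis ⧸ Ideal.span {π}) := Ideal.Quotient.field _
  have := finite_quot hp.ne_zero
  let : Fintype (Eis ⧸ Ideal.span {π}) := Fintype.ofFinite _
  refine ⟨Eis ⧸ Ideal.span {π}, inferInstance, inferInstance, Ideal.Quotient.mk _, chiMC hχ hp hpp,
    Ideal.Quotient.mk_surjective, ?_, ?_, chiMC_mk hχ hp hpp, ?_⟩
  · intro a; rw [Ideal.Quotient.eq_zero_iff_mem, Ideal.mem_span_singleton]
  · rw [← card_quot, Nat.card_eq_fintype_card]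
  · have : Fact (Nat.Prime 3) := ⟨by norm_num⟩
    refine orderOf_eq_prime (chiMC_cube hχ hp hpp) ?_
    intro h
    obtain ⟨u, h1, h2⟩ := exists_ne hχ hp hpp
    rw [h, MulChar.one_apply_coe] at h2
    exact h2 rfl

lemma CV.mul_conj {x : Eis} (hx : CV x) : (x : ℂ) * (starRingEnd ℂ) (x : ℂ) = 1 := by
  rw [Complex.mul_conj, Complex.normSq_eq_norm_sq, hx.norm]; simp

lemma sum_binom_zero {F : Type} [Field F] [Fintype F] (m : ℕ) (h : 2 * m < Fintype.card F - 1) :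
    ∑ x : F, x ^ m * (1 - x) ^ m = 0 := by
  have : ∀ x : F, x ^ m * (1 - x) ^ m = ∑ k ∈ Finset.range (m + 1), ((-1) ^ k * (m.choose k : F)) * x ^ (m + k) := by
    intro x
    rw [sub_eq_neg_add, add_pow, Finset.mul_sum]
    refine Finset.sum_congr rfl fun k _ => ?_
    rw [neg_pow]; ring
  simp_rw [this]
  rw [Finset.sum_comm]
  refine Finset.sum_eq_zero fun k hk => ?_
  rw [← Finset.mul_sum, FiniteField.sum_pow_lt_card_sub_one, mul_zero]
  have := Finset.mem_range.1 hk
  omega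

lemma jacobi_eq (hχ : IsCubicSymbol χ) {π : Eis} (hp : Prime π) (hpp : Pri π)
    {F : Type} [Field F] [Fintype F] (mk : Eis →+* F) (ψ : MulChar F Eis) (hs : Function.Surjective mk)
    (hk : ∀ a, mk a = 0 ↔ π ∣ a) (hc : Fintype.card F = NmN π) (hψ : ∀ a, ψ (mk a) = χ π a)
    (ho : orderOf ψ = 3) : jacobiSum ψ ψ = -π := by
  have h31 := NmN_mod_three hpp
  have h1lt := one_lt_NmN hp
  have hψ3 : ψ ^ 3 = 1 := by rw [← ho, pow_orderOf_eq_one]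
  have hval : ∀ x : F, x ≠ 0 → CV (ψ x) := by
    intro x hx
    obtain ⟨a, rfl⟩ := hs x
    rw [hψ]
    exact chi_prime_ne hχ hp hpp (fun h => hx ((hk a).2 h))
  -- primary
  have hpri : Pri (-jacobiSum ψ ψ) := by
    obtain ⟨z, -, hz⟩ := exists_jacobiSum_eq_neg_one_add (n := 3) (by norm_num) hψ3 hψ3 (by rw [hc]; omega) prim_ω
    refine ⟨z * ωE, ?_⟩
    rw [hz]
    linear_combination (-z) * ωE_sq
  -- divisibility
  have hdvd : π ∣ jacobiSum ψ ψ := by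
    rw [← hk, jacobiSum, map_sum]
    rw [← sum_binom_zero (F := F) ((NmN π - 1) / 3) (by rw [hc]; omega)]
    have hpow : ∀ x : F, mk (ψ x) = x ^ ((NmN π - 1) / 3) := by
      intro x
      obtain ⟨a, rfl⟩ := hs x
      have := (hk _).2 (hχ.prime_congr π a hp hpp)
      rw [map_sub, map_pow, sub_eq_zero] at this
      rw [this, hψ]
    refine Finset.sum_congr rfl fun x _ => ?_
    rw [map_mul, hpow, hpow]
  -- norm
  have hnorm : Nm (jacobiSum ψ ψ) = Nm π := by
    let f : Eis →+* ℂ := Eis.subtype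
    have hf : Function.Injective f := Subtype.val_injective
    have hne : ∀ k, 0 < k → k < 3 → (ψ ^ k).ringHomComp f ≠ 1 := by
      intro k h0 h1
      rw [MulChar.ringHomComp_ne_one_iff hf]
      intro h
      have := orderOf_dvd_of_pow_eq_one h
      rw [ho] at this
      have := Nat.le_of_dvd h0 this
      omega
    have hne1 : ψ.ringHomComp f ≠ 1 := by simpa using hne 1 (by norm_num) (by norm_num)
    have hne2 : ψ.ringHomComp f * ψ.ringHomComp f ≠ 1 := by
      have := hne 2 (by norm_num) (by norm_num)
      rwa [← MulChar.ringHomComp_pow, sq] at this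
    have hch : ringChar ℂ ≠ ringChar F := by
      rw [ringChar.eq_zero]
      exact (CharP.char_ne_zero_of_finite F _).symm
    have h := jacobiSum_mul_jacobiSum_inv hch hne1 hne1 hne2
    rw [jacobiSum_ringHomComp] at h
    have hinv : jacobiSum (ψ.ringHomComp f)⁻¹ (ψ.ringHomComp f)⁻¹ = (starRingEnd ℂ) (f (jacobiSum ψ ψ)) := by
      have hi : ∀ x, (ψ.ringHomComp f)⁻¹ x = (starRingEnd ℂ) (f (ψ x)) := by
        intro x
        rw [MulChar.inv_apply_eq_inv']
        change (f (ψ x))⁻¹ = _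
        by_cases hx : x = 0
        · rw [hx, MulChar.map_zero]; simp
        · exact inv_eq_of_mul_eq_one_right (hval x hx).mul_conj
      rw [jacobiSum, jacobiSum, map_sum, map_sum]
      refine Finset.sum_congr rfl fun x _ => ?_
      rw [hi, hi, map_mul, map_mul]
    rw [hinv, hc, Complex.mul_conj] at h
    have h2 : Complex.normSq (f (jacobiSum ψ ψ)) = (NmN π : ℝ) := by exact_mod_cast h
    rw [← NmN_cast π, ← h2]; rfl
  obtain ⟨c, hcc⟩ := hdvd
  have hNc : Nm c = 1 := by
    have := hnorm
    rw [hcc, Nm_mul] at this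
    have hpos := Nm_pos hp.ne_zero
    nlinarith
  have hu := isUnit_iff_Nm.2 hNc
  have : -jacobiSum ψ ψ = π := by
    apply Pri.associated_eq hpri hpp
    rw [hcc, ← mul_neg]
    exact associated_mul_unit_left _ _ hu.neg
  rw [← this, neg_neg]

/-- key relation -/
lemma recip_star (hχ : IsCubicSymbol χ) {π ρ : Eis} (hp : Prime π) (hpp : Pri π) (hr : Prime ρ) (hrp : Pri ρ)
    (h1 : ¬ ρ ∣ π * conjE π) (h2 : ¬ π ∣ ρ * conjE ρ) :
    χ ρ (π * (π * conjE π)) * χ π (ρ * conjE ρ) = 1 := by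
  obtain ⟨F, _, _, mk, ψ, hs, hk, hc, hψ, ho⟩ := exists_model hχ hp hpp
  obtain ⟨F', _, _, mk', ψ', hs', hk', hc', hψ', ho'⟩ := exists_model hχ hr hrp
  have hJ := jacobi_eq hχ hp hpp mk ψ hs hk hc hψ ho
  have hval : ∀ a, ¬ π ∣ a → CV (χ π a) := fun a => chi_prime_ne hχ hp hpp
  let φ := ψ.ringHomComp mk'
  have hφ : orderOf φ = 3 := by
    have : Fact (Nat.Prime 3) := ⟨by norm_num⟩
    apply orderOf_eq_prime
    · change (ψ.ringHomComp mk') ^ 3 = 1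
      rw [MulChar.ringHomComp_pow, ← ho, pow_orderOf_eq_one, MulChar.ringHomComp_one]
    · intro h
      obtain ⟨a, ha, ha'⟩ := chi_prime_nontrivial hχ hp hpp
      have h0 : mk a ≠ 0 := fun h => ha ((hk a).1 h)
      have e : φ (mk a) = 1 := by
        rw [h, MulChar.one_apply (Ne.isUnit h0)]
      have e2 : mk' (χ π a) = 1 := by rw [← hψ]; exact e
      apply ha'
      apply CV.eq_of_dvd hr hrp (hval a ha) (Or.inl rfl)
      rw [← hk', map_sub, e2, map_one, sub_self]
  have hcq : ∀ x, ((NmN x : ℕ) : Eis) = x * conjE x := fun x => (mul_conjE x).symm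
  have e1 : (Fintype.card F : F') = mk' (π * conjE π) := by rw [hc, ← hcq, map_natCast]
  have e2 : (Fintype.card F' : F) = mk (ρ * conjE ρ) := by rw [hc', ← hcq, map_natCast]
  have h := cubic_gauss φ hφ (by rw [e1]; exact fun h => h1 ((hk' _).1 h)) (by rw [hc']; exact NmN_mod_three hrp)
    (by rw [e2]; exact fun h => h2 ((hk _).1 h))
  rw [jacobiSum_ringHomComp, hJ, e1, e2] at h
  have e3 : φ (mk (ρ * conjE ρ)) = mk' (χ π (ρ * conjE ρ)) := by rw [← hψ]; rfl
  have e4 : φ (-1) = 1 := by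
    have : φ (mk (-1)) = mk' (χ π (-1)) := by rw [← hψ]; rfl
    rwa [chi_neg_one hχ hpp, map_neg, map_one, map_one] at this
  rw [e3, e4, one_mul, hc', ← map_mul, ← map_pow] at h
  have hnd : ¬ ρ ∣ π * conjE π * -π := by
    intro hd
    rcases hr.dvd_or_dvd hd with hd | hd
    · exact h1 hd
    · exact h1 (dvd_mul_of_dvd_left ((dvd_neg).1 hd) _)
  have h5 : mk' ((π * conjE π * -π) ^ ((NmN ρ - 1) / 3)) = mk' (χ ρ (π * conjE π * -π)) := by
    have := (hk' _).2 (hχ.prime_congr ρ (π * conjE π * -π) hr hrp)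
    rwa [map_sub, sub_eq_zero] at this
  rw [h5, ← map_mul] at h
  have h6 : χ ρ (π * conjE π * -π) = χ ρ (π * (π * conjE π)) := by
    rw [show π * conjE π * -π = (-1) * (π * (π * conjE π)) by ring, chi_mul hχ hrp, chi_neg_one hχ hrp, one_mul]
  rw [← h6]
  apply CV.eq_of_dvd hr hrp (CV.mul (chi_prime_ne hχ hr hrp hnd) (hval _ h2)) (Or.inl rfl)
  rw [← hk', map_sub, h, map_one, sub_self]

end P2b

section P2c
open scoped Classical
variable {χ : Eis → Eis → Eis}

lemma Pri.conj {x : Eis} (hx : Pri x) : Pri (conjE x) := by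
  obtain ⟨c, hc⟩ := hx
  refine ⟨conjE c, ?_⟩
  have := congrArg conjE hc
  rw [map_sub, map_one, map_mul, map_ofNat] at this
  exact this

lemma conjE_dvd {a b : Eis} (h : a ∣ b) : conjE a ∣ conjE b := map_dvd conjE h

lemma prime_conj {p : Eis} (hp : Prime p) : Prime (conjE p) := by
  refine ⟨?_, ?_, ?_⟩
  · intro h; apply hp.ne_zero; rw [← conjE_conjE p, h, map_zero]
  · intro h; apply hp.not_isUnit; rw [← conjE_conjE p]; exact h.map conjE
  · intro a b h
    have h1 := conjE_dvd h
    rw [conjE_conjE, map_mul] at h1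
    rcases hp.dvd_or_dvd h1 with h2 | h2
    · left; have := conjE_dvd h2; rwa [conjE_conjE] at this
    · right; have := conjE_dvd h2; rwa [conjE_conjE] at this

lemma conj_ω : conjE ωE = ωE ^ 2 := by
  have h1 := mul_conjE ωE
  have h2 : NmN ωE = 1 := by
    have h := isUnit_iff_Nm.1 isUnit_ω
    have := NmN_cast ωE
    rw [h] at this; exact_mod_cast this
  rw [h2, Nat.cast_one] at h1
  linear_combination ωE ^ 2 * h1 - conjE ωE * ωE_cube

lemma CV.conj {x : Eis} (hx : CV x) : CV (conjE x) := by
  rcases hx with rfl | rfl | rfl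
  · left; simp
  · right; right; exact conj_ω
  · right; left; rw [map_pow, conj_ω]; linear_combination ωE * ωE_cube

lemma CV.eq_one_of_conj {x : Eis} (hx : CV x) (h : conjE x = x) : x = 1 := by
  have h1 : x * conjE x = 1 := by
    apply Subtype.ext
    rw [Subring.coe_mul, conjE_coe, hx.mul_conj]; rfl
  rw [h] at h1
  have := hx.cube
  calc x = x ^ 3 := by rw [pow_succ, sq, h1, one_mul]
    _ = 1 := this

lemma chi_conj (hχ : IsCubicSymbol χ) {n : Eis} (hn : Pri n) (a : Eis) :
    χ (conjE n) (conjE a) = conjE (χ n a) := by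
  refine Pri.induction (P := fun n => χ (conjE n) (conjE a) = conjE (χ n a)) ?_ ?_ n hn
  · simp [hχ.one_bot]
  · intro p x hp hpp hx ih
    rw [map_mul, hχ.mul_bot _ _ _ hpp.conj hx.conj, ih, hχ.mul_bot p x a hpp hx, map_mul]
    congr 1
    by_cases hd : p ∣ a
    · rw [(hχ.prime_eq_zero _ _ hp hpp).2 hd, (hχ.prime_eq_zero _ _ (prime_conj hp) hpp.conj).2 (conjE_dvd hd), map_zero]
    · apply chi_prime_unique hχ (prime_conj hp) hpp.conj
      · intro h; apply hd; have := conjE_dvd h; rwa [conjE_conjE, conjE_conjE] at this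
      · exact (chi_prime_ne hχ hp hpp hd).conj
      · rw [NmN_conjE, ← map_pow, ← map_sub]
        exact conjE_dvd (hχ.prime_congr p a hp hpp)

lemma recip_ind (hχ : IsCubicSymbol χ) {a b : Eis} (ha : Pri a) (hb : Pri b)
    (h : ∀ p q, Prime p → Pri p → Prime q → Pri q → p ∣ a → q ∣ b → χ p q = χ q p) : χ a b = χ b a := by
  revert h
  refine Pri.induction (P := fun a => (∀ p q, Prime p → Pri p → Prime q → Pri q → p ∣ a → q ∣ b → χ p q = χ q p) →
    χ a b = χ b a) ?_ ?_ a ha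
  · intro _; rw [hχ.one_bot, chi_one hχ hb]
  · intro p x hp hpp hx ih h
    rw [hχ.mul_bot _ _ _ hpp hx, chi_mul hχ hb, ih (fun p' q a1 a2 a3 a4 a5 a6 => h p' q a1 a2 a3 a4 (a5.mul_left _) a6)]
    congr 1
    have h' : ∀ q, Prime q → Pri q → q ∣ b → χ p q = χ q p := fun q h1 h2 h3 => h p q hp hpp h1 h2 (dvd_mul_right _ _) h3
    clear ih h
    revert h'
    refine Pri.induction (P := fun b => (∀ q, Prime q → Pri q → q ∣ b → χ p q = χ q p) → χ p b = χ b p) ?_ ?_ b hb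
    · intro _; rw [hχ.one_bot, chi_one hχ hpp]
    · intro q y hq hqq hy ih h
      rw [hχ.mul_bot _ _ _ hqq hy, chi_mul hχ hpp, ih (fun q' a1 a2 a3 => h q' a1 a2 (a3.mul_left _)),
        h q hq hqq (dvd_mul_right _ _)]

lemma recip_prime1 (hχ : IsCubicSymbol χ) {π ρ : Eis} (hp : Prime π) (hpp : Pri π) (hr : Prime ρ) (hrp : Pri ρ)
    (hne : ρ ≠ π) (hne' : ρ ≠ conjE π) : χ ρ π = χ π ρ := by
  have key : ∀ {x y : Eis}, Prime x → Pri x → Prime y → Pri y → x ∣ y → x = y := fun hx hxx hy hyy h =>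
    Pri.associated_eq hxx hyy (hx.irreducible.associated_of_dvd hy.irreducible h)
  have a1 : ¬ ρ ∣ π := fun h => hne (key hr hrp hp hpp h)
  have a2 : ¬ ρ ∣ conjE π := fun h => hne' (key hr hrp (prime_conj hp) hpp.conj h)
  have a3 : ¬ π ∣ ρ := fun h => hne (key hp hpp hr hrp h).symm
  have a4 : ¬ π ∣ conjE ρ := fun h => hne' (by
    have := key hp hpp (prime_conj hr) hrp.conj h
    rw [this, conjE_conjE])
  have h1 : ¬ ρ ∣ π * conjE π := fun h => (hr.dvd_or_dvd h).elim a1 a2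
  have h2 : ¬ π ∣ ρ * conjE ρ := fun h => (hp.dvd_or_dvd h).elim a3 a4
  have e1 := recip_star hχ hp hpp hr hrp h1 h2
  have e2 := recip_star hχ hr hrp hp hpp h2 h1
  simp only [chi_mul hχ hrp, chi_mul hχ hpp] at e1 e2
  have n1 := (chi_prime_ne hχ hr hrp a1).ne_zero
  have n2 := (chi_prime_ne hχ hr hrp a2).ne_zero
  have n3 := (chi_prime_ne hχ hp hpp a3).ne_zero
  have n4 := (chi_prime_ne hχ hp hpp a4).ne_zero
  have : (χ ρ π - χ π ρ) * (χ ρ π * χ ρ (conjE π) * χ π ρ * χ π (conjE ρ)) = 0 := by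
    linear_combination e1 - e2
  have hz : χ ρ π * χ ρ (conjE π) * χ π ρ * χ π (conjE ρ) ≠ 0 :=
    mul_ne_zero (mul_ne_zero (mul_ne_zero n1 n2) n3) n4
  exact sub_eq_zero.1 ((mul_eq_zero.1 this).resolve_right hz)

lemma recip_conj (hχ : IsCubicSymbol χ) {π : Eis} (hp : Prime π) (hpp : Pri π) (hne : conjE π ≠ π) :
    χ π (conjE π) = 1 := by
  have key : ∀ {x y : Eis}, Prime x → Pri x → Prime y → Pri y → x ∣ y → x = y := fun hx hxx hy hyy h =>
    Pri.associated_eq hxx hyy (hx.irreducible.associated_of_dvd hy.irreducible h)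
  have hnd : ¬ π ∣ conjE π := fun h => hne (key hp hpp (prime_conj hp) hpp.conj h).symm
  have hnd' : ¬ conjE π ∣ π := fun h => hne (key (prime_conj hp) hpp.conj hp hpp h)
  set a := -(π + conjE π) with hadef
  have hca : conjE a = a := by rw [hadef, map_neg, map_add, conjE_conjE, add_comm]
  have ha : Pri a := by
    obtain ⟨d, hd⟩ := hpp.conj
    obtain ⟨c, hc⟩ := hpp
    exact ⟨-c - d - 1, by rw [hadef]; linear_combination - hc - hd⟩
  have h1 : χ π (conjE π) = χ π a := by
    rw [hadef, neg_eq_neg_one_mul, chi_mul hχ hpp, chi_neg_one hχ hpp, one_mul]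
    apply chi_prime_congr hχ hp hpp
    exact ⟨-1, by ring⟩
  have h2 : χ a π = χ π a := by
    apply recip_ind hχ ha hpp
    intro p q hp' hpp' hq hqq hpa hqπ
    have hqe := key hq hqq hp hpp hqπ
    rw [hqe]
    apply recip_prime1 hχ hp hpp hp' hpp'
    · rintro rfl
      apply hnd
      have := dvd_add hpa (dvd_refl p)
      rw [hadef] at this
      rw [← dvd_neg]
      convert this using 1; ring
    · rintro rfl
      apply hnd'
      have := dvd_add hpa (dvd_refl (conjE π))
      rw [hadef] at this
      rw [← dvd_neg]
      convert this using 1; ring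
  have h3 : χ a (conjE π) = χ a π := by
    have : χ a (conjE π) = χ a (-1 * π) := by
      apply chi_congr hχ ha
      exact ⟨-1, by rw [hadef]; ring⟩
    rw [this, chi_mul hχ ha, chi_neg_one hχ ha, one_mul]
  have h4 := chi_conj hχ ha π
  rw [hca, h3, h2, ← h1] at h4
  exact (chi_prime_ne hχ hp hpp hnd).eq_one_of_conj h4.symm

/-- cubic reciprocity -/
theorem recip (hχ : IsCubicSymbol χ) {a b : Eis} (ha : Pri a) (hb : Pri b) : χ a b = χ b a := by
  apply recip_ind hχ ha hb
  intro p q hp hpp hq hqq _ _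
  by_cases h : p = q
  · rw [h]
  by_cases h' : p = conjE q
  · have hne : conjE q ≠ q := fun e => h (h'.trans e)
    rw [recip_conj hχ hq hqq hne |> fun e => (by rw [h']; exact e : χ q p = 1)]
    have := chi_conj hχ hqq (conjE q)
    rw [conjE_conjE, recip_conj hχ hq hqq hne, map_one] at this
    rw [h', this]
  · exact recip_prime1 hχ hq hqq hp hpp h h'

end P2c

section P3
open scoped Classical
variable {χ : Eis → Eis → Eis}

/-- sum over residues -/
def qsum (n : Eis) (F : Eis → ℂ) : ℂ := ∑ᶠ x : Eis ⧸ Ideal.span {n}, F x.out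

/-- periodic functions -/
def Per (n : Eis) (F : Eis → ℂ) : Prop := ∀ a b, n ∣ a - b → F a = F b

lemma mk_out (n : Eis) (x : Eis ⧸ Ideal.span {n}) : Ideal.Quotient.mk (Ideal.span {n}) x.out = x :=
  Quotient.out_eq (s := Submodule.quotientRel _) x

lemma mk_eq {n a b : Eis} : Ideal.Quotient.mk (Ideal.span {n}) a = Ideal.Quotient.mk (Ideal.span {n}) b ↔ n ∣ a - b := by
  rw [Ideal.Quotient.eq, Ideal.mem_span_singleton]

lemma Per.out {n : Eis} {F : Eis → ℂ} (hF : Per n F) (a : Eis) :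
    F (Ideal.Quotient.mk (Ideal.span {n}) a).out = F a := by
  apply hF; rw [← mk_eq, mk_out]

lemma qsum_eq {n : Eis} (F : Eis → ℂ) [Fintype (Eis ⧸ Ideal.span {n})] :
    qsum n F = ∑ x : Eis ⧸ Ideal.span {n}, F x.out := by
  rw [qsum, finsum_eq_sum_of_fintype]

lemma qsum_reindex {n : Eis} {F : Eis → ℂ} (hF : Per n F) (e : Eis ⧸ Ideal.span {n} ≃ Eis ⧸ Ideal.span {n})
    (g : Eis → Eis) (hg : ∀ a, e (Ideal.Quotient.mk _ a) = Ideal.Quotient.mk _ (g a)) :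
    qsum n (fun a => F (g a)) = qsum n F := by
  unfold qsum
  rw [← finsum_comp_equiv e (f := fun x => F x.out)]
  refine finsum_congr fun x => ?_
  have h1 : e x = Ideal.Quotient.mk _ (g x.out) := by rw [← hg, mk_out]
  rw [h1, hF.out]

lemma qsum_mul_unit {n k : Eis} {F : Eis → ℂ} (hF : Per n F) (hk : IsCoprime k n) :
    qsum n (fun a => F (k * a)) = qsum n F := by
  obtain ⟨u, v, huv⟩ := hk
  have hu : IsUnit (Ideal.Quotient.mk (Ideal.span {n}) k) := by
    refine IsUnit.of_mul_eq_one (Ideal.Quotient.mk _ u) ?_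
    rw [← map_mul, ← map_one (Ideal.Quotient.mk _), mk_eq]
    exact ⟨-v, by linear_combination huv⟩
  refine qsum_reindex hF (Units.mulLeft hu.unit) _ ?_
  intro a
  rw [map_mul]; rfl

lemma qsum_add {n : Eis} {F : Eis → ℂ} (hF : Per n F) (c : Eis) :
    qsum n (fun a => F (a + c)) = qsum n F := by
  refine qsum_reindex hF (Equiv.addRight (Ideal.Quotient.mk _ c)) _ ?_
  intro a
  rw [map_add]; rfl

lemma qsum_const_mul {n : Eis} (hn : n ≠ 0) (c : ℂ) (F : Eis → ℂ) : qsum n (fun a => c * F a) = c * qsum n F := by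
  have := finite_quot hn
  let : Fintype (Eis ⧸ Ideal.span {n}) := Fintype.ofFinite _
  rw [qsum_eq, qsum_eq, Finset.mul_sum]

lemma qsum_crt {n₁ n₂ : Eis} (h1 : n₁ ≠ 0) (h2 : n₂ ≠ 0) (hc : IsCoprime n₁ n₂) {F : Eis → ℂ} (hF : Per (n₁ * n₂) F) :
    qsum (n₁ * n₂) F = qsum n₁ (fun a => qsum n₂ (fun b => F (n₂ * a + n₁ * b))) := by
  have := finite_quot h1
  have := finite_quot h2
  have := finite_quot (mul_ne_zero h1 h2)
  let i1 : Fintype (Eis ⧸ Ideal.span {n₁}) := Fintype.ofFinite _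
  let i2 : Fintype (Eis ⧸ Ideal.span {n₂}) := Fintype.ofFinite _
  let i3 : Fintype (Eis ⧸ Ideal.span {n₁ * n₂}) := Fintype.ofFinite _
  let φ : (Eis ⧸ Ideal.span {n₁}) × (Eis ⧸ Ideal.span {n₂}) → Eis ⧸ Ideal.span {n₁ * n₂} := fun p =>
    Ideal.Quotient.mk _ (n₂ * p.1.out + n₁ * p.2.out)
  have hφ : Function.Bijective φ := by
    rw [Fintype.bijective_iff_injective_and_card]
    constructor
    · rintro ⟨a, b⟩ ⟨c, d⟩ h
      have h' := mk_eq.1 h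
      have hA : n₁ ∣ n₂ * (a.out - c.out) := by
        have := (dvd_mul_right n₁ n₂).trans h'
        have h3 := dvd_sub this (dvd_mul_right n₁ (b.out - d.out))
        convert h3 using 1; ring
      have hB : n₂ ∣ n₁ * (b.out - d.out) := by
        have := (dvd_mul_left n₂ n₁).trans h'
        have h3 := dvd_sub this (dvd_mul_right n₂ (a.out - c.out))
        convert h3 using 1; ring
      have hA' := hc.dvd_of_dvd_mul_left hA
      have hB' := hc.symm.dvd_of_dvd_mul_left hB
      rw [← mk_eq, mk_out, mk_out] at hA' hB'
      rw [hA', hB']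
    · rw [Fintype.card_prod, ← Nat.card_eq_fintype_card, ← Nat.card_eq_fintype_card, ← Nat.card_eq_fintype_card,
        card_quot, card_quot, card_quot, NmN_mul]
  rw [qsum_eq, qsum_eq]
  simp_rw [qsum_eq]
  rw [← Fintype.sum_prod_type' (f := fun (a : Eis ⧸ Ideal.span {n₁}) (b : Eis ⧸ Ideal.span {n₂}) => F (n₂ * a.out + n₁ * b.out))]
  refine (Fintype.sum_bijective φ hφ _ _ ?_).symm
  intro p
  exact (hF.out _).symm

lemma exists_rep_equiv {n : Eis} (hn : n ≠ 0) :
    ∃ e : (Eis ⧸ Ideal.span {n}) × Eis ≃ Eis, ∀ p, e p = p.1.out + n * p.2 := by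
  refine ⟨Equiv.ofBijective (fun p => p.1.out + n * p.2) ⟨?_, ?_⟩, fun p => rfl⟩
  · rintro ⟨a, l⟩ ⟨b, m⟩ h
    have h : a.out + n * l = b.out + n * m := h
    have h1 : a = b := by
      rw [← mk_out n a, ← mk_out n b, mk_eq]
      exact ⟨m - l, by linear_combination h⟩
    subst h1
    have : n * l = n * m := by linear_combination h
    rw [mul_left_cancel₀ hn this]
  · intro x
    have : n ∣ x - (Ideal.Quotient.mk (Ideal.span {n}) x).out := by
      rw [← mk_eq, mk_out]
    obtain ⟨l, hl⟩ := this
    exact ⟨(Ideal.Quotient.mk _ x, l), by change _ + n * l = x; rw [← hl]; ring⟩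

lemma tsum_classes {n : Eis} (hn : n ≠ 0) {G : Eis → ℂ} (hG : Summable G) :
    ∑' m, G m = qsum n (fun a => ∑' l, G (a + n * l)) := by
  have := finite_quot hn
  let i1 : Fintype (Eis ⧸ Ideal.span {n}) := Fintype.ofFinite _
  obtain ⟨e, he⟩ := exists_rep_equiv hn
  have hs : Summable (fun p => G (e p)) := e.summable_iff.2 hG
  rw [qsum_eq, ← e.tsum_eq, hs.tsum_prod, tsum_fintype]
  refine Finset.sum_congr rfl fun x _ => tsum_congr fun l => ?_
  rw [he]

/-- primitive character -/
structure PChar (n : Eis) (f : Eis → ℂ) : Prop where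
  ne : n ≠ 0
  mul : ∀ a b, f (a * b) = f a * f b
  per : Per n f
  zero : ∀ a, ¬ IsCoprime a n → f a = 0
  one : ∀ a, IsCoprime a n → ‖f a‖ = 1
  prim : ∀ p m, Prime p → n = p * m → ∃ a, IsCoprime a n ∧ m ∣ a - 1 ∧ f a ≠ 1

lemma PChar.f_one {n : Eis} {f : Eis → ℂ} (h : PChar n f) : f 1 = 1 := by
  have h1 := h.mul 1 1
  have h2 := h.one 1 isCoprime_one_left
  rw [mul_one] at h1
  have : f 1 ≠ 0 := fun h0 => by rw [h0] at h2; simp at h2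
  exact mul_left_cancel₀ this (by rw [mul_one]; exact h1.symm)

lemma PChar.conj {n : Eis} {f : Eis → ℂ} (h : PChar n f) : PChar n (fun a => (starRingEnd ℂ) (f a)) where
  ne := h.ne
  mul a b := by rw [h.mul, map_mul]
  per a b hab := congrArg (starRingEnd ℂ) (h.per a b hab)
  zero a ha := by rw [h.zero a ha, map_zero]
  one a ha := by rw [RCLike.norm_conj, h.one a ha]
  prim p m hp hn := by
    obtain ⟨a, h1, h2, h3⟩ := h.prim p m hp hn
    refine ⟨a, h1, h2, fun h4 => h3 ?_⟩
    have := congrArg (starRingEnd ℂ) h4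
    simpa using this

lemma PChar.const : PChar 1 (fun _ => 1) where
  ne := one_ne_zero
  mul a b := by simp
  per a b _ := rfl
  zero a ha := absurd isCoprime_one_right ha
  one a _ := by simp
  prim p m hp h := absurd (IsUnit.of_mul_eq_one m h.symm) hp.not_isUnit

lemma exists_crt {n₁ n₂ : Eis} (hc : IsCoprime n₁ n₂) (a : Eis) : ∃ x, n₁ ∣ x - a ∧ n₂ ∣ x - 1 := by
  obtain ⟨u, v, h⟩ := hc
  refine ⟨a * (v * n₂) + u * n₁, ⟨u - a * u, ?_⟩, ⟨a * v - v, ?_⟩⟩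
  · linear_combination a * h
  · linear_combination h

lemma coprime_congr {n a b : Eis} (h : n ∣ a - b) (hb : IsCoprime b n) : IsCoprime a n := by
  obtain ⟨c, hc⟩ := h
  have : a = b + n * c := by linear_combination hc
  rw [this]
  rw [mul_comm n c]
  exact IsCoprime.add_mul_right_left_iff.2 hb

lemma PChar.mul_coprime {n₁ n₂ : Eis} {f₁ f₂ : Eis → ℂ} (h1 : PChar n₁ f₁) (h2 : PChar n₂ f₂) (hc : IsCoprime n₁ n₂) :
    PChar (n₁ * n₂) (fun a => f₁ a * f₂ a) where
  ne := mul_ne_zero h1.ne h2.ne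
  mul a b := by simp only [h1.mul, h2.mul]; ring
  per a b hab := by
    change f₁ a * f₂ a = f₁ b * f₂ b
    rw [h1.per a b ((dvd_mul_right _ _).trans hab), h2.per a b ((dvd_mul_left _ _).trans hab)]
  zero a ha := by
    by_cases h : IsCoprime a n₁
    · rw [h2.zero a (fun h' => ha (h.mul_right h')), mul_zero]
    · rw [h1.zero a h, zero_mul]
  one a ha := by
    rw [norm_mul, h1.one a ha.of_mul_right_left, h2.one a ha.of_mul_right_right, mul_one]
  prim p m hp hn := by
    have aux : ∀ {n₁ n₂ : Eis} {f₁ f₂ : Eis → ℂ}, PChar n₁ f₁ → PChar n₂ f₂ → IsCoprime n₁ n₂ → n₁ * n₂ = p * m → p ∣ n₁ →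
      ∃ a, IsCoprime a (n₁ * n₂) ∧ m ∣ a - 1 ∧ f₁ a * f₂ a ≠ 1 := by
      intro n₁ n₂ f₁ f₂ h1 h2 hc hn hpd
      obtain ⟨m₁, rfl⟩ := hpd
      have hm : m = m₁ * n₂ := by
        apply mul_left_cancel₀ hp.ne_zero
        rw [← hn]; ring
      obtain ⟨a, ha1, ha2, ha3⟩ := h1.prim p m₁ hp rfl
      obtain ⟨x, hx1, hx2⟩ := exists_crt hc a
      refine ⟨x, (coprime_congr hx1 ha1).mul_right (coprime_congr hx2 isCoprime_one_left), ?_, ?_⟩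
      · rw [hm]
        apply IsCoprime.mul_dvd hc.of_mul_left_right
        · have := dvd_add ((dvd_mul_left _ _).trans hx1) ha2
          simpa using this
        · exact hx2
      · rw [h1.per _ _ hx1, h2.per _ _ hx2, h2.f_one, mul_one]; exact ha3
    have hpd : p ∣ n₁ * n₂ := ⟨m, hn⟩
    rcases hp.dvd_or_dvd hpd with h | h
    · exact aux h1 h2 hc hn h
    · obtain ⟨a, ha1, ha2, ha3⟩ := aux h2 h1 hc.symm (by rw [mul_comm]; exact hn) h
      exact ⟨a, by rwa [mul_comm], ha2, by rwa [mul_comm]⟩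

/-- complex valued cubic character -/
def chiC (χ : Eis → Eis → Eis) (n a : Eis) : ℂ := (χ n a : ℂ)

lemma coprime_of_squarefree_mul {a b : Eis} (h : Squarefree (a * b)) : IsCoprime a b := by
  rw [squarefree_mul_iff] at h
  exact h.1.isCoprime

lemma PChar.chi (hχ : IsCubicSymbol χ) {n : Eis} (hn : Pri n) (hs : Squarefree n) : PChar n (chiC χ n) := by
  revert hs
  refine Pri.induction (P := fun n => Squarefree n → PChar n (chiC χ n)) ?_ ?_ n hn
  · intro _
    have : chiC χ 1 = fun _ => 1 := by
      funext a; simp [chiC, hχ.one_bot]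
    rw [this]; exact PChar.const
  · intro p x hp hpp hx ih hs
    have hc := coprime_of_squarefree_mul hs
    have hp1 : PChar p (chiC χ p) := by
      have hcp : ∀ a, IsCoprime a p ↔ ¬ p ∣ a := fun a => by
        rw [isCoprime_comm, hp.irreducible.coprime_iff_not_dvd]
      refine ⟨hp.ne_zero, ?_, ?_, ?_, ?_, ?_⟩
      · intro a b; simp [chiC, chi_prime_mul hχ hp hpp]
      · intro a b h; simp [chiC, chi_prime_congr hχ hp hpp h]
      · intro a h
        rw [hcp, not_not] at h
        simp [chiC, (hχ.prime_eq_zero _ _ hp hpp).2 h]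
      · intro a h
        rw [hcp] at h
        exact (chi_prime_ne hχ hp hpp h).norm
      · intro p' m hp' h
        obtain ⟨a, ha, ha'⟩ := chi_prime_nontrivial hχ hp hpp
        refine ⟨a, (hcp a).2 ha, ?_, ?_⟩
        · have := hp.irreducible.isUnit_or_isUnit h
          rcases this with h1 | h1
          · exact absurd h1 hp'.not_isUnit
          · exact h1.dvd
        · intro h1; apply ha'; apply Subtype.ext; exact h1
    have := hp1.mul_coprime (ih (hs.squarefree_of_dvd (dvd_mul_left _ _))) hc
    have e : chiC χ (p * x) = fun a => chiC χ p a * chiC χ x a := by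
      funext a; simp [chiC, hχ.mul_bot p x a hpp hx]
    rw [e]; exact this

end P3

section P3b
open scoped Classical
variable {χ : Eis → Eis → Eis}

/-- additive character `e(Tr(z/λ))` -/
def ee (z : ℂ) : ℂ := Complex.exp (2 * Real.pi * Complex.I * ((2 * z.im / Real.sqrt 3 : ℝ) : ℂ))

lemma ee_add (z w : ℂ) : ee (z + w) = ee z * ee w := by
  unfold ee; rw [← Complex.exp_add]; congr 1
  rw [Complex.add_im]; push_cast; ring

lemma ee_zero : ee 0 = 1 := by simp [ee]

lemma ee_neg (z : ℂ) : ee (-z) = (starRingEnd ℂ) (ee z) := by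
  unfold ee; rw [← Complex.exp_conj]; congr 1
  simp only [map_mul, map_ofNat, Complex.conj_ofReal, Complex.conj_I, Complex.neg_im]; push_cast; ring

lemma ee_norm (z : ℂ) : ‖ee z‖ = 1 := by
  unfold ee
  have : (2 * Real.pi * Complex.I * ((2 * z.im / Real.sqrt 3 : ℝ) : ℂ)) = ((2 * Real.pi * (2 * z.im / Real.sqrt 3) : ℝ) : ℂ) * Complex.I := by
    push_cast; ring
  rw [this, Complex.norm_exp_ofReal_mul_I]

lemma ee_mkE_div (a b : ℤ) (N : ℝ) : ee (((mkE a b : Eis) : ℂ) / (N : ℂ)) = Complex.exp (2 * Real.pi * Complex.I * ((b / N : ℝ) : ℂ)) := by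
  unfold ee
  rw [Complex.div_ofReal_im, mkE_im]
  have h3 : Real.sqrt 3 ≠ 0 := by positivity
  have : 2 * ((b : ℝ) * (Real.sqrt 3 / 2) / N) / Real.sqrt 3 = b / N := by
    by_cases hN : N = 0
    · simp [hN]
    · field_simp
  rw [this]

lemma ee_Eis (x : Eis) : ee (x : ℂ) = 1 := by
  obtain ⟨a, b, rfl⟩ := exists_mkE x
  have := ee_mkE_div a b 1
  simp only [Complex.ofReal_one, div_one] at this
  rw [this, Complex.exp_eq_one_iff]
  exact ⟨b, by push_cast; ring⟩

lemma exp_int_div {b : ℤ} {N : ℕ} (hN : N ≠ 0) (h : Complex.exp (2 * Real.pi * Complex.I * ((b / (N : ℝ) : ℝ) : ℂ)) = 1) :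
    (N : ℤ) ∣ b := by
  rw [Complex.exp_eq_one_iff] at h
  obtain ⟨k, hk⟩ := h
  have h1 : (2 * Real.pi * Complex.I : ℂ) ≠ 0 := Complex.two_pi_I_ne_zero
  rw [mul_comm (k : ℂ)] at hk
  have h2 := mul_left_cancel₀ h1 hk
  have h3 : (b / (N : ℝ) : ℝ) = k := by exact_mod_cast h2
  have hN' : (N : ℝ) ≠ 0 := by exact_mod_cast hN
  rw [div_eq_iff hN'] at h3
  refine ⟨k, ?_⟩
  have : (b : ℝ) = ((N * k : ℤ) : ℝ) := by rw [h3]; push_cast; ring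
  exact_mod_cast this

lemma ee_nontriv {n c : Eis} (hn : n ≠ 0) (h : ¬ n ∣ c) : ∃ x : Eis, ee (((x * c : Eis) : ℂ) / (n : ℂ)) ≠ 1 := by
  by_contra hcon
  push Not at hcon
  apply h
  have hN : NmN n ≠ 0 := (NmN_pos hn).ne'
  have hnc : (n : ℂ) ≠ 0 := by intro h; apply hn; exact Subtype.ext h
  have key : ∀ x : Eis, ((x * c : Eis) : ℂ) / (n : ℂ) = ((x * (c * conjE n) : Eis) : ℂ) / (((NmN n : ℝ)) : ℂ) := by
    intro x
    have e : ((n * conjE n : Eis) : ℂ) = (NmN n : ℂ) := by rw [mul_conjE]; simp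
    have hN' : (NmN n : ℂ) ≠ 0 := by exact_mod_cast hN
    rw [div_eq_div_iff hnc (by exact_mod_cast hN')]
    rw [Complex.ofReal_natCast, ← e]
    push_cast; ring
  obtain ⟨a, b, hab⟩ := exists_mkE (c * conjE n)
  have h1 := hcon 1
  have h2 := hcon ωE
  rw [key, hab] at h1 h2
  have hω : ωE * mkE a b = mkE (-b) (a - b) := by
    simp only [mkE]; push_cast; linear_combination (b : Eis) * ωE_sq
  rw [one_mul, ee_mkE_div] at h1
  rw [hω, ee_mkE_div] at h2
  obtain ⟨k, hk⟩ := exp_int_div hN h1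
  obtain ⟨l, hl⟩ := exp_int_div hN h2
  have hdiv : n * conjE n ∣ c * conjE n := by
    rw [hab, mul_conjE]
    refine ⟨mkE (l + k) k, ?_⟩
    have ha : a = NmN n * (l + k) := by linarith
    rw [ha, hk]
    simp only [mkE]; push_cast; ring
  have hcn : conjE n ≠ 0 := fun h => hn (by rw [← conjE_conjE n, h, map_zero])
  exact (mul_dvd_mul_iff_right hcn).1 hdiv

lemma ee_congr {n a b : Eis} (hn : n ≠ 0) (k : Eis) (h : n ∣ a - b) :
    ee ((k : ℂ) * (a : ℂ) / (n : ℂ)) = ee ((k : ℂ) * (b : ℂ) / (n : ℂ)) := by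
  obtain ⟨c, hc⟩ := h
  have hnc : (n : ℂ) ≠ 0 := by intro h; apply hn; exact Subtype.ext h
  have ha : (a : ℂ) = b + n * c := by
    have : a = b + n * c := by linear_combination hc
    rw [this]; push_cast; ring
  have : (k : ℂ) * (a : ℂ) / (n : ℂ) = (k : ℂ) * (b : ℂ) / (n : ℂ) + ((k * c : Eis) : ℂ) := by
    rw [ha]; push_cast; field_simp
  rw [this, ee_add, ee_Eis, mul_one]

lemma ee_orth {n c : Eis} (hn : n ≠ 0) :
    qsum n (fun k => ee ((c : ℂ) * (k : ℂ) / (n : ℂ))) = if n ∣ c then (NmN n : ℂ) else 0 := by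
  have := finite_quot hn
  let i1 : Fintype (Eis ⧸ Ideal.span {n}) := Fintype.ofFinite _
  have hnc : (n : ℂ) ≠ 0 := by intro h; apply hn; exact Subtype.ext h
  split_ifs with h
  · obtain ⟨d, rfl⟩ := h
    rw [qsum_eq]
    have : ∀ x : Eis ⧸ Ideal.span {n}, ee (((n * d : Eis) : ℂ) * ((x.out : Eis) : ℂ) / (n : ℂ)) = 1 := by
      intro x
      rw [show ((n * d : Eis) : ℂ) * ((x.out : Eis) : ℂ) / (n : ℂ) = ((d * x.out : Eis) : ℂ) by push_cast; field_simp]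
      exact ee_Eis _
    rw [Finset.sum_congr rfl (fun x _ => this x)]
    simp [← Nat.card_eq_fintype_card, card_quot]
  · obtain ⟨x, hx⟩ := ee_nontriv hn h
    have hper : Per n (fun k : Eis => ee ((c : ℂ) * (k : ℂ) / (n : ℂ))) := fun a b hab => ee_congr hn c hab
    have h1 := qsum_add hper x
    have h2 : (fun a : Eis => ee ((c : ℂ) * ((a + x : Eis) : ℂ) / (n : ℂ))) =
        fun a : Eis => ee (((x * c : Eis) : ℂ) / (n : ℂ)) * ee ((c : ℂ) * (a : ℂ) / (n : ℂ)) := by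
      funext a
      rw [← ee_add]; congr 1; push_cast; ring
    rw [h2, qsum_const_mul hn] at h1
    have h3 : (ee (((x * c : Eis) : ℂ) / (n : ℂ)) - 1) * qsum n (fun k => ee ((c : ℂ) * (k : ℂ) / (n : ℂ))) = 0 := by
      linear_combination h1
    exact (mul_eq_zero.1 h3).resolve_left (sub_ne_zero.2 hx)

/-- Gauss sum -/
def gs (f : Eis → ℂ) (n k : Eis) : ℂ := qsum n (fun a => f a * ee ((k : ℂ) * (a : ℂ) / (n : ℂ)))

lemma PChar.per_gs {n : Eis} {f : Eis → ℂ} (h : PChar n f) (k : Eis) :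
    Per n (fun a => f a * ee ((k : ℂ) * (a : ℂ) / (n : ℂ))) := by
  intro a b hab
  simp only
  rw [h.per a b hab, ee_congr h.ne k hab]

lemma exists_prime_of_not_coprime {k n : Eis} (hn : n ≠ 0) (h : ¬ IsCoprime k n) : ∃ p, Prime p ∧ p ∣ k ∧ p ∣ n := by
  by_contra hcon
  push Not at hcon
  exact h (isCoprime_of_prime_dvd (fun h' => hn h'.2) fun z hz h1 h2 => hcon z hz h1 h2)

lemma PChar.gs_eq {n : Eis} {f : Eis → ℂ} (h : PChar n f) (k : Eis) :
    gs f n k = (starRingEnd ℂ) (f k) * gs f n 1 := by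
  have hper1 : Per n (fun a : Eis => f a * ee (((1 : Eis) : ℂ) * (a : ℂ) / (n : ℂ))) := h.per_gs 1
  by_cases hk : IsCoprime k n
  · have h1 := qsum_mul_unit hper1 hk
    have h2 : (fun a : Eis => f (k * a) * ee (((1 : Eis) : ℂ) * ((k * a : Eis) : ℂ) / (n : ℂ))) =
        fun a : Eis => f k * (f a * ee ((k : ℂ) * (a : ℂ) / (n : ℂ))) := by
      funext a
      rw [h.mul]; push_cast; rw [one_mul]; ring
    rw [h2, qsum_const_mul h.ne] at h1
    change f k * gs f n k = gs f n 1 at h1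
    rw [← h1, ← mul_assoc, mul_comm ((starRingEnd ℂ) _), Complex.mul_conj, Complex.normSq_eq_norm_sq, h.one k hk]
    simp
  · rw [h.zero k hk, map_zero, zero_mul]
    obtain ⟨p, hp, ⟨k', rfl⟩, ⟨m, hm⟩⟩ := exists_prime_of_not_coprime h.ne hk
    obtain ⟨a₀, h1, ⟨c, hc⟩, h3⟩ := h.prim p m hp hm
    have hnc : (n : ℂ) ≠ 0 := by intro h'; apply h.ne; exact Subtype.ext h'
    have h4 := qsum_mul_unit (h.per_gs (p * k')) h1
    have h2 : (fun a : Eis => f (a₀ * a) * ee (((p * k' : Eis) : ℂ) * ((a₀ * a : Eis) : ℂ) / (n : ℂ))) =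
        fun a : Eis => f a₀ * (f a * ee (((p * k' : Eis) : ℂ) * (a : ℂ) / (n : ℂ))) := by
      funext a
      have e : ((p * k' : Eis) : ℂ) * ((a₀ * a : Eis) : ℂ) / (n : ℂ) =
          ((p * k' : Eis) : ℂ) * (a : ℂ) / (n : ℂ) + ((k' * c * a : Eis) : ℂ) := by
        have ha : a₀ = 1 + m * c := by linear_combination hc
        have hm' : (n : ℂ) = p * m := by rw [hm]; push_cast; rfl
        rw [ha, div_add' _ _ _ hnc]
        congr 1
        rw [hm']; push_cast; ring
      rw [e, ee_add, ee_Eis, h.mul]; ring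
    rw [h2, qsum_const_mul h.ne] at h4
    change f a₀ * gs f n (p * k') = gs f n (p * k') at h4
    have h5 : (f a₀ - 1) * gs f n (p * k') = 0 := by linear_combination h4
    exact (mul_eq_zero.1 h5).resolve_left (sub_ne_zero.2 h3)

lemma PChar.gs_normSq {n : Eis} {f : Eis → ℂ} (h : PChar n f) : ‖gs f n 1‖ ^ 2 = Nm n := by
  have := finite_quot h.ne
  let i1 : Fintype (Eis ⧸ Ideal.span {n}) := Fintype.ofFinite _
  let φ : ℂ := ∑ x : Eis ⧸ Ideal.span {n}, f x.out * (starRingEnd ℂ) (f x.out)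
  have hφ : φ ≠ 0 := by
    have e : φ = ((∑ x : Eis ⧸ Ideal.span {n}, ‖f x.out‖ ^ 2 : ℝ) : ℂ) := by
      change ∑ x : Eis ⧸ Ideal.span {n}, f x.out * (starRingEnd ℂ) (f x.out) = _
      push_cast
      refine Finset.sum_congr rfl fun x _ => ?_
      rw [Complex.mul_conj, Complex.normSq_eq_norm_sq]; push_cast; rfl
    rw [e]
    have : 0 < ∑ x : Eis ⧸ Ideal.span {n}, ‖f x.out‖ ^ 2 := by
      apply Finset.sum_pos' (fun _ _ => by positivity)
      refine ⟨Ideal.Quotient.mk _ 1, Finset.mem_univ _, ?_⟩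
      rw [h.per.out, h.f_one]; simp
    exact_mod_cast this.ne'
  have L : ∑ k : Eis ⧸ Ideal.span {n}, gs f n k.out * (starRingEnd ℂ) (gs f n k.out) =
      φ * (gs f n 1 * (starRingEnd ℂ) (gs f n 1)) := by
    rw [Finset.sum_mul]
    refine Finset.sum_congr rfl fun k _ => ?_
    rw [h.gs_eq k.out, map_mul, Complex.conj_conj]; ring
  have R : ∑ k : Eis ⧸ Ideal.span {n}, gs f n k.out * (starRingEnd ℂ) (gs f n k.out) = (NmN n : ℂ) * φ := by
    have e1 : ∀ k : Eis ⧸ Ideal.span {n}, gs f n k.out * (starRingEnd ℂ) (gs f n k.out) =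
        ∑ a : Eis ⧸ Ideal.span {n}, ∑ b : Eis ⧸ Ideal.span {n}, f a.out * (starRingEnd ℂ) (f b.out) *
          ee (((a.out - b.out : Eis) : ℂ) * ((k.out : Eis) : ℂ) / (n : ℂ)) := by
      intro k
      rw [gs, qsum_eq, map_sum, Finset.sum_mul_sum]
      refine Finset.sum_congr rfl fun a _ => Finset.sum_congr rfl fun b _ => ?_
      rw [map_mul, ← ee_neg, show ∀ x y z w : ℂ, x * y * (z * w) = x * z * (y * w) by intros; ring, ← ee_add]
      congr 2; push_cast; ring
    rw [Finset.sum_congr rfl (fun k _ => e1 k), Finset.sum_comm, Finset.mul_sum]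
    refine Finset.sum_congr rfl fun a _ => ?_
    rw [Finset.sum_comm]
    have e2 : ∀ b : Eis ⧸ Ideal.span {n}, ∑ k : Eis ⧸ Ideal.span {n}, f a.out * (starRingEnd ℂ) (f b.out) *
          ee (((a.out - b.out : Eis) : ℂ) * ((k.out : Eis) : ℂ) / (n : ℂ)) =
        if b = a then f a.out * (starRingEnd ℂ) (f b.out) * (NmN n : ℂ) else 0 := by
      intro b
      rw [← Finset.mul_sum, ← qsum_eq (fun k : Eis => ee (((a.out - b.out : Eis) : ℂ) * (k : ℂ) / (n : ℂ))), ee_orth h.ne]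
      have : n ∣ a.out - b.out ↔ b = a := by
        rw [← mk_eq, mk_out, mk_out, eq_comm]
      simp only [this, mul_ite, mul_zero]
    rw [Finset.sum_congr rfl (fun b _ => e2 b), Finset.sum_ite_eq' Finset.univ a]
    simp only [Finset.mem_univ, if_true]; ring
  rw [L, mul_comm] at R
  have R' := mul_right_cancel₀ hφ R
  rw [Complex.mul_conj, Complex.normSq_eq_norm_sq] at R'
  rw [← NmN_cast]
  exact_mod_cast R'

lemma gs_mul {n₁ n₂ : Eis} {f₁ f₂ : Eis → ℂ} (h1 : PChar n₁ f₁) (h2 : PChar n₂ f₂) (hc : IsCoprime n₁ n₂) :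
    gs (fun a => f₁ a * f₂ a) (n₁ * n₂) 1 = (f₁ n₂ * f₂ n₁) * (gs f₁ n₁ 1 * gs f₂ n₂ 1) := by
  have hn1 : (n₁ : ℂ) ≠ 0 := by intro h'; apply h1.ne; exact Subtype.ext h'
  have hn2 : (n₂ : ℂ) ≠ 0 := by intro h'; apply h2.ne; exact Subtype.ext h'
  rw [gs, qsum_crt h1.ne h2.ne hc ((h1.mul_coprime h2 hc).per_gs 1)]
  have e : ∀ a b : Eis, f₁ (n₂ * a + n₁ * b) * f₂ (n₂ * a + n₁ * b) *
      ee (((1 : Eis) : ℂ) * ((n₂ * a + n₁ * b : Eis) : ℂ) / ((n₁ * n₂ : Eis) : ℂ)) =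
      (f₁ n₂ * f₂ n₁ * (f₁ a * ee (((1 : Eis) : ℂ) * (a : ℂ) / (n₁ : ℂ)))) * (f₂ b * ee (((1 : Eis) : ℂ) * (b : ℂ) / (n₂ : ℂ))) := by
    intro a b
    rw [h1.per (n₂ * a + n₁ * b) (n₂ * a) ⟨b, by ring⟩, h2.per (n₂ * a + n₁ * b) (n₁ * b) ⟨a, by ring⟩, h1.mul, h2.mul]
    have : ((1 : Eis) : ℂ) * ((n₂ * a + n₁ * b : Eis) : ℂ) / ((n₁ * n₂ : Eis) : ℂ) =
        ((1 : Eis) : ℂ) * (a : ℂ) / (n₁ : ℂ) + ((1 : Eis) : ℂ) * (b : ℂ) / (n₂ : ℂ) := by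
      push_cast; field_simp
    rw [this, ee_add]; ring
  simp_rw [e]
  simp_rw [qsum_const_mul h2.ne]
  change qsum n₁ (fun a => f₁ n₂ * f₂ n₁ * (f₁ a * ee (((1 : Eis) : ℂ) * (a : ℂ) / (n₁ : ℂ))) * gs f₂ n₂ 1) = _
  have e3 : (fun a : Eis => f₁ n₂ * f₂ n₁ * (f₁ a * ee (((1 : Eis) : ℂ) * (a : ℂ) / (n₁ : ℂ))) * gs f₂ n₂ 1) =
     fun a : Eis => (f₁ n₂ * f₂ n₁ * gs f₂ n₂ 1) * (f₁ a * ee (((1 : Eis) : ℂ) * (a : ℂ) / (n₁ : ℂ))) := by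
    funext a; ring
  rw [e3, qsum_const_mul h1.ne]
  change _ * gs f₁ n₁ 1 = _
  ring

/-- mixed character -/
def mixC (χ : Eis → Eis → Eis) (r s a : Eis) : ℂ := chiC χ r a * (starRingEnd ℂ) (chiC χ s a)

/-- normalized Gauss factor of `χ_r` -/
def tauC (χ : Eis → Eis → Eis) (r : Eis) : ℂ := gs (chiC χ r) r 1
/-- Gauss factor of the conjugate -/
def tauD (χ : Eis → Eis → Eis) (r : Eis) : ℂ := gs (fun a => (starRingEnd ℂ) (chiC χ r a)) r 1

lemma PChar.mix (hχ : IsCubicSymbol χ) {r s : Eis} (hr : Pri r) (hs : Pri s) (hsq : Squarefree (r * s)) :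
    PChar (r * s) (mixC χ r s) :=
  (PChar.chi hχ hr (hsq.squarefree_of_dvd (dvd_mul_right _ _))).mul_coprime
    (PChar.chi hχ hs (hsq.squarefree_of_dvd (dvd_mul_left _ _))).conj (coprime_of_squarefree_mul hsq)

lemma gs_mix (hχ : IsCubicSymbol χ) {r s : Eis} (hr : Pri r) (hs : Pri s) (hsq : Squarefree (r * s)) :
    gs (mixC χ r s) (r * s) 1 = tauC χ r * tauD χ s := by
  have h1 := PChar.chi hχ hr (hsq.squarefree_of_dvd (dvd_mul_right _ _))
  have h2 := PChar.chi hχ hs (hsq.squarefree_of_dvd (dvd_mul_left _ _))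
  have hc := coprime_of_squarefree_mul hsq
  have := gs_mul h1 h2.conj hc
  unfold mixC tauC tauD
  rw [this]
  have e : chiC χ r s * (starRingEnd ℂ) (chiC χ s r) = 1 := by
    rw [show chiC χ s r = chiC χ r s by unfold chiC; rw [recip hχ hs hr], Complex.mul_conj,
      Complex.normSq_eq_norm_sq, h1.one s hc.symm]
    simp
  rw [e, one_mul]

lemma norm_tauC (hχ : IsCubicSymbol χ) {r : Eis} (hr : Pri r) (hs : Squarefree r) : ‖tauC χ r‖ ^ 2 = Nm r :=
  (PChar.chi hχ hr hs).gs_normSq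
lemma norm_tauD (hχ : IsCubicSymbol χ) {r : Eis} (hr : Pri r) (hs : Squarefree r) : ‖tauD χ r‖ ^ 2 = Nm r :=
  (PChar.chi hχ hr hs).conj.gs_normSq

end P3b

section P4
open scoped Classical
variable {χ : Eis → Eis → Eis}

lemma exp_neg_le_rpow {s x : ℝ} (hs : 0 ≤ s) (hx : 0 < x) : ∃ C : ℝ, 0 < C ∧ ∀ y : ℝ, 0 ≤ y → Real.exp (-(x * y)) ≤ C * (1 + y) ^ (-s) := by
  obtain ⟨k, hk⟩ := exists_nat_ge s
  refine ⟨Real.exp x * (k.factorial / x ^ k), by positivity, fun y hy => ?_⟩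
  have h1 : (x * (1 + y)) ^ k / k.factorial ≤ Real.exp (x * (1 + y)) := Real.pow_div_factorial_le_exp _ (by positivity) k
  have h2 : (1 + y) ^ s ≤ (1 + y) ^ k := by
    rw [← Real.rpow_natCast]
    exact Real.rpow_le_rpow_of_exponent_le (by linarith) hk
  rw [Real.rpow_neg (by linarith), ← div_eq_mul_inv, le_div_iff₀ (by positivity)]
  have e : Real.exp (-(x * y)) = Real.exp x / Real.exp (x * (1 + y)) := by
    rw [← Real.exp_sub]; congr 1; ring
  rw [e]
  calc Real.exp x / Real.exp (x * (1 + y)) * (1 + y) ^ s ≤ Real.exp x / ((x * (1 + y)) ^ k / k.factorial) * (1 + y) ^ k := by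
        gcongr
    _ = Real.exp x * (k.factorial / x ^ k) := by
        rw [mul_pow]; field_simp

lemma Nm_nn (x : Eis) : 0 ≤ Nm x := Complex.normSq_nonneg _

lemma summable_gauss0 {c : ℝ} (hc : 0 < c) : Summable fun l : Eis => Real.exp (-(c * Nm l)) := by
  obtain ⟨C, hC, h⟩ := exp_neg_le_rpow (s := 2) (by norm_num) hc
  have h0 : Summable fun l : Eis => if l = 0 then (1 : ℝ) else 0 :=
    summable_of_ne_finset_zero (s := {0}) (fun b hb => by simp at hb; simp [hb])
  refine Summable.of_nonneg_of_le (fun _ => (Real.exp_pos _).le) (fun l => ?_) (((summable_Nm (s := 2) (by norm_num)).mul_left C).add h0)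
  by_cases hl : l = 0
  · subst hl
    simp only [if_true]
    have : Nm 0 = 0 := by simp [Nm]
    rw [this]; simp
  · simp only [hl, if_false, add_zero]
    have h1 := one_le_Nm hl
    refine (h _ (Nm_nn l)).trans ?_
    gcongr C * ?_
    rw [Real.rpow_neg (by linarith), Real.rpow_neg (by linarith)]
    gcongr
    linarith

lemma normSq_shift (l z : ℂ) : Complex.normSq l / 2 - Complex.normSq z ≤ Complex.normSq (l + z) := by
  simp only [Complex.normSq_apply, Complex.add_re, Complex.add_im]
  nlinarith [sq_nonneg (l.re + 2 * z.re), sq_nonneg (l.im + 2 * z.im)]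

lemma summable_gauss {c : ℝ} (hc : 0 < c) (z : ℂ) : Summable fun l : Eis => Real.exp (-(c * Complex.normSq ((l : ℂ) + z))) := by
  refine Summable.of_nonneg_of_le (fun _ => (Real.exp_pos _).le) (fun l => ?_) ((summable_gauss0 (c := c / 2) (by positivity)).mul_left (Real.exp (c * Complex.normSq z)))
  rw [← Real.exp_add]
  apply Real.exp_le_exp.2
  have := normSq_shift l z
  unfold Nm
  nlinarith

lemma summable_gauss_int {c : ℝ} (hc : 0 < c) (t : ℝ) : Summable fun b : ℤ => Real.exp (-(c * ((b : ℝ) + t) ^ 2)) := by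
  have h := (summable_gauss hc (t : ℂ)).comp_injective (i := fun b : ℤ => mkE b 0) (fun a b hab => (mkE_inj hab).1)
  refine h.congr fun b => ?_
  simp only [Function.comp]
  congr 3
  rw [mkE_coe, Complex.normSq_apply]
  simp; ring

lemma poisson1 {α : ℝ} (hα : 0 < α) (x β : ℝ) :
    ∑' b : ℤ, cexp (((-(Real.pi * α * (b + x) ^ 2) : ℝ) : ℂ) + 2 * Real.pi * I * ((-(β * (b + x)) : ℝ) : ℂ)) =
    ((1 / Real.sqrt α : ℝ) : ℂ) * ∑' n : ℤ, cexp (((-(Real.pi / α * (n + β) ^ 2) : ℝ) : ℂ) + 2 * Real.pi * I * ((n * x : ℝ) : ℂ)) := by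
  have h := Complex.tsum_exp_neg_quadratic (a := (α : ℂ)) (by simpa using hα) (-(α * x) - I * β)
  have hαc : (α : ℂ) ≠ 0 := by exact_mod_cast hα.ne'
  have e1 : ∀ b : ℤ, cexp (((-(Real.pi * α * (b + x) ^ 2) : ℝ) : ℂ) + 2 * Real.pi * I * ((-(β * (b + x)) : ℝ) : ℂ)) =
      cexp (-(Real.pi * α * x ^ 2) - 2 * Real.pi * I * (β * x)) * cexp (-Real.pi * α * b ^ 2 + 2 * Real.pi * (-(α * x) - I * β) * b) := by
    intro b
    rw [← Complex.exp_add]; congr 1; push_cast; ring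
  have e2 : ∀ n : ℤ, cexp (((-(Real.pi / α * (n + β) ^ 2) : ℝ) : ℂ) + 2 * Real.pi * I * ((n * x : ℝ) : ℂ)) =
     cexp (-(Real.pi * α * x ^ 2) - 2 * Real.pi * I * (β * x)) * cexp (-Real.pi / α * (n + I * (-(α * x) - I * β)) ^ 2) := by
    intro b
    rw [← Complex.exp_add]; congr 1; push_cast
    rw [show I * (-((α:ℂ) * x) - I * β) = β - I * α * x by linear_combination (-(β:ℂ)) * Complex.I_sq]
    field_simp
    linear_combination ((α:ℂ)^2*x^2) * Complex.I_sq
  simp_rw [e1, e2, tsum_mul_left]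
  rw [h]
  have e3 : (α : ℂ) ^ (1 / 2 : ℂ) = ((Real.sqrt α : ℝ) : ℂ) := by
    rw [Real.sqrt_eq_rpow, Complex.ofReal_cpow hα.le]; norm_num
  rw [e3]; push_cast; ring

/-- the coordinate equivalence -/
def eqE : ℤ × ℤ ≃ Eis := Equiv.ofBijective (fun p => mkE p.1 p.2)
  ⟨fun p q h => Prod.ext (mkE_inj h).1 (mkE_inj h).2, fun x => by
    obtain ⟨a, b, h⟩ := exists_mkE x; exact ⟨(a, b), h.symm⟩⟩

lemma eqE_apply (p : ℤ × ℤ) : eqE p = mkE p.1 p.2 := rfl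

/-- the equivalence used on the dual side -/
def eqE2 : ℤ × ℤ ≃ Eis := Equiv.trans ⟨fun p => (p.1 + p.2, p.1), fun p => (p.2, p.1 - p.2), fun p => by simp, fun p => by simp⟩ eqE

lemma eqE2_apply (p : ℤ × ℤ) : eqE2 p = mkE (p.1 + p.2) p.1 := rfl

lemma norm_gauss_e (u v : ℝ) : ‖cexp ((u : ℂ) + 2 * Real.pi * I * (v : ℂ))‖ = Real.exp u := by
  rw [Complex.norm_exp]; congr 1
  simp

/-- Two-dimensional theta inversion. -/
lemma theta_base {y : ℝ} (hy : 0 < y) (z : ℂ) :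
    ∑' l : Eis, cexp ((-(2 * Real.pi * y * Complex.normSq ((l : ℂ) + z)) : ℝ) : ℂ) =
    ((1 / (Real.sqrt 3 * y) : ℝ) : ℂ) * ∑' k : Eis, cexp ((-(2 * Real.pi / (3 * y) * Nm k) : ℝ) : ℂ) * ee ((k : ℂ) * z) := by
  have hs3 : Real.sqrt 3 ≠ 0 := by positivity
  have hs3' : Real.sqrt 3 ^ 2 = 3 := Real.sq_sqrt (by norm_num)
  set t : ℝ := 2 * z.im / Real.sqrt 3 with ht
  set s : ℝ := z.re + t / 2 with hs
  have hzi : z.im = t * (Real.sqrt 3 / 2) := by rw [ht]; field_simp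
  have hzr : z.re = s - t / 2 := by rw [hs]; ring
  have hpi := Real.pi_pos
  have n1 : ∀ a b : ℤ, Complex.normSq ((mkE a b : ℂ) + z) = (a + (s - (b + t) / 2)) ^ 2 + 3 / 4 * (b + t) ^ 2 := by
    intro a b
    rw [Complex.normSq_apply, Complex.add_re, Complex.add_im, mkE_re, mkE_im, hzr, hzi]
    linear_combination ((b + t) ^ 2 / 4) * hs3'
  have n2 : ∀ m n : ℤ, Nm (mkE (m + n) m) = 3 / 4 * m ^ 2 + (n + m / 2) ^ 2 := by
    intro m n
    rw [Nm_mkE]; push_cast; ring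
  have n3 : ∀ m n : ℤ, ee ((mkE (m + n) m : ℂ) * z) = cexp (2 * Real.pi * I * ((m * s + n * t : ℝ) : ℂ)) := by
    intro m n
    unfold ee
    have : 2 * ((mkE (m + n) m : ℂ) * z).im / Real.sqrt 3 = m * s + n * t := by
      rw [Complex.mul_im, mkE_re, mkE_im, hzr, hzi]
      push_cast
      field_simp
      ring
    rw [this]
  let P : ℤ → ℤ → ℂ := fun b m => cexp ((-(Real.pi / (2 * y) * m ^ 2) : ℝ) + 2 * Real.pi * I * ((m * (s - (b + t) / 2) : ℝ) : ℂ)) *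
      cexp ((-(Real.pi * (3 * y / 2) * (b + t) ^ 2) : ℝ) : ℂ)
  have hP : Summable (Function.uncurry P) := by
    apply Summable.of_norm
    have h1 := summable_gauss_int (c := Real.pi * (3 * y / 2)) (by positivity) t
    have h2 := summable_gauss_int (c := Real.pi / (2 * y)) (by positivity) 0
    refine (h1.mul_of_nonneg h2 (fun _ => (Real.exp_pos _).le) (fun _ => (Real.exp_pos _).le)).congr fun p => ?_
    simp only [Function.uncurry, P]
    rw [norm_mul, norm_gauss_e, Complex.norm_exp, Complex.ofReal_re, mul_comm]
    simp
  have L1 : ∑' l : Eis, cexp ((-(2 * Real.pi * y * Complex.normSq ((l : ℂ) + z)) : ℝ) : ℂ) =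
      ∑' b : ℤ, ∑' a : ℤ, cexp ((-(2 * Real.pi * y * ((a + (s - (b + t) / 2)) ^ 2 + 3 / 4 * (b + t) ^ 2)) : ℝ) : ℂ) := by
    rw [← eqE.tsum_eq, ← (Equiv.prodComm ℤ ℤ).tsum_eq]
    have hsum : Summable fun p : ℤ × ℤ => cexp ((-(2 * Real.pi * y * Complex.normSq ((eqE (Equiv.prodComm ℤ ℤ p) : ℂ) + z)) : ℝ) : ℂ) := by
      have h := summable_gauss (c := 2 * Real.pi * y) (by positivity) z
      have h' : Summable fun l : Eis => cexp ((-(2 * Real.pi * y * Complex.normSq ((l : ℂ) + z)) : ℝ) : ℂ) := by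
        apply Summable.of_norm
        refine h.congr fun l => ?_
        rw [Complex.norm_exp, Complex.ofReal_re]
      exact ((Equiv.prodComm ℤ ℤ).trans eqE).summable_iff.2 h'
    rw [hsum.tsum_prod]
    refine tsum_congr fun b => tsum_congr fun a => ?_
    rw [eqE_apply]
    simp only [Equiv.prodComm_apply, Prod.swap]
    rw [n1]
  have L2 : ∀ b : ℤ, ∑' a : ℤ, cexp ((-(2 * Real.pi * y * ((a + (s - (b + t) / 2)) ^ 2 + 3 / 4 * (b + t) ^ 2)) : ℝ) : ℂ) =
      ((1 / Real.sqrt (2 * y) : ℝ) : ℂ) * ∑' m : ℤ, P b m := by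
    intro b
    have h := poisson1 (α := 2 * y) (by positivity) (s - (b + t) / 2) 0
    simp only [P]
    rw [tsum_mul_right, ← mul_assoc]
    simp only [add_zero] at h
    rw [← h, ← tsum_mul_right]
    refine tsum_congr fun a => ?_
    rw [← Complex.exp_add]; congr 1; push_cast; ring
  have L3 : ∀ m : ℤ, ∑' b : ℤ, P b m = ((1 / Real.sqrt (3 * y / 2) : ℝ) : ℂ) *
      ∑' n : ℤ, cexp ((-(2 * Real.pi / (3 * y) * Nm (mkE (m + n) m)) : ℝ) : ℂ) * ee ((mkE (m + n) m : ℂ) * z) := by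
    intro m
    have h := poisson1 (α := 3 * y / 2) (by positivity) t (m / 2)
    have e : ∀ b : ℤ, P b m = cexp ((-(Real.pi / (2 * y) * m ^ 2) : ℝ) + 2 * Real.pi * I * ((m * s : ℝ) : ℂ)) *
        cexp (((-(Real.pi * (3 * y / 2) * (b + t) ^ 2) : ℝ) : ℂ) + 2 * Real.pi * I * ((-(m / 2 * (b + t)) : ℝ) : ℂ)) := by
      intro b
      simp only [P]
      rw [← Complex.exp_add, ← Complex.exp_add]; congr 1; push_cast; ring
    simp_rw [e]
    rw [tsum_mul_left, h, mul_left_comm, ← tsum_mul_left]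
    congr 1
    refine tsum_congr fun n => ?_
    rw [n2, n3, ← Complex.exp_add, ← Complex.exp_add]; congr 1; push_cast
    have : (y : ℂ) ≠ 0 := by exact_mod_cast hy.ne'
    field_simp
    ring
  rw [L1]
  simp_rw [L2]
  rw [tsum_mul_left, ← hP.tsum_comm]
  simp_rw [L3]
  rw [tsum_mul_left, ← mul_assoc]
  congr 1
  · rw [← Complex.ofReal_mul]
    congr 1
    rw [div_mul_div_comm, ← Real.sqrt_mul (by positivity)]
    rw [show 2 * y * (3 * y / 2) = 3 * y ^ 2 by ring, Real.sqrt_mul (by norm_num), Real.sqrt_sq hy.le, one_mul]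
  · let G : Eis → ℂ := fun k => cexp ((-(2 * Real.pi / (3 * y) * Nm k) : ℝ) : ℂ) * ee ((k : ℂ) * z)
    have h' : Summable G := by
      apply Summable.of_norm
      refine (summable_gauss0 (c := 2 * Real.pi / (3 * y)) (by positivity)).congr fun l => ?_
      simp only [G]
      rw [norm_mul, ee_norm, Complex.norm_exp, Complex.ofReal_re, mul_one]
    have hsum : Summable (G ∘ eqE2) := eqE2.summable_iff.2 h'
    have h2 : ∑' k, G k = ∑' p, (G ∘ eqE2) p := (eqE2.tsum_eq G).symm
    change _ = ∑' k, G k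
    rw [h2, hsum.tsum_prod]
    exact tsum_congr fun m => tsum_congr fun n => rfl

/-- theta function attached to a bounded function -/
def Th (f : Eis → ℂ) (y : ℝ) : ℂ := ∑' m : Eis, f m * ((Real.exp (-(2 * Real.pi * y * Nm m)) : ℝ) : ℂ)

lemma summable_Th {f : Eis → ℂ} (hf : ∀ m, ‖f m‖ ≤ 1) {c : ℝ} (hc : 0 < c) :
    Summable fun m : Eis => f m * ((Real.exp (-(c * Nm m)) : ℝ) : ℂ) := by
  apply Summable.of_norm
  refine Summable.of_nonneg_of_le (fun _ => norm_nonneg _) (fun l => ?_) (summable_gauss0 hc)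
  rw [norm_mul, Complex.norm_real, Real.norm_of_nonneg (Real.exp_pos _).le]
  exact mul_le_of_le_one_left (Real.exp_pos _).le (hf l)

lemma PChar.norm_le {n : Eis} {f : Eis → ℂ} (h : PChar n f) (a : Eis) : ‖f a‖ ≤ 1 := by
  by_cases ha : IsCoprime a n
  · exact (h.one a ha).le
  · rw [h.zero a ha]; simp

lemma theta_fe {n : Eis} {f : Eis → ℂ} (h : PChar n f) {y : ℝ} (hy : 0 < y) :
    Th f y = gs f n 1 * ((1 / (Real.sqrt 3 * (y * Nm n)) : ℝ) : ℂ) *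
      Th (fun k => (starRingEnd ℂ) (f k)) (1 / (3 * (y * Nm n))) := by
  have hn := h.ne
  have hnc : (n : ℂ) ≠ 0 := by intro h'; apply hn; exact Subtype.ext h'
  have hN : 0 < Nm n := Nm_pos hn
  have hpi := Real.pi_pos
  have := finite_quot hn
  let i1 : Fintype (Eis ⧸ Ideal.span {n}) := Fintype.ofFinite _
  unfold Th
  rw [tsum_classes hn (summable_Th h.norm_le (by positivity)), qsum_eq]
  have e1 : ∀ a : Eis, ∑' l : Eis, f (a + n * l) * ((Real.exp (-(2 * Real.pi * y * Nm (a + n * l))) : ℝ) : ℂ) =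
      ((1 / (Real.sqrt 3 * (y * Nm n)) : ℝ) : ℂ) * ∑' k : Eis, f a * ee ((k : ℂ) * a / n) * cexp ((-(2 * Real.pi / (3 * (y * Nm n)) * Nm k) : ℝ) : ℂ) := by
    intro a
    have hb := theta_base (y := y * Nm n) (by positivity) ((a : ℂ) / n)
    have e2 : ∀ l : Eis, f (a + n * l) * ((Real.exp (-(2 * Real.pi * y * Nm (a + n * l))) : ℝ) : ℂ) =
        f a * cexp ((-(2 * Real.pi * (y * Nm n) * Complex.normSq ((l : ℂ) + (a : ℂ) / n)) : ℝ) : ℂ) := by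
      intro l
      rw [h.per (a + n * l) a ⟨l, by ring⟩, Complex.ofReal_exp]
      congr 4
      have : ((a + n * l : Eis) : ℂ) = n * ((l : ℂ) + (a : ℂ) / n) := by
        push_cast; field_simp; ring
      unfold Nm
      rw [this, Complex.normSq_mul]; ring
    simp_rw [e2]
    rw [tsum_mul_left, hb, mul_left_comm, ← tsum_mul_left]
    congr 1
    refine tsum_congr fun k => ?_
    rw [mul_div_assoc]; ring
  simp_rw [e1]
  rw [← Finset.mul_sum, ← Summable.tsum_finsetSum]
  · rw [← tsum_mul_left, ← tsum_mul_left]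
    refine tsum_congr fun k => ?_
    have hg := h.gs_eq k
    unfold gs at hg
    rw [qsum_eq, qsum_eq] at hg
    rw [← Finset.sum_mul, hg, gs, qsum_eq]
    rw [Complex.ofReal_exp]
    rw [show 2 * Real.pi / (3 * (y * Nm n)) * Nm k = 2 * Real.pi * (1 / (3 * (y * Nm n))) * Nm k by ring]
    ring
  · intro a _
    apply Summable.of_norm
    refine Summable.of_nonneg_of_le (fun _ => norm_nonneg _) (fun k => ?_) (summable_gauss0 (c := 2 * Real.pi / (3 * (y * Nm n))) (by positivity))
    rw [norm_mul, norm_mul, ee_norm, Complex.norm_exp, Complex.ofReal_re, mul_one]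
    exact mul_le_of_le_one_left (Real.exp_pos _).le (h.norm_le _)

end P4

section P5a
open scoped Classical
variable {χ : Eis → Eis → Eis}

/-- primary squarefree elements of norm at most `N` -/
def SF (N : ℝ) : Finset Eis := (ball N).filter (fun n => Pri n ∧ Squarefree n)
/-- nonzero elements of norm at most `K` -/
def nz (K : ℝ) : Finset Eis := (ball K).filter (fun n => n ≠ 0)

lemma mem_SF {N : ℝ} {n : Eis} : n ∈ SF N ↔ Nm n ≤ N ∧ Pri n ∧ Squarefree n := by
  simp [SF, mem_ball]
lemma mem_nz {N : ℝ} {n : Eis} : n ∈ nz N ↔ Nm n ≤ N ∧ n ≠ 0 := by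
  simp [nz, mem_ball]
lemma SF_mono {A B : ℝ} (h : A ≤ B) : SF A ⊆ SF B := fun n hn => by
  rw [mem_SF] at hn ⊢; exact ⟨hn.1.trans h, hn.2⟩
lemma SF_empty {A : ℝ} (h : A < 1) : SF A = ∅ := by
  rw [Finset.eq_empty_iff_forall_notMem]
  intro n hn; rw [mem_SF] at hn
  have := one_le_Nm hn.2.1.ne_zero
  linarith
lemma nz_empty {A : ℝ} (h : A < 1) : nz A = ∅ := by
  rw [Finset.eq_empty_iff_forall_notMem]
  intro n hn; rw [mem_nz] at hn
  have := one_le_Nm hn.2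
  linarith
lemma card_SF {N : ℝ} (hN : 0 ≤ N) : ((SF N).card : ℝ) ≤ 25 * N := by
  by_cases h : 1 ≤ N
  · refine le_trans ?_ (card_ball h)
    exact_mod_cast Finset.card_le_card (Finset.filter_subset _ _)
  · rw [SF_empty (by linarith)]; simp; positivity
lemma card_nz {N : ℝ} (hN : 0 ≤ N) : ((nz N).card : ℝ) ≤ 25 * N := by
  by_cases h : 1 ≤ N
  · refine le_trans ?_ (card_ball h)
    exact_mod_cast Finset.card_le_card (Finset.filter_subset _ _)
  · rw [nz_empty (by linarith)]; simp; positivity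

lemma chiC_norm_le (hχ : IsCubicSymbol χ) {n : Eis} (hn : Pri n) (a : Eis) : ‖chiC χ n a‖ ≤ 1 := by
  unfold chiC
  by_cases h : IsCoprime a n
  · exact ((chi_ne hχ hn).1 h).norm.le
  · rw [(chi_ne hχ hn).2 h]; simp

lemma chiC_mul (hχ : IsCubicSymbol χ) {n : Eis} (hn : Pri n) (a b : Eis) : chiC χ n (a * b) = chiC χ n a * chiC χ n b := by
  unfold chiC; rw [chi_mul hχ hn]; push_cast; rfl

lemma chiC_sq (hχ : IsCubicSymbol χ) {n : Eis} (hn : Pri n) (a : Eis) : chiC χ n (a ^ 2) = (starRingEnd ℂ) (chiC χ n a) := by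
  rw [pow_two, chiC_mul hχ hn]
  by_cases h : IsCoprime a n
  · have h1 : ‖chiC χ n a‖ = 1 := ((chi_ne hχ hn).1 h).norm
    have h2 : chiC χ n a ^ 3 = 1 := by
      have := ((chi_ne hχ hn).1 h).cube
      unfold chiC; exact_mod_cast congrArg (fun z : Eis => (z : ℂ)) this
    have h3 : chiC χ n a ≠ 0 := fun h0 => by rw [h0] at h1; simp at h1
    have h4 : chiC χ n a * (starRingEnd ℂ) (chiC χ n a) = 1 := by
      rw [Complex.mul_conj, Complex.normSq_eq_norm_sq, h1]; simp
    apply mul_left_cancel₀ h3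
    rw [h4, ← h2]; ring
  · have : chiC χ n a = 0 := by unfold chiC; rw [(chi_ne hχ hn).2 h]; simp
    rw [this]; simp

lemma chiC_recip (hχ : IsCubicSymbol χ) {a b : Eis} (ha : Pri a) (hb : Pri b) : chiC χ a b = chiC χ b a := by
  unfold chiC; rw [recip hχ ha hb]

/-- finite duality -/
lemma duality {ι κ : Type*} (S : Finset ι) (T : Finset κ) (f : ι → κ → ℂ) {G : ℝ} (hG : 0 ≤ G)
    (h : ∀ c : κ → ℂ, ∑ m ∈ S, ‖∑ n ∈ T, c n * f m n‖ ^ 2 ≤ G * ∑ n ∈ T, ‖c n‖ ^ 2) (d : ι → ℂ) :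
    ∑ n ∈ T, ‖∑ m ∈ S, d m * f m n‖ ^ 2 ≤ G * ∑ m ∈ S, ‖d m‖ ^ 2 := by
  set t : κ → ℂ := fun n => ∑ m ∈ S, d m * f m n with ht
  set V := ∑ n ∈ T, ‖t n‖ ^ 2 with hV
  have hV0 : 0 ≤ V := Finset.sum_nonneg fun _ _ => by positivity
  have hD0 : 0 ≤ ∑ m ∈ S, ‖d m‖ ^ 2 := Finset.sum_nonneg fun _ _ => by positivity
  have h1 := h (fun n => (starRingEnd ℂ) (t n))
  simp only [RCLike.norm_conj] at h1
  have h2 : (V : ℂ) = ∑ m ∈ S, d m * ∑ n ∈ T, (starRingEnd ℂ) (t n) * f m n := by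
    rw [hV]; push_cast
    simp_rw [Finset.mul_sum]
    rw [Finset.sum_comm]
    refine Finset.sum_congr rfl fun n _ => ?_
    have : ((‖t n‖ : ℝ) : ℂ) ^ 2 = t n * (starRingEnd ℂ) (t n) := by
      rw [Complex.mul_conj, Complex.normSq_eq_norm_sq]; push_cast; rfl
    rw [this]
    conv_lhs => rw [ht]
    simp only []
    rw [Finset.sum_mul]
    refine Finset.sum_congr rfl fun m _ => by ring
  have h3 : V ≤ ∑ m ∈ S, ‖d m‖ * ‖∑ n ∈ T, (starRingEnd ℂ) (t n) * f m n‖ := by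
    have : V = ‖(V : ℂ)‖ := by rw [Complex.norm_real, Real.norm_of_nonneg hV0]
    rw [this, h2]
    exact (norm_sum_le _ _).trans (Finset.sum_le_sum fun m _ => (norm_mul _ _).le)
  have h4 : V ^ 2 ≤ (∑ m ∈ S, ‖d m‖ ^ 2) * (G * V) := by
    calc V ^ 2 ≤ (∑ m ∈ S, ‖d m‖ * ‖∑ n ∈ T, (starRingEnd ℂ) (t n) * f m n‖) ^ 2 := by gcongr
      _ ≤ _ := Finset.sum_mul_sq_le_sq_mul_sq _ _ _
      _ ≤ _ := by gcongr
  rcases hV0.eq_or_lt with h0 | h0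
  · rw [← h0]; positivity
  · nlinarith

/-- large sieve bound for squarefree against squarefree -/
def LSB (χ : Eis → Eis → Eis) (A B G : ℝ) : Prop := ∀ c : Eis → ℂ,
  ∑ m ∈ SF A, ‖∑ n ∈ SF B, c n * chiC χ n m‖ ^ 2 ≤ G * ∑ n ∈ SF B, ‖c n‖ ^ 2
/-- large sieve bound for all nonzero elements against squarefree -/
def EB (χ : Eis → Eis → Eis) (A B G : ℝ) : Prop := ∀ c : Eis → ℂ,
  ∑ m ∈ nz A, ‖∑ n ∈ SF B, c n * chiC χ n m‖ ^ 2 ≤ G * ∑ n ∈ SF B, ‖c n‖ ^ 2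

lemma LSB.symm (hχ : IsCubicSymbol χ) {A B G : ℝ} (hG : 0 ≤ G) (h : LSB χ A B G) : LSB χ B A G := by
  intro d
  refine le_trans (le_of_eq ?_) (duality (SF A) (SF B) (fun m n => chiC χ n m) hG h d)
  refine Finset.sum_congr rfl fun n hn => ?_
  congr 2
  refine Finset.sum_congr rfl fun m hm => ?_
  rw [chiC_recip hχ (mem_SF.1 hm).2.1 (mem_SF.1 hn).2.1]

lemma LSB.mono {A B G A' B' G' : ℝ} (h : LSB χ A B G) (hA : A' ≤ A) (hB : B' ≤ B) (hG : G ≤ G') : LSB χ A' B' G' := by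
  intro c
  have h1 := h (fun n => if n ∈ SF B' then c n else 0)
  have hs := SF_mono hB
  have e1 : ∀ m, ∑ n ∈ SF B, (if n ∈ SF B' then c n else 0) * chiC χ n m = ∑ n ∈ SF B', c n * chiC χ n m := by
    intro m
    rw [← Finset.sum_subset hs (fun x _ hx => by simp [hx])]
    exact Finset.sum_congr rfl fun n hn => by simp [hn]
  have e2 : ∑ n ∈ SF B, ‖if n ∈ SF B' then c n else 0‖ ^ 2 = ∑ n ∈ SF B', ‖c n‖ ^ 2 := by
    rw [← Finset.sum_subset hs (fun x _ hx => by simp [hx])]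
    exact Finset.sum_congr rfl fun n hn => by simp [hn]
  simp_rw [e1] at h1
  rw [e2] at h1
  refine le_trans (Finset.sum_le_sum_of_subset_of_nonneg (SF_mono hA) (fun _ _ _ => by positivity)) (h1.trans ?_)
  have : 0 ≤ ∑ n ∈ SF B', ‖c n‖ ^ 2 := Finset.sum_nonneg fun _ _ => by positivity
  gcongr

lemma EB.mono {A B G A' B' G' : ℝ} (h : EB χ A B G) (hA : A' ≤ A) (hB : B' ≤ B) (hG : G ≤ G') : EB χ A' B' G' := by
  intro c
  have h1 := h (fun n => if n ∈ SF B' then c n else 0)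
  have hs := SF_mono hB
  have e1 : ∀ m, ∑ n ∈ SF B, (if n ∈ SF B' then c n else 0) * chiC χ n m = ∑ n ∈ SF B', c n * chiC χ n m := by
    intro m
    rw [← Finset.sum_subset hs (fun x _ hx => by simp [hx])]
    exact Finset.sum_congr rfl fun n hn => by simp [hn]
  have e2 : ∑ n ∈ SF B, ‖if n ∈ SF B' then c n else 0‖ ^ 2 = ∑ n ∈ SF B', ‖c n‖ ^ 2 := by
    rw [← Finset.sum_subset hs (fun x _ hx => by simp [hx])]
    exact Finset.sum_congr rfl fun n hn => by simp [hn]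
  simp_rw [e1] at h1
  rw [e2] at h1
  have hA' : nz A' ⊆ nz A := fun n hn => by rw [mem_nz] at hn ⊢; exact ⟨hn.1.trans hA, hn.2⟩
  refine le_trans (Finset.sum_le_sum_of_subset_of_nonneg hA' (fun _ _ _ => by positivity)) (h1.trans ?_)
  have : 0 ≤ ∑ n ∈ SF B', ‖c n‖ ^ 2 := Finset.sum_nonneg fun _ _ => by positivity
  gcongr

lemma LSB.of_lt_one {A B G : ℝ} (hG : 0 ≤ G) (hA : A < 1) : LSB χ A B G := by
  intro c; rw [SF_empty hA]; simp; positivity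
lemma EB.of_lt_one {A B G : ℝ} (hG : 0 ≤ G) (hA : A < 1) : EB χ A B G := by
  intro c; rw [nz_empty hA]; simp; positivity

lemma sum_norm_weight {S : Finset Eis} {c w : Eis → ℂ} (hw : ∀ n ∈ S, ‖w n‖ ≤ 1) :
    ∑ n ∈ S, ‖c n * w n‖ ^ 2 ≤ ∑ n ∈ S, ‖c n‖ ^ 2 := by
  refine Finset.sum_le_sum fun n hn => ?_
  rw [norm_mul]
  have := mul_le_of_le_one_right (norm_nonneg (c n)) (hw n hn)
  gcongr

lemma LSB.weight {A B G : ℝ} (hG : 0 ≤ G) (h : LSB χ A B G) (c w : Eis → ℂ) (hw : ∀ n ∈ SF B, ‖w n‖ ≤ 1) :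
    ∑ m ∈ SF A, ‖∑ n ∈ SF B, c n * w n * chiC χ n m‖ ^ 2 ≤ G * ∑ n ∈ SF B, ‖c n‖ ^ 2 :=
  (h (fun n => c n * w n)).trans (by gcongr ?_ * ?_; exact sum_norm_weight hw)

lemma LSB.weight_conj {A B G : ℝ} (hG : 0 ≤ G) (h : LSB χ A B G) (c w : Eis → ℂ) (hw : ∀ n ∈ SF B, ‖w n‖ ≤ 1) :
    ∑ m ∈ SF A, ‖∑ n ∈ SF B, c n * w n * (starRingEnd ℂ) (chiC χ n m)‖ ^ 2 ≤ G * ∑ n ∈ SF B, ‖c n‖ ^ 2 := by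
  have h1 := h.weight hG (fun n => (starRingEnd ℂ) (c n)) (fun n => (starRingEnd ℂ) (w n)) (by simpa using hw)
  simp only [RCLike.norm_conj] at h1
  refine le_trans (le_of_eq ?_) h1
  refine Finset.sum_congr rfl fun m _ => ?_
  rw [← RCLike.norm_conj, map_sum]
  simp only [map_mul, Complex.conj_conj]

lemma EB_trivial (hχ : IsCubicSymbol χ) {K N : ℝ} (hK : 0 ≤ K) (hN : 0 ≤ N) : EB χ K N (625 * (K * N)) := by
  intro c
  have h1 : ∀ m ∈ nz K, ‖∑ n ∈ SF N, c n * chiC χ n m‖ ^ 2 ≤ 25 * N * ∑ n ∈ SF N, ‖c n‖ ^ 2 := by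
    intro m _
    have a1 : ‖∑ n ∈ SF N, c n * chiC χ n m‖ ≤ ∑ n ∈ SF N, 1 * ‖c n‖ := by
      refine (norm_sum_le _ _).trans (Finset.sum_le_sum fun n hn => ?_)
      rw [norm_mul, one_mul]
      exact mul_le_of_le_one_right (norm_nonneg _) (chiC_norm_le hχ (mem_SF.1 hn).2.1 m)
    calc ‖∑ n ∈ SF N, c n * chiC χ n m‖ ^ 2 ≤ (∑ n ∈ SF N, 1 * ‖c n‖) ^ 2 := by gcongr
      _ ≤ (∑ n ∈ SF N, (1:ℝ) ^ 2) * ∑ n ∈ SF N, ‖c n‖ ^ 2 := Finset.sum_mul_sq_le_sq_mul_sq _ _ _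
      _ ≤ _ := by
        gcongr
        simpa using card_SF hN
  refine (Finset.sum_le_sum h1).trans ?_
  rw [Finset.sum_const, nsmul_eq_mul]
  have := card_nz hK
  calc ((nz K).card : ℝ) * (25 * N * ∑ n ∈ SF N, ‖c n‖ ^ 2) ≤ (25 * K) * (25 * N * ∑ n ∈ SF N, ‖c n‖ ^ 2) := by gcongr
    _ = _ := by ring

lemma sum_le_sum_surj {ι κ : Type*} {s : Finset κ} {I : Finset ι} (φ : ι → κ) {f : κ → ℝ} (hf : ∀ k, 0 ≤ f k)
    (h : ∀ k ∈ s, ∃ i ∈ I, φ i = k) : ∑ k ∈ s, f k ≤ ∑ i ∈ I, f (φ i) := by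
  have h1 : s ⊆ I.image φ := fun k hk => by
    obtain ⟨i, hi, rfl⟩ := h k hk; exact Finset.mem_image_of_mem _ hi
  refine (Finset.sum_le_sum_of_subset_of_nonneg h1 fun _ _ _ => hf _).trans ?_
  have : ∀ k ∈ I.image φ, f k ≤ ∑ i ∈ I with φ i = k, f (φ i) := by
    intro k hk
    obtain ⟨i, hi, rfl⟩ := Finset.mem_image.1 hk
    exact Finset.single_le_sum (f := fun j => f (φ j)) (fun _ _ => hf _) (by simp [hi])
  refine (Finset.sum_le_sum this).trans (le_of_eq ?_)
  exact Finset.sum_fiberwise_of_maps_to (fun i hi => Finset.mem_image_of_mem _ hi) _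

lemma sum_Nm_le {s : ℝ} (hs : 1 < s) : ∃ C : ℝ, 0 < C ∧ ∀ S : Finset Eis, ∑ x ∈ S, Nm x ^ (-s) ≤ C := by
  refine ⟨1 + ∑' x : Eis, Nm x ^ (-s), ?_, fun S => ?_⟩
  · have : 0 ≤ ∑' x : Eis, Nm x ^ (-s) := tsum_nonneg fun x => Real.rpow_nonneg (Nm_nn x) _
    linarith
  · have := (summable_Nm hs).sum_le_tsum S (fun x _ => Real.rpow_nonneg (Nm_nn x) _)
    linarith

end P5a

section P5b
open scoped Classical
variable {χ : Eis → Eis → Eis}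

lemma sum_le_sum_surj2 {ι ι' κ : Type*} {s : Finset κ} {I : Finset ι} {t : ι → Finset ι'} (φ : ι → ι' → κ)
    {f : κ → ℝ} (hf : ∀ k, 0 ≤ f k) (h : ∀ k ∈ s, ∃ i ∈ I, ∃ j ∈ t i, φ i j = k) :
    ∑ k ∈ s, f k ≤ ∑ i ∈ I, ∑ j ∈ t i, f (φ i j) := by
  have h1 := sum_le_sum_surj (s := s) (I := I.sigma t) (fun x => φ x.1 x.2) hf (by
    intro k hk
    obtain ⟨i, hi, j, hj, e⟩ := h k hk
    exact ⟨⟨i, j⟩, by simp [hi, hj], e⟩)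
  rwa [Finset.sum_sigma] at h1

lemma LSB_inner : ∃ C : ℝ, 0 < C ∧ ∀ χ, IsCubicSymbol χ → ∀ W K N : ℝ, 0 ≤ W → 1 ≤ N →
    (∀ A, 0 < A → A ≤ K → LSB χ A N (W * (N + (N * A) ^ (2/3 : ℝ)))) →
    ∀ K', 0 < K' → K' ≤ K → ∀ c w : Eis → ℂ, (∀ n ∈ SF N, ‖w n‖ ≤ 1) →
    ∑ p ∈ (SF K' ×ˢ SF K').filter (fun p => Nm p.1 * Nm p.2 ^ 2 ≤ K'),
      ‖∑ n ∈ SF N, c n * w n * (chiC χ n p.1 * (starRingEnd ℂ) (chiC χ n p.2))‖ ^ 2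
      ≤ C * W * (K' ^ (1/3 : ℝ) * N + (N * K') ^ (2/3 : ℝ)) * ∑ n ∈ SF N, ‖c n‖ ^ 2 := by
  obtain ⟨C0, hC0, hsum⟩ := sum_Nm_le (s := 4/3) (by norm_num)
  refine ⟨50 + C0, by positivity, ?_⟩
  intro χ hχ W K N hW hN hL K' hK' hKK c w hw
  set V := ∑ n ∈ SF N, ‖c n‖ ^ 2 with hV
  have hV0 : 0 ≤ V := Finset.sum_nonneg fun _ _ => by positivity
  by_cases h1 : K' < 1
  · rw [SF_empty h1]; simp; positivity
  push Not at h1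
  set f : Eis → Eis → ℝ := fun a b => ‖∑ n ∈ SF N, c n * w n * (chiC χ n a * (starRingEnd ℂ) (chiC χ n b))‖ ^ 2 with hf
  have hf0 : ∀ a b, 0 ≤ f a b := fun a b => by simp only [hf]; positivity
  set B := SF (K' ^ (1/3 : ℝ)) with hB
  have hc0 : 0 ≤ K' ^ (1/3 : ℝ) := by positivity
  have hcube : (K' ^ (1/3 : ℝ)) ^ 3 = K' := by
    rw [← Real.rpow_natCast, ← Real.rpow_mul hK'.le]; norm_num
  have key : ∑ p ∈ (SF K' ×ˢ SF K').filter (fun p => Nm p.1 * Nm p.2 ^ 2 ≤ K'), f p.1 p.2 ≤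
      ∑ b ∈ B, ∑ a ∈ SF (K' / Nm b ^ 2), f a b + ∑ a ∈ B, ∑ b ∈ SF ((K' / Nm a) ^ (1/2 : ℝ)), f a b := by
    rw [← Finset.sum_filter_add_sum_filter_not _ (fun p : Eis × Eis => Nm p.2 ≤ K' ^ (1/3 : ℝ))]
    refine add_le_add ?_ ?_
    · refine sum_le_sum_surj2 (fun b a => (a, b)) (f := fun p => f p.1 p.2) (fun k => hf0 _ _) ?_
      rintro ⟨a, b⟩ hk
      simp only [Finset.mem_filter, Finset.mem_product, mem_SF] at hk
      obtain ⟨⟨⟨ha, hb⟩, hab⟩, hb'⟩ := hk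
      have hb1 := Nm_pos hb.2.1.ne_zero
      refine ⟨b, mem_SF.2 ⟨hb', hb.2⟩, a, mem_SF.2 ⟨?_, ha.2⟩, rfl⟩
      rw [le_div_iff₀ (by positivity)]; exact hab
    · refine sum_le_sum_surj2 (fun a b => (a, b)) (f := fun p => f p.1 p.2) (fun k => hf0 _ _) ?_
      rintro ⟨a, b⟩ hk
      simp only [Finset.mem_filter, Finset.mem_product, mem_SF, not_le] at hk
      obtain ⟨⟨⟨ha, hb⟩, hab⟩, hb'⟩ := hk
      have hb1 := Nm_pos hb.2.1.ne_zero
      have ha1 := Nm_pos ha.2.1.ne_zero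
      refine ⟨a, mem_SF.2 ⟨?_, ha.2⟩, b, mem_SF.2 ⟨?_, hb.2⟩, rfl⟩
      · by_contra hcon
        push Not at hcon
        have : K' ^ (1/3 : ℝ) * (K' ^ (1/3 : ℝ)) ^ 2 < Nm a * Nm b ^ 2 := by gcongr
        nlinarith
      · rw [← Real.sqrt_eq_rpow]
        apply Real.le_sqrt_of_sq_le
        rw [le_div_iff₀ ha1]; linarith
  have hbB : ∀ b ∈ B, 1 ≤ Nm b ∧ Pri b := fun b hb => ⟨one_le_Nm (mem_SF.1 hb).2.1.ne_zero, (mem_SF.1 hb).2.1⟩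
  have hcard : (B.card : ℝ) ≤ 25 * K' ^ (1/3 : ℝ) := card_SF hc0
  set Q := (N * K') ^ (2/3 : ℝ) with hQ
  have hQ0 : 0 ≤ Q := by positivity
  have b1 : ∀ b ∈ B, ∑ a ∈ SF (K' / Nm b ^ 2), f a b ≤ W * (N + Q * Nm b ^ (-(4/3) : ℝ)) * V := by
    intro b hb
    obtain ⟨hb1, hbP⟩ := hbB b hb
    have l1 := hL (K' / Nm b ^ 2) (by positivity) ((div_le_self hK'.le (by nlinarith)).trans hKK)
    have l2 := l1.weight (by positivity) c (fun n => w n * (starRingEnd ℂ) (chiC χ n b)) (by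
      intro n hn
      rw [norm_mul, RCLike.norm_conj]
      exact mul_le_one₀ (hw n hn) (norm_nonneg _) (chiC_norm_le hχ (mem_SF.1 hn).2.1 b))
    have e : (N * (K' / Nm b ^ 2)) ^ (2/3 : ℝ) = Q * Nm b ^ (-(4/3) : ℝ) := by
      rw [← mul_div_assoc, Real.div_rpow (by positivity) (by positivity), ← Real.rpow_natCast (Nm b),
        ← Real.rpow_mul (by positivity), Real.rpow_neg (by positivity), div_eq_mul_inv]
      norm_num [hQ]
    rw [e] at l2
    refine le_trans (le_of_eq ?_) l2
    refine Finset.sum_congr rfl fun a _ => ?_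
    simp only [hf]; congr 2
    refine Finset.sum_congr rfl fun n _ => by ring
  have b2 : ∀ a ∈ B, ∑ b ∈ SF ((K' / Nm a) ^ (1/2 : ℝ)), f a b ≤ W * (N + N ^ (2/3 : ℝ) * K' ^ (1/3 : ℝ)) * V := by
    intro a ha
    obtain ⟨ha1, haP⟩ := hbB a ha
    have q0 : 0 < K' / Nm a := by positivity
    have q1 : (K' / Nm a) ^ (1/2 : ℝ) ≤ K' ^ (1/2 : ℝ) := by
      gcongr; exact div_le_self hK'.le ha1
    have q2 : K' ^ (1/2 : ℝ) ≤ K' := by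
      calc K' ^ (1/2 : ℝ) ≤ K' ^ (1 : ℝ) := Real.rpow_le_rpow_of_exponent_le h1 (by norm_num)
        _ = K' := Real.rpow_one _
    have l1 := hL ((K' / Nm a) ^ (1/2 : ℝ)) (by positivity) (q1.trans (q2.trans hKK))
    have l2 := l1.weight_conj (by positivity) c (fun n => w n * (chiC χ n a)) (by
      intro n hn
      rw [norm_mul]
      exact mul_le_one₀ (hw n hn) (norm_nonneg _) (chiC_norm_le hχ (mem_SF.1 hn).2.1 a))
    have e : (N * (K' / Nm a) ^ (1/2 : ℝ)) ^ (2/3 : ℝ) ≤ N ^ (2/3 : ℝ) * K' ^ (1/3 : ℝ) := by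
      calc (N * (K' / Nm a) ^ (1/2 : ℝ)) ^ (2/3 : ℝ) ≤ (N * K' ^ (1/2 : ℝ)) ^ (2/3 : ℝ) := by gcongr
        _ = _ := by
          rw [Real.mul_rpow (by positivity) (by positivity), ← Real.rpow_mul hK'.le]; norm_num
    refine le_trans (le_of_eq ?_) (l2.trans ?_)
    · refine Finset.sum_congr rfl fun b _ => ?_
      simp only [hf]; congr 2
      refine Finset.sum_congr rfl fun n _ => by ring
    · gcongr
  have s1 : ∑ b ∈ B, ∑ a ∈ SF (K' / Nm b ^ 2), f a b ≤ W * (25 * K' ^ (1/3 : ℝ) * N + Q * C0) * V := by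
    refine (Finset.sum_le_sum b1).trans ?_
    rw [← Finset.sum_mul, ← Finset.mul_sum, Finset.sum_add_distrib, ← Finset.mul_sum]
    simp only [Finset.sum_const, nsmul_eq_mul]
    gcongr
    exact hsum B
  have s2 : ∑ a ∈ B, ∑ b ∈ SF ((K' / Nm a) ^ (1/2 : ℝ)), f a b ≤ W * (25 * K' ^ (1/3 : ℝ) * N + 25 * Q) * V := by
    refine (Finset.sum_le_sum b2).trans ?_
    rw [Finset.sum_const, nsmul_eq_mul]
    have e : Q = N ^ (2/3 : ℝ) * K' ^ (1/3 : ℝ) * K' ^ (1/3 : ℝ) := by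
      rw [hQ, Real.mul_rpow (by positivity) (by positivity), mul_assoc, ← Real.rpow_add hK']; norm_num
    calc (B.card : ℝ) * (W * (N + N ^ (2/3 : ℝ) * K' ^ (1/3 : ℝ)) * V) ≤ 25 * K' ^ (1/3 : ℝ) * (W * (N + N ^ (2/3 : ℝ) * K' ^ (1/3 : ℝ)) * V) := by gcongr
      _ = _ := by rw [e]; ring
  refine key.trans ((add_le_add s1 s2).trans ?_)
  have : 0 ≤ W * V * (C0 * (K' ^ (1/3 : ℝ) * N)+ 25 * Q) := by positivity
  linarith

lemma E_step (ε : ℝ) (hε : 0 < ε) : ∃ C : ℝ, 0 < C ∧ ∀ χ, IsCubicSymbol χ → ∀ W K N : ℝ, 0 ≤ W → 1 ≤ N → 1 ≤ K →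
    (∀ A, 0 < A → A ≤ K → LSB χ A N (W * (N + (N * A) ^ (2/3 : ℝ)))) →
    EB χ K N (C * W * K ^ ε * (K ^ (1/3 : ℝ) * N + (N * K) ^ (2/3 : ℝ))) := by
  obtain ⟨C1, hC1, hin⟩ := LSB_inner
  obtain ⟨C2, hC2, hsum⟩ := sum_Nm_le (s := 1 + ε) (by linarith)
  set r : ℝ := 3 ^ (-(1/3) : ℝ) with hr
  have hr0 : 0 < r := by positivity
  have hr1 : r < 1 := Real.rpow_lt_one_of_one_lt_of_neg (by norm_num) (by norm_num)
  have hr1' : 0 < 1 - r := by linarith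
  refine ⟨25 * (1 - r)⁻¹ * C1 * C2, by positivity, ?_⟩
  intro χ hχ W K N hW hN hK hL c
  have hK0 : 0 < K := by linarith
  set V := ∑ n ∈ SF N, ‖c n‖ ^ 2 with hV
  have hV0 : 0 ≤ V := Finset.sum_nonneg fun _ _ => by positivity
  obtain ⟨J, hJ⟩ := pow_unbounded_of_one_lt K (by norm_num : (1:ℝ) < 3)
  set F : Eis → ℝ := fun m => ‖∑ n ∈ SF N, c n * chiC χ n m‖ ^ 2 with hF
  set T := (ball 1) ×ˢ (Finset.range J) ×ˢ (nz K) with hT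
  set K' : (Eis × ℕ × Eis) → ℝ := fun t => K / (3 ^ t.2.1 * Nm t.2.2 ^ 3) with hK'
  set B := K ^ (1/3 : ℝ) * N + (N * K) ^ (2/3 : ℝ) with hB
  have hB0 : 0 ≤ B := by positivity
  have key : ∑ m ∈ nz K, F m ≤ ∑ t ∈ T.filter (fun t => IsUnit t.1), ∑ p ∈ (SF (K' t) ×ˢ SF (K' t)).filter (fun p => Nm p.1 * Nm p.2 ^ 2 ≤ K' t),
      F (t.1 * lam ^ t.2.1 * t.2.2 ^ 3 * (p.1 * p.2 ^ 2)) := by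
    refine sum_le_sum_surj2 (fun (t : Eis × ℕ × Eis) (p : Eis × Eis) => t.1 * lam ^ t.2.1 * t.2.2 ^ 3 * (p.1 * p.2 ^ 2)) (fun k => by simp only [hF]; positivity) ?_
    intro m hm
    obtain ⟨hmK, hm0⟩ := mem_nz.1 hm
    obtain ⟨u, j, x, hu, hx, rfl⟩ := exists_factor hm0
    obtain ⟨a, b, c, ha, hb, hc, hsq, rfl⟩ := exists_abc x hx
    have ha1 := one_le_Nm ha.ne_zero
    have hb1 := one_le_Nm hb.ne_zero
    have hc1 := one_le_Nm hc.ne_zero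
    rw [Nm_mul, Nm_mul, Nm_mul, Nm_mul, Nm_pow, Nm_pow, Nm_pow, Nm_lam, isUnit_iff_Nm.1 hu, one_mul] at hmK
    have h3 : (1:ℝ) ≤ 3 ^ j := one_le_pow₀ (by norm_num)
    have hcc : Nm c ≤ Nm c ^ 3 := le_self_pow₀ hc1 (by norm_num)
    have hbb : Nm b ≤ Nm b ^ 2 := le_self_pow₀ hb1 (by norm_num)
    have hab1 : 1 ≤ Nm a * Nm b ^ 2 := one_le_mul_of_one_le_of_one_le ha1 (one_le_pow₀ hb1)
    have hle : Nm a * Nm b ^ 2 ≤ K / (3 ^ j * Nm c ^ 3) := by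
      rw [le_div_iff₀ (by positivity)]; linarith
    have hd : 3 ^ j * Nm c ^ 3 ≤ K := by
      refine le_trans ?_ hmK
      nlinarith [mul_nonneg (sub_nonneg.2 hab1) (by positivity : 0 ≤ 3 ^ j * Nm c ^ 3)]
    refine ⟨(u, j, c), ?_, (a, b), ?_, by ring⟩
    · simp only [hT, Finset.mem_filter, Finset.mem_product, mem_ball, Finset.mem_range, mem_nz]
      refine ⟨⟨(isUnit_iff_Nm.1 hu).le, ?_, ?_, hc.ne_zero⟩, hu⟩
      · have : (3:ℝ) ^ j < 3 ^ J := by nlinarith [one_le_pow₀ (n := 3) hc1]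
        exact (pow_lt_pow_iff_right₀ (by norm_num)).1 this
      · nlinarith
    · simp only [Finset.mem_filter, Finset.mem_product, mem_SF]
      refine ⟨⟨⟨?_, ha, hsq.of_mul_left⟩, ?_, hb, hsq.of_mul_right⟩, hle⟩
      · refine le_trans ?_ hle; nlinarith
      · refine le_trans ?_ hle; nlinarith
  refine key.trans ?_
  have hb : ∀ t ∈ T.filter (fun t => IsUnit t.1), ∑ p ∈ (SF (K' t) ×ˢ SF (K' t)).filter (fun p => Nm p.1 * Nm p.2 ^ 2 ≤ K' t),
      F (t.1 * lam ^ t.2.1 * t.2.2 ^ 3 * (p.1 * p.2 ^ 2)) ≤ C1 * W * B * V * (r ^ t.2.1 * (K ^ ε * Nm t.2.2 ^ (-(1 + ε)))) := by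
    rintro ⟨u, j, e⟩ ht
    simp only [hT, Finset.mem_filter, Finset.mem_product, mem_ball, Finset.mem_range, mem_nz] at ht
    obtain ⟨⟨_, _, heK, he0⟩, hu⟩ := ht
    have he1 := one_le_Nm he0
    have h3 : (1:ℝ) ≤ 3 ^ j := one_le_pow₀ (by norm_num)
    have hd1 : 1 ≤ 3 ^ j * Nm e ^ 3 := one_le_mul_of_one_le_of_one_le h3 (one_le_pow₀ he1)
    have hK'0 : 0 < K' (u, j, e) := by simp only [hK']; positivity
    have l := hin χ hχ W K N hW hN hL (K' (u, j, e)) hK'0 (div_le_self hK0.le hd1) c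
      (fun n => chiC χ n (u * lam ^ j * e ^ 3)) (fun n hn => chiC_norm_le hχ (mem_SF.1 hn).2.1 _)
    refine le_trans (le_of_eq ?_) (l.trans ?_)
    · refine Finset.sum_congr rfl fun p _ => ?_
      simp only [hF]; congr 2
      refine Finset.sum_congr rfl fun n hn => ?_
      have hn' := (mem_SF.1 hn).2.1
      rw [chiC_mul hχ hn', chiC_mul hχ hn' p.1, chiC_sq hχ hn']; ring
    · have c1 : K' (u, j, e) ^ (1/3 : ℝ) = r ^ j * (Nm e)⁻¹ * K ^ (1/3 : ℝ) := by
        simp only [hK', hr]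
        rw [Real.div_rpow hK0.le (by positivity), Real.mul_rpow (by positivity) (by positivity), Real.rpow_neg (by norm_num),
          ← Real.rpow_natCast (Nm e), ← Real.rpow_mul (by positivity), ← Real.rpow_natCast (3:ℝ), ← Real.rpow_mul (by positivity),
          inv_pow, ← Real.rpow_natCast ((3:ℝ)^(1/3:ℝ)), ← Real.rpow_mul (by positivity)]
        norm_num
        field_simp
      have c2 : (N * K' (u, j, e)) ^ (2/3 : ℝ) ≤ r ^ j * (Nm e)⁻¹ * (N * K) ^ (2/3 : ℝ) := by
        have e2 : (N * K' (u, j, e)) ^ (2/3 : ℝ) = (r ^ j * (Nm e)⁻¹) ^ 2 * (N * K) ^ (2/3 : ℝ) := by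
          have e3 : K' (u, j, e) ^ (2/3 : ℝ) = (K' (u, j, e) ^ (1/3 : ℝ)) ^ 2 := by
            rw [← Real.rpow_natCast, ← Real.rpow_mul hK'0.le]; norm_num
          have e4 : K ^ (2/3 : ℝ) = (K ^ (1/3 : ℝ)) ^ 2 := by
            rw [← Real.rpow_natCast, ← Real.rpow_mul hK0.le]; norm_num
          rw [Real.mul_rpow (by positivity) hK'0.le, Real.mul_rpow (by positivity) hK0.le, e3, c1, e4]; ring
        rw [e2]
        have : r ^ j * (Nm e)⁻¹ ≤ 1 := mul_le_one₀ (pow_le_one₀ hr0.le hr1.le) (by positivity) (inv_le_one_of_one_le₀ he1)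
        have h0 : 0 ≤ r ^ j * (Nm e)⁻¹ := by positivity
        gcongr
        nlinarith
      have c3 : (Nm e)⁻¹ ≤ K ^ ε * Nm e ^ (-(1 + ε)) := by
        have : Nm e ^ (-(1 + ε)) = (Nm e)⁻¹ * (Nm e ^ ε)⁻¹ := by
          rw [Real.rpow_neg (by positivity), Real.rpow_add (by positivity), Real.rpow_one, mul_inv]
        rw [this]
        have h5 : Nm e ^ ε ≤ K ^ ε := by gcongr
        have h6 : 0 < Nm e ^ ε := by positivity
        calc (Nm e)⁻¹ = (Nm e ^ ε) * ((Nm e)⁻¹ * (Nm e ^ ε)⁻¹) := by field_simp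
          _ ≤ _ := by gcongr
      calc C1 * W * (K' (u, j, e) ^ (1/3 : ℝ) * N + (N * K' (u, j, e)) ^ (2/3 : ℝ)) * V
          ≤ C1 * W * (r ^ j * (Nm e)⁻¹ * K ^ (1/3 : ℝ) * N + r ^ j * (Nm e)⁻¹ * (N * K) ^ (2/3 : ℝ)) * V := by
            rw [c1]; gcongr
        _ = C1 * W * B * V * (r ^ j * (Nm e)⁻¹) := by rw [hB]; ring
        _ ≤ _ := by gcongr
  refine (Finset.sum_le_sum hb).trans ?_
  refine (Finset.sum_le_sum_of_subset_of_nonneg (Finset.filter_subset _ _) (fun t _ _ => ?_)).trans ?_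
  · have := Nm_nn t.2.2; positivity
  have g1 : ∑ i ∈ Finset.range J, r ^ i ≤ (1 - r)⁻¹ := by
    rw [← tsum_geometric_of_lt_one hr0.le hr1]
    exact (summable_geometric_of_lt_one hr0.le hr1).sum_le_tsum _ (fun _ _ => by positivity)
  have g2 := hsum (nz K)
  have g3 := card_ball (le_refl (1:ℝ))
  have g0 : 0 ≤ ∑ x ∈ nz K, Nm x ^ (-(1 + ε)) := Finset.sum_nonneg fun x _ => Real.rpow_nonneg (Nm_nn x) _
  have g4 : 0 ≤ ∑ i ∈ Finset.range J, r ^ i := Finset.sum_nonneg fun _ _ => by positivity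
  have g5 : ∑ t ∈ T, r ^ t.2.1 * (K ^ ε * Nm t.2.2 ^ (-(1 + ε))) =
      ((ball 1).card : ℝ) * ((∑ i ∈ Finset.range J, r ^ i) * (K ^ ε * ∑ x ∈ nz K, Nm x ^ (-(1 + ε)))) := by
    rw [hT, Finset.sum_product]
    simp only [Finset.sum_product, Finset.sum_const, nsmul_eq_mul]
    congr 1
    rw [Finset.mul_sum (nz K), Finset.sum_mul_sum]
  rw [← Finset.mul_sum, g5]
  calc _ ≤ C1 * W * B * V * ((25 * 1) * ((1 - r)⁻¹ * (K ^ ε * C2))) := by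
        gcongr
    _ = _ := by ring

end P5b

section P5c
open scoped Classical
variable {χ : Eis → Eis → Eis}

lemma norm_Gamma_le {s : ℂ} (hs : 0 < s.re) : ‖Complex.Gamma s‖ ≤ Real.Gamma s.re := by
  rw [Complex.Gamma_eq_integral hs, Complex.GammaIntegral, Real.Gamma_eq_integral hs]
  refine (MeasureTheory.norm_integral_le_integral_norm _).trans (le_of_eq ?_)
  refine MeasureTheory.setIntegral_congr_fun measurableSet_Ioi fun x hx => ?_
  simp only [norm_mul]
  rw [Complex.norm_cpow_eq_rpow_re_of_pos hx]
  simp; left; rw [Complex.norm_exp]; simp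

lemma Gamma_vertical_cont {σ : ℝ} (hσ : 0 < σ) : Continuous (fun t : ℝ => Complex.Gamma (σ + t * Complex.I)) := by
  rw [continuous_iff_continuousAt]
  intro t
  have h : ContinuousAt Complex.Gamma (σ + t * Complex.I) := by
    refine Complex.continuousAt_Gamma _ fun m hm => ?_
    have := congrArg Complex.re hm
    simp at this
    have h2 : (0:ℝ) ≤ m := Nat.cast_nonneg m
    linarith
  exact ContinuousAt.comp (f := fun t : ℝ => (σ + t * Complex.I : ℂ)) h (by fun_prop)

lemma Gamma_vertical_bound {σ : ℝ} (hσ : 0 < σ) (t : ℝ) :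
    ‖Complex.Gamma (σ + t * Complex.I)‖ ≤ Real.Gamma (σ + 2) * (min 1 (σ ^ 2))⁻¹ * (1 + t ^ 2)⁻¹ := by
  set s : ℂ := σ + t * Complex.I with hs
  have hre : s.re = σ := by simp [hs]
  have him : s.im = t := by simp [hs]
  have hs0 : s ≠ 0 := fun h => by rw [h] at hre; simp at hre; linarith
  have hs1 : s + 1 ≠ 0 := fun h => by
    have := congrArg Complex.re h; simp [hre] at this; linarith
  have e : Complex.Gamma (s + 1 + 1) = (s + 1) * (s * Complex.Gamma s) := by
    rw [Complex.Gamma_add_one _ hs1, Complex.Gamma_add_one _ hs0]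
  have h1 : ‖Complex.Gamma (s + 1 + 1)‖ ≤ Real.Gamma (σ + 2) := by
    refine (norm_Gamma_le (by simp [hre]; linarith)).trans (le_of_eq ?_)
    congr 1; simp [hre]; ring
  rw [e, norm_mul, norm_mul, ← mul_assoc] at h1
  have n1 : ‖s‖ ^ 2 = σ ^ 2 + t ^ 2 := by
    rw [← Complex.normSq_eq_norm_sq, Complex.normSq_apply, hre, him]; ring
  have n2 : ‖s + 1‖ ^ 2 = (σ + 1) ^ 2 + t ^ 2 := by
    rw [← Complex.normSq_eq_norm_sq, Complex.normSq_apply]; simp [hre, him]; ring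
  have n3 : ‖s‖ ≤ ‖s + 1‖ := by
    apply (sq_le_sq₀ (norm_nonneg _) (norm_nonneg _)).1
    rw [n1, n2]; nlinarith
  set m := min 1 (σ ^ 2) with hm
  have hm0 : 0 < m := lt_min one_pos (by positivity)
  have n4 : m * (1 + t ^ 2) ≤ ‖s + 1‖ * ‖s‖ := by
    have : ‖s‖ ^ 2 ≤ ‖s + 1‖ * ‖s‖ := by nlinarith [norm_nonneg s]
    refine le_trans ?_ this
    rw [n1]
    have a1 : m ≤ 1 := min_le_left _ _
    have a2 : m ≤ σ ^ 2 := min_le_right _ _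
    nlinarith [sq_nonneg t]
  have n5 : m * (1 + t ^ 2) * ‖Complex.Gamma s‖ ≤ Real.Gamma (σ + 2) := le_trans (by gcongr) h1
  rw [mul_assoc, ← mul_inv, ← div_eq_mul_inv, le_div_iff₀ (by positivity)]
  linarith

lemma Gamma_vertical_integrable {σ : ℝ} (hσ : 0 < σ) :
    MeasureTheory.Integrable (fun t : ℝ => Complex.Gamma (σ + t * Complex.I)) := by
  refine MeasureTheory.Integrable.mono' (g := fun t => Real.Gamma (σ + 2) * (min 1 (σ ^ 2))⁻¹ * (1 + t ^ 2)⁻¹) ?_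
    (Gamma_vertical_cont hσ).aestronglyMeasurable (Filter.Eventually.of_forall (Gamma_vertical_bound hσ))
  exact integrable_inv_one_add_sq.const_mul _

lemma exp_mellin {σ : ℝ} (hσ : 0 < σ) {x : ℝ} (hx : 0 < x) :
    ((Real.exp (-x) : ℝ) : ℂ) = ((1 / (2 * Real.pi) : ℝ) : ℂ) * ∫ t : ℝ, (x : ℂ) ^ (-(σ + t * Complex.I)) * Complex.Gamma (σ + t * Complex.I) := by
  have hmel : ∀ t : ℝ, mellin (fun x : ℝ => ((Real.exp (-x) : ℝ) : ℂ)) (σ + t * Complex.I) = Complex.Gamma (σ + t * Complex.I) := by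
    intro t
    rw [← Complex.GammaIntegral_eq_mellin, Complex.Gamma_eq_integral (by simpa using hσ)]
  have h := mellinInv_mellin_eq σ (fun x : ℝ => ((Real.exp (-x) : ℝ) : ℂ)) hx ?_ ?_ ?_
  · rw [← h, mellinInv]
    simp only [hmel, smul_eq_mul, Complex.real_smul]
  · have := Complex.GammaIntegral_convergent (s := σ) (by simpa using hσ)
    unfold MellinConvergent
    refine this.congr_fun (fun x _ => ?_) measurableSet_Ioi
    simp [mul_comm]
  · unfold Complex.VerticalIntegrable
    simp only [hmel]
    exact Gamma_vertical_integrable hσ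
  · fun_prop

lemma mellin_sep {σ : ℝ} (hσ : 0 < σ) : ∃ C : ℝ, 0 < C ∧ ∀ {ι : Type} (s : Finset ι) (w : ι → ℂ) (x : ι → ℝ) (W : ℝ),
    (∀ i ∈ s, 0 < x i) → (∀ t : ℝ, ‖∑ i ∈ s, w i * (x i : ℂ) ^ (-(σ + t * Complex.I))‖ ≤ W) →
    ‖∑ i ∈ s, w i * ((Real.exp (-(x i)) : ℝ) : ℂ)‖ ≤ C * W := by
  have hG := Gamma_vertical_integrable hσ
  refine ⟨1 + ∫ t : ℝ, ‖Complex.Gamma (σ + t * Complex.I)‖, ?_, ?_⟩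
  · have : 0 ≤ ∫ t : ℝ, ‖Complex.Gamma (σ + t * Complex.I)‖ := MeasureTheory.integral_nonneg fun _ => norm_nonneg _
    linarith
  intro ι s w x W hx hW
  have hW0 : 0 ≤ W := (norm_nonneg _).trans (hW 0)
  have hI : ∀ i ∈ s, MeasureTheory.Integrable (fun t : ℝ => w i * ((x i : ℂ) ^ (-(σ + t * Complex.I)) * Complex.Gamma (σ + t * Complex.I))) := by
    intro i hi
    refine MeasureTheory.Integrable.const_mul ?_ _
    have hxi : (x i : ℂ) ≠ 0 := by exact_mod_cast (hx i hi).ne'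
    refine hG.bdd_mul (c := (x i) ^ (-σ)) ?_ ?_
    · apply Continuous.aestronglyMeasurable
      exact Continuous.const_cpow (by fun_prop) (Or.inl hxi)
    · refine Filter.Eventually.of_forall fun t => ?_
      rw [Complex.norm_cpow_eq_rpow_re_of_pos (hx i hi)]
      simp
  have e : ∑ i ∈ s, w i * ((Real.exp (-(x i)) : ℝ) : ℂ) = ((1 / (2 * Real.pi) : ℝ) : ℂ) *
      ∫ t : ℝ, (∑ i ∈ s, w i * (x i : ℂ) ^ (-(σ + t * Complex.I))) * Complex.Gamma (σ + t * Complex.I) := by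
    simp only [Finset.sum_mul]
    simp only [mul_assoc]
    rw [MeasureTheory.integral_finsetSum _ hI, Finset.mul_sum]
    refine Finset.sum_congr rfl fun i hi => ?_
    rw [MeasureTheory.integral_const_mul, exp_mellin hσ (hx i hi)]; ring
  rw [e, norm_mul]
  have p1 : ‖((1 / (2 * Real.pi) : ℝ) : ℂ)‖ ≤ 1 := by
    rw [Complex.norm_real, Real.norm_of_nonneg (by positivity)]
    rw [div_le_one (by positivity)]
    linarith [Real.pi_gt_three]
  have p2 : ‖∫ t : ℝ, (∑ i ∈ s, w i * (x i : ℂ) ^ (-(σ + t * Complex.I))) * Complex.Gamma (σ + t * Complex.I)‖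
      ≤ ∫ t : ℝ, W * ‖Complex.Gamma (σ + t * Complex.I)‖ := by
    refine MeasureTheory.norm_integral_le_of_norm_le (hG.norm.const_mul W) (Filter.Eventually.of_forall fun t => ?_)
    rw [norm_mul]
    exact mul_le_mul_of_nonneg_right (hW t) (norm_nonneg _)
  rw [MeasureTheory.integral_const_mul] at p2
  calc _ ≤ 1 * (W * ∫ t : ℝ, ‖Complex.Gamma (σ + t * Complex.I)‖) := by gcongr
    _ ≤ _ := by linarith

end P5c

section P5c2
open scoped Classical
variable {χ : Eis → Eis → Eis}

lemma shell_sum {ε : ℝ} (hε : 0 < ε) : ∃ C : ℝ, 0 < C ∧ ∀ (h : Eis → ℝ) (ψ : ℝ → ℝ) (B : ℝ), (∀ k, 0 ≤ h k) →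
    (∀ x, 1 ≤ x → 0 < ψ x) → (∀ x y, 1 ≤ x → x ≤ y → ψ x ≤ ψ y) → 0 ≤ B →
    (∀ K, 1 ≤ K → ∑ k ∈ nz K, h k ≤ B * ψ K) → ∀ T : Finset Eis, (∀ k ∈ T, k ≠ 0) →
    ∑ k ∈ T, Nm k ^ (-ε) * (ψ (2 * Nm k))⁻¹ * h k ≤ C * B := by
  set r : ℝ := 2 ^ (-ε) with hr
  have hr0 : 0 < r := by positivity
  have hr1 : r < 1 := Real.rpow_lt_one_of_one_lt_of_neg (by norm_num) (by linarith)
  have hr1' : 0 < 1 - r := by linarith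
  refine ⟨(1 - r)⁻¹, by positivity, ?_⟩
  intro h ψ B hh hψ hmono hB hH T hT
  set key : Eis → ℕ := fun k => Nat.log 2 (NmN k) with hkey
  set J := T.sup key + 1 with hJ
  have hmap : ∀ k ∈ T, key k ∈ Finset.range J := fun k hk => by
    rw [Finset.mem_range, hJ]; exact Nat.lt_succ_of_le (Finset.le_sup hk)
  rw [← Finset.sum_fiberwise_of_maps_to hmap]
  have hb : ∀ j ∈ Finset.range J, ∑ k ∈ T with key k = j, Nm k ^ (-ε) * (ψ (2 * Nm k))⁻¹ * h k ≤ B * r ^ j := by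
    intro j _
    have h1 : ∀ k ∈ T.filter (fun k => key k = j), (2:ℝ) ^ j ≤ Nm k ∧ Nm k ≤ 2 ^ (j + 1) ∧ k ≠ 0 := by
      intro k hk
      rw [Finset.mem_filter] at hk
      have hk0 := hT k hk.1
      have c := NmN_cast k
      have p1 : 1 ≤ NmN k := by
        have := one_le_Nm hk0; rw [← c] at this; exact_mod_cast this
      have a1 := Nat.pow_log_le_self 2 (x := NmN k) (by omega)
      have a2 := Nat.lt_pow_succ_log_self (b := 2) (by norm_num) (NmN k)
      have e : Nat.log 2 (NmN k) = j := hk.2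
      rw [e] at a1 a2
      refine ⟨?_, ?_, hk0⟩
      · rw [← c]; exact_mod_cast a1
      · rw [← c]; exact_mod_cast a2.le
    have p2 : (1:ℝ) ≤ 2 ^ j := one_le_pow₀ (by norm_num)
    have p3 : (1:ℝ) ≤ 2 ^ (j + 1) := one_le_pow₀ (by norm_num)
    have hψ1 := hψ _ p3
    have h2 : ∀ k ∈ T.filter (fun k => key k = j), Nm k ^ (-ε) * (ψ (2 * Nm k))⁻¹ * h k ≤ r ^ j * (ψ (2 ^ (j+1)))⁻¹ * h k := by
      intro k hk
      obtain ⟨a1, a2, a3⟩ := h1 k hk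
      have b1 : Nm k ^ (-ε) ≤ r ^ j := by
        have : r ^ j = ((2:ℝ) ^ j) ^ (-ε) := by
          rw [hr, ← Real.rpow_natCast, ← Real.rpow_mul (by norm_num), ← Real.rpow_natCast, ← Real.rpow_mul (by norm_num)]; ring_nf
        rw [this]
        exact Real.rpow_le_rpow_of_nonpos (by positivity) a1 (by linarith)
      have b2 : ψ (2 ^ (j+1)) ≤ ψ (2 * Nm k) := hmono _ _ p3 (by rw [pow_succ]; linarith)
      have := hh k
      have b3 : 0 ≤ (ψ (2 * Nm k))⁻¹ := inv_nonneg.2 (hψ1.le.trans b2)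
      gcongr
    refine (Finset.sum_le_sum h2).trans ?_
    rw [← Finset.mul_sum]
    have h3 : ∑ k ∈ T with key k = j, h k ≤ B * ψ (2 ^ (j+1)) := by
      refine le_trans (Finset.sum_le_sum_of_subset_of_nonneg ?_ fun k _ _ => hh k) (hH _ p3)
      intro k hk
      obtain ⟨a1, a2, a3⟩ := h1 k hk
      exact mem_nz.2 ⟨a2, a3⟩
    calc _ ≤ r ^ j * (ψ (2 ^ (j+1)))⁻¹ * (B * ψ (2 ^ (j+1))) := by gcongr
      _ = _ := by field_simp
  refine (Finset.sum_le_sum hb).trans ?_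
  rw [← Finset.mul_sum, mul_comm]
  gcongr
  rw [← tsum_geometric_of_lt_one hr0.le hr1]
  exact (summable_geometric_of_lt_one hr0.le hr1).sum_le_tsum _ (fun _ _ => by positivity)

lemma sep_part {ε A σ : ℝ} (hε : 0 < ε) (hA : 0 ≤ A) (hσ : 0 < σ) : ∃ C : ℝ, 0 < C ∧ ∀ χ, IsCubicSymbol χ → ∀ (S : Finset Eis)
    (Q x0 G V : ℝ) (a b : Eis → ℂ), 0 < x0 → 0 ≤ G → (∀ n ∈ S, n ≠ 0 ∧ Nm n ≤ Q) →
    (∀ K, 1 ≤ K → ∀ c : Eis → ℂ, ∑ k ∈ nz K, ‖∑ n ∈ S, c n * chiC χ n k‖ ^ 2 ≤ G * (1 + K * x0) ^ A * ∑ n ∈ S, ‖c n‖ ^ 2) →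
    ∑ n ∈ S, ‖a n‖ ^ 2 ≤ V → ∑ n ∈ S, ‖b n‖ ^ 2 ≤ V → ∀ T : Finset Eis, (∀ k ∈ T, k ≠ 0) →
    (∀ k ∈ T, (x0 * Nm k) ^ (-σ) * (1 + 2 * Nm k * x0) ^ A ≤ 3 ^ A * (x0 * Nm k) ^ (-ε)) →
    ∑ k ∈ T, ‖∑ n ∈ S, ∑ n' ∈ S, a n * b n' * ((starRingEnd ℂ) (chiC χ n k) * chiC χ n' k) *
      ((Real.exp (-(2 * Real.pi / 3 * x0 * Nm k * (Q / Nm n) * (Q / Nm n'))) : ℝ) : ℂ)‖ ≤ C * x0 ^ (-ε) * G * V := by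
  obtain ⟨C1, hC1, hmel⟩ := mellin_sep hσ
  obtain ⟨C2, hC2, hsh⟩ := shell_sum hε
  refine ⟨C1 * C2 * 3 ^ A, by positivity, ?_⟩
  intro χ hχ S Q x0 G V a b hx0 hG hS hE ha hb T hT hw
  set z : Eis → ℂ := fun k => ∑ n ∈ S, ∑ n' ∈ S, a n * b n' * ((starRingEnd ℂ) (chiC χ n k) * chiC χ n' k) *
      ((Real.exp (-(2 * Real.pi / 3 * x0 * Nm k * (Q / Nm n) * (Q / Nm n'))) : ℝ) : ℂ) with hz
  have hV0 : 0 ≤ V := le_trans (Finset.sum_nonneg fun _ _ => by positivity) ha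
  set θ : Eis → ℂ := fun k => (starRingEnd ℂ) (z k) / (‖z k‖ : ℂ) with hθ
  have hθ1 : ∀ k, ‖θ k‖ ≤ 1 := fun k => by
    simp only [hθ, norm_div, RCLike.norm_conj, Complex.norm_real, norm_norm]; exact div_self_le_one _
  have hθz : ∀ k, θ k * z k = (‖z k‖ : ℂ) := fun k => by
    by_cases h0 : z k = 0
    · simp [h0]
    · have : (‖z k‖ : ℂ) ≠ 0 := by exact_mod_cast (norm_ne_zero_iff.2 h0)
      simp only [hθ]
      rw [div_mul_eq_mul_div, div_eq_iff this, mul_comm, Complex.mul_conj, Complex.normSq_eq_norm_sq]; push_cast; ring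
  have hQ : ∀ n ∈ S, 1 ≤ Q / Nm n := fun n hn => by
    rw [one_le_div (Nm_pos (hS n hn).1)]; exact (hS n hn).2
  have hpi : 1 ≤ 2 * Real.pi / 3 := by linarith [Real.pi_gt_three]
  have e1 : ((∑ k ∈ T, ‖z k‖ : ℝ) : ℂ) = ∑ p ∈ T ×ˢ S ×ˢ S, (θ p.1 * (a p.2.1 * b p.2.2 * ((starRingEnd ℂ) (chiC χ p.2.1 p.1) * chiC χ p.2.2 p.1))) *
      ((Real.exp (-(2 * Real.pi / 3 * x0 * Nm p.1 * (Q / Nm p.2.1) * (Q / Nm p.2.2))) : ℝ) : ℂ) := by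
    rw [Finset.sum_product]; push_cast
    refine Finset.sum_congr rfl fun k _ => ?_
    rw [← hθz, Finset.sum_product, hz, Finset.mul_sum]
    refine Finset.sum_congr rfl fun n _ => ?_
    rw [Finset.mul_sum]
    refine Finset.sum_congr rfl fun n' _ => ?_
    push_cast; ring
  have e2 : ∑ k ∈ T, ‖z k‖ = ‖((∑ k ∈ T, ‖z k‖ : ℝ) : ℂ)‖ := by
    rw [Complex.norm_real, Real.norm_of_nonneg (Finset.sum_nonneg fun _ _ => norm_nonneg _)]
  rw [e2, e1]
  refine (hmel (T ×ˢ S ×ˢ S) _ _ (C2 * 3 ^ A * x0 ^ (-ε) * G * V) ?_ ?_).trans (le_of_eq (by ring))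
  · rintro ⟨k, n, n'⟩ hp
    simp only [Finset.mem_product] at hp
    have := Nm_pos (hT k hp.1)
    have := hQ n hp.2.1
    have := hQ n' hp.2.2
    positivity
  intro t
  set s : ℂ := -(σ + t * Complex.I) with hs
  set al : Eis → ℂ := fun k => ∑ n ∈ S, (a n * ((Q / Nm n : ℝ) : ℂ) ^ s) * (starRingEnd ℂ) (chiC χ n k) with hal
  set be : Eis → ℂ := fun k => ∑ n ∈ S, (b n * ((Q / Nm n : ℝ) : ℂ) ^ s) * chiC χ n k with hbe
  have e3 : ∑ p ∈ T ×ˢ S ×ˢ S, (θ p.1 * (a p.2.1 * b p.2.2 * ((starRingEnd ℂ) (chiC χ p.2.1 p.1) * chiC χ p.2.2 p.1))) *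
      ((2 * Real.pi / 3 * x0 * Nm p.1 * (Q / Nm p.2.1) * (Q / Nm p.2.2) : ℝ) : ℂ) ^ s =
      ∑ k ∈ T, θ k * ((2 * Real.pi / 3 * x0 * Nm k : ℝ) : ℂ) ^ s * (al k * be k) := by
    rw [Finset.sum_product]
    refine Finset.sum_congr rfl fun k hk => ?_
    rw [Finset.sum_product, hal, hbe, Finset.sum_mul_sum, Finset.mul_sum]
    refine Finset.sum_congr rfl fun n hn => ?_
    rw [Finset.mul_sum]
    refine Finset.sum_congr rfl fun n' hn' => ?_
    have k1 := Nm_pos (hT k hk)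
    have k2 := hQ n hn
    have k3 := hQ n' hn'
    simp only []
    rw [Complex.ofReal_mul, Complex.mul_cpow_ofReal_nonneg (by positivity) (by positivity), Complex.ofReal_mul, Complex.mul_cpow_ofReal_nonneg (by positivity) (by positivity)]
    ring
  rw [e3]
  have hsre : s.re = -σ := by simp [hs]
  have hzs : ∀ n ∈ S, ‖((Q / Nm n : ℝ) : ℂ) ^ s‖ ≤ 1 := fun n hn => by
    have := hQ n hn
    rw [Complex.norm_cpow_eq_rpow_re_of_pos (by linarith), hsre]
    exact Real.rpow_le_one_of_one_le_of_nonpos this (by linarith)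
  have hpt : ∀ k ∈ T, ‖θ k * ((2 * Real.pi / 3 * x0 * Nm k : ℝ) : ℂ) ^ s * (al k * be k)‖ ≤
      3 ^ A * x0 ^ (-ε) * (1/2) * (Nm k ^ (-ε) * ((1 + 2 * Nm k * x0) ^ A)⁻¹ * (‖al k‖ ^ 2 + ‖be k‖ ^ 2)) := by
    intro k hk
    have k1 := Nm_pos (hT k hk)
    rw [norm_mul, norm_mul, norm_mul, Complex.norm_cpow_eq_rpow_re_of_pos (by positivity), hsre]
    have b1 : (2 * Real.pi / 3 * x0 * Nm k) ^ (-σ) ≤ (x0 * Nm k) ^ (-σ) := by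
      apply Real.rpow_le_rpow_of_nonpos (by positivity) _ (by linarith)
      nlinarith [mul_pos hx0 k1]
    have b2 : (x0 * Nm k) ^ (-σ) ≤ 3 ^ A * (x0 ^ (-ε) * Nm k ^ (-ε)) * ((1 + 2 * Nm k * x0) ^ A)⁻¹ := by
      rw [← Real.mul_rpow hx0.le k1.le, ← div_eq_mul_inv, le_div_iff₀ (by positivity)]
      exact hw k hk
    have b3 : ‖al k‖ * ‖be k‖ ≤ (1/2) * (‖al k‖ ^ 2 + ‖be k‖ ^ 2) := by nlinarith [sq_nonneg (‖al k‖ - ‖be k‖)]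
    calc _ ≤ 1 * (3 ^ A * (x0 ^ (-ε) * Nm k ^ (-ε)) * ((1 + 2 * Nm k * x0) ^ A)⁻¹) * ((1/2) * (‖al k‖ ^ 2 + ‖be k‖ ^ 2)) := by
          gcongr
          · exact hθ1 k
          · exact b1.trans b2
      _ = _ := by ring
  refine (norm_sum_le _ _).trans ((Finset.sum_le_sum hpt).trans ?_)
  rw [← Finset.mul_sum]
  have hfin := hsh (fun k => ‖al k‖ ^ 2 + ‖be k‖ ^ 2) (fun K => (1 + K * x0) ^ A) (2 * G * V) (fun k => by positivity)
    (fun x hx => by positivity) (fun x y hx hxy => by gcongr) (by positivity) (by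
      intro K hK
      rw [Finset.sum_add_distrib]
      have i1 := hE K hK (fun n => (starRingEnd ℂ) (a n * ((Q / Nm n : ℝ) : ℂ) ^ s))
      have i2 := hE K hK (fun n => (b n * ((Q / Nm n : ℝ) : ℂ) ^ s))
      have j1 : ∑ n ∈ S, ‖(starRingEnd ℂ) (a n * ((Q / Nm n : ℝ) : ℂ) ^ s)‖ ^ 2 ≤ V := by
        simp only [RCLike.norm_conj]
        exact (sum_norm_weight hzs).trans ha
      have j2 : ∑ n ∈ S, ‖b n * ((Q / Nm n : ℝ) : ℂ) ^ s‖ ^ 2 ≤ V := (sum_norm_weight hzs).trans hb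
      have j3 : ∑ k ∈ nz K, ‖al k‖ ^ 2 = ∑ k ∈ nz K, ‖∑ n ∈ S, (starRingEnd ℂ) (a n * ((Q / Nm n : ℝ) : ℂ) ^ s) * chiC χ n k‖ ^ 2 := by
        refine Finset.sum_congr rfl fun k _ => ?_
        rw [← RCLike.norm_conj, hal, map_sum]
        simp only [map_mul, Complex.conj_conj]
      have m1 : 0 ≤ G * (1 + K * x0) ^ A := by positivity
      rw [j3]
      have := mul_le_mul_of_nonneg_left j1 m1
      have := mul_le_mul_of_nonneg_left j2 m1
      simp only [hbe]
      linarith) T hT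
  calc _ ≤ 3 ^ A * x0 ^ (-ε) * (1/2) * (C2 * (2 * G * V)) := by
        gcongr
    _ = _ := by ring

lemma sep_full {ε A : ℝ} (hε : 0 < ε) (hε1 : ε ≤ 1) (hA : 0 ≤ A) : ∃ C : ℝ, 0 < C ∧ ∀ χ, IsCubicSymbol χ → ∀ (S : Finset Eis)
    (Q x0 G V : ℝ) (a b : Eis → ℂ), 0 < x0 → 0 ≤ G → (∀ n ∈ S, n ≠ 0 ∧ Nm n ≤ Q) →
    (∀ K, 1 ≤ K → ∀ c : Eis → ℂ, ∑ k ∈ nz K, ‖∑ n ∈ S, c n * chiC χ n k‖ ^ 2 ≤ G * (1 + K * x0) ^ A * ∑ n ∈ S, ‖c n‖ ^ 2) →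
    ∑ n ∈ S, ‖a n‖ ^ 2 ≤ V → ∑ n ∈ S, ‖b n‖ ^ 2 ≤ V → ∀ T : Finset Eis, (∀ k ∈ T, k ≠ 0) →
    ∑ k ∈ T, ‖∑ n ∈ S, ∑ n' ∈ S, a n * b n' * ((starRingEnd ℂ) (chiC χ n k) * chiC χ n' k) *
      ((Real.exp (-(2 * Real.pi / 3 * x0 * Nm k * (Q / Nm n) * (Q / Nm n'))) : ℝ) : ℂ)‖ ≤ C * x0 ^ (-ε) * G * V := by
  obtain ⟨C1, hC1, h1⟩ := sep_part (ε := ε) (A := A) (σ := A + 1) hε hA (by linarith)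
  obtain ⟨C2, hC2, h2⟩ := sep_part (ε := ε) (A := A) (σ := ε) hε hA hε
  refine ⟨C1 + C2, by positivity, ?_⟩
  intro χ hχ S Q x0 G V a b hx0 hG hS hE ha hb T hT
  rw [← Finset.sum_filter_add_sum_filter_not T (fun k => 1 ≤ x0 * Nm k)]
  have i1 := h1 χ hχ S Q x0 G V a b hx0 hG hS hE ha hb (T.filter (fun k => 1 ≤ x0 * Nm k)) (fun k hk => hT k (Finset.mem_filter.1 hk).1) (by
    intro k hk
    rw [Finset.mem_filter] at hk
    have p := hk.2
    set y := x0 * Nm k with hy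
    have e : 1 + 2 * Nm k * x0 ≤ 3 * y := by rw [hy] at p ⊢; linarith
    have hy0 : 0 < y := by linarith
    have k1 := Nm_nn k
    calc y ^ (-(A + 1)) * (1 + 2 * Nm k * x0) ^ A ≤ y ^ (-(A+1)) * (3 * y) ^ A := by gcongr
      _ = 3 ^ A * y ^ (-1 : ℝ) := by
        rw [Real.mul_rpow (by norm_num) hy0.le, mul_left_comm, ← Real.rpow_add hy0]; ring_nf
      _ ≤ 3 ^ A * y ^ (-ε) := by
        gcongr 3 ^ A * ?_
        exact Real.rpow_le_rpow_of_exponent_le p (by linarith))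
  have i2 := h2 χ hχ S Q x0 G V a b hx0 hG hS hE ha hb (T.filter (fun k => ¬ 1 ≤ x0 * Nm k)) (fun k hk => hT k (Finset.mem_filter.1 hk).1) (by
    intro k hk
    rw [Finset.mem_filter, not_le] at hk
    have p := hk.2
    have k1 := Nm_nn k
    have k2 : 0 ≤ x0 * Nm k := by positivity
    have : (1 + 2 * Nm k * x0) ^ A ≤ 3 ^ A := by
      gcongr; linarith
    calc _ ≤ (x0 * Nm k) ^ (-ε) * 3 ^ A := by gcongr
      _ = _ := by ring)
  linarith

end P5c2

section P5d
open scoped Classical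
variable {χ : Eis → Eis → Eis}

lemma exists_gcd_pri {a b : Eis} (ha : Pri a) (hb : Pri b) : ∃ g n n' : Eis, Pri g ∧ Pri n ∧ Pri n' ∧ IsCoprime n n' ∧
    a = g * n ∧ b = g * n' := by
  obtain ⟨g0, hg0⟩ := (IsPrincipalIdealRing.principal (Ideal.span {a, b})).principal
  have hg0' : Ideal.span {a, b} = Ideal.span {g0} := hg0
  have da : g0 ∣ a := by
    rw [← Ideal.mem_span_singleton, ← hg0']; exact Ideal.subset_span (by simp)
  have db : g0 ∣ b := by
    rw [← Ideal.mem_span_singleton, ← hg0']; exact Ideal.subset_span (by simp)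
  have hm : g0 ∈ Ideal.span {a, b} := by rw [hg0']; exact Ideal.mem_span_singleton_self _
  obtain ⟨x, y, hxy⟩ := Ideal.mem_span_pair.1 hm
  have hl : ¬ lam ∣ g0 := fun h => ha.not_lam_dvd (h.trans da)
  obtain ⟨u, hu, hug⟩ := exists_pri_assoc hl
  have hdu : ∀ z, g0 ∣ z → u * g0 ∣ z := fun z hz => (hu.mul_left_dvd).2 hz
  obtain ⟨n, hn⟩ := hdu a da
  obtain ⟨n', hn'⟩ := hdu b db
  refine ⟨u * g0, n, n', hug, hug.of_mul_left (hn ▸ ha), hug.of_mul_left (hn' ▸ hb), ?_, hn, hn'⟩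
  refine ⟨x * u, y * u, ?_⟩
  have h0 : g0 ≠ 0 := fun h => hug.ne_zero (by rw [h, mul_zero])
  apply mul_left_cancel₀ h0
  calc g0 * (x * u * n + y * u * n') = x * (u * g0 * n) + y * (u * g0 * n') := by ring
    _ = g0 * 1 := by rw [← hn, ← hn', hxy, mul_one]

lemma gcd_pri_unique {g n n' h m m' : Eis} (hg : Pri g) (hh : Pri h) (c1 : IsCoprime n n') (c2 : IsCoprime m m')
    (e1 : g * n = h * m) (e2 : g * n' = h * m') : g = h := by
  apply hg.associated_eq hh
  apply associated_of_dvd_dvd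
  · obtain ⟨a, b, hab⟩ := c2
    refine ⟨a * n + b * n', ?_⟩
    calc h = h * (a * m + b * m') := by rw [hab, mul_one]
      _ = a * (h * m) + b * (h * m') := by ring
      _ = _ := by rw [← e1, ← e2]; ring
  · obtain ⟨a, b, hab⟩ := c1
    refine ⟨a * m + b * m', ?_⟩
    calc g = g * (a * n + b * n') := by rw [hab, mul_one]
      _ = a * (g * n) + b * (g * n') := by ring
      _ = _ := by rw [e1, e2]; ring

lemma pair_decomp {Z : ℝ} (S : Finset Eis) (hS : S ⊆ SF Z) (F : Eis → Eis → ℂ) :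
    ∑ n ∈ S, ∑ n' ∈ S, F n n' = ∑ g ∈ SF Z, ∑ n ∈ (SF Z).filter (fun n => g * n ∈ S), ∑ n' ∈ (SF Z).filter (fun n => g * n ∈ S),
      (if IsCoprime n n' then F (g * n) (g * n') else 0) := by
  rw [← Finset.sum_product']
  have e : ∀ g ∈ SF Z, ∑ n ∈ (SF Z).filter (fun n => g * n ∈ S), ∑ n' ∈ (SF Z).filter (fun n => g * n ∈ S),
      (if IsCoprime n n' then F (g * n) (g * n') else 0) =
      ∑ p ∈ ((SF Z).filter (fun n => g * n ∈ S) ×ˢ (SF Z).filter (fun n => g * n ∈ S)).filter (fun p => IsCoprime p.1 p.2), F (g * p.1) (g * p.2) := by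
    intro g _
    rw [← Finset.sum_product', Finset.sum_filter]
  rw [Finset.sum_congr rfl e, Finset.sum_sigma']
  symm
  refine Finset.sum_bij (fun x _ => (x.1 * x.2.1, x.1 * x.2.2)) ?_ ?_ ?_ ?_
  · rintro ⟨g, n, n'⟩ hx
    simp only [Finset.mem_sigma, Finset.mem_filter, Finset.mem_product] at hx ⊢
    exact ⟨hx.2.1.1.2, hx.2.1.2.2⟩
  · rintro ⟨g, n, n'⟩ hx ⟨h, m, m'⟩ hy hxy
    simp only [Finset.mem_sigma, Finset.mem_filter, Finset.mem_product, mem_SF] at hx hy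
    simp only [Prod.mk.injEq] at hxy
    have hgh := gcd_pri_unique hx.1.2.1 hy.1.2.1 hx.2.2 hy.2.2 hxy.1 hxy.2
    subst hgh
    have h0 := hx.1.2.1.ne_zero
    rw [mul_left_cancel₀ h0 hxy.1, mul_left_cancel₀ h0 hxy.2]
  · rintro ⟨a, b⟩ hab
    rw [Finset.mem_product] at hab
    obtain ⟨haZ, haP, hasq⟩ := mem_SF.1 (hS hab.1)
    obtain ⟨hbZ, hbP, hbsq⟩ := mem_SF.1 (hS hab.2)
    obtain ⟨g, n, n', hg, hn, hn', hc, rfl, rfl⟩ := exists_gcd_pri haP hbP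
    have hle : ∀ x y, x ∣ y → y ≠ 0 → Nm y ≤ Z → Nm x ≤ Z := fun x y h h0 hz => (Nm_le_of_dvd h0 h).trans hz
    refine ⟨⟨g, n, n'⟩, ?_, rfl⟩
    simp only [Finset.mem_sigma, Finset.mem_filter, Finset.mem_product, mem_SF]
    refine ⟨⟨hle _ _ (dvd_mul_right _ _) haP.ne_zero haZ, hg, hasq.of_mul_left⟩, ⟨⟨⟨hle _ _ (dvd_mul_left _ _) haP.ne_zero haZ, hn, hasq.of_mul_right⟩, hab.1⟩,
      ⟨hle _ _ (dvd_mul_left _ _) hbP.ne_zero hbZ, hn', hbsq.of_mul_right⟩, hab.2⟩, hc⟩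
  · intro _ _; rfl

lemma Th_coprime {μ : Eis → ℤ} (hμ : IsMoebius μ) {g : Eis} (hg : Pri g) (hs : Squarefree g) {f : Eis → ℂ}
    (hf : ∀ a b, f (a * b) = f a * f b) (hf1 : ∀ a, ‖f a‖ ≤ 1) {y : ℝ} (hy : 0 < y) :
    Th (fun m => (if IsCoprime m g then 1 else 0) * f m) y = ∑ d ∈ pd g, (μ d : ℂ) * f d * Th f (Nm d * y) := by
  have h1 : ∀ d ∈ pd g, HasSum (fun m : Eis => (if d ∣ m then (μ d : ℂ) else 0) * f m * ((Real.exp (-(2 * Real.pi * y * Nm m)) : ℝ) : ℂ))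
      ((μ d : ℂ) * f d * Th f (Nm d * y)) := by
    intro d hd
    have hd0 : d ≠ 0 := ((mem_pd hg.ne_zero).1 hd).1.ne_zero
    have hN := Nm_pos hd0
    have hinj : Function.Injective (fun m : Eis => d * m) := fun a b h => mul_left_cancel₀ hd0 h
    rw [← hinj.hasSum_iff]
    · have h2 := (summable_Th hf1 (c := 2 * Real.pi * (Nm d * y)) (by positivity)).hasSum.mul_left ((μ d : ℂ) * f d)
      refine h2.congr_fun ?_ |> fun h => h
      intro m
      simp only [Function.comp]
      rw [if_pos (dvd_mul_right _ _), hf, Nm_mul]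
      have : 2 * Real.pi * y * (Nm d * Nm m) = 2 * Real.pi * (Nm d * y) * Nm m := by ring
      rw [this]; ring
    · intro m hm
      rw [if_neg]; · simp
      rintro ⟨k, rfl⟩; exact hm ⟨k, rfl⟩
  have h2 := hasSum_sum h1
  unfold Th at h2 ⊢
  rw [← h2.tsum_eq]
  refine tsum_congr fun m => ?_
  rw [← Finset.sum_mul, ← Finset.sum_mul]
  have := moebius_sum hμ m hg hs
  have h3 := congrArg (fun z : ℤ => (z : ℂ)) this
  push_cast at h3
  simp only [h3]

lemma chi_zero_sum (hχ : IsCubicSymbol χ) (B : Finset Eis) (hB : ∀ n ∈ B, Pri n) (a : Eis → ℂ) :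
    ‖∑ n ∈ B, a n * chiC χ n 0‖ ^ 2 ≤ ∑ n ∈ B, ‖a n‖ ^ 2 := by
  have h0 : ∀ n ∈ B, n ≠ 1 → a n * chiC χ n 0 = 0 := by
    intro n hn h1
    have : ¬ IsCoprime 0 n := by
      rw [isCoprime_zero_left]; exact fun h => h1 (pri_unit_eq_one h (hB n hn))
    rw [chiC, (chi_ne hχ (hB n hn)).2 this]; simp
  by_cases h1 : (1 : Eis) ∈ B
  · rw [Finset.sum_eq_single_of_mem 1 h1 h0, norm_mul]
    have := chiC_norm_le hχ (hB 1 h1) 0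
    have h3 : ‖a 1‖ ^ 2 ≤ ∑ n ∈ B, ‖a n‖ ^ 2 := Finset.single_le_sum (f := fun n => ‖a n‖ ^ 2) (fun _ _ => by positivity) h1
    refine le_trans ?_ h3
    have := mul_le_of_le_one_right (norm_nonneg (a 1)) this
    gcongr
  · rw [Finset.sum_eq_zero]
    · simp only [norm_zero]; rw [zero_pow two_ne_zero]; exact Finset.sum_nonneg fun _ _ => by positivity
    · intro n hn; exact h0 n hn (fun h => h1 (h ▸ hn))

end P5d

section P5d2
open scoped Classical
variable {χ : Eis → Eis → Eis}

/-- the dual sum attached to a pair of coprime moduli -/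
def Pk (χ : Eis → Eis → Eis) (M : ℝ) (d n n' : Eis) : ℂ :=
  mixC χ n n' d * (tauC χ n * tauD χ n' * ((1 / (Real.sqrt 3 * ((Nm d * M⁻¹) * Nm (n * n'))) : ℝ) : ℂ) *
    Th (fun k => (starRingEnd ℂ) (mixC χ n n' k)) (1 / (3 * ((Nm d * M⁻¹) * Nm (n * n')))))

lemma mixC_norm_le (hχ : IsCubicSymbol χ) {n n' : Eis} (hn : Pri n) (hn' : Pri n') (a : Eis) : ‖mixC χ n n' a‖ ≤ 1 := by
  unfold mixC
  rw [norm_mul, RCLike.norm_conj]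
  exact mul_le_one₀ (chiC_norm_le hχ hn a) (norm_nonneg _) (chiC_norm_le hχ hn' a)

lemma norm_div_tau {c x t : ℂ} {N Q : ℝ} (hQ : 0 < Q) (hN : Q / 2 ≤ N) (hx : ‖x‖ ≤ 1) (ht : ‖t‖ ^ 2 = N) :
    ‖c * x * t / (N : ℂ)‖ ^ 2 ≤ 2 / Q * ‖c‖ ^ 2 := by
  have hN0 : 0 < N := by linarith
  rw [norm_div, norm_mul, norm_mul, Complex.norm_real, Real.norm_of_nonneg hN0.le, div_pow, mul_pow, mul_pow, ht]
  have h1 : ‖x‖ ^ 2 ≤ 1 := by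
    have := norm_nonneg x; nlinarith
  have : ‖c‖ ^ 2 * ‖x‖ ^ 2 * N / N ^ 2 = ‖c‖ ^ 2 * ‖x‖ ^ 2 * (1 / N) := by field_simp
  rw [this]
  have h2 : 1 / N ≤ 2 / Q := by
    rw [div_le_div_iff₀ hN0 hQ]; linarith
  calc ‖c‖ ^ 2 * ‖x‖ ^ 2 * (1 / N) ≤ ‖c‖ ^ 2 * 1 * (2 / Q) := by gcongr
    _ = _ := by ring

lemma block {ε A : ℝ} (hε : 0 < ε) (hε1 : ε ≤ 1) (hA : 0 ≤ A) : ∃ C : ℝ, 0 < C ∧ ∀ χ, IsCubicSymbol χ → ∀ (B : Finset Eis)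
    (Q M G : ℝ) (d : Eis) (c : Eis → ℂ), 0 < M → 0 ≤ G → Pri d → 1 ≤ Q →
    (∀ n ∈ B, Pri n ∧ Squarefree n ∧ Q / 2 ≤ Nm n ∧ Nm n ≤ Q) →
    (∀ K, 1 ≤ K → EB χ K Q (G * (Q * Nm d / M) * (1 + K * (M / (Nm d * Q ^ 2))) ^ A)) →
    ‖∑ n ∈ B, ∑ n' ∈ B, c n * (starRingEnd ℂ) (c n') * Pk χ M d n n'‖ ≤
      C * (M + (M / (Nm d * Q ^ 2)) ^ (-ε) * G) * ∑ n ∈ B, ‖c n‖ ^ 2 := by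
  obtain ⟨C1, hC1, h1⟩ := sep_full hε hε1 hA
  refine ⟨2 + 2 * C1, by positivity, ?_⟩
  intro χ hχ B Q M G d c hM hG hd hQ hB hE
  set W := ∑ n ∈ B, ‖c n‖ ^ 2 with hW
  have hW0 : 0 ≤ W := Finset.sum_nonneg fun _ _ => by positivity
  have hQ0 : 0 < Q := by linarith
  have hδ : 1 ≤ Nm d := one_le_Nm hd.ne_zero
  have hδ0 : 0 < Nm d := by linarith
  set x0 := M / (Nm d * Q ^ 2) with hx0
  have hx0p : 0 < x0 := by positivity
  set a : Eis → ℂ := fun n => c n * chiC χ n d * tauC χ n / (Nm n : ℂ) with ha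
  set b : Eis → ℂ := fun n => (starRingEnd ℂ) (c n) * (starRingEnd ℂ) (chiC χ n d) * tauD χ n / (Nm n : ℂ) with hb
  have hV1 : ∑ n ∈ B, ‖a n‖ ^ 2 ≤ 2 / Q * W := by
    rw [hW, Finset.mul_sum]
    refine Finset.sum_le_sum fun n hn => ?_
    obtain ⟨p, s, l, u⟩ := hB n hn
    exact norm_div_tau hQ0 l (chiC_norm_le hχ p d) (norm_tauC hχ p s)
  have hV2 : ∑ n ∈ B, ‖b n‖ ^ 2 ≤ 2 / Q * W := by
    rw [hW, Finset.mul_sum]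
    refine Finset.sum_le_sum fun n hn => ?_
    obtain ⟨p, s, l, u⟩ := hB n hn
    have := norm_div_tau (c := (starRingEnd ℂ) (c n)) (x := (starRingEnd ℂ) (chiC χ n d)) hQ0 l (by rw [RCLike.norm_conj]; exact chiC_norm_le hχ p d) (norm_tauD hχ p s)
    rwa [RCLike.norm_conj] at this
  set Ew : Eis → Eis → Eis → ℂ := fun k n n' => ((Real.exp (-(2 * Real.pi / 3 * x0 * Nm k * (Q / Nm n) * (Q / Nm n'))) : ℝ) : ℂ) with hEw
  set Z : Eis → ℂ := fun k => ∑ n ∈ B, ∑ n' ∈ B, a n * b n' * ((starRingEnd ℂ) (chiC χ n k) * chiC χ n' k) * Ew k n n' with hZ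
  have hBE : ∀ K, 1 ≤ K → ∀ c : Eis → ℂ, ∑ k ∈ nz K, ‖∑ n ∈ B, c n * chiC χ n k‖ ^ 2 ≤
      G * (Q * Nm d / M) * (1 + K * x0) ^ A * ∑ n ∈ B, ‖c n‖ ^ 2 := by
    intro K hK c
    have hsub : B ⊆ SF Q := fun n hn => by
      obtain ⟨p, s, l, u⟩ := hB n hn
      exact mem_SF.2 ⟨u, p, s⟩
    have h2 := hE K hK (fun n => if n ∈ B then c n else 0)
    have e1 : ∀ m, ∑ n ∈ SF Q, (if n ∈ B then c n else 0) * chiC χ n m = ∑ n ∈ B, c n * chiC χ n m := by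
      intro m
      rw [← Finset.sum_subset hsub]
      · exact Finset.sum_congr rfl fun n hn => by rw [if_pos hn]
      · intro n _ hn; rw [if_neg hn, zero_mul]
    have e2 : ∑ n ∈ SF Q, ‖(if n ∈ B then c n else 0)‖ ^ 2 = ∑ n ∈ B, ‖c n‖ ^ 2 := by
      rw [← Finset.sum_subset hsub]
      · exact Finset.sum_congr rfl fun n hn => by rw [if_pos hn]
      · intro n _ hn; rw [if_neg hn]; simp
    simp only [e1, e2] at h2
    exact h2
  have hZT : ∀ T : Finset Eis, (∀ k ∈ T, k ≠ 0) → ∑ k ∈ T, ‖Z k‖ ≤ C1 * x0 ^ (-ε) * (G * (Q * Nm d / M)) * (2 / Q * W) := by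
    intro T hT
    exact h1 χ hχ B Q x0 (G * (Q * Nm d / M)) (2 / Q * W) a b hx0p (by positivity)
      (fun n hn => ⟨(hB n hn).1.ne_zero, (hB n hn).2.2.2⟩) hBE hV1 hV2 T hT
  have hZ0 : ‖Z 0‖ ≤ 2 / Q * W := by
    have e : Z 0 = (∑ n ∈ B, a n * (starRingEnd ℂ) (chiC χ n 0)) * (∑ n ∈ B, b n * chiC χ n 0) := by
      simp only [hZ, hEw, Nm_zero, mul_zero, zero_mul, neg_zero, Real.exp_zero, Complex.ofReal_one, mul_one]
      rw [Finset.sum_mul_sum]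
      exact Finset.sum_congr rfl fun n _ => Finset.sum_congr rfl fun n' _ => by ring
    have u1 : ‖∑ n ∈ B, a n * (starRingEnd ℂ) (chiC χ n 0)‖ ^ 2 ≤ 2 / Q * W := by
      have := chi_zero_sum hχ B (fun n hn => (hB n hn).1) (fun n => (starRingEnd ℂ) (a n))
      simp only [RCLike.norm_conj] at this
      refine le_trans (le_of_eq ?_) (this.trans hV1)
      rw [← RCLike.norm_conj, map_sum]
      simp only [map_mul, Complex.conj_conj]
    have u2 := (chi_zero_sum hχ B (fun n hn => (hB n hn).1) b).trans hV2
    rw [e, norm_mul]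
    nlinarith [sq_nonneg (‖∑ n ∈ B, a n * (starRingEnd ℂ) (chiC χ n 0)‖ - ‖∑ n ∈ B, b n * chiC χ n 0‖)]
  set R := 2 / Q * W + C1 * x0 ^ (-ε) * (G * (Q * Nm d / M)) * (2 / Q * W) with hR
  have hZall : ∀ T : Finset Eis, ∑ k ∈ T, ‖Z k‖ ≤ R := by
    intro T
    calc ∑ k ∈ T, ‖Z k‖ ≤ ∑ k ∈ insert 0 (T.erase 0), ‖Z k‖ := by
          apply Finset.sum_le_sum_of_subset_of_nonneg
          · intro k hk; by_cases h : k = 0 <;> simp [h, hk]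
          · intros; positivity
      _ = ‖Z 0‖ + ∑ k ∈ T.erase 0, ‖Z k‖ := Finset.sum_insert (by simp)
      _ ≤ R := add_le_add hZ0 (hZT _ (fun k hk => Finset.ne_of_mem_erase hk))
  have hsumm : Summable fun k => ‖Z k‖ := summable_of_sum_le (fun _ => norm_nonneg _) hZall
  have hts : ‖∑' k, Z k‖ ≤ R := (norm_tsum_le_tsum_norm hsumm).trans (Real.tsum_le_of_sum_le (fun _ => norm_nonneg _) hZall)
  -- identity
  have hid : ∑ n ∈ B, ∑ n' ∈ B, c n * (starRingEnd ℂ) (c n') * Pk χ M d n n' = ((M / (Real.sqrt 3 * Nm d) : ℝ) : ℂ) * ∑' k, Z k := by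
    have hs : ∀ n ∈ B, ∀ n' ∈ B, Summable fun k => a n * b n' * ((starRingEnd ℂ) (chiC χ n k) * chiC χ n' k) * Ew k n n' := by
      intro n hn n' hn'
      have p1 := Nm_pos (hB n hn).1.ne_zero
      have p2 := Nm_pos (hB n' hn').1.ne_zero
      have := (summable_Th (f := fun k => (starRingEnd ℂ) (mixC χ n n' k)) (fun m => by
        rw [RCLike.norm_conj]; exact mixC_norm_le hχ (hB n hn).1 (hB n' hn').1 m)
        (c := 2 * Real.pi / 3 * x0 * (Q / Nm n) * (Q / Nm n')) (by positivity)).mul_left (a n * b n')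
      refine this.congr fun k => ?_
      simp only [hEw, mixC, map_mul, Complex.conj_conj]
      rw [show 2 * Real.pi / 3 * x0 * Nm k * (Q / Nm n) * (Q / Nm n') = 2 * Real.pi / 3 * x0 * (Q / Nm n) * (Q / Nm n') * Nm k by ring]
      ring
    have e1 : ∑' k, Z k = ∑ n ∈ B, ∑ n' ∈ B, ∑' k, a n * b n' * ((starRingEnd ℂ) (chiC χ n k) * chiC χ n' k) * Ew k n n' := by
      simp only [hZ]
      rw [Summable.tsum_finsetSum (fun n hn => summable_sum (hs n hn))]
      exact Finset.sum_congr rfl fun n hn => Summable.tsum_finsetSum (hs n hn)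
    rw [e1, Finset.mul_sum]
    refine Finset.sum_congr rfl fun n hn => ?_
    rw [Finset.mul_sum]
    refine Finset.sum_congr rfl fun n' hn' => ?_
    have p1 := Nm_pos (hB n hn).1.ne_zero
    have p2 := Nm_pos (hB n' hn').1.ne_zero
    unfold Pk Th
    rw [← tsum_mul_left, ← tsum_mul_left, ← tsum_mul_left, ← tsum_mul_left]
    refine tsum_congr fun k => ?_
    have e2 : 2 * Real.pi * (1 / (3 * ((Nm d * M⁻¹) * Nm (n * n')))) * Nm k = 2 * Real.pi / 3 * x0 * Nm k * (Q / Nm n) * (Q / Nm n') := by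
      rw [Nm_mul, hx0]; field_simp
    have e3 : (1 / (Real.sqrt 3 * ((Nm d * M⁻¹) * Nm (n * n'))) : ℝ) = M / (Real.sqrt 3 * Nm d) * (1 / Nm n) * (1 / Nm n') := by
      rw [Nm_mul]; field_simp
    rw [e2, e3]
    simp only [ha, hb, hEw, mixC, map_mul, Complex.conj_conj]
    push_cast
    ring
  rw [hid, norm_mul, Complex.norm_real, Real.norm_of_nonneg (by positivity)]
  have hs3 : 1 ≤ Real.sqrt 3 := Real.one_le_sqrt.2 (by norm_num)
  calc M / (Real.sqrt 3 * Nm d) * ‖∑' k, Z k‖ ≤ M / (1 * Nm d) * R := by gcongr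
    _ = 2 * M / (Nm d * Q) * W + 2 * C1 * (x0 ^ (-ε) * G) * W := by rw [hR]; field_simp
    _ ≤ 2 * M * W + 2 * C1 * (x0 ^ (-ε) * G) * W := by
        gcongr
        apply div_le_self (by positivity)
        nlinarith
    _ ≤ (2 + 2 * C1) * (M + x0 ^ (-ε) * G) * W := by
        have : 0 ≤ x0 ^ (-ε) * G := by positivity
        have h4 : 0 ≤ 2 * C1 * M * W := by positivity
        have h5 : 0 ≤ 2 * (x0 ^ (-ε) * G) * W := by positivity
        nlinarith

end P5d2

section P5d3
open scoped Classical
variable {χ : Eis → Eis → Eis}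

lemma mixC_gcd (hχ : IsCubicSymbol χ) {g n n' : Eis} (hg : Pri g) (hn : Pri n) (hn' : Pri n') (m : Eis) :
    mixC χ (g * n) (g * n') m = (if IsCoprime m g then 1 else 0) * mixC χ n n' m := by
  unfold mixC chiC
  rw [hχ.mul_bot g n m hg hn, hχ.mul_bot g n' m hg hn']
  push_cast
  rw [map_mul]
  have h : ((χ g m : Eis) : ℂ) * (starRingEnd ℂ) ((χ g m : Eis) : ℂ) = if IsCoprime m g then 1 else 0 := by
    rw [Complex.mul_conj, Complex.normSq_eq_norm_sq]
    split_ifs with h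
    · rw [((chi_ne hχ hg).1 h).norm]; simp
    · rw [(chi_ne hχ hg).2 h]; simp
  rw [← h]; ring

lemma Th_pair {μ : Eis → ℤ} (hμ : IsMoebius μ) (hχ : IsCubicSymbol χ) {g n n' : Eis} (hg : Pri g) (hgs : Squarefree g) (hn : Pri n) (hn' : Pri n')
    (hs : Squarefree (n * n')) {M : ℝ} (hM : 0 < M) :
    Th (mixC χ (g * n) (g * n')) M⁻¹ = ∑ d ∈ pd g, (μ d : ℂ) * Pk χ M d n n' := by
  have e : mixC χ (g * n) (g * n') = fun m => (if IsCoprime m g then 1 else 0) * mixC χ n n' m := funext fun m => mixC_gcd hχ hg hn hn' m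
  have hp := PChar.mix hχ hn hn' hs
  rw [e, Th_coprime hμ hg hgs hp.mul hp.norm_le (by positivity)]
  refine Finset.sum_congr rfl fun d hd => ?_
  have hd0 := Nm_pos ((mem_pd hg.ne_zero).1 hd).1.ne_zero
  rw [theta_fe hp (by positivity), gs_mix hχ hn hn' hs, Pk]
  ring

lemma coprime_moebius {μ : Eis → ℤ} (hμ : IsMoebius μ) {Z : ℝ} {n n' : Eis} (hn : n ∈ SF Z) :
    (if IsCoprime n n' then (1 : ℂ) else 0) = ∑ f ∈ SF Z, if f ∣ n ∧ f ∣ n' then (μ f : ℂ) else 0 := by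
  obtain ⟨hZ, hp, hs⟩ := mem_SF.1 hn
  have h := congrArg (fun z : ℤ => (z : ℂ)) (moebius_sum hμ n' hp hs)
  push_cast at h
  have e : (if IsCoprime n n' then (1 : ℂ) else 0) = if IsCoprime n' n then (1 : ℂ) else 0 := by
    simp only [isCoprime_comm]
  rw [e, ← h]
  have hpd : pd n = (SF Z).filter (fun f => f ∣ n) := by
    ext f
    rw [mem_pd hp.ne_zero, Finset.mem_filter, mem_SF]
    exact ⟨fun h => ⟨⟨(Nm_le_of_dvd hp.ne_zero h.2).trans hZ, h.1, hs.squarefree_of_dvd h.2⟩, h.2⟩, fun h => ⟨h.1.2.1, h.2⟩⟩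
  rw [hpd, Finset.sum_filter]
  refine Finset.sum_congr rfl fun f _ => ?_
  by_cases h1 : f ∣ n <;> by_cases h2 : f ∣ n' <;> simp [h1, h2]

/-- counting the multiplicity of the decomposition -/
lemma W_sum {Z D : ℝ} (hD0 : 0 ≤ D) (hD : ∀ x ∈ SF Z, ((pd x).card : ℝ) ≤ D) (S : Finset Eis) (hS : S ⊆ SF Z) (h : Eis → ℝ) (h0 : ∀ x, 0 ≤ h x) :
    ∑ g ∈ SF Z, ∑ _d ∈ pd g, ∑ f ∈ SF Z, ∑ n ∈ (SF Z).filter (fun n => g * n ∈ S ∧ f ∣ n), h (g * n) ≤ D ^ 3 * ∑ n ∈ S, h n := by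
  have hsub : ∀ x ∈ SF Z, ((SF Z).filter (fun f => f ∣ x)) ⊆ pd x := fun x hx f hf => by
    rw [Finset.mem_filter, mem_SF] at hf
    exact (mem_pd (mem_SF.1 hx).2.1.ne_zero).2 ⟨hf.1.2.1, hf.2⟩
  have hcard : ∀ x ∈ SF Z, (((SF Z).filter (fun f => f ∣ x)).card : ℝ) ≤ D := fun x hx =>
    le_trans (by exact_mod_cast Finset.card_le_card (hsub x hx)) (hD x hx)
  have s1 : ∀ g ∈ SF Z, ∑ f ∈ SF Z, ∑ n ∈ (SF Z).filter (fun n => g * n ∈ S ∧ f ∣ n), h (g * n) ≤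
      D * ∑ k ∈ S.filter (fun k => g ∣ k), h k := by
    intro g hg
    have hg0 := (mem_SF.1 hg).2.1.ne_zero
    have e : ∑ f ∈ SF Z, ∑ n ∈ (SF Z).filter (fun n => g * n ∈ S ∧ f ∣ n), h (g * n) =
        ∑ n ∈ (SF Z).filter (fun n => g * n ∈ S), ∑ f ∈ (SF Z).filter (fun f => f ∣ n), h (g * n) := by
      apply Finset.sum_comm'
      intro x y; simp only [Finset.mem_filter]; tauto
    rw [e]
    calc _ ≤ ∑ n ∈ (SF Z).filter (fun n => g * n ∈ S), D * h (g * n) := by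
          refine Finset.sum_le_sum fun n hn => ?_
          rw [Finset.sum_const, nsmul_eq_mul]
          exact mul_le_mul_of_nonneg_right (hcard n (Finset.mem_filter.1 hn).1) (h0 _)
      _ = D * ∑ k ∈ ((SF Z).filter (fun n => g * n ∈ S)).image (fun n => g * n), h k := by
          rw [Finset.mul_sum, Finset.sum_image (fun a _ b _ hab => mul_left_cancel₀ hg0 hab)]
      _ ≤ _ := by
          gcongr
          · intro k _ _; exact h0 k
          · intro k hk
            obtain ⟨n, hn, rfl⟩ := Finset.mem_image.1 hk
            exact Finset.mem_filter.2 ⟨(Finset.mem_filter.1 hn).2, dvd_mul_right _ _⟩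
  calc _ ≤ ∑ g ∈ SF Z, D * (D * ∑ k ∈ S.filter (fun k => g ∣ k), h k) := by
        refine Finset.sum_le_sum fun g hg => ?_
        rw [Finset.sum_const, nsmul_eq_mul]
        exact mul_le_mul (hD g hg) (s1 g hg) (Finset.sum_nonneg fun _ _ => Finset.sum_nonneg fun _ _ => h0 _) hD0
    _ = D * (D * ∑ k ∈ S, ∑ g ∈ (SF Z).filter (fun g => g ∣ k), h k) := by
        rw [← Finset.mul_sum, ← Finset.mul_sum]
        congr 2
        apply Finset.sum_comm'
        intro x y; simp only [Finset.mem_filter]; tauto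
    _ ≤ D * (D * ∑ k ∈ S, D * h k) := by
        gcongr with k hk
        rw [Finset.sum_const, nsmul_eq_mul]
        exact mul_le_mul_of_nonneg_right (hcard k (hS hk)) (h0 _)
    _ = _ := by rw [← Finset.mul_sum]; ring

lemma theta_majorant (hχ : IsCubicSymbol χ) (S : Finset Eis) (hS : ∀ n ∈ S, Pri n) (c : Eis → ℂ) {M : ℝ} (hM : 0 < M) :
    ∑ m ∈ SF M, ‖∑ n ∈ S, c n * chiC χ n m‖ ^ 2 ≤ Real.exp (2 * Real.pi) *
      ‖∑ n ∈ S, ∑ n' ∈ S, c n * (starRingEnd ℂ) (c n') * Th (mixC χ n n') M⁻¹‖ := by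
  set T := ∑ n ∈ S, ∑ n' ∈ S, c n * (starRingEnd ℂ) (c n') * Th (mixC χ n n') M⁻¹ with hT
  have h1 : HasSum (fun m : Eis => ((‖∑ n ∈ S, c n * chiC χ n m‖ ^ 2 * Real.exp (-(2 * Real.pi * M⁻¹ * Nm m)) : ℝ) : ℂ)) T := by
    have : ∀ n ∈ S, ∀ n' ∈ S, HasSum (fun m : Eis => c n * (starRingEnd ℂ) (c n') * (mixC χ n n' m * ((Real.exp (-(2 * Real.pi * M⁻¹ * Nm m)) : ℝ) : ℂ)))
        (c n * (starRingEnd ℂ) (c n') * Th (mixC χ n n') M⁻¹) := fun n hn n' hn' =>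
      (summable_Th (mixC_norm_le hχ (hS n hn) (hS n' hn')) (by positivity)).hasSum.mul_left _
    have h2 := hasSum_sum fun n hn => hasSum_sum (this n hn)
    refine h2.congr_fun ?_ |> fun h => h
    intro m
    push_cast
    rw [← Complex.conj_mul', map_sum, Finset.sum_mul_sum, Finset.sum_comm, Finset.sum_mul]
    refine Finset.sum_congr rfl fun n _ => ?_
    rw [Finset.sum_mul]
    refine Finset.sum_congr rfl fun n' _ => ?_
    rw [map_mul, mixC]; ring
  have h2 : HasSum (fun m : Eis => ‖∑ n ∈ S, c n * chiC χ n m‖ ^ 2 * Real.exp (-(2 * Real.pi * M⁻¹ * Nm m))) T.re := by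
    have := Complex.hasSum_re h1
    simpa only [Complex.ofReal_re] using this
  have h3 := sum_le_hasSum (SF M) (fun m _ => by positivity) h2
  calc ∑ m ∈ SF M, ‖∑ n ∈ S, c n * chiC χ n m‖ ^ 2 ≤ ∑ m ∈ SF M, Real.exp (2 * Real.pi) * (‖∑ n ∈ S, c n * chiC χ n m‖ ^ 2 * Real.exp (-(2 * Real.pi * M⁻¹ * Nm m))) := by
        refine Finset.sum_le_sum fun m hm => ?_
        have hm1 := (mem_SF.1 hm).1
        have : 1 ≤ Real.exp (2 * Real.pi) * Real.exp (-(2 * Real.pi * M⁻¹ * Nm m)) := by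
          rw [← Real.exp_add]
          apply Real.one_le_exp
          have : M⁻¹ * Nm m ≤ 1 := by rw [inv_mul_le_one₀ hM]; exact hm1
          nlinarith [Real.pi_pos]
        nlinarith [sq_nonneg ‖∑ n ∈ S, c n * chiC χ n m‖]
    _ = Real.exp (2 * Real.pi) * ∑ m ∈ SF M, (‖∑ n ∈ S, c n * chiC χ n m‖ ^ 2 * Real.exp (-(2 * Real.pi * M⁻¹ * Nm m))) := by rw [Finset.mul_sum]
    _ ≤ Real.exp (2 * Real.pi) * ‖T‖ := by
        gcongr
        exact h3.trans (Complex.re_le_norm T)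

lemma poisson_identity {μ : Eis → ℤ} (hμ : IsMoebius μ) (hχ : IsCubicSymbol χ) {Z M : ℝ} (hM : 0 < M) (S : Finset Eis) (hS : S ⊆ SF Z) (c : Eis → ℂ) :
    ∑ n ∈ S, ∑ n' ∈ S, c n * (starRingEnd ℂ) (c n') * Th (mixC χ n n') M⁻¹ =
    ∑ g ∈ SF Z, ∑ d ∈ pd g, ∑ f ∈ SF Z, (μ d : ℂ) * (μ f : ℂ) *
      ∑ n ∈ (SF Z).filter (fun n => g * n ∈ S ∧ f ∣ n), ∑ n' ∈ (SF Z).filter (fun n => g * n ∈ S ∧ f ∣ n),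
        c (g * n) * (starRingEnd ℂ) (c (g * n')) * Pk χ M d n n' := by
  rw [pair_decomp S hS]
  refine Finset.sum_congr rfl fun g hg => ?_
  obtain ⟨-, hgp, hgs⟩ := mem_SF.1 hg
  have e1 : ∀ n ∈ (SF Z).filter (fun n => g * n ∈ S), ∀ n' ∈ (SF Z).filter (fun n => g * n ∈ S),
      (if IsCoprime n n' then c (g * n) * (starRingEnd ℂ) (c (g * n')) * Th (mixC χ (g * n) (g * n')) M⁻¹ else 0) =
      ∑ d ∈ pd g, ∑ f ∈ SF Z, if f ∣ n then (if f ∣ n' then (μ d : ℂ) * (μ f : ℂ) * (c (g * n) * (starRingEnd ℂ) (c (g * n')) * Pk χ M d n n') else 0) else 0 := by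
    intro n hn n' hn'
    obtain ⟨hn, -⟩ := Finset.mem_filter.1 hn
    obtain ⟨hn', -⟩ := Finset.mem_filter.1 hn'
    obtain ⟨-, p, s⟩ := mem_SF.1 hn
    obtain ⟨-, p', s'⟩ := mem_SF.1 hn'
    have e2 : (if IsCoprime n n' then c (g * n) * (starRingEnd ℂ) (c (g * n')) * Th (mixC χ (g * n) (g * n')) M⁻¹ else 0) =
        (if IsCoprime n n' then (1 : ℂ) else 0) * ∑ d ∈ pd g, (μ d : ℂ) * (c (g * n) * (starRingEnd ℂ) (c (g * n')) * Pk χ M d n n') := by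
      split_ifs with h
      · rw [Th_pair hμ hχ hgp hgs p p' (squarefree_mul_iff.2 ⟨h.isRelPrime, s, s'⟩) hM, one_mul, Finset.mul_sum]
        exact Finset.sum_congr rfl fun d _ => by ring
      · rw [zero_mul]
    rw [e2, coprime_moebius hμ hn, Finset.mul_sum]
    refine Finset.sum_congr rfl fun d _ => ?_
    rw [Finset.sum_mul]
    refine Finset.sum_congr rfl fun f _ => ?_
    by_cases h1 : f ∣ n <;> by_cases h2 : f ∣ n' <;> simp [h1, h2]
    ring
  rw [Finset.sum_congr rfl fun n hn => Finset.sum_congr rfl (e1 n hn)]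
  have e3 : ∀ n, ∑ n' ∈ (SF Z).filter (fun n => g * n ∈ S), ∑ d ∈ pd g, ∑ f ∈ SF Z, (if f ∣ n then (if f ∣ n' then (μ d : ℂ) * (μ f : ℂ) * (c (g * n) * (starRingEnd ℂ) (c (g * n')) * Pk χ M d n n') else 0) else 0)
      = ∑ d ∈ pd g, ∑ f ∈ SF Z, ∑ n' ∈ (SF Z).filter (fun n => g * n ∈ S), (if f ∣ n then (if f ∣ n' then (μ d : ℂ) * (μ f : ℂ) * (c (g * n) * (starRingEnd ℂ) (c (g * n')) * Pk χ M d n n') else 0) else 0) := by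
    intro n
    rw [Finset.sum_comm]
    exact Finset.sum_congr rfl fun d _ => Finset.sum_comm
  rw [Finset.sum_congr rfl fun n _ => e3 n, Finset.sum_comm]
  refine Finset.sum_congr rfl fun d _ => ?_
  rw [Finset.sum_comm]
  refine Finset.sum_congr rfl fun f _ => ?_
  have e4 : (SF Z).filter (fun n => g * n ∈ S ∧ f ∣ n) = ((SF Z).filter (fun n => g * n ∈ S)).filter (fun n => f ∣ n) := by
    rw [Finset.filter_filter]
  rw [e4]
  conv_rhs => rw [Finset.sum_filter, Finset.mul_sum]
  refine Finset.sum_congr rfl fun n _ => ?_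
  by_cases h1 : f ∣ n
  · simp only [if_pos h1]
    conv_rhs => rw [Finset.sum_filter, Finset.mul_sum]
    refine Finset.sum_congr rfl fun n' _ => ?_
    by_cases h2 : f ∣ n' <;> simp [h2]
  · simp [h1]

lemma poissonLS {ε A : ℝ} (hε : 0 < ε) (hε1 : ε ≤ 1) (hA : 0 ≤ A) : ∃ C : ℝ, 0 < C ∧ ∀ χ, IsCubicSymbol χ → ∀ μ, IsMoebius μ →
    ∀ (Z M G : ℝ) (S : Finset Eis) (c : Eis → ℂ), 1 ≤ Z → 1 ≤ M → 0 ≤ G → S ⊆ SF Z → (∀ n ∈ S, Z / 2 ≤ Nm n) →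
    (∀ Q δ K, 1 ≤ Q → 1 ≤ δ → δ * Q ≤ Z → 1 ≤ K → EB χ K Q (G * (Q * δ / M) * (1 + K * (M / (δ * Q ^ 2))) ^ A)) →
    ∑ m ∈ SF M, ‖∑ n ∈ S, c n * chiC χ n m‖ ^ 2 ≤ C * Z ^ ε * (M + G) * ∑ n ∈ S, ‖c n‖ ^ 2 := by
  obtain ⟨C1, hC1, h1⟩ := block (ε := ε / 4) (A := A) (by positivity) (by linarith) hA
  obtain ⟨C2, hC2, h2⟩ := divisor_bound (ε / 6) (by positivity)
  refine ⟨Real.exp (2 * Real.pi) * (C1 * C2 ^ 3), by positivity, ?_⟩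
  intro χ hχ μ hμ Z M G S c hZ hM hG hS hSl hE
  have hM0 : 0 < M := by linarith
  have hZ0 : 0 < Z := by linarith
  refine (theta_majorant hχ S (fun n hn => (mem_SF.1 (hS hn)).2.1) c hM0).trans ?_
  rw [poisson_identity hμ hχ hM0 S hS c]
  have key : ∀ g ∈ SF Z, ∀ d ∈ pd g, ∀ f ∈ SF Z, ‖(μ d : ℂ) * (μ f : ℂ) *
      ∑ n ∈ (SF Z).filter (fun n => g * n ∈ S ∧ f ∣ n), ∑ n' ∈ (SF Z).filter (fun n => g * n ∈ S ∧ f ∣ n),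
        c (g * n) * (starRingEnd ℂ) (c (g * n')) * Pk χ M d n n'‖ ≤
      C1 * (Z ^ (ε / 2) * (M + G)) * ∑ n ∈ (SF Z).filter (fun n => g * n ∈ S ∧ f ∣ n), ‖c (g * n)‖ ^ 2 := by
    intro g hg d hd f hf
    obtain ⟨hgZ, hgp, hgs⟩ := mem_SF.1 hg
    obtain ⟨hdp, hdg⟩ := (mem_pd hgp.ne_zero).1 hd
    have hNg := Nm_pos hgp.ne_zero
    have hNd := one_le_Nm hdp.ne_zero
    have hdg' := Nm_le_of_dvd hgp.ne_zero hdg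
    have hQ1 : 1 ≤ Z / Nm g := by rw [one_le_div hNg]; exact hgZ
    have hQZ : Z / Nm g ≤ Z := div_le_self hZ0.le (one_le_Nm hgp.ne_zero)
    have hdQ : Nm d * (Z / Nm g) ≤ Z := by
      rw [mul_div_assoc', div_le_iff₀ hNg]; nlinarith
    have m1 : ‖(μ d : ℂ)‖ ≤ 1 := by
      rw [Complex.norm_intCast]; exact_mod_cast moebius_abs hμ hdp
    have m2 : ‖(μ f : ℂ)‖ ≤ 1 := by
      rw [Complex.norm_intCast]; exact_mod_cast moebius_abs hμ (mem_SF.1 hf).2.1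
    rw [norm_mul, norm_mul]
    have hb := h1 χ hχ ((SF Z).filter (fun n => g * n ∈ S ∧ f ∣ n)) (Z / Nm g) M G d (fun n => c (g * n)) hM0 hG hdp hQ1 ?_ ?_
    · refine le_trans (mul_le_of_le_one_left (norm_nonneg _) (mul_le_one₀ m1 (norm_nonneg _) m2)) (hb.trans ?_)
      gcongr
      have hz1 : 1 ≤ Z ^ (ε / 2) := Real.one_le_rpow hZ (by positivity)
      have hx : (M / (Nm d * (Z / Nm g) ^ 2)) ^ (-(ε / 4)) ≤ Z ^ (ε / 2) := by
        rw [Real.rpow_neg (by positivity), ← Real.inv_rpow (by positivity), inv_div]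
        calc (Nm d * (Z / Nm g) ^ 2 / M) ^ (ε / 4) ≤ (Z ^ 2) ^ (ε / 4) := by
              apply Real.rpow_le_rpow (by positivity) _ (by positivity)
              refine (div_le_self (by positivity) hM).trans ?_
              calc Nm d * (Z / Nm g) ^ 2 = (Nm d * (Z / Nm g)) * (Z / Nm g) := by ring
                _ ≤ Z * Z := by gcongr
                _ = Z ^ 2 := by ring
          _ = Z ^ (ε / 2) := by
              rw [← Real.rpow_natCast, ← Real.rpow_mul hZ0.le]; congr 1; push_cast; ring
      have h3 : M ≤ Z ^ (ε / 2) * M := le_mul_of_one_le_left hM0.le hz1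
      have h4 : (M / (Nm d * (Z / Nm g) ^ 2)) ^ (-(ε / 4)) * G ≤ Z ^ (ε / 2) * G := by gcongr
      linarith
    · intro n hn
      obtain ⟨hn, hnS, -⟩ := Finset.mem_filter.1 hn
      obtain ⟨-, p, s⟩ := mem_SF.1 hn
      have a1 := hSl _ hnS
      have a2 := (mem_SF.1 (hS hnS)).1
      rw [Nm_mul] at a1 a2
      refine ⟨p, s, ?_, ?_⟩
      · rw [div_div, div_le_iff₀ (by positivity)]; linarith
      · rw [le_div_iff₀ hNg]; linarith
    · intro K hK
      exact hE (Z / Nm g) (Nm d) K hQ1 hNd hdQ hK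
  have hD : ∀ x ∈ SF Z, ((pd x).card : ℝ) ≤ C2 * Z ^ (ε / 6) := fun x hx => by
    obtain ⟨l, p, s⟩ := mem_SF.1 hx
    refine (h2 x p.ne_zero).trans ?_
    have := Nm_nonneg x
    gcongr
  have hw := W_sum (by positivity) hD S hS (fun n => ‖c n‖ ^ 2) (fun _ => by positivity)
  have hZe : (Z ^ (ε / 6)) ^ 3 * Z ^ (ε / 2) = Z ^ ε := by
    rw [← Real.rpow_natCast, ← Real.rpow_mul hZ0.le, ← Real.rpow_add hZ0]; congr 1; push_cast; ring
  calc _ ≤ Real.exp (2 * Real.pi) * ∑ g ∈ SF Z, ∑ d ∈ pd g, ∑ f ∈ SF Z, C1 * (Z ^ (ε / 2) * (M + G)) * ∑ n ∈ (SF Z).filter (fun n => g * n ∈ S ∧ f ∣ n), ‖c (g * n)‖ ^ 2 := by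
        gcongr
        refine norm_sum_le_of_le _ fun g hg => norm_sum_le_of_le _ fun d hd => norm_sum_le_of_le _ fun f hf => key g hg d hd f hf
    _ = Real.exp (2 * Real.pi) * (C1 * (Z ^ (ε / 2) * (M + G)) * ∑ g ∈ SF Z, ∑ d ∈ pd g, ∑ f ∈ SF Z, ∑ n ∈ (SF Z).filter (fun n => g * n ∈ S ∧ f ∣ n), ‖c (g * n)‖ ^ 2) := by
        simp only [Finset.mul_sum]
    _ ≤ Real.exp (2 * Real.pi) * (C1 * (Z ^ (ε / 2) * (M + G)) * ((C2 * Z ^ (ε / 6)) ^ 3 * ∑ n ∈ S, ‖c n‖ ^ 2)) := by gcongr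
    _ = _ := by rw [← hZe]; ring

end P5d3

section P5e
open scoped Classical
variable {χ : Eis → Eis → Eis}

lemma exists_dyadic_idx {N : ℝ} (hN : 1 ≤ N) {ε : ℝ} (hε : 0 < ε) : ∃ (L : ℕ) (idx : ℝ → ℕ),
    (L : ℝ) ≤ (1 + 1 / (ε * Real.log 2)) * N ^ ε ∧ ∀ t, 1 ≤ t → t ≤ N → idx t < L ∧ (2 : ℝ) ^ idx t ≤ N / t ∧ N / t < 2 ^ (idx t + 1) := by
  have hl2 : 0 < Real.log 2 := Real.log_pos (by norm_num)
  have hex : ∀ t : ℝ, ∃ i : ℕ, 1 ≤ t → t ≤ N → (2 : ℝ) ^ i ≤ N / t ∧ N / t < 2 ^ (i + 1) := by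
    intro t
    by_cases h : 1 ≤ t ∧ t ≤ N
    · obtain ⟨i, hi⟩ := exists_nat_pow_near (x := N / t) (y := 2) (by rw [one_le_div (by linarith)]; exact h.2) (by norm_num)
      exact ⟨i, fun _ _ => hi⟩
    · exact ⟨0, fun a b => absurd ⟨a, b⟩ h⟩
  choose idx hidx using hex
  obtain ⟨j, hj1, hj2⟩ := exists_nat_pow_near (x := N) (y := 2) hN (by norm_num)
  refine ⟨j + 1, idx, ?_, ?_⟩
  · have h1 : (j : ℝ) * Real.log 2 ≤ Real.log N := by
      rw [← Real.log_pow]; exact Real.log_le_log (by positivity) hj1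
    have h2 : Real.log N ≤ N ^ ε / ε := Real.log_le_rpow_div (by linarith) hε
    have h3 : (j : ℝ) ≤ N ^ ε / ε / Real.log 2 := by
      rw [le_div_iff₀ hl2]; linarith
    have h4 : 1 ≤ N ^ ε := Real.one_le_rpow hN hε.le
    push_cast
    have : N ^ ε / ε / Real.log 2 = 1 / (ε * Real.log 2) * N ^ ε := by field_simp
    rw [this] at h3
    linarith
  · intro t h1 h2
    obtain ⟨a, b⟩ := hidx t h1 h2
    refine ⟨?_, a, b⟩
    have h3 : (2 : ℝ) ^ idx t < 2 ^ (j + 1) := (a.trans (div_le_self (by linarith) h1)).trans_lt hj2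
    exact (pow_lt_pow_iff_right₀ (by norm_num : (1 : ℝ) < 2)).1 h3

lemma sq_norm_sum_le_card {ι : Type*} (s : Finset ι) (f : ι → ℂ) : ‖∑ i ∈ s, f i‖ ^ 2 ≤ s.card * ∑ i ∈ s, ‖f i‖ ^ 2 :=
  (pow_le_pow_left₀ (norm_nonneg _) (norm_sum_le _ _) 2).trans sq_sum_le_card_mul_sum_sq

lemma LS_dyadic {ε A : ℝ} (hε : 0 < ε) (hε1 : ε ≤ 1) (hA : 0 ≤ A) : ∃ C : ℝ, 0 < C ∧ ∀ χ, IsCubicSymbol χ → ∀ μ, IsMoebius μ →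
    ∀ N M G : ℝ, 1 ≤ N → 1 ≤ M → 0 ≤ G →
    (∀ Q δ K, 1 ≤ Q → 1 ≤ δ → δ * Q ≤ N → 1 ≤ K → EB χ K Q (G * (Q * δ / M) * (1 + K * (M / (δ * Q ^ 2))) ^ A)) →
    LSB χ M N (C * N ^ ε * (M + G)) := by
  obtain ⟨C1, hC1, h1⟩ := poissonLS (ε := ε / 2) (A := A) (by positivity) (by linarith) hA
  have hl2 : 0 < Real.log 2 := Real.log_pos (by norm_num)
  refine ⟨(1 + 1 / (ε / 2 * Real.log 2)) * C1, by positivity, ?_⟩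
  intro χ hχ μ hμ N M G hN hM hG hE c
  have hN0 : 0 < N := by linarith
  obtain ⟨L, idx, hL, hidx⟩ := exists_dyadic_idx hN (ε := ε / 2) (by positivity)
  have hmaps : ∀ n ∈ SF N, idx (Nm n) ∈ Finset.range L := fun n hn => by
    obtain ⟨l, p, s⟩ := mem_SF.1 hn
    exact Finset.mem_range.2 (hidx _ (one_le_Nm p.ne_zero) l).1
  have hsh : ∀ i ∈ Finset.range L, ∑ m ∈ SF M, ‖∑ n ∈ (SF N).filter (fun n => idx (Nm n) = i), c n * chiC χ n m‖ ^ 2 ≤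
      C1 * N ^ (ε / 2) * (M + G) * ∑ n ∈ (SF N).filter (fun n => idx (Nm n) = i), ‖c n‖ ^ 2 := by
    intro i hi
    set S := (SF N).filter (fun n => idx (Nm n) = i) with hS
    by_cases hZ : 1 ≤ N / 2 ^ i
    · have := h1 χ hχ μ hμ (N / 2 ^ i) M G S c hZ hM hG ?_ ?_ ?_
      · refine this.trans ?_
        have h3 : (N / 2 ^ i) ^ (ε / 2) ≤ N ^ (ε / 2) := by
          apply Real.rpow_le_rpow (by positivity) (div_le_self hN0.le (one_le_pow₀ (by norm_num))) (by positivity)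
        gcongr
      · intro n hn
        obtain ⟨hn', hi'⟩ := Finset.mem_filter.1 hn
        obtain ⟨l, p, s⟩ := mem_SF.1 hn'
        refine mem_SF.2 ⟨?_, p, s⟩
        have h3 := (hidx _ (one_le_Nm p.ne_zero) l).2.1
        rw [hi'] at h3
        rw [le_div_iff₀ (Nm_pos p.ne_zero)] at h3
        rw [le_div_iff₀ (by positivity)]; linarith
      · intro n hn
        obtain ⟨hn', hi'⟩ := Finset.mem_filter.1 hn
        obtain ⟨l, p, s⟩ := mem_SF.1 hn'
        have h3 := (hidx _ (one_le_Nm p.ne_zero) l).2.2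
        rw [hi'] at h3
        rw [div_lt_iff₀ (Nm_pos p.ne_zero), pow_succ] at h3
        rw [div_div, div_le_iff₀ (by positivity)]; linarith
      · intro Q δ K hQ hδ hδQ hK
        exact hE Q δ K hQ hδ (hδQ.trans (div_le_self hN0.le (one_le_pow₀ (by norm_num)))) hK
    · have : S = ∅ := by
        rw [Finset.eq_empty_iff_forall_notMem]
        intro n hn
        obtain ⟨hn', hi'⟩ := Finset.mem_filter.1 hn
        obtain ⟨l, p, s⟩ := mem_SF.1 hn'
        have h3 := (hidx _ (one_le_Nm p.ne_zero) l).2.1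
        rw [hi'] at h3
        apply hZ
        rw [one_le_div (by positivity)]
        exact h3.trans (div_le_self hN0.le (one_le_Nm p.ne_zero))
      rw [this]; simp
  calc ∑ m ∈ SF M, ‖∑ n ∈ SF N, c n * chiC χ n m‖ ^ 2 = ∑ m ∈ SF M, ‖∑ i ∈ Finset.range L, ∑ n ∈ (SF N).filter (fun n => idx (Nm n) = i), c n * chiC χ n m‖ ^ 2 := by
        refine Finset.sum_congr rfl fun m _ => ?_
        rw [Finset.sum_fiberwise_of_maps_to hmaps]
    _ ≤ ∑ m ∈ SF M, L * ∑ i ∈ Finset.range L, ‖∑ n ∈ (SF N).filter (fun n => idx (Nm n) = i), c n * chiC χ n m‖ ^ 2 := by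
        refine Finset.sum_le_sum fun m _ => ?_
        have := sq_norm_sum_le_card (Finset.range L) (fun i => ∑ n ∈ (SF N).filter (fun n => idx (Nm n) = i), c n * chiC χ n m)
        rwa [Finset.card_range] at this
    _ = L * ∑ i ∈ Finset.range L, ∑ m ∈ SF M, ‖∑ n ∈ (SF N).filter (fun n => idx (Nm n) = i), c n * chiC χ n m‖ ^ 2 := by
        rw [← Finset.mul_sum, Finset.sum_comm]
    _ ≤ L * ∑ i ∈ Finset.range L, C1 * N ^ (ε / 2) * (M + G) * ∑ n ∈ (SF N).filter (fun n => idx (Nm n) = i), ‖c n‖ ^ 2 := by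
        gcongr with i hi; exact hsh i hi
    _ = L * (C1 * N ^ (ε / 2) * (M + G) * ∑ n ∈ SF N, ‖c n‖ ^ 2) := by
        rw [← Finset.mul_sum, Finset.sum_fiberwise_of_maps_to hmaps]
    _ ≤ ((1 + 1 / (ε / 2 * Real.log 2)) * N ^ (ε / 2)) * (C1 * N ^ (ε / 2) * (M + G) * ∑ n ∈ SF N, ‖c n‖ ^ 2) := by
        gcongr
    _ = _ := by
        have : N ^ ε = N ^ (ε / 2) * N ^ (ε / 2) := by rw [← Real.rpow_add hN0]; congr 1; ring
        rw [this]; ring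

/-- inductive statement -/
def PT (θ : ℝ) : Prop := ∀ ε : ℝ, 0 < ε → ∃ C : ℝ, 0 < C ∧ ∀ χ, IsCubicSymbol χ → ∀ μ, IsMoebius μ →
  ∀ M N : ℝ, 1 ≤ M → 1 ≤ N → N ≤ M ^ θ → LSB χ M N (C * M ^ ε * (M + (M * N) ^ (2 / 3 : ℝ)))

lemma PT_base : PT (1 / 2) := by
  intro ε hε
  obtain ⟨C1, hC1, h1⟩ := LS_dyadic (ε := min ε 1) (A := 1) (by positivity) (min_le_right _ _) (by norm_num)
  refine ⟨C1 * 626, by positivity, ?_⟩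
  intro χ hχ μ hμ M N hM hN hNM
  have hM0 : 0 < M := by linarith
  have hN0 : 0 < N := by linarith
  have hN2 : N ^ 2 ≤ M := by
    rw [← Real.sqrt_eq_rpow] at hNM
    exact (Real.le_sqrt hN0.le hM0.le).1 hNM
  have hNM' : N ≤ M := by nlinarith
  have h := h1 χ hχ μ hμ N M (625 * N ^ 2) hN hM (by positivity) ?_
  · refine h.mono le_rfl le_rfl ?_
    have e1 : N ^ (min ε 1) ≤ M ^ ε := by
      calc N ^ (min ε 1) ≤ N ^ ε := Real.rpow_le_rpow_of_exponent_le hN (min_le_left _ _)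
        _ ≤ M ^ ε := Real.rpow_le_rpow hN0.le hNM' hε.le
    calc C1 * N ^ (min ε 1) * (M + 625 * N ^ 2) ≤ C1 * M ^ ε * (626 * (M + (M * N) ^ (2 / 3 : ℝ))) := by
          gcongr
          have : 0 ≤ (M * N) ^ (2 / 3 : ℝ) := by positivity
          linarith
      _ = _ := by ring
  · intro Q δ K hQ hδ hδQ hK
    refine (EB_trivial hχ (by linarith) (by linarith)).mono le_rfl le_rfl ?_
    have hQ0 : 0 < Q := by linarith
    have hδ0 : 0 < δ := by linarith
    have hQN : Q ≤ N := by nlinarith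
    rw [Real.rpow_one]
    calc 625 * (K * Q) = 625 * Q ^ 2 * (Q * δ / M) * (K * (M / (δ * Q ^ 2))) := by field_simp
      _ ≤ 625 * N ^ 2 * (Q * δ / M) * (1 + K * (M / (δ * Q ^ 2))) := by
          gcongr; linarith

end P5e

section P5f
open scoped Classical
variable {χ : Eis → Eis → Eis}

lemma E_bound {θ : ℝ} (hθ : 1 / 2 ≤ θ) (hθ1 : θ ≤ 1) (hP : PT θ) {ε : ℝ} (hε : 0 < ε) : ∃ C : ℝ, 0 < C ∧ ∀ χ, IsCubicSymbol χ → ∀ μ, IsMoebius μ →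
    ∀ Q K : ℝ, 1 ≤ Q → 1 ≤ K → EB χ K Q (C * (Q ^ ε * K ^ (3 * ε)) * (K ^ (1 / 3 : ℝ) * Q + (Q * K) ^ (2 / 3 : ℝ) + K ^ (1 / 3 + 1 / θ))) := by
  obtain ⟨C1, hC1, h1⟩ := hP ε hε
  obtain ⟨C2, hC2, h2⟩ := E_step ε hε
  have hθ0 : 0 < θ := by linarith
  refine ⟨2 * (C2 * C1), by positivity, ?_⟩
  intro χ hχ μ hμ Q K hQ hK
  have hQ0 : 0 < Q := by linarith
  have hK0 : 0 < K := by linarith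
  have main : ∀ Q : ℝ, 1 ≤ Q → K ≤ Q ^ θ → EB χ K Q (C2 * (C1 * Q ^ ε) * K ^ ε * (K ^ (1 / 3 : ℝ) * Q + (Q * K) ^ (2 / 3 : ℝ))) := by
    intro Q hQ hKQ
    refine h2 χ hχ (C1 * Q ^ ε) K Q (by positivity) hQ hK ?_
    intro A hA hAK
    by_cases hA1 : 1 ≤ A
    · exact (h1 χ hχ μ hμ Q A hQ hA1 (hAK.trans hKQ)).symm hχ (by positivity)
    · exact LSB.of_lt_one (by positivity) (not_le.1 hA1)
  have hK1 : 1 ≤ K ^ (2 * ε) := Real.one_le_rpow hK (by positivity)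
  have hKe : K ^ (3 * ε) = K ^ ε * K ^ (2 * ε) := by rw [← Real.rpow_add hK0]; congr 1; ring
  have hQ1 : 1 ≤ Q ^ ε := Real.one_le_rpow hQ hε.le
  by_cases hc : K ≤ Q ^ θ
  · refine (main Q hQ hc).mono le_rfl le_rfl ?_
    rw [hKe]
    calc C2 * (C1 * Q ^ ε) * K ^ ε * (K ^ (1 / 3 : ℝ) * Q + (Q * K) ^ (2 / 3 : ℝ)) = (C2 * C1) * (Q ^ ε * (K ^ ε * 1)) * (K ^ (1 / 3 : ℝ) * Q + (Q * K) ^ (2 / 3 : ℝ) + 0) := by ring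
      _ ≤ (2 * (C2 * C1)) * (Q ^ ε * (K ^ ε * K ^ (2 * ε))) * (K ^ (1 / 3 : ℝ) * Q + (Q * K) ^ (2 / 3 : ℝ) + K ^ (1 / 3 + 1 / θ)) := by
          have hD : C2 * C1 ≤ 2 * (C2 * C1) := by linarith [mul_pos hC2 hC1]
          have hp : 0 ≤ K ^ (1 / 3 + 1 / θ) := by positivity
          exact mul_le_mul (mul_le_mul hD (by gcongr) (by positivity) (by positivity)) (by linarith) (by positivity) (by positivity)
  · set Q1 := K ^ (1 / θ) with hQ1'
    have hQQ1 : Q ≤ Q1 := by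
      calc Q = (Q ^ θ) ^ (1 / θ) := by rw [← Real.rpow_mul hQ0.le, mul_one_div_cancel hθ0.ne', Real.rpow_one]
        _ ≤ Q1 := Real.rpow_le_rpow (by positivity) (not_le.1 hc).le (by positivity)
    have hKQ1 : K ≤ Q1 ^ θ := by
      rw [hQ1', ← Real.rpow_mul hK0.le, one_div_mul_cancel hθ0.ne', Real.rpow_one]
    refine (main Q1 (hQ.trans hQQ1) hKQ1).mono le_rfl hQQ1 ?_
    have e1 : K ^ (1 / 3 : ℝ) * Q1 = K ^ (1 / 3 + 1 / θ) := by rw [hQ1', ← Real.rpow_add hK0]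
    have h1θ : 1 ≤ 1 / θ := by rw [one_le_div hθ0]; exact hθ1
    have h1θ2 : 1 / θ ≤ 2 := by rw [div_le_iff₀ hθ0]; linarith
    have e2 : (Q1 * K) ^ (2 / 3 : ℝ) ≤ K ^ (1 / 3 + 1 / θ) := by
      have : Q1 * K = K ^ (1 / θ + 1) := by rw [Real.rpow_add hK0, Real.rpow_one]
      rw [this, ← Real.rpow_mul hK0.le]
      apply Real.rpow_le_rpow_of_exponent_le hK
      linarith
    have e3 : Q1 ^ ε ≤ K ^ (2 * ε) := by
      rw [hQ1', ← Real.rpow_mul hK0.le]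
      apply Real.rpow_le_rpow_of_exponent_le hK
      nlinarith
    rw [e1, hKe]
    calc C2 * (C1 * Q1 ^ ε) * K ^ ε * (K ^ (1 / 3 + 1 / θ) + (Q1 * K) ^ (2 / 3 : ℝ))
        ≤ C2 * (C1 * K ^ (2 * ε)) * K ^ ε * (K ^ (1 / 3 + 1 / θ) + K ^ (1 / 3 + 1 / θ)) := by gcongr
      _ = 2 * (C2 * C1) * (1 * (K ^ ε * K ^ (2 * ε))) * (0 + 0 + K ^ (1 / 3 + 1 / θ)) := by ring
      _ ≤ 2 * (C2 * C1) * (Q ^ ε * (K ^ ε * K ^ (2 * ε))) * (K ^ (1 / 3 : ℝ) * Q + (Q * K) ^ (2 / 3 : ℝ) + K ^ (1 / 3 + 1 / θ)) := by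
          gcongr <;> positivity

/-- purely real inequality used in the inductive step -/
lemma step_ineq {θ ε Q δ K M N : ℝ} (hθ : 1 / 2 ≤ θ) (hθ1 : θ ≤ 1) (hε : 0 < ε) (hε1 : ε ≤ 1 / 9) (hQ : 1 ≤ Q) (hδ : 1 ≤ δ)
    (hδQ : δ * Q ≤ N) (hK : 1 ≤ K) (hNM : N ≤ M) (hM : N ^ (2 - θ) ≤ M) :
    Q ^ ε * K ^ (3 * ε) * (K ^ (1 / 3 : ℝ) * Q + (Q * K) ^ (2 / 3 : ℝ) + K ^ (1 / 3 + 1 / θ)) ≤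
      3 * M ^ (4 * ε) * (M * N) ^ (2 / 3 : ℝ) * (Q * δ / M) * (1 + K * (M / (δ * Q ^ 2))) ^ (3 : ℝ) := by
  have hθ0 : 0 < θ := by linarith
  have hQ0 : 0 < Q := by linarith
  have hδ0 : 0 < δ := by linarith
  have hK0 : 0 < K := by linarith
  have hQN : Q ≤ N := by nlinarith
  have hN0 : 0 < N := by linarith
  have hM0 : 0 < M := by linarith
  have hM1 : 1 ≤ M := by linarith
  set B := δ * Q ^ 2 / M with hB
  have hB0 : 0 < B := by positivity
  set u := 1 + K * (M / (δ * Q ^ 2)) with hu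
  have hKM : 0 < K * (M / (δ * Q ^ 2)) := by positivity
  have hu1 : 1 ≤ u := by linarith
  have hu0 : 0 < u := by linarith
  have hKu : K ≤ u * B := by
    have : K = K * (M / (δ * Q ^ 2)) * B := by rw [hB]; field_simp
    calc K = K * (M / (δ * Q ^ 2)) * B := this
      _ ≤ u * B := by gcongr; linarith
  have hBθ : B ≤ Q ^ θ := by
    rw [hB, div_le_iff₀ hM0]
    have h1 : (δ * Q) ^ (2 - θ) ≤ M := (Real.rpow_le_rpow (by positivity) hδQ (by linarith)).trans hM
    calc δ * Q ^ 2 = δ ^ (1 : ℝ) * Q ^ (2 : ℝ) := by rw [Real.rpow_one]; norm_num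
      _ ≤ δ ^ (2 - θ) * Q ^ (2 : ℝ) := by
          gcongr
          linarith
      _ = Q ^ θ * (δ * Q) ^ (2 - θ) := by
          rw [Real.mul_rpow hδ0.le hQ0.le]
          have : Q ^ (2 : ℝ) = Q ^ θ * Q ^ (2 - θ) := by rw [← Real.rpow_add hQ0]; congr 1; ring
          rw [this]; ring
      _ ≤ Q ^ θ * M := by gcongr
  have hBQ : B ≤ Q := hBθ.trans (by
    calc Q ^ θ ≤ Q ^ (1 : ℝ) := Real.rpow_le_rpow_of_exponent_le hQ hθ1
      _ = Q := Real.rpow_one Q)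
  have hBQ' : B ^ (1 / θ) ≤ Q := by
    calc B ^ (1 / θ) ≤ (Q ^ θ) ^ (1 / θ) := Real.rpow_le_rpow hB0.le hBθ (by positivity)
      _ = Q := by rw [← Real.rpow_mul hQ0.le, mul_one_div_cancel hθ0.ne', Real.rpow_one]
  set R := (M * N) ^ (2 / 3 : ℝ) * δ / M with hR
  have hR0 : 0 < R := by positivity
  have hB3 : B ^ (1 / 3 : ℝ) ≤ R := by
    have e : B ≤ (δ * N) ^ 2 * δ / M := by
      rw [hB]; gcongr ?_ / M
      have : Q ^ 2 ≤ N ^ 2 := by gcongr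
      nlinarith [mul_pos hδ0 hδ0, mul_pos (mul_pos hδ0 hδ0) hδ0, sq_nonneg N, mul_le_mul hδ hδ (by norm_num) hδ0.le, mul_nonneg (mul_nonneg hδ0.le (sq_nonneg N)) (by nlinarith : 0 ≤ δ * δ - 1)]
    have e2 : R ^ (3 : ℝ) = (δ * N) ^ 2 * δ / M := by
      rw [hR, Real.div_rpow (by positivity) hM0.le, Real.mul_rpow (by positivity) hδ0.le, ← Real.rpow_mul (by positivity)]
      rw [show (2 / 3 : ℝ) * 3 = (2 : ℕ) by norm_num, show (3 : ℝ) = (3 : ℕ) by norm_num]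
      simp only [Real.rpow_natCast]
      field_simp
    calc B ^ (1 / 3 : ℝ) ≤ (R ^ (3 : ℝ)) ^ (1 / 3 : ℝ) := Real.rpow_le_rpow hB0.le (by rw [e2]; exact e) (by norm_num)
      _ = R := by rw [← Real.rpow_mul hR0.le]; norm_num
  have h1θ : 1 / θ ≤ 2 := by rw [div_le_iff₀ hθ0]; linarith
  have hup : ∀ e : ℝ, 0 ≤ e → e ≤ 7 / 3 → K ^ e ≤ u ^ (7 / 3 : ℝ) * B ^ e := by
    intro e he he'
    calc K ^ e ≤ (u * B) ^ e := Real.rpow_le_rpow hK0.le hKu he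
      _ = u ^ e * B ^ e := Real.mul_rpow hu0.le hB0.le
      _ ≤ u ^ (7 / 3 : ℝ) * B ^ e := by gcongr
  set U := u ^ (7 / 3 : ℝ) with hU
  have hU0 : 0 < U := by positivity
  have t1 : K ^ (1 / 3 : ℝ) * Q ≤ U * (R * Q) := by
    calc K ^ (1 / 3 : ℝ) * Q ≤ U * B ^ (1 / 3 : ℝ) * Q := by gcongr; exact hup _ (by norm_num) (by norm_num)
      _ ≤ U * R * Q := by gcongr
      _ = _ := by ring
  have t2 : (Q * K) ^ (2 / 3 : ℝ) ≤ U * (R * Q) := by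
    rw [Real.mul_rpow hQ0.le hK0.le]
    calc Q ^ (2 / 3 : ℝ) * K ^ (2 / 3 : ℝ) ≤ Q ^ (2 / 3 : ℝ) * (U * B ^ (2 / 3 : ℝ)) := by gcongr; exact hup _ (by norm_num) (by norm_num)
      _ = U * (B ^ (1 / 3 : ℝ) * (Q ^ (2 / 3 : ℝ) * B ^ (1 / 3 : ℝ))) := by
          have : B ^ (2 / 3 : ℝ) = B ^ (1 / 3 : ℝ) * B ^ (1 / 3 : ℝ) := by rw [← Real.rpow_add hB0]; norm_num
          rw [this]; ring
      _ ≤ U * (R * (Q ^ (2 / 3 : ℝ) * Q ^ (1 / 3 : ℝ))) := by gcongr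
      _ = _ := by rw [← Real.rpow_add hQ0]; norm_num
  have t3 : K ^ (1 / 3 + 1 / θ) ≤ U * (R * Q) := by
    calc K ^ (1 / 3 + 1 / θ) ≤ U * B ^ (1 / 3 + 1 / θ) := hup _ (by positivity) (by linarith)
      _ = U * (B ^ (1 / 3 : ℝ) * B ^ (1 / θ)) := by rw [Real.rpow_add hB0]
      _ ≤ _ := by gcongr
  have t4 : K ^ (3 * ε) ≤ u ^ (2 / 3 : ℝ) * M ^ (3 * ε) := by
    calc K ^ (3 * ε) ≤ (u * M) ^ (3 * ε) := by
          apply Real.rpow_le_rpow hK0.le _ (by positivity)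
          refine hKu.trans ?_
          gcongr; linarith
      _ = u ^ (3 * ε) * M ^ (3 * ε) := Real.mul_rpow hu0.le hM0.le
      _ ≤ _ := by
          gcongr
          linarith
  have t5 : Q ^ ε ≤ M ^ ε := Real.rpow_le_rpow hQ0.le (by linarith) hε.le
  have e4 : M ^ (4 * ε) = M ^ ε * M ^ (3 * ε) := by rw [← Real.rpow_add hM0]; congr 1; ring
  have e5 : u ^ (3 : ℝ) = u ^ (2 / 3 : ℝ) * U := by rw [hU, ← Real.rpow_add hu0]; norm_num
  calc _ ≤ M ^ ε * (u ^ (2 / 3 : ℝ) * M ^ (3 * ε)) * (U * (R * Q) + U * (R * Q) + U * (R * Q)) := by gcongr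
    _ = _ := by rw [e4, e5, hR]; ring

lemma PT_step {θ : ℝ} (hθ : 1 / 2 ≤ θ) (hθ1 : θ ≤ 1) (hP : PT θ) : PT (1 / (2 - θ)) := by
  intro ε hε
  set η := min (ε / 5) (1 / 9) with hη
  have hη0 : 0 < η := by positivity
  have hη1 : η ≤ 1 / 9 := min_le_right _ _
  have hη2 : 5 * η ≤ ε := by have : η ≤ ε / 5 := min_le_left _ _; linarith
  obtain ⟨C1, hC1, h1⟩ := E_bound hθ hθ1 hP hη0
  obtain ⟨C2, hC2, h2⟩ := LS_dyadic (ε := η) (A := 3) hη0 (by linarith) (by norm_num)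
  refine ⟨C2 * (1 + 3 * C1), by positivity, ?_⟩
  intro χ hχ μ hμ M N hM hN hNM
  have hM0 : 0 < M := by linarith
  have hN0 : 0 < N := by linarith
  have h2θ : 0 < 2 - θ := by linarith
  have hN2 : N ^ (2 - θ) ≤ M := by
    calc N ^ (2 - θ) ≤ (M ^ (1 / (2 - θ))) ^ (2 - θ) := Real.rpow_le_rpow hN0.le hNM h2θ.le
      _ = M := by rw [← Real.rpow_mul hM0.le, one_div_mul_cancel h2θ.ne', Real.rpow_one]
  have hNM' : N ≤ M := by
    calc N = N ^ (1 : ℝ) := (Real.rpow_one N).symm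
      _ ≤ N ^ (2 - θ) := Real.rpow_le_rpow_of_exponent_le hN (by linarith)
      _ ≤ M := hN2
  have h := h2 χ hχ μ hμ N M (3 * C1 * M ^ (4 * η) * (M * N) ^ (2 / 3 : ℝ)) hN hM (by positivity) ?_
  · refine h.mono le_rfl le_rfl ?_
    have hm1 : 1 ≤ M ^ (4 * η) := Real.one_le_rpow hM (by positivity)
    have e1 : N ^ η ≤ M ^ η := Real.rpow_le_rpow hN0.le hNM' hη0.le
    have e2 : M ^ η * M ^ (4 * η) ≤ M ^ ε := by
      rw [← Real.rpow_add hM0]; exact Real.rpow_le_rpow_of_exponent_le hM (by linarith)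
    have hp : 0 ≤ (M * N) ^ (2 / 3 : ℝ) := by positivity
    calc C2 * N ^ η * (M + 3 * C1 * M ^ (4 * η) * (M * N) ^ (2 / 3 : ℝ))
        ≤ C2 * M ^ η * (M ^ (4 * η) * ((1 + 3 * C1) * (M + (M * N) ^ (2 / 3 : ℝ)))) := by
          gcongr
          have a1 : M ≤ M ^ (4 * η) * M := le_mul_of_one_le_left hM0.le hm1
          have a2 : 0 ≤ M ^ (4 * η) * (3 * C1 * M) := by positivity
          have a3 : 0 ≤ M ^ (4 * η) * (M * N) ^ (2 / 3 : ℝ) := by positivity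
          nlinarith
      _ = C2 * (1 + 3 * C1) * (M ^ η * M ^ (4 * η)) * (M + (M * N) ^ (2 / 3 : ℝ)) := by ring
      _ ≤ _ := by gcongr
  · intro Q δ K hQ hδ hδQ hK
    refine (h1 χ hχ μ hμ Q K hQ hK).mono le_rfl le_rfl ?_
    have := step_ineq hθ hθ1 hη0 hη1 hQ hδ hδQ hK hNM' hN2
    calc _ = C1 * (Q ^ η * K ^ (3 * η) * (K ^ (1 / 3 : ℝ) * Q + (Q * K) ^ (2 / 3 : ℝ) + K ^ (1 / 3 + 1 / θ))) := by ring
      _ ≤ C1 * _ := mul_le_mul_of_nonneg_left this hC1.le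
      _ = _ := by ring

lemma PT_nat (n : ℕ) : PT ((n + 1 : ℝ) / (n + 2)) := by
  induction n with
  | zero => simpa using PT_base
  | succ k ih =>
    have h := PT_step (by rw [div_le_div_iff₀ (by norm_num) (by positivity)]; linarith [(Nat.cast_nonneg k : (0:ℝ) ≤ k)])
      (by rw [div_le_one (by positivity)]; linarith) ih
    have e : 1 / (2 - ((k : ℝ) + 1) / (k + 2)) = (((k + 1 : ℕ) : ℝ) + 1) / (((k + 1 : ℕ) : ℝ) + 2) := by
      have h3 : (2 : ℝ) - ((k : ℝ) + 1) / (k + 2) = (k + 3) / (k + 2) := by field_simp; ring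
      rw [h3, one_div_div]; push_cast; congr 1 <;> ring
    rwa [e] at h

/-- the large sieve parameter -/
def Lam (M N : ℝ) : ℝ := M + N + (M * N) ^ (2 / 3 : ℝ)

lemma large_sieve {ε : ℝ} (hε : 0 < ε) : ∃ C : ℝ, 0 < C ∧ ∀ χ, IsCubicSymbol χ → ∀ μ, IsMoebius μ →
    ∀ M N : ℝ, 1 ≤ M → 1 ≤ N → LSB χ M N (C * (M * N) ^ ε * Lam M N) := by
  obtain ⟨n, hn⟩ := exists_nat_gt (2 / ε)
  have hn0 : 0 < (n : ℝ) := lt_trans (by positivity) hn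
  obtain ⟨C, hC, h⟩ := PT_nat n (ε / 4) (by positivity)
  refine ⟨C, hC, ?_⟩
  intro χ hχ μ hμ
  have key : ∀ M N : ℝ, 1 ≤ M → 1 ≤ N → N ≤ M → LSB χ M N (C * (M * N) ^ ε * Lam M N) := by
    intro M N hM hN hNM
    have hM0 : 0 < M := by linarith
    have hN0 : 0 < N := by linarith
    set κ : ℝ := 1 / (n + 1) with hκ
    have hκ0 : 0 < κ := by positivity
    have hκε : κ ≤ ε / 2 := by
      rw [hκ, div_le_div_iff₀ (by positivity) (by norm_num)]
      rw [div_lt_iff₀ hε] at hn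
      nlinarith
    have hκ1 : κ ≤ 1 := by rw [hκ, div_le_one (by positivity)]; linarith
    set M1 := M ^ (1 + κ) with hM1
    have hMM1 : M ≤ M1 := by
      calc M = M ^ (1 : ℝ) := (Real.rpow_one M).symm
        _ ≤ M1 := Real.rpow_le_rpow_of_exponent_le hM (by linarith)
    have hM1' : M1 = M * M ^ κ := by rw [hM1, Real.rpow_add hM0, Real.rpow_one]
    have hθ : N ≤ M1 ^ ((n + 1 : ℝ) / (n + 2)) := by
      rw [hM1, ← Real.rpow_mul hM0.le]
      have : (1 + κ) * ((n + 1 : ℝ) / (n + 2)) = 1 := by rw [hκ]; field_simp; ring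
      rw [this, Real.rpow_one]; exact hNM
    refine (h χ hχ μ hμ M1 N (hM.trans hMM1) hN hθ).mono hMM1 le_rfl ?_
    have hmk : 1 ≤ M ^ κ := Real.one_le_rpow hM hκ0.le
    have e1 : (M1 * N) ^ (2 / 3 : ℝ) ≤ M ^ κ * (M * N) ^ (2 / 3 : ℝ) := by
      rw [hM1', show M * M ^ κ * N = M ^ κ * (M * N) by ring, Real.mul_rpow (by positivity) (by positivity)]
      gcongr
      calc (M ^ κ) ^ (2 / 3 : ℝ) ≤ (M ^ κ) ^ (1 : ℝ) := Real.rpow_le_rpow_of_exponent_le hmk (by norm_num)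
        _ = M ^ κ := Real.rpow_one _
    have e2 : M1 ^ (ε / 4) * M ^ κ ≤ (M * N) ^ ε := by
      rw [hM1, ← Real.rpow_mul hM0.le, ← Real.rpow_add hM0]
      calc M ^ ((1 + κ) * (ε / 4) + κ) ≤ M ^ ε := Real.rpow_le_rpow_of_exponent_le hM (by nlinarith)
        _ ≤ (M * N) ^ ε := Real.rpow_le_rpow hM0.le (by nlinarith) hε.le
    calc C * M1 ^ (ε / 4) * (M1 + (M1 * N) ^ (2 / 3 : ℝ)) ≤ C * M1 ^ (ε / 4) * (M ^ κ * Lam M N) := by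
          gcongr
          rw [Lam]
          have : 0 ≤ M ^ κ * N := by positivity
          rw [hM1'] at e1 ⊢
          nlinarith
      _ = C * (M1 ^ (ε / 4) * M ^ κ) * Lam M N := by ring
      _ ≤ _ := by
          have : 0 ≤ Lam M N := by unfold Lam; positivity
          gcongr
  intro M N hM hN
  rcases le_total N M with h1 | h1
  · exact key M N hM hN h1
  · have := (key N M hN hM h1).symm hχ (by unfold Lam; positivity)
    rw [Lam, mul_comm N M, add_comm N M] at this
    exact this

end P5f

section P6a
open scoped Classical
variable {χ : Eis → Eis → Eis}


open MeasureTheory in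
lemma Phi_eq : ∃ c0 : ℂ, ∀ y : ℝ, 0 < y → Φ 1 y = c0 * ((∫ v in Set.Ioi y, Real.exp (-(2 * Real.pi * v)) * v ^ (-(1 / 2) : ℝ) : ℝ) : ℂ) := by
  refine ⟨((2 * Real.pi : ℝ) : ℂ) ^ (1 / 2 : ℂ) / Complex.Gamma (1 / 2), ?_⟩
  intro y hy
  have hpi : (0 : ℝ) < 2 * Real.pi := by positivity
  set a : ℝ → ℂ := fun t => ((2 * Real.pi : ℝ) : ℂ) ^ (-((2 : ℂ) + t * Complex.I)) * (Complex.Gamma (((5 / 2 : ℝ) : ℂ) + t * Complex.I) / Complex.Gamma (1 / 2)) with ha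
  have hG := Gamma_vertical_integrable (σ := 5 / 2) (by norm_num)
  have hGc := Gamma_vertical_cont (σ := 5 / 2) (by norm_num)
  have hac : Continuous a := by
    have : Continuous fun t : ℝ => ((2 * Real.pi : ℝ) : ℂ) ^ (-((2 : ℂ) + t * Complex.I)) := by
      refine Continuous.const_cpow (by fun_prop) (Or.inl ?_)
      exact_mod_cast hpi.ne'
    exact this.mul (hGc.div_const _)
  have hai : Integrable a := by
    refine Integrable.mono' ((hG.norm).const_mul (‖(((2 * Real.pi : ℝ) : ℂ) ^ (-(2 : ℂ)))‖ / ‖Complex.Gamma (1 / 2)‖)) hac.aestronglyMeasurable ?_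
    filter_upwards with t
    simp only [ha, norm_mul, norm_div]
    rw [Complex.norm_cpow_eq_rpow_re_of_pos hpi, Complex.norm_cpow_eq_rpow_re_of_pos hpi]
    simp
    apply le_of_eq; ring
  have e1 : Φ 1 y = (1 / (2 * Real.pi)) * ∫ t : ℝ, ∫ v in Set.Ioi y, a t * (v : ℂ) ^ (-((2 : ℂ) + t * Complex.I) - 1) := by
    unfold Φ
    congr 1
    apply integral_congr_ae
    filter_upwards with t
    rw [integral_const_mul, integral_Ioi_cpow_of_lt (by simp; norm_num) hy]
    have hw : ((2 : ℂ) + t * Complex.I) ≠ 0 := by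
      intro h; have := congrArg Complex.re h; simp at this
    have e5 : (1 / 2 + ((2 : ℂ) + t * Complex.I)) = (((5 / 2 : ℝ) : ℂ) + t * Complex.I) := by push_cast; ring
    simp only [ha, e5, pow_one]
    have e6 : (-((2 : ℂ) + t * Complex.I) - 1 + 1) = -((2 : ℂ) + t * Complex.I) := by ring
    rw [e6, neg_div_neg_eq]
    push_cast
    simp only [one_mul]
    ring
  have hIntg : Integrable (Function.uncurry fun (t : ℝ) (v : ℝ) => a t * (v : ℂ) ^ (-((2 : ℂ) + t * Complex.I) - 1)) (volume.prod (volume.restrict (Set.Ioi y))) := by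
    have hv : Integrable (fun v : ℝ => v ^ (-3 : ℝ)) (volume.restrict (Set.Ioi y)) := integrableOn_Ioi_rpow_of_lt (by norm_num) hy
    refine Integrable.mono' (hai.norm.mul_prod hv) ?_ ?_
    · apply Measurable.aestronglyMeasurable
      have := hac.measurable
      simp only [Function.uncurry_def]
      fun_prop
    · have := (Measure.quasiMeasurePreserving_snd (μ := (volume : Measure ℝ)) (ν := volume.restrict (Set.Ioi y))).ae (ae_restrict_mem measurableSet_Ioi)
      filter_upwards [this] with p hp
      have hp0 : 0 < p.2 := hy.trans hp
      simp only [Function.uncurry_def, norm_mul]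
      rw [Complex.norm_cpow_eq_rpow_re_of_pos hp0]
      simp
      norm_num
  rw [e1, integral_integral_swap hIntg, ← integral_complex_ofReal, ← integral_const_mul, ← integral_const_mul]
  apply setIntegral_congr_fun measurableSet_Ioi
  intro v hv
  have hv0 : 0 < v := hy.trans hv
  have hx : 0 < 2 * Real.pi * v := by positivity
  simp only []
  rw [Complex.ofReal_mul (Real.exp (-(2 * Real.pi * v))), exp_mellin (σ := 5 / 2) (by norm_num) hx]
  have key : ∀ t : ℝ, a t * (v : ℂ) ^ (-((2 : ℂ) + t * Complex.I) - 1) = (((2 * Real.pi : ℝ) : ℂ) ^ (1 / 2 : ℂ) / Complex.Gamma (1 / 2) * ((v ^ (-(1 / 2) : ℝ) : ℝ) : ℂ)) * (((2 * Real.pi * v : ℝ) : ℂ) ^ (-(((5 / 2 : ℝ) : ℂ) + t * Complex.I)) * Complex.Gamma (((5 / 2 : ℝ) : ℂ) + t * Complex.I)) := by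
    intro t
    have h2 : ((2 * Real.pi : ℝ) : ℂ) ≠ 0 := by exact_mod_cast hpi.ne'
    have h3 : (v : ℂ) ≠ 0 := by exact_mod_cast hv0.ne'
    rw [Complex.ofReal_mul (2 * Real.pi) v, Complex.mul_cpow_ofReal_nonneg hpi.le hv0.le, Complex.ofReal_cpow hv0.le]
    have e7 : ((2 * Real.pi : ℝ) : ℂ) ^ (-((2 : ℂ) + t * Complex.I)) = ((2 * Real.pi : ℝ) : ℂ) ^ (1 / 2 : ℂ) * ((2 * Real.pi : ℝ) : ℂ) ^ (-(((5 / 2 : ℝ) : ℂ) + t * Complex.I)) := by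
      rw [← Complex.cpow_add _ _ h2]; congr 1; push_cast; ring
    have e8 : (v : ℂ) ^ (-((2 : ℂ) + t * Complex.I) - 1) = (v : ℂ) ^ (((-(1 / 2) : ℝ)) : ℂ) * (v : ℂ) ^ (-(((5 / 2 : ℝ) : ℂ) + t * Complex.I)) := by
      rw [← Complex.cpow_add _ _ h3]; congr 1; push_cast; ring
    simp only [ha]
    rw [e7, e8]
    ring
  simp_rw [key]
  rw [integral_const_mul]
  push_cast
  ring

end P6a

section P6b
open scoped Classical
variable {χ : Eis → Eis → Eis}


lemma ωE_isUnit : IsUnit ωE := by rw [isUnit_iff_Nm]; exact Nm_ω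

lemma chi_omega (hχ : IsCubicSymbol χ) {n : Eis} (hn : Pri n) : χ n ωE = ωE ^ ((NmN n - 1) / 3) := by
  refine Pri.induction (P := fun n => χ n ωE = ωE ^ ((NmN n - 1) / 3)) ?_ ?_ n hn
  · have : NmN 1 = 1 := by
      have : ((NmN 1 : ℕ) : ℝ) = ((1 : ℕ) : ℝ) := by rw [NmN_cast, Nm_one]; norm_num
      exact_mod_cast this
    simp [this, hχ.one_bot]
  · intro p x hp hpp hx ih
    rw [hχ.mul_bot p x _ hpp hx, ih]
    have hc : ¬ p ∣ ωE := fun h => hp.not_isUnit (isUnit_of_dvd_unit h ωE_isUnit)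
    have h1 : χ p ωE = ωE ^ ((NmN p - 1) / 3) := by
      have hcv : ∀ k : ℕ, CV (ωE ^ k) := by
        intro k
        induction k with
        | zero => exact Or.inl (pow_zero _)
        | succ k ih => rw [pow_succ]; exact ih.mul (Or.inr (Or.inl rfl))
      exact (CV.eq_of_dvd hp hpp (hcv _) (chi_prime_ne hχ hp hpp hc) (hχ.prime_congr p ωE hp hpp)).symm
    rw [h1, NmN_mul]
    obtain ⟨a, ha⟩ : ∃ a, NmN p = 3 * a + 1 := ⟨NmN p / 3, by have := NmN_mod_three hpp; omega⟩
    obtain ⟨b, hb⟩ : ∃ a, NmN x = 3 * a + 1 := ⟨NmN x / 3, by have := NmN_mod_three hx; omega⟩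
    rw [ha, hb]
    have e1 : ((3 * a + 1) * (3 * b + 1) - 1) / 3 = 3 * (a * b) + (a + b) := by
      have : (3 * a + 1) * (3 * b + 1) - 1 = 3 * (3 * (a * b) + (a + b)) := by
        rw [Nat.sub_eq_iff_eq_add (by nlinarith)]; ring
      rw [this]; simp
    have e2 : (3 * a + 1 - 1) / 3 = a := by omega
    have e3 : (3 * b + 1 - 1) / 3 = b := by omega
    rw [e1, e2, e3, pow_add, pow_mul, ωE_cube, one_pow, one_mul, pow_add]

lemma chi_omega_nine (hχ : IsCubicSymbol χ) {q : Eis} (hq : (9 : Eis) ∣ q - 1) : χ q ωE = 1 := by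
  have hp : Pri q := dvd_trans ⟨3, by norm_num⟩ hq
  rw [chi_omega hχ hp]
  obtain ⟨z, hz⟩ := hq
  obtain ⟨a, b, rfl⟩ := exists_mkE z
  have hq : q = mkE (1 + 9 * a) (9 * b) := by
    have : q = 1 + 9 * mkE a b := by rw [← hz]; ring
    rw [this]; simp [mkE]; ring
  have h2 : ((NmN q : ℤ) : ℝ) = ((1 + 9 * (2 * a + 9 * a ^ 2 - b - 9 * a * b + 9 * b ^ 2) : ℤ) : ℝ) := by
    rw [Int.cast_natCast, NmN_cast, hq, Nm_mkE]; push_cast; ring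
  have h3 : (NmN q : ℤ) = 1 + 9 * (2 * a + 9 * a ^ 2 - b - 9 * a * b + 9 * b ^ 2) := by exact_mod_cast h2
  obtain ⟨k, hk⟩ : ∃ k, (NmN q - 1) / 3 = 3 * k := ⟨(NmN q - 1) / 9, by omega⟩
  rw [hk, pow_mul, ωE_cube, one_pow]

lemma chi_unit_nine (hχ : IsCubicSymbol χ) {q u : Eis} (hq : (9 : Eis) ∣ q - 1) (hu : IsUnit u) : χ q u = 1 := by
  have hp : Pri q := dvd_trans ⟨3, by norm_num⟩ hq
  have h1 := chi_omega_nine hχ hq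
  have h2 := chi_neg_one hχ hp
  have h3 : χ q (-ωE) = 1 := by rw [neg_eq_neg_one_mul, chi_mul hχ hp, h1, h2, one_mul]
  have h4 : χ q (ωE ^ 2) = 1 := by rw [chi_pow hχ hp, h1, one_pow]
  rcases unit_cases hu with rfl | rfl | rfl | rfl | rfl | rfl
  · exact chi_one hχ hp
  · exact h2
  · exact h1
  · exact h3
  · exact h4
  · rw [neg_eq_neg_one_mul, chi_mul hχ hp, h4, h2, one_mul]

lemma Rep.ne_zero {n : Eis} (h : Rep n) : n ≠ 0 := by
  obtain ⟨k, c, hc, rfl⟩ := h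
  exact mul_ne_zero (pow_ne_zero _ prime_lam.ne_zero) (Pri.ne_zero hc)

lemma Rep.eq_of_unit {n m u v : Eis} (hn : Rep n) (hm : Rep m) (hu : IsUnit u) (hv : IsUnit v) (h : u * n = v * m) : n = m := by
  obtain ⟨k, c, hc, rfl⟩ := hn
  obtain ⟨l, d, hd, rfl⟩ := hm
  have key : ∀ {u v c d : Eis} {k l : ℕ}, IsUnit u → IsUnit v → Pri c → Pri d → u * (lam ^ k * c) = v * (lam ^ l * d) → l ≤ k := by
    intro u v c d k l hu hv hc hd h
    by_contra hlt
    push Not at hlt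
    have h1 : lam ^ (k + 1) ∣ u * (lam ^ k * c) := by
      rw [h]; exact dvd_mul_of_dvd_right (dvd_mul_of_dvd_left (pow_dvd_pow _ hlt) _) _
    rw [hu.dvd_mul_left, pow_succ] at h1
    exact hc.not_lam_dvd ((mul_dvd_mul_iff_left (pow_ne_zero _ prime_lam.ne_zero)).1 h1)
  have hkl : k = l := le_antisymm (key hv hu hd hc h.symm) (key hu hv hc hd h)
  subst hkl
  have h2 : u * c = v * d := by
    apply mul_left_cancel₀ (pow_ne_zero k prime_lam.ne_zero)
    linear_combination h
  have h3 : Associated c d := by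
    have a1 : Associated (u * c) c := associated_unit_mul_left c u hu
    have a2 : Associated (v * d) d := associated_unit_mul_left d v hv
    exact (a1.symm.trans (h2 ▸ a2))
  rw [Pri.associated_eq hc hd h3]

/-- nonzero elements are uniquely unit times representative -/
lemma rep_bij : Function.Bijective (fun p : Eisˣ × {x : Eis // Rep x} => (⟨p.1 * p.2.1, mul_ne_zero p.1.ne_zero p.2.2.ne_zero⟩ : {x : Eis // x ≠ 0})) := by
  constructor
  · rintro ⟨u, n, hn⟩ ⟨v, m, hm⟩ h
    have h' : (u : Eis) * n = v * m := congrArg Subtype.val h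
    have := hn.eq_of_unit hm u.isUnit v.isUnit h'
    subst this
    have : (u : Eis) = v := mul_right_cancel₀ hn.ne_zero h'
    simp [Units.ext_iff, this]
  · rintro ⟨x, hx⟩
    obtain ⟨u, j, c, hu, hc, h⟩ := exists_factor hx
    refine ⟨⟨hu.unit, lam ^ j * c, j, c, hc, rfl⟩, ?_⟩
    apply Subtype.ext
    simp [h, mul_assoc]

lemma Eis_countable : Countable Eis := Countable.of_equiv _ eqE

lemma rep_Th (hχ : IsCubicSymbol χ) {q : Eis} (hq : (9 : Eis) ∣ q - 1) (hq1 : q ≠ 1) {y : ℝ} (hy : 0 < y) :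
    ‖∑' n : {x : Eis // Rep x}, chiC χ q n.1 * ((Real.exp (-(2 * Real.pi * y * Nm n.1)) : ℝ) : ℂ)‖ ≤ ‖Th (chiC χ q) y‖ := by
  have hp : Pri q := dvd_trans ⟨3, by norm_num⟩ hq
  set G : Eis → ℂ := fun m => chiC χ q m * ((Real.exp (-(2 * Real.pi * y * Nm m)) : ℝ) : ℂ) with hG
  have hs : Summable G := summable_Th (fun m => chiC_norm_le hχ hp m) (by positivity)
  have h0 : G 0 = 0 := by
    have : χ q 0 = 0 := (chi_ne hχ hp).2 (by
      rw [isCoprime_zero_left]; exact fun h => hq1 (pri_unit_eq_one h hp))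
    simp [hG, chiC, this]
  have e1 : Th (chiC χ q) y = ∑' x : {x : Eis // x ≠ 0}, G x := by
    unfold Th
    rw [show (∑' m, chiC χ q m * ((Real.exp (-(2 * Real.pi * y * Nm m)) : ℝ) : ℂ)) = ∑' m, G m from rfl]
    symm
    apply tsum_subtype_eq_of_support_subset (s := {x : Eis | x ≠ 0})
    intro x hx h
    exact hx (by rw [show x = 0 from h]; exact h0)
  have e2 : ∀ p : Eisˣ × {x : Eis // Rep x}, G (p.1 * p.2.1) = G p.2.1 := by
    intro p
    simp only [hG, chiC, chi_mul hχ hp, chi_unit_nine hχ hq p.1.isUnit, one_mul, Nm_mul, isUnit_iff_Nm.1 p.1.isUnit]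
  have hfin : Finite Eisˣ := by
    have : Set.Finite {x : Eis | x ∈ ball 1} := Finset.finite_toSet (ball 1)
    refine Finite.of_injective (β := {x : Eis // x ∈ ball 1}) (fun u => ⟨u, by rw [mem_ball, isUnit_iff_Nm.1 u.isUnit]⟩) ?_
    intro u v h
    exact Units.ext (congrArg Subtype.val h)
  have hft := Fintype.ofFinite Eisˣ
  have hsr : Summable fun n : {x : Eis // Rep x} => G n.1 := hs.comp_injective Subtype.val_injective
  have hsp : Summable fun p : Eisˣ × {x : Eis // Rep x} => G p.2.1 := by
    have := (hs.comp_injective Subtype.val_injective : Summable fun x : {x : Eis // x ≠ 0} => G x.1).comp_injective rep_bij.1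
    refine this.congr fun p => ?_
    exact e2 p
  have e3 : Th (chiC χ q) y = (Fintype.card Eisˣ : ℂ) * ∑' n : {x : Eis // Rep x}, G n.1 := by
    rw [e1, ← (Equiv.ofBijective _ rep_bij).tsum_eq]
    simp only [Equiv.ofBijective_apply]
    simp_rw [e2]
    rw [hsp.tsum_prod]
    rw [tsum_fintype]
    simp
  rw [e3, norm_mul]
  have : (1 : ℝ) ≤ ‖(Fintype.card Eisˣ : ℂ)‖ := by
    simp only [Complex.norm_natCast]
    exact_mod_cast Fintype.card_pos
  exact le_mul_of_one_le_left (norm_nonneg _) this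

end P6b

section P6b2
open scoped Classical
variable {χ : Eis → Eis → Eis}


lemma Th_cont {f : Eis → ℂ} (hf : ∀ m, ‖f m‖ ≤ 1) : ContinuousOn (Th f) (Set.Ioi 0) := by
  intro y0 hy0
  have hy0 : 0 < y0 := hy0
  have h1 : ContinuousOn (Th f) (Set.Ioi (y0 / 2)) := by
    unfold Th
    refine continuousOn_tsum (u := fun m => Real.exp (-(2 * Real.pi * (y0 / 2) * Nm m))) ?_ (summable_gauss0 (by positivity)) ?_
    · intro m
      apply Continuous.continuousOn
      fun_prop
    · intro m y hy
      rw [norm_mul, Complex.norm_real, Real.norm_of_nonneg (Real.exp_nonneg _)]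
      refine (mul_le_of_le_one_left (Real.exp_nonneg _) (hf m)).trans ?_
      have hy : y0 / 2 < y := hy
      apply Real.exp_le_exp.2
      have := Nm_nn m
      gcongr
  exact (h1.continuousAt (Ioi_mem_nhds (by linarith))).continuousWithinAt

lemma Th_decay {s : ℝ} (hs : 1 < s) : ∃ C : ℝ, 0 < C ∧ ∀ f : Eis → ℂ, (∀ m, ‖f m‖ ≤ 1) → f 0 = 0 → ∀ y : ℝ, 0 < y → ‖Th f y‖ ≤ C * y ^ (-s) := by
  obtain ⟨C, hC, h⟩ := exp_neg_le_rpow (s := s) (x := 2 * Real.pi) (by linarith) (by positivity)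
  have hS0 : 0 ≤ ∑' n : Eis, Nm n ^ (-s) := tsum_nonneg fun n => Real.rpow_nonneg (Nm_nn _) _
  refine ⟨C * (∑' n : Eis, Nm n ^ (-s) + 1), by positivity, ?_⟩
  intro f hf hf0 y hy
  have hb : ∀ m : Eis, ‖f m * ((Real.exp (-(2 * Real.pi * y * Nm m)) : ℝ) : ℂ)‖ ≤ (C * y ^ (-s)) * Nm m ^ (-s) := by
    intro m
    by_cases hm : m = 0
    · rw [hm, hf0, zero_mul, norm_zero, Nm_zero, Real.zero_rpow (by linarith), mul_zero]
    have hN := Nm_pos hm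
    rw [norm_mul, Complex.norm_real, Real.norm_of_nonneg (Real.exp_nonneg _)]
    refine (mul_le_of_le_one_left (Real.exp_nonneg _) (hf m)).trans ?_
    have h1 := h (y * Nm m) (by positivity)
    have h2 : (1 + y * Nm m) ^ (-s) ≤ (y * Nm m) ^ (-s) := Real.rpow_le_rpow_of_nonpos (by positivity) (by linarith) (by linarith)
    rw [Real.mul_rpow hy.le hN.le] at h2
    rw [show 2 * Real.pi * y * Nm m = 2 * Real.pi * (y * Nm m) by ring]
    calc _ ≤ _ := h1
      _ ≤ C * (y ^ (-s) * Nm m ^ (-s)) := by gcongr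
      _ = _ := by ring
  have := tsum_of_norm_bounded ((summable_Nm hs).mul_left (C * y ^ (-s))).hasSum hb
  rw [tsum_mul_left] at this
  calc _ ≤ _ := this
    _ ≤ C * y ^ (-s) * (∑' n : Eis, Nm n ^ (-s) + 1) := by gcongr; linarith
    _ = _ := by ring

open MeasureTheory in
lemma Th_meas {f : Eis → ℂ} (hf : ∀ m, ‖f m‖ ≤ 1) {w : ℝ} (hw : 0 ≤ w) (e : ℝ) :
    AEStronglyMeasurable (fun v : ℝ => v ^ e * ‖Th f v‖) (volume.restrict (Set.Ioi w)) := by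
  apply ContinuousOn.aestronglyMeasurable _ measurableSet_Ioi
  apply ContinuousOn.mul
  · intro v hv
    exact (Real.continuousAt_rpow_const v e (Or.inl (hw.trans_lt hv).ne')).continuousWithinAt
  · exact ((Th_cont hf).mono (Set.Ioi_subset_Ioi hw)).norm

open MeasureTheory in
lemma Th_int {f : Eis → ℂ} (hf : ∀ m, ‖f m‖ ≤ 1) (hf0 : f 0 = 0) {w : ℝ} (hw : 0 < w) :
    IntegrableOn (fun v : ℝ => v ^ (-(1 / 2) : ℝ) * ‖Th f v‖) (Set.Ioi w) := by
  obtain ⟨C, hC, h⟩ := Th_decay (s := 2) (by norm_num)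
  refine Integrable.mono' ((integrableOn_Ioi_rpow_of_lt (a := -(5 / 2)) (by norm_num) hw).const_mul C) (Th_meas hf hw.le _) ?_
  filter_upwards [ae_restrict_mem measurableSet_Ioi] with v hv
  have hv0 : 0 < v := hw.trans hv
  rw [Real.norm_of_nonneg (by positivity)]
  calc _ ≤ v ^ (-(1 / 2) : ℝ) * (C * v ^ (-2 : ℝ)) := by gcongr; exact h f hf hf0 v hv0
    _ = C * (v ^ (-(1 / 2) : ℝ) * v ^ (-2 : ℝ)) := by ring
    _ = _ := by rw [← Real.rpow_add hv0]; norm_num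

open MeasureTheory in
lemma refl_int {h : ℝ → ℝ} {W : ℝ} (hW : 0 < W) (hfe : ∀ y, 0 < y → h y = W / y * h (W ^ 2 / y))
    (hIntg : IntegrableOn (fun v : ℝ => v ^ (-(1 / 2) : ℝ) * h v) (Set.Ioi W)) :
    IntegrableOn (fun v : ℝ => v ^ (-(1 / 2) : ℝ) * h v) (Set.Ioi 0) ∧
    ∫ v in Set.Ioi 0, v ^ (-(1 / 2) : ℝ) * h v = 2 * ∫ v in Set.Ioi W, v ^ (-(1 / 2) : ℝ) * h v := by
  set k : ℝ → ℝ := fun v => v ^ (-(1 / 2) : ℝ) * h v with hk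
  set φ : ℝ → ℝ := (Set.Ioi 1).indicator (fun x => k (W * x)) with hφ
  have h1 : IntegrableOn (fun x => k (W * x)) (Set.Ioi 1) := by
    rw [integrableOn_Ioi_comp_mul_left_iff k 1 hW, mul_one]; exact hIntg
  have hφi : IntegrableOn φ (Set.Ioi 0) := ((integrable_indicator_iff measurableSet_Ioi).2 h1).integrableOn
  have hφ2 := (integrableOn_Ioi_comp_rpow_iff φ (p := -1) (by norm_num)).2 hφi
  have hφ3 := integral_comp_rpow_Ioi φ (p := -1) (by norm_num)
  have hsum : ∀ x : ℝ, x ∈ Set.Ioi 0 → x ≠ 1 → k (W * x) = φ x + (|(-1 : ℝ)| * x ^ ((-1 : ℝ) - 1)) • φ (x ^ (-1 : ℝ)) := by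
    intro x hx hx1
    have hx0 : 0 < x := hx
    have hinv : x ^ (-1 : ℝ) = 1 / x := by rw [Real.rpow_neg hx0.le, Real.rpow_one, one_div]
    rw [hinv]
    rcases lt_or_gt_of_ne hx1 with hlt | hgt
    · have a1 : φ x = 0 := Set.indicator_of_notMem (by simp; exact hlt.le) _
      have a2 : φ (1 / x) = k (W * (1 / x)) := Set.indicator_of_mem (by rw [Set.mem_Ioi, lt_div_iff₀ hx0]; linarith) _
      rw [a1, a2, zero_add]
      have a3 := hfe (W * x) (by positivity)
      have a4 : W ^ 2 / (W * x) = W * (1 / x) := by field_simp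
      rw [a4] at a3
      have a5 : x ^ ((-1 : ℝ) - 1) = (x * x)⁻¹ := by
        rw [show (-1 : ℝ) - 1 = -(2 : ℝ) by norm_num, Real.rpow_neg hx0.le]; norm_num; ring
      simp only [hk, a3, smul_eq_mul, a5]
      have a6 : (W * (1 / x)) ^ (-(1 / 2) : ℝ) = (W * x) ^ (-(1 / 2) : ℝ) * x := by
        rw [Real.mul_rpow hW.le (by positivity), Real.mul_rpow hW.le hx0.le, one_div x, Real.inv_rpow hx0.le, ← Real.rpow_neg hx0.le, mul_assoc]
        congr 1
        nth_rewrite 3 [← Real.rpow_one x]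
        rw [← Real.rpow_add hx0]; norm_num
      rw [a6]
      simp only [abs_neg, abs_one]
      field_simp
    · have a1 : φ x = k (W * x) := Set.indicator_of_mem (by exact hgt) _
      have a2 : φ (1 / x) = 0 := Set.indicator_of_notMem (by
        rw [Set.mem_Ioi, not_lt, div_le_iff₀ hx0]; linarith [show (1 : ℝ) < x from hgt]) _
      rw [a1, a2, smul_zero, add_zero]
  have hae : (fun x => k (W * x)) =ᵐ[volume.restrict (Set.Ioi 0)] (fun x => φ x + (|(-1 : ℝ)| * x ^ ((-1 : ℝ) - 1)) • φ (x ^ (-1 : ℝ))) := by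
    have hne : ∀ᵐ x : ℝ ∂(volume.restrict (Set.Ioi 0)), x ≠ 1 := by
      apply ae_restrict_of_ae
      simp [ae_iff, measure_singleton]
    filter_upwards [ae_restrict_mem measurableSet_Ioi, hne] with x hx hx1
    exact hsum x hx hx1
  have hI0 : IntegrableOn (fun x => k (W * x)) (Set.Ioi 0) := (hφi.add hφ2).congr hae.symm
  have hJ : IntegrableOn k (Set.Ioi 0) := by
    have := (integrableOn_Ioi_comp_mul_left_iff k 0 hW).1 hI0
    rwa [mul_zero] at this
  refine ⟨hJ, ?_⟩
  have e1 := integral_comp_mul_left_Ioi' k 0 hW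
  have e2 := integral_comp_mul_left_Ioi' k 1 hW
  rw [mul_zero] at e1
  rw [mul_one] at e2
  rw [← e1, ← e2, integral_congr_ae hae, integral_add hφi hφ2, hφ3]
  have e3 : ∫ y in Set.Ioi 0, φ y = ∫ x in Set.Ioi 1, k (W * x) := by
    rw [hφ, setIntegral_indicator measurableSet_Ioi]
    congr 2
    ext x; simp
  rw [e3, smul_eq_mul, smul_eq_mul]; ring

lemma Th_conj (f : Eis → ℂ) (y : ℝ) : Th (fun k => (starRingEnd ℂ) (f k)) y = (starRingEnd ℂ) (Th f y) := by
  unfold Th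
  rw [Complex.conj_tsum]
  apply tsum_congr
  intro m
  rw [map_mul, Complex.conj_ofReal]

lemma Th_refl {n : Eis} {f : Eis → ℂ} (h : PChar n f) {y : ℝ} (hy : 0 < y) :
    ‖Th f y‖ = (1 / Real.sqrt (3 * Nm n)) / y * ‖Th f ((1 / Real.sqrt (3 * Nm n)) ^ 2 / y)‖ := by
  have hQ := Nm_pos h.ne
  have e0 : (1 / Real.sqrt (3 * Nm n)) ^ 2 / y = 1 / (3 * (y * Nm n)) := by
    rw [div_pow, Real.sq_sqrt (by positivity)]; field_simp
  rw [theta_fe h hy, e0, Th_conj, norm_mul, norm_mul, RCLike.norm_conj, Complex.norm_real, Real.norm_of_nonneg (by positivity)]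
  congr 1
  have e1 : ‖gs f n 1‖ = Real.sqrt (Nm n) := by
    rw [← h.gs_normSq, Real.sqrt_sq (norm_nonneg _)]
  rw [e1, Real.sqrt_mul (by norm_num)]
  have : Nm n = Real.sqrt (Nm n) * Real.sqrt (Nm n) := (Real.mul_self_sqrt hQ.le).symm
  have h3 : 0 < Real.sqrt (Nm n) := by positivity
  rw [div_div, mul_one_div, div_eq_div_iff (by positivity) (by positivity)]
  nth_rewrite 3 [this]
  ring

end P6b2

section P6c
open scoped Classical
variable {χ : Eis → Eis → Eis}


open MeasureTheory in
lemma gam_int {s : ℝ} (hs : 1 < s) : ∃ C : ℝ, 0 < C ∧ ∀ N w : ℝ, 0 < N → 0 < w →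
    IntegrableOn (fun v : ℝ => Real.exp (-(2 * Real.pi * v * N)) * v ^ (-(1 / 2) : ℝ)) (Set.Ioi w) ∧
    ∫ v in Set.Ioi w, Real.exp (-(2 * Real.pi * v * N)) * v ^ (-(1 / 2) : ℝ) ≤ C * (w ^ (1 / 2 - s) * N ^ (-s)) := by
  obtain ⟨C, hC, h⟩ := exp_neg_le_rpow (s := s) (x := 2 * Real.pi) (by linarith) (by positivity)
  refine ⟨C / (s - 1 / 2), div_pos hC (by linarith), ?_⟩
  intro N w hN hw
  have hb : ∀ v : ℝ, v ∈ Set.Ioi w → Real.exp (-(2 * Real.pi * v * N)) * v ^ (-(1 / 2) : ℝ) ≤ C * N ^ (-s) * v ^ (-s - 1 / 2) := by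
    intro v hv
    have hv0 : 0 < v := hw.trans hv
    have h1 := h (v * N) (by positivity)
    have h2 : (1 + v * N) ^ (-s) ≤ (v * N) ^ (-s) := Real.rpow_le_rpow_of_nonpos (by positivity) (by linarith) (by linarith)
    calc _ ≤ (C * (v * N) ^ (-s)) * v ^ (-(1 / 2) : ℝ) := by
          gcongr
          rw [show 2 * Real.pi * v * N = 2 * Real.pi * (v * N) by ring]
          exact h1.trans (by gcongr)
      _ = C * N ^ (-s) * v ^ (-s - 1 / 2) := by
          rw [Real.mul_rpow hv0.le hN.le, sub_eq_add_neg (-s), Real.rpow_add hv0]; ring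
  have hi : IntegrableOn (fun v : ℝ => C * N ^ (-s) * v ^ (-s - 1 / 2)) (Set.Ioi w) := (integrableOn_Ioi_rpow_of_lt (by linarith) hw).const_mul _
  have hI : IntegrableOn (fun v : ℝ => Real.exp (-(2 * Real.pi * v * N)) * v ^ (-(1 / 2) : ℝ)) (Set.Ioi w) := by
    refine Integrable.mono' hi (by apply Measurable.aestronglyMeasurable; fun_prop) ?_
    filter_upwards [ae_restrict_mem measurableSet_Ioi] with v hv
    have hv0 : 0 < v := hw.trans hv
    rw [Real.norm_of_nonneg (by positivity)]
    exact hb v hv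
  refine ⟨hI, ?_⟩
  calc _ ≤ ∫ v in Set.Ioi w, C * N ^ (-s) * v ^ (-s - 1 / 2) := setIntegral_mono_on hI hi measurableSet_Ioi hb
    _ = _ := by
      rw [integral_const_mul, integral_Ioi_rpow_of_lt (by linarith) hw]
      have e : -s - 1 / 2 + 1 = 1 / 2 - s := by ring
      have e2 : s - 1 / 2 ≠ 0 := by linarith
      have e3 : 1 / 2 - s = -(s - 1 / 2) := by ring
      rw [e, e3, neg_div_neg_eq]
      field_simp

open MeasureTheory in
lemma A1_eq : ∃ c0 : ℂ, ∀ χ, IsCubicSymbol χ → ∀ q : Eis, q ≠ 0 →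
    A₁ χ q = c0 * ∑' n : {x : Eis // Rep x}, ∫ v in Set.Ioi (1 / Real.sqrt (3 * Nm q)),
      chiC χ q n.1 * (((Real.exp (-(2 * Real.pi * v * Nm n.1)) * v ^ (-(1 / 2) : ℝ)) : ℝ) : ℂ) := by
  obtain ⟨c0, h⟩ := Phi_eq
  refine ⟨c0, ?_⟩
  intro χ hχ q hq
  have hQ := Nm_pos hq
  have hw : 0 < 1 / Real.sqrt (3 * Nm q) := by positivity
  unfold A₁
  rw [← tsum_mul_left]
  apply tsum_congr
  intro n
  have hN := Nm_pos n.2.ne_zero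
  rw [h _ (by positivity), integral_const_mul, integral_complex_ofReal]
  have e1 := integral_comp_mul_left_Ioi' (fun v : ℝ => Real.exp (-(2 * Real.pi * v)) * v ^ (-(1 / 2) : ℝ)) (1 / Real.sqrt (3 * Nm q)) hN
  have e2 : Nm n.1 / Real.sqrt (3 * Nm q) = Nm n.1 * (1 / Real.sqrt (3 * Nm q)) := by ring
  have e3 : ∫ v in Set.Ioi (1 / Real.sqrt (3 * Nm q)), Real.exp (-(2 * Real.pi * (Nm n.1 * v))) * (Nm n.1 * v) ^ (-(1 / 2) : ℝ)
      = Nm n.1 ^ (-(1 / 2) : ℝ) * ∫ v in Set.Ioi (1 / Real.sqrt (3 * Nm q)), Real.exp (-(2 * Real.pi * v * Nm n.1)) * v ^ (-(1 / 2) : ℝ) := by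
    rw [← integral_const_mul]
    apply setIntegral_congr_fun measurableSet_Ioi
    intro v hv
    have hv0 : 0 < v := hw.trans hv
    simp only []
    rw [Real.mul_rpow hN.le hv0.le, show 2 * Real.pi * (Nm n.1 * v) = 2 * Real.pi * v * Nm n.1 by ring]
    ring
  rw [e2, ← e1, e3, smul_eq_mul]
  have e4 : (Nm n.1 : ℂ) ^ (-(1 / 2 : ℂ)) = ((Nm n.1 ^ (-(1 / 2) : ℝ) : ℝ) : ℂ) := by
    rw [Complex.ofReal_cpow hN.le]; push_cast; rfl
  rw [e4]
  have e5 : Nm n.1 ^ (-(1 / 2) : ℝ) * (Nm n.1 * Nm n.1 ^ (-(1 / 2) : ℝ)) = 1 := by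
    calc _ = Nm n.1 ^ (-(1 / 2) : ℝ) * Nm n.1 ^ (-(1 / 2) : ℝ) * Nm n.1 ^ (1 : ℝ) := by rw [Real.rpow_one]; ring
      _ = 1 := by rw [← Real.rpow_add hN, ← Real.rpow_add hN]; norm_num
  have e6 : ((Nm n.1 ^ (-(1 / 2) : ℝ) : ℝ) : ℂ) * ((Nm n.1 : ℂ) * ((Nm n.1 ^ (-(1 / 2) : ℝ) : ℝ) : ℂ)) = 1 := by
    exact_mod_cast e5
  simp only [chiC]
  set I := ∫ v in Set.Ioi (1 / Real.sqrt (3 * Nm q)), Real.exp (-(2 * Real.pi * v * Nm n.1)) * v ^ (-(1 / 2) : ℝ)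
  rw [Complex.ofReal_mul, Complex.ofReal_mul]
  linear_combination (((χ q n.1 : Eis) : ℂ) * c0 * (I : ℂ)) * e6

open MeasureTheory in
lemma A1_le : ∃ C : ℝ, 0 < C ∧ ∀ χ, IsCubicSymbol χ → ∀ q : Eis, (9 : Eis) ∣ q - 1 → q ≠ 1 →
    ‖A₁ χ q‖ ≤ C * ∫ v in Set.Ioi (1 / Real.sqrt (3 * Nm q)), v ^ (-(1 / 2) : ℝ) * ‖Th (chiC χ q) v‖ := by
  obtain ⟨c0, h⟩ := A1_eq
  obtain ⟨C2, hC2, hgam⟩ := gam_int (s := 2) (by norm_num)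
  refine ⟨‖c0‖ + 1, by positivity, ?_⟩
  intro χ hχ q hq hq1
  have hp : Pri q := dvd_trans ⟨3, by norm_num⟩ hq
  have hQ := Nm_pos hp.ne_zero
  rw [h χ hχ q hp.ne_zero, norm_mul]
  set w := 1 / Real.sqrt (3 * Nm q) with hwdef
  have hw : 0 < w := by positivity
  have hcount := Eis_countable
  have hsN : Summable fun n : {x : Eis // Rep x} => Nm n.1 ^ (-2 : ℝ) := (summable_Nm (by norm_num)).comp_injective Subtype.val_injective
  have hnorm : ∀ (n : {x : Eis // Rep x}) (v : ℝ), v ∈ Set.Ioi w → ‖chiC χ q n.1 * (((Real.exp (-(2 * Real.pi * v * Nm n.1)) * v ^ (-(1 / 2) : ℝ)) : ℝ) : ℂ)‖ ≤ Real.exp (-(2 * Real.pi * v * Nm n.1)) * v ^ (-(1 / 2) : ℝ) := by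
    intro n v hv
    have hv0 : 0 < v := hw.trans hv
    rw [norm_mul, Complex.norm_real, Real.norm_of_nonneg (by positivity)]
    exact mul_le_of_le_one_left (by positivity) (chiC_norm_le hχ hp _)
  have hIntg : ∀ n : {x : Eis // Rep x}, Integrable (fun v : ℝ => chiC χ q n.1 * (((Real.exp (-(2 * Real.pi * v * Nm n.1)) * v ^ (-(1 / 2) : ℝ)) : ℝ) : ℂ)) (volume.restrict (Set.Ioi w)) := by
    intro n
    exact ((hgam (Nm n.1) w (Nm_pos n.2.ne_zero) hw).1.ofReal).const_mul _
  rw [integral_tsum_of_summable_integral_norm hIntg]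
  · calc ‖c0‖ * ‖∫ v in Set.Ioi w, ∑' n : {x : Eis // Rep x}, chiC χ q n.1 * (((Real.exp (-(2 * Real.pi * v * Nm n.1)) * v ^ (-(1 / 2) : ℝ)) : ℝ) : ℂ)‖
        ≤ ‖c0‖ * ∫ v in Set.Ioi w, v ^ (-(1 / 2) : ℝ) * ‖Th (chiC χ q) v‖ := by
          gcongr
          apply norm_integral_le_of_norm_le
          · refine Th_int (fun m => chiC_norm_le hχ hp m) ?_ hw
            have h0 : χ q 0 = 0 := (chi_ne hχ hp).2 (by
              rw [isCoprime_zero_left]; exact fun h => hq1 (pri_unit_eq_one h hp))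
            rw [chiC, h0]; rfl
          · filter_upwards [ae_restrict_mem measurableSet_Ioi] with v hv
            have hv0 : 0 < v := hw.trans hv
            have e : ∀ n : {x : Eis // Rep x}, chiC χ q n.1 * (((Real.exp (-(2 * Real.pi * v * Nm n.1)) * v ^ (-(1 / 2) : ℝ)) : ℝ) : ℂ) = ((v ^ (-(1 / 2) : ℝ) : ℝ) : ℂ) * (chiC χ q n.1 * ((Real.exp (-(2 * Real.pi * v * Nm n.1)) : ℝ) : ℂ)) := by
              intro n; push_cast; ring
            simp_rw [e]
            rw [tsum_mul_left, norm_mul, Complex.norm_real, Real.norm_of_nonneg (by positivity)]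
            gcongr
            exact rep_Th hχ hq hq1 hv0
      _ ≤ (‖c0‖ + 1) * ∫ v in Set.Ioi w, v ^ (-(1 / 2) : ℝ) * ‖Th (chiC χ q) v‖ := by
          gcongr ?_ * ?_
          · apply setIntegral_nonneg measurableSet_Ioi
            intro v hv
            have hv0 : 0 < v := hw.trans hv
            positivity
          · linarith
  · refine Summable.of_nonneg_of_le (fun n => integral_nonneg fun _ => norm_nonneg _) (fun n => ?_) (hsN.mul_left (C2 * w ^ (1 / 2 - 2 : ℝ)))
    have := hgam (Nm n.1) w (Nm_pos n.2.ne_zero) hw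
    calc _ ≤ ∫ v in Set.Ioi w, Real.exp (-(2 * Real.pi * v * Nm n.1)) * v ^ (-(1 / 2) : ℝ) := setIntegral_mono_on (hIntg n).norm this.1 measurableSet_Ioi (hnorm n)
      _ ≤ _ := this.2.trans (le_of_eq (by ring))

open MeasureTheory in
lemma A1_triv {δ : ℝ} (hδ : 0 < δ) : ∃ C : ℝ, 0 < C ∧ ∀ χ, IsCubicSymbol χ → ∀ q : Eis, Pri q →
    ‖A₁ χ q‖ ≤ C * Nm q ^ (1 / 4 + δ) := by
  obtain ⟨c0, h⟩ := A1_eq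
  set s := 1 + 2 * δ with hs
  obtain ⟨C2, hC2, hgam⟩ := gam_int (s := s) (by linarith)
  have hsN : Summable fun n : {x : Eis // Rep x} => Nm n.1 ^ (-s) := (summable_Nm (by linarith)).comp_injective Subtype.val_injective
  have hS0 : 0 ≤ ∑' n : {x : Eis // Rep x}, Nm n.1 ^ (-s) := tsum_nonneg fun n => Real.rpow_nonneg (Nm_nn _) _
  refine ⟨(‖c0‖ + 1) * (C2 * 3 ^ (1 / 4 + δ)) * (∑' n : {x : Eis // Rep x}, Nm n.1 ^ (-s) + 1), by positivity, ?_⟩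
  intro χ hχ q hp
  have hQ := Nm_pos hp.ne_zero
  rw [h χ hχ q hp.ne_zero, norm_mul]
  set w := 1 / Real.sqrt (3 * Nm q) with hwdef
  have hw : 0 < w := by positivity
  have hnorm : ∀ (n : {x : Eis // Rep x}) (v : ℝ), v ∈ Set.Ioi w → ‖chiC χ q n.1 * (((Real.exp (-(2 * Real.pi * v * Nm n.1)) * v ^ (-(1 / 2) : ℝ)) : ℝ) : ℂ)‖ ≤ Real.exp (-(2 * Real.pi * v * Nm n.1)) * v ^ (-(1 / 2) : ℝ) := by
    intro n v hv
    have hv0 : 0 < v := hw.trans hv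
    rw [norm_mul, Complex.norm_real, Real.norm_of_nonneg (by positivity)]
    exact mul_le_of_le_one_left (by positivity) (chiC_norm_le hχ hp _)
  have hbd : ∀ n : {x : Eis // Rep x}, ‖∫ v in Set.Ioi w, chiC χ q n.1 * (((Real.exp (-(2 * Real.pi * v * Nm n.1)) * v ^ (-(1 / 2) : ℝ)) : ℝ) : ℂ)‖ ≤ (C2 * w ^ (1 / 2 - s)) * Nm n.1 ^ (-s) := by
    intro n
    have := hgam (Nm n.1) w (Nm_pos n.2.ne_zero) hw
    calc _ ≤ ∫ v in Set.Ioi w, Real.exp (-(2 * Real.pi * v * Nm n.1)) * v ^ (-(1 / 2) : ℝ) := by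
          apply norm_integral_le_of_norm_le this.1
          filter_upwards [ae_restrict_mem measurableSet_Ioi] with v hv
          exact hnorm n v hv
      _ ≤ _ := this.2.trans (le_of_eq (by ring))
  have hsum := tsum_of_norm_bounded (hsN.mul_left (C2 * w ^ (1 / 2 - s))).hasSum hbd
  rw [tsum_mul_left] at hsum
  have hwe : w ^ (1 / 2 - s) = 3 ^ (1 / 4 + δ) * Nm q ^ (1 / 4 + δ) := by
    rw [hwdef, Real.sqrt_eq_rpow, one_div, ← Real.rpow_neg (by positivity), ← Real.rpow_mul (by positivity), ← Real.mul_rpow (by norm_num) hQ.le]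
    congr 1; rw [hs]; ring
  rw [hwe] at hsum
  calc _ ≤ (‖c0‖ + 1) * (C2 * (3 ^ (1 / 4 + δ) * Nm q ^ (1 / 4 + δ)) * (∑' n : {x : Eis // Rep x}, Nm n.1 ^ (-s) + 1)) := by
        gcongr
        · linarith
        · refine hsum.trans ?_
          gcongr
          linarith
    _ = _ := by ring

end P6c

section P6d
open scoped Classical
variable {χ : Eis → Eis → Eis}

lemma Pri.ofNine {q : Eis} (h : (9 : Eis) ∣ q - 1) : Pri q := dvd_trans ⟨3, by norm_num⟩ h

lemma chiC_q (hχ : IsCubicSymbol χ) {r s t : Eis} (hr : Pri r) (hs : Pri s) (ht : Pri t) (m : Eis) :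
    chiC χ (r * s ^ 2 * t ^ 3) m = (if IsCoprime m t then 1 else 0) * mixC χ r s m := by
  have e1 : χ (r * s ^ 2 * t ^ 3) m = χ r m * (χ s m * χ s m) * (χ t m * χ t m * χ t m) := by
    rw [hχ.mul_bot _ _ _ (hr.mul (hs.pow 2)) (ht.pow 3), hχ.mul_bot _ _ _ hr (hs.pow 2), pow_two, hχ.mul_bot _ _ _ hs hs,
      show t ^ 3 = t * t * t by ring, hχ.mul_bot _ _ _ (ht.mul ht) ht, hχ.mul_bot _ _ _ ht ht]
  have e2 : (starRingEnd ℂ) (chiC χ s m) = (χ s m : ℂ) * (χ s m : ℂ) := by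
    rw [← chiC_sq hχ hs, pow_two, chiC_mul hχ hs]; rfl
  rw [mixC, e2]
  simp only [chiC, e1]
  push_cast
  split_ifs with h
  · have h3 : χ t m ^ 3 = 1 := ((chi_ne hχ ht).1 h).cube
    have h4 : (χ t m : ℂ) ^ 3 = 1 := by exact_mod_cast congrArg (Subtype.val) h3
    rw [show (χ t m : ℂ) * (χ t m : ℂ) * (χ t m : ℂ) = (χ t m : ℂ) ^ 3 by ring, h4]; ring
  · have h3 : χ t m = 0 := (chi_ne hχ ht).2 h
    rw [h3]; simp

open MeasureTheory in
lemma mix_int (hχ : IsCubicSymbol χ) {r s : Eis} (hr : Pri r) (hs : Pri s) (hsq : Squarefree (r * s)) (h1 : r * s ≠ 1) :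
    IntegrableOn (fun v : ℝ => v ^ (-(1 / 2) : ℝ) * ‖Th (mixC χ r s) v‖) (Set.Ioi 0) ∧
    ∫ v in Set.Ioi 0, v ^ (-(1 / 2) : ℝ) * ‖Th (mixC χ r s) v‖ =
      2 * ∫ v in Set.Ioi (1 / Real.sqrt (3 * Nm (r * s))), v ^ (-(1 / 2) : ℝ) * ‖Th (mixC χ r s) v‖ := by
  have hP := PChar.mix hχ hr hs hsq
  have hQ := Nm_pos hP.ne
  have hW : 0 < 1 / Real.sqrt (3 * Nm (r * s)) := by positivity
  refine refl_int (h := fun v => ‖Th (mixC χ r s) v‖) hW (fun y hy => Th_refl hP hy) ?_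
  refine Th_int hP.norm_le (hP.zero 0 ?_) hW
  rw [isCoprime_zero_left]
  exact fun h => h1 (pri_unit_eq_one h (hr.mul hs))

open MeasureTheory in
lemma A1_bound : ∃ C : ℝ, 0 < C ∧ ∀ χ, IsCubicSymbol χ → ∀ μ, IsMoebius μ → ∀ r s t : Eis, Pri r → Pri s → Pri t →
    Squarefree (r * s) → r * s ≠ 1 → (9 : Eis) ∣ r * s ^ 2 * t ^ 3 - 1 →
    ‖A₁ χ (r * s ^ 2 * t ^ 3)‖ ≤ C * (pd t).card * ∫ v in Set.Ioi (1 / Real.sqrt (3 * Nm (r * s))), v ^ (-(1 / 2) : ℝ) * ‖Th (mixC χ r s) v‖ := by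
  obtain ⟨C, hC, H⟩ := A1_le
  refine ⟨C * 2, by positivity, ?_⟩
  intro χ hχ μ hμ r s t hr hs ht hsq h1 h9
  have hP := PChar.mix hχ hr hs hsq
  set q := r * s ^ 2 * t ^ 3 with hq
  have hpq : Pri q := .ofNine h9
  have hq1 : q ≠ 1 := by
    intro h
    apply h1
    apply pri_unit_eq_one _ (hr.mul hs)
    apply isUnit_of_dvd_one
    rw [← h, hq]; exact ⟨s * t ^ 3, by ring⟩
  have hmain := H χ hχ q h9 hq1
  obtain ⟨g, hg, hgs, hgt, hgc⟩ := exists_radical t ht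
  set I := ∫ v in Set.Ioi 0, v ^ (-(1 / 2) : ℝ) * ‖Th (mixC χ r s) v‖ with hI
  have hII := mix_int hχ hr hs hsq h1
  have hI0 : 0 ≤ I := setIntegral_nonneg measurableSet_Ioi (fun v hv => by
    have : (0 : ℝ) < v := hv
    positivity)
  have hqf : chiC χ q = fun m => (if IsCoprime m g then 1 else 0) * mixC χ r s m := by
    funext m
    rw [hq, chiC_q hχ hr hs ht]
    simp only [hgc m]
  have hw : 0 < 1 / Real.sqrt (3 * Nm q) := by
    have := Nm_pos hpq.ne_zero
    positivity
  have hd : ∀ d ∈ pd g, IntegrableOn (fun v : ℝ => v ^ (-(1 / 2) : ℝ) * ‖Th (mixC χ r s) (Nm d * v)‖) (Set.Ioi 0) ∧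
      ∫ v in Set.Ioi 0, v ^ (-(1 / 2) : ℝ) * ‖Th (mixC χ r s) (Nm d * v)‖ ≤ I := by
    intro d hd
    have hdp : Pri d := ((mem_pd hg.ne_zero).1 hd).1
    have hD := Nm_pos hdp.ne_zero
    have hD1 := one_le_Nm hdp.ne_zero
    set k : ℝ → ℝ := fun v => v ^ (-(1 / 2) : ℝ) * ‖Th (mixC χ r s) v‖ with hk
    have e : ∀ v ∈ Set.Ioi (0 : ℝ), v ^ (-(1 / 2) : ℝ) * ‖Th (mixC χ r s) (Nm d * v)‖ = Nm d ^ (1 / 2 : ℝ) * k (Nm d * v) := by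
      intro v hv
      simp only [hk]
      rw [Real.mul_rpow hD.le (le_of_lt hv), Real.rpow_neg hD.le]
      field_simp
    have i1 : IntegrableOn (fun v => k (Nm d * v)) (Set.Ioi 0) := by
      rw [integrableOn_Ioi_comp_mul_left_iff k 0 hD, mul_zero]; exact hII.1
    constructor
    · exact IntegrableOn.congr_fun (i1.const_mul _) (fun v hv => (e v hv).symm) measurableSet_Ioi
    · rw [setIntegral_congr_fun measurableSet_Ioi e, integral_const_mul]
      have e1 := integral_comp_mul_left_Ioi k 0 hD
      rw [mul_zero] at e1
      rw [e1, smul_eq_mul, ← mul_assoc]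
      apply mul_le_of_le_one_left hI0
      rw [← Real.rpow_neg_one, ← Real.rpow_add hD]
      exact Real.rpow_le_one_of_one_le_of_nonpos hD1 (by norm_num)
  have hle : ∫ v in Set.Ioi (1 / Real.sqrt (3 * Nm q)), v ^ (-(1 / 2) : ℝ) * ‖Th (chiC χ q) v‖ ≤ (pd t).card * I := by
    calc _ ≤ ∫ v in Set.Ioi (1 / Real.sqrt (3 * Nm q)), ∑ d ∈ pd g, v ^ (-(1 / 2) : ℝ) * ‖Th (mixC χ r s) (Nm d * v)‖ := by
          apply integral_mono_of_nonneg
          · filter_upwards [ae_restrict_mem measurableSet_Ioi] with v hv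
            have hv0 : 0 < v := hw.trans hv
            positivity
          · exact integrable_finset_sum _ fun d hdd => (hd d hdd).1.mono_set (Set.Ioi_subset_Ioi hw.le)
          · filter_upwards [ae_restrict_mem measurableSet_Ioi] with v hv
            have hv0 : 0 < v := hw.trans hv
            rw [hqf, Th_coprime hμ hg hgs hP.mul hP.norm_le hv0, ← Finset.mul_sum]
            gcongr
            refine (norm_sum_le _ _).trans (Finset.sum_le_sum fun d hdd => ?_)
            rw [norm_mul, norm_mul]
            apply mul_le_of_le_one_left (norm_nonneg _)
            apply mul_le_one₀ _ (norm_nonneg _) (hP.norm_le _)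
            have := moebius_abs hμ ((mem_pd hg.ne_zero).1 hdd).1
            rw [Complex.norm_intCast]
            exact_mod_cast this
      _ = ∑ d ∈ pd g, ∫ v in Set.Ioi (1 / Real.sqrt (3 * Nm q)), v ^ (-(1 / 2) : ℝ) * ‖Th (mixC χ r s) (Nm d * v)‖ :=
          integral_finsetSum _ fun d hdd => (hd d hdd).1.mono_set (Set.Ioi_subset_Ioi hw.le)
      _ ≤ ∑ d ∈ pd g, I := by
          refine Finset.sum_le_sum fun d hdd => le_trans ?_ (hd d hdd).2
          apply setIntegral_mono_set (hd d hdd).1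
          · filter_upwards [ae_restrict_mem measurableSet_Ioi] with v hv
            have hv0 : (0 : ℝ) < v := hv
            positivity
          · exact (Set.Ioi_subset_Ioi hw.le).eventuallyLE
      _ = (pd g).card * I := by rw [Finset.sum_const, nsmul_eq_mul]
      _ ≤ (pd t).card * I := by
          gcongr
          intro d hdd
          rw [mem_pd hg.ne_zero] at hdd
          rw [mem_pd ht.ne_zero]
          exact ⟨hdd.1, hdd.2.trans hgt⟩
  calc _ ≤ _ := hmain
    _ ≤ C * ((pd t).card * I) := by gcongr
    _ = _ := by rw [hI, hII.2]; ring

end P6d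

section P6e
open scoped Classical
variable {χ : Eis → Eis → Eis}

/-- the non-squarefree part of a lattice point -/
def IsKey (k : Eis) : Prop := ∃ v b c : Eis, Nm v ≤ 3 ∧ v ≠ 0 ∧ b ≠ 0 ∧ c ≠ 0 ∧ k = v * b ^ 2 * c ^ 3

lemma IsKey.ne {k : Eis} (h : IsKey k) : k ≠ 0 := by
  obtain ⟨v, b, c, _, hv, hb, hc, rfl⟩ := h
  exact mul_ne_zero (mul_ne_zero hv (pow_ne_zero _ hb)) (pow_ne_zero _ hc)

lemma exists_key (n : Eis) (hn : n ≠ 0) : ∃ k a : Eis, n = k * a ∧ Pri a ∧ Squarefree a ∧ IsKey k := by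
  obtain ⟨u, j, x, hu, hx, rfl⟩ := exists_factor hn
  obtain ⟨a, b, c, ha, hb, hc, hsq, rfl⟩ := exists_abc x hx
  have hl : lam ≠ 0 := prime_lam.ne_zero
  have hu1 : Nm u = 1 := (isUnit_iff_Nm).1 hu
  refine ⟨u * lam ^ j * b ^ 2 * c ^ 3, a, by ring, ha, hsq.squarefree_of_dvd (dvd_mul_right _ _), ?_⟩
  rcases Nat.even_or_odd j with ⟨i, rfl⟩ | ⟨i, rfl⟩
  · exact ⟨u, lam ^ i * b, c, by linarith, hu.ne_zero, mul_ne_zero (pow_ne_zero _ hl) hb.ne_zero, hc.ne_zero, by ring⟩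
  · exact ⟨u * lam, lam ^ i * b, c, by rw [Nm_mul, hu1, Nm_lam]; norm_num, mul_ne_zero hu.ne_zero hl,
      mul_ne_zero (pow_ne_zero _ hl) hb.ne_zero, hc.ne_zero, by ring⟩

lemma key_sum {δ : ℝ} (hδ : 0 < δ) : ∃ C : ℝ, 0 < C ∧ ∀ Z : ℝ, 1 ≤ Z → ∀ S : Finset Eis, (∀ k ∈ S, Nm k ≤ Z ∧ IsKey k) →
    ∑ k ∈ S, Nm k ^ (-(1 / 2) : ℝ) ≤ C * Z ^ δ := by
  obtain ⟨C1, hC1, h1⟩ := sum_Nm_le (s := 1 + 2 * δ) (by linarith)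
  obtain ⟨C2, hC2, h2⟩ := sum_Nm_le (s := 3 / 2 + 3 * δ) (by linarith)
  refine ⟨75 * C1 * C2, by positivity, ?_⟩
  intro Z hZ S hS
  have a1 : ∀ k ∈ S, Nm k ^ (-(1 / 2) : ℝ) ≤ Z ^ δ * Nm k ^ (-(1 / 2 + δ) : ℝ) := by
    intro k hk
    have hk0 := Nm_pos (hS k hk).2.ne
    rw [show (-(1 / 2 + δ) : ℝ) = -(1 / 2) + -δ by ring, Real.rpow_add hk0, Real.rpow_neg hk0.le δ]
    have : Nm k ^ δ ≤ Z ^ δ := Real.rpow_le_rpow hk0.le (hS k hk).1 hδ.le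
    have h3 : 0 < Nm k ^ δ := by positivity
    have h4 : 1 ≤ Z ^ δ * (Nm k ^ δ)⁻¹ := by
      rw [← div_eq_mul_inv, one_le_div h3]; exact this
    calc _ ≤ Nm k ^ (-(1 / 2) : ℝ) * (Z ^ δ * (Nm k ^ δ)⁻¹) := le_mul_of_one_le_right (by positivity) h4
      _ = _ := by ring
  have a2 : ∑ k ∈ S, Nm k ^ (-(1 / 2 + δ) : ℝ) ≤ ∑ i ∈ (nz 3 ×ˢ (nz Z ×ˢ nz Z)), Nm (i.1 * i.2.1 ^ 2 * i.2.2 ^ 3) ^ (-(1 / 2 + δ) : ℝ) := by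
    refine sum_le_sum_surj (fun i : Eis × Eis × Eis => i.1 * i.2.1 ^ 2 * i.2.2 ^ 3) (f := fun k => Nm k ^ (-(1 / 2 + δ) : ℝ)) (fun k => Real.rpow_nonneg (Nm_nn _) _) ?_
    intro k hk
    obtain ⟨hkZ, v, b, c, hv3, hv, hb, hc, rfl⟩ := hS k hk
    refine ⟨(v, b, c), ?_, rfl⟩
    have hv1 := one_le_Nm hv
    have hb1 := one_le_Nm hb
    have hc1 := one_le_Nm hc
    have hk0 : v * b ^ 2 * c ^ 3 ≠ 0 := (hS _ hk).2.ne
    simp only [Finset.mem_product, mem_nz]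
    exact ⟨⟨hv3, hv⟩, ⟨(Nm_le_of_dvd hk0 ⟨v * b * c ^ 3, by ring⟩).trans hkZ, hb⟩, ⟨(Nm_le_of_dvd hk0 ⟨v * b ^ 2 * c ^ 2, by ring⟩).trans hkZ, hc⟩⟩
  have a3 : ∑ i ∈ (nz 3 ×ˢ (nz Z ×ˢ nz Z)), Nm (i.1 * i.2.1 ^ 2 * i.2.2 ^ 3) ^ (-(1 / 2 + δ) : ℝ) ≤
      ∑ i ∈ (nz 3 ×ˢ (nz Z ×ˢ nz Z)), (Nm i.2.1 ^ (-(1 + 2 * δ)) * Nm i.2.2 ^ (-(3 / 2 + 3 * δ)) : ℝ) := by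
    refine Finset.sum_le_sum ?_
    rintro ⟨v, b, c⟩ hi
    simp only [Finset.mem_product, mem_nz] at hi
    have hv1 := one_le_Nm hi.1.2
    have hb1 := one_le_Nm hi.2.1.2
    have hc1 := one_le_Nm hi.2.2.2
    rw [Nm_mul, Nm_mul, Nm_pow, Nm_pow, Real.mul_rpow (by positivity) (by positivity), Real.mul_rpow (by positivity) (by positivity),
      ← Real.rpow_natCast, ← Real.rpow_natCast, ← Real.rpow_mul (by positivity), ← Real.rpow_mul (by positivity)]
    have : Nm v ^ (-(1 / 2 + δ)) ≤ 1 := Real.rpow_le_one_of_one_le_of_nonpos hv1 (by linarith)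
    calc _ ≤ 1 * Nm b ^ (((2 : ℕ) : ℝ) * -(1 / 2 + δ)) * Nm c ^ (((3 : ℕ) : ℝ) * -(1 / 2 + δ)) := by gcongr
      _ = _ := by rw [one_mul]; congr 2 <;> (push_cast; ring)
  have a4 : ∑ i ∈ (nz 3 ×ˢ (nz Z ×ˢ nz Z)), (Nm i.2.1 ^ (-(1 + 2 * δ)) * Nm i.2.2 ^ (-(3 / 2 + 3 * δ)) : ℝ) ≤ 75 * (C1 * C2) := by
    rw [Finset.sum_product]
    simp only [Finset.sum_const, nsmul_eq_mul]
    have h5 : ∑ x ∈ nz Z ×ˢ nz Z, (Nm x.1 ^ (-(1 + 2 * δ)) * Nm x.2 ^ (-(3 / 2 + 3 * δ)) : ℝ) ≤ C1 * C2 := by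
      rw [Finset.sum_product]
      dsimp only
      rw [← Finset.sum_mul_sum]
      exact mul_le_mul (h1 _) (h2 _) (Finset.sum_nonneg fun _ _ => Real.rpow_nonneg (Nm_nn _) _) hC1.le
    have h6 : ((nz 3).card : ℝ) ≤ 75 := (card_nz (by norm_num)).trans (by norm_num)
    calc _ ≤ ((nz 3).card : ℝ) * (C1 * C2) := by gcongr
      _ ≤ _ := by gcongr
  calc _ ≤ ∑ k ∈ S, Z ^ δ * Nm k ^ (-(1 / 2 + δ) : ℝ) := Finset.sum_le_sum a1
    _ = Z ^ δ * ∑ k ∈ S, Nm k ^ (-(1 / 2 + δ) : ℝ) := by rw [Finset.mul_sum]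
    _ ≤ Z ^ δ * (75 * (C1 * C2)) := by gcongr; exact a2.trans (a3.trans a4)
    _ = _ := by ring

lemma Lam_mono {a b c d : ℝ} (ha : 0 ≤ a) (hc : 0 ≤ c) (h1 : a ≤ b) (h2 : c ≤ d) : Lam a c ≤ Lam b d := by
  unfold Lam
  have : (a * c) ^ (2 / 3 : ℝ) ≤ (b * d) ^ (2 / 3 : ℝ) := by
    apply Real.rpow_le_rpow (by positivity) _ (by norm_num)
    gcongr
    linarith
  linarith

lemma Lam_nonneg {a b : ℝ} (ha : 0 ≤ a) (hb : 0 ≤ b) : 0 ≤ Lam a b := by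
  unfold Lam; positivity

lemma T_bound {ε : ℝ} (hε : 0 < ε) : ∃ C : ℝ, 0 < C ∧ ∀ χ, IsCubicSymbol χ → ∀ μ, IsMoebius μ →
    ∀ R Z : ℝ, 1 ≤ R → 1 ≤ Z → ∀ β : Eis → ℂ, (∀ n, ‖β n‖ ≤ 1) →
      ∑ r ∈ SF R, ‖∑ n ∈ nz Z, β n * chiC χ r n‖ ^ 2 ≤ C * (R * Z) ^ ε * Z * Lam R Z := by
  obtain ⟨C1, hC1, h1⟩ := large_sieve (ε := ε / 2) (by positivity)
  obtain ⟨C2, hC2, h2⟩ := key_sum (δ := ε / 4) (by positivity)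
  refine ⟨C2 ^ 2 * (C1 * 25), by positivity, ?_⟩
  intro χ hχ μ hμ R Z hR hZ β hβ
  have hL := Lam_nonneg (a := R) (b := Z) (by linarith) (by linarith)
  choose! K A hKA using exists_key
  set S := (nz Z).image K with hS
  have hSK : ∀ k ∈ S, Nm k ≤ Z ∧ IsKey k := by
    intro k hk
    obtain ⟨n, hn, rfl⟩ := Finset.mem_image.1 hk
    have hn' := mem_nz.1 hn
    obtain ⟨e1, e2, e3, e4⟩ := hKA n hn'.2
    exact ⟨(Nm_le_of_dvd hn'.2 ⟨_, e1⟩).trans hn'.1, e4⟩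
  have hW := h2 Z hZ S hSK
  have hW0 : 0 ≤ ∑ k ∈ S, Nm k ^ (-(1 / 2) : ℝ) := Finset.sum_nonneg fun _ _ => Real.rpow_nonneg (Nm_nn _) _
  set cf : Eis → Eis → ℂ := fun k a => if K (k * a) = k ∧ A (k * a) = a then β (k * a) else 0 with hcf
  have hcf1 : ∀ k a, ‖cf k a‖ ≤ 1 := by
    intro k a; simp only [hcf]; split_ifs
    · exact hβ _
    · simp
  have e1 : ∀ r ∈ SF R, ∑ n ∈ nz Z, β n * chiC χ r n = ∑ k ∈ S, chiC χ r k * ∑ a ∈ SF (Z / Nm k), cf k a * chiC χ a r := by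
    intro r hr
    have hr' := mem_SF.1 hr
    rw [← Finset.sum_fiberwise_of_maps_to (g := K) (t := S) (fun n hn => Finset.mem_image_of_mem _ hn)]
    refine Finset.sum_congr rfl fun k hk => ?_
    have hk0 := (hSK k hk).2.ne
    have hkN := Nm_pos hk0
    rw [Finset.mul_sum]
    have : ∀ a ∈ SF (Z / Nm k), chiC χ r k * (cf k a * chiC χ a r) = if K (k * a) = k ∧ A (k * a) = a then β (k * a) * chiC χ r (k * a) else 0 := by
      intro a ha
      have ha' := mem_SF.1 ha
      rw [chiC_mul hχ hr'.2.1, chiC_recip hχ ha'.2.1 hr'.2.1]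
      simp only [hcf]
      split_ifs <;> ring
    rw [Finset.sum_congr rfl this, ← Finset.sum_filter]
    refine Finset.sum_bij' (fun n _ => A n) (fun a _ => k * a) ?_ ?_ ?_ ?_ ?_
    · intro n hn
      obtain ⟨hn1, hn2⟩ := Finset.mem_filter.1 hn
      have hn' := mem_nz.1 hn1
      obtain ⟨e1, e2, e3, e4⟩ := hKA n hn'.2
      rw [hn2] at e1
      rw [Finset.mem_filter, mem_SF, ← e1]
      refine ⟨⟨?_, e2, e3⟩, hn2, rfl⟩
      rw [le_div_iff₀ hkN, mul_comm, ← Nm_mul, ← e1]; exact hn'.1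
    · intro a ha
      obtain ⟨ha1, ha2⟩ := Finset.mem_filter.1 ha
      have ha' := mem_SF.1 ha1
      rw [Finset.mem_filter, mem_nz]
      refine ⟨⟨?_, mul_ne_zero hk0 ha'.2.1.ne_zero⟩, ha2.1⟩
      have := (le_div_iff₀ hkN).1 ha'.1
      rw [Nm_mul]; linarith
    · intro n hn
      obtain ⟨hn1, hn2⟩ := Finset.mem_filter.1 hn
      have e1 := (hKA n (mem_nz.1 hn1).2).1
      rw [hn2] at e1
      exact e1.symm
    · intro a ha
      exact (Finset.mem_filter.1 ha).2.2
    · intro n hn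
      obtain ⟨hn1, hn2⟩ := Finset.mem_filter.1 hn
      have e1 := (hKA n (mem_nz.1 hn1).2).1
      rw [hn2] at e1
      rw [← e1]
  have e2 : ∀ r ∈ SF R, ‖∑ n ∈ nz Z, β n * chiC χ r n‖ ^ 2 ≤ (∑ k ∈ S, Nm k ^ (-(1 / 2) : ℝ)) * ∑ k ∈ S, Nm k ^ (1 / 2 : ℝ) * ‖∑ a ∈ SF (Z / Nm k), cf k a * chiC χ a r‖ ^ 2 := by
    intro r hr
    rw [e1 r hr]
    calc _ ≤ (∑ k ∈ S, ‖∑ a ∈ SF (Z / Nm k), cf k a * chiC χ a r‖) ^ 2 := by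
          gcongr
          refine (norm_sum_le _ _).trans (Finset.sum_le_sum fun k hk => ?_)
          rw [norm_mul]
          exact mul_le_of_le_one_left (norm_nonneg _) (chiC_norm_le hχ (mem_SF.1 hr).2.1 _)
      _ ≤ _ := by
          apply Finset.sum_sq_le_sum_mul_sum_of_sq_le_mul
          · intro k _; exact Real.rpow_nonneg (Nm_nn _) _
          · intro k _; have := Real.rpow_nonneg (Nm_nn k) (1 / 2); positivity
          · intro k hk
            have hkN := Nm_pos (hSK k hk).2.ne
            rw [← mul_assoc, ← Real.rpow_add hkN]; norm_num
  have e3 : ∀ k ∈ S, ∑ r ∈ SF R, ‖∑ a ∈ SF (Z / Nm k), cf k a * chiC χ a r‖ ^ 2 ≤ (C1 * (R * Z) ^ (ε / 2) * Lam R Z) * (25 * (Z / Nm k)) := by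
    intro k hk
    have hkN := Nm_pos (hSK k hk).2.ne
    have hk1 := one_le_Nm (hSK k hk).2.ne
    have hz1 : 1 ≤ Z / Nm k := by rw [one_le_div hkN]; exact (hSK k hk).1
    have hzZ : Z / Nm k ≤ Z := div_le_self (by linarith) hk1
    refine (h1 χ hχ μ hμ R (Z / Nm k) hR hz1 (cf k)).trans ?_
    have hR0 : 0 ≤ R := by linarith
    have hLam := Lam_mono hR0 (by linarith) le_rfl hzZ
    have hLam0 := Lam_nonneg (a := R) (b := Z / Nm k) hR0 (by linarith)
    have hs : ∑ n ∈ SF (Z / Nm k), ‖cf k n‖ ^ 2 ≤ 25 * (Z / Nm k) := by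
      refine le_trans ?_ (card_SF (by linarith))
      rw [Finset.card_eq_sum_ones, Nat.cast_sum]
      refine Finset.sum_le_sum fun a _ => ?_
      simpa using pow_le_one₀ (n := 2) (norm_nonneg _) (hcf1 k a)
    gcongr
  calc _ ≤ ∑ r ∈ SF R, (∑ k ∈ S, Nm k ^ (-(1 / 2) : ℝ)) * ∑ k ∈ S, Nm k ^ (1 / 2 : ℝ) * ‖∑ a ∈ SF (Z / Nm k), cf k a * chiC χ a r‖ ^ 2 := Finset.sum_le_sum e2
    _ = (∑ k ∈ S, Nm k ^ (-(1 / 2) : ℝ)) * ∑ k ∈ S, Nm k ^ (1 / 2 : ℝ) * ∑ r ∈ SF R, ‖∑ a ∈ SF (Z / Nm k), cf k a * chiC χ a r‖ ^ 2 := by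
        rw [← Finset.mul_sum, Finset.sum_comm]
        simp only [Finset.mul_sum]
    _ ≤ (∑ k ∈ S, Nm k ^ (-(1 / 2) : ℝ)) * ∑ k ∈ S, Nm k ^ (1 / 2 : ℝ) * ((C1 * (R * Z) ^ (ε / 2) * Lam R Z) * (25 * (Z / Nm k))) := by
        gcongr with k hk
        · exact Real.rpow_nonneg (Nm_nn _) _
        · exact e3 k hk
    _ = (∑ k ∈ S, Nm k ^ (-(1 / 2) : ℝ)) ^ 2 * ((C1 * (R * Z) ^ (ε / 2) * Lam R Z) * (25 * Z)) := by
        rw [pow_two, mul_assoc (∑ k ∈ S, Nm k ^ (-(1 / 2) : ℝ))]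
        congr 1
        rw [Finset.sum_mul]
        refine Finset.sum_congr rfl fun k hk => ?_
        have hkN := Nm_pos (hSK k hk).2.ne
        rw [show (-(1 / 2) : ℝ) = 1 / 2 + -1 by norm_num, Real.rpow_add hkN, Real.rpow_neg_one]
        field_simp
    _ ≤ (C2 * Z ^ (ε / 4)) ^ 2 * ((C1 * (R * Z) ^ (ε / 2) * Lam R Z) * (25 * Z)) := by gcongr
    _ = C2 ^ 2 * (C1 * 25) * (Z ^ (ε / 2) * (R * Z) ^ (ε / 2)) * Z * Lam R Z := by
        rw [mul_pow, ← Real.rpow_natCast (Z ^ (ε / 4)), ← Real.rpow_mul (by linarith)]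
        rw [show ε / 4 * ((2 : ℕ) : ℝ) = ε / 2 by push_cast; ring]; ring
    _ ≤ C2 ^ 2 * (C1 * 25) * ((R * Z) ^ (ε / 2) * (R * Z) ^ (ε / 2)) * Z * Lam R Z := by
        gcongr
        nlinarith
    _ = _ := by
        rw [← Real.rpow_add (by positivity)]; ring_nf

end P6e

section P6f
open scoped Classical
variable {χ : Eis → Eis → Eis}

lemma shell_dec (Z : ℝ) (hZ : 0 < Z) (f : Eis → ℂ) (k : ℕ) :
    ∑ n ∈ nz (Z * 2 ^ k), f n = ∑ i ∈ Finset.range (k + 1), ∑ n ∈ nz (Z * 2 ^ i), (if i = 0 ∨ Z * 2 ^ i < 2 * Nm n then f n else 0) := by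
  induction k with
  | zero => simp
  | succ k ih =>
    rw [Finset.sum_range_succ, ← ih, ← Finset.sum_filter_add_sum_filter_not (nz (Z * 2 ^ (k + 1))) (fun n => Nm n ≤ Z * 2 ^ k), ← Finset.sum_filter]
    congr 1
    · apply Finset.sum_congr _ fun _ _ => rfl
      ext n
      simp only [Finset.mem_filter, mem_nz]
      have : Z * 2 ^ k ≤ Z * 2 ^ (k + 1) := by gcongr <;> norm_num
      constructor
      · rintro ⟨h1, h2⟩; exact ⟨h2, h1.2⟩
      · rintro ⟨h1, h2⟩; exact ⟨⟨h1.trans this, h2⟩, h1⟩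
    · apply Finset.sum_congr _ fun _ _ => rfl
      ext n
      simp only [Finset.mem_filter, not_le, Nat.succ_ne_zero, false_or, and_congr_right_iff]
      intro _
      rw [pow_succ]
      constructor <;> intro h <;> nlinarith

lemma Lam_scale {R Z t : ℝ} (hR : 0 ≤ R) (hZ : 0 ≤ Z) (ht : 1 ≤ t) : Lam R (Z * t) ≤ t * Lam R Z := by
  unfold Lam
  have h1 : (R * (Z * t)) ^ (2 / 3 : ℝ) ≤ t * (R * Z) ^ (2 / 3 : ℝ) := by
    rw [← mul_assoc, Real.mul_rpow (by positivity) (by linarith), mul_comm]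
    gcongr
    calc t ^ (2 / 3 : ℝ) ≤ t ^ (1 : ℝ) := Real.rpow_le_rpow_of_exponent_le ht (by norm_num)
      _ = t := Real.rpow_one t
  nlinarith [mul_nonneg hR (sub_nonneg.2 ht)]

lemma Th_mean {ε : ℝ} (hε : 0 < ε) (hε1 : ε ≤ 1) : ∃ C : ℝ, 0 < C ∧ ∀ χ, IsCubicSymbol χ → ∀ μ, IsMoebius μ →
    ∀ s : Eis, Pri s → ∀ R Z y : ℝ, 1 ≤ R → 0 < y → 1 ≤ Z → 1 ≤ y * Z →
      ∑ r ∈ (SF R).filter (fun r => r * s ≠ 1), ‖Th (mixC χ r s) y‖ ^ 2 ≤ C * Real.exp (-(2 * Real.pi * y)) * (R * Z) ^ ε * Z * Lam R Z := by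
  obtain ⟨C1, hC1, h1⟩ := T_bound hε
  obtain ⟨C2, hC2, h2⟩ := exp_neg_le_rpow (s := 3) (x := Real.pi / 2) (by norm_num) (by positivity)
  refine ⟨4 * (C2 + 1) ^ 2 * C1, by positivity, ?_⟩
  intro χ hχ μ hμ s hs R Z y hR hy hZ hyZ
  have hL := Lam_nonneg (a := R) (b := Z) (by linarith) (by linarith)
  have hR0 : 0 < R := by linarith
  have hZ0 : 0 < Z := by linarith
  set g : Eis → ℂ := fun n => (starRingEnd ℂ) (chiC χ s n) * ((Real.exp (-(2 * Real.pi * y * Nm n)) : ℝ) : ℂ) with hg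
  set E := Real.exp (-(Real.pi * y)) with hE
  have hE0 : 0 < E := Real.exp_pos _
  set c : ℕ → ℝ := fun i => E * ((C2 + 1) * ((2 : ℝ) ^ i)⁻¹ ^ 3) with hc
  have hc0 : ∀ i, 0 < c i := fun i => by simp only [hc]; positivity
  set b : ℕ → Eis → ℂ := fun i n => if n ≠ 0 ∧ (i = 0 ∨ Z * 2 ^ i < 2 * Nm n) then g n else 0 with hb
  have hbc : ∀ i n, ‖b i n‖ ≤ c i := by
    intro i n
    simp only [hb]
    split_ifs with hn
    · have hn1 := one_le_Nm hn.1
      have hg1 : ‖g n‖ ≤ Real.exp (-(2 * Real.pi * y * Nm n)) := by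
        simp only [hg]
        rw [norm_mul, RCLike.norm_conj, Complex.norm_real, Real.norm_of_nonneg (Real.exp_nonneg _)]
        exact mul_le_of_le_one_left (Real.exp_nonneg _) (chiC_norm_le hχ hs _)
      have hg2 : Real.exp (-(2 * Real.pi * y * Nm n)) ≤ E * Real.exp (-(Real.pi * (y * Nm n))) := by
        rw [hE, ← Real.exp_add]
        apply Real.exp_le_exp.2
        have : Real.pi * y * 1 ≤ Real.pi * y * Nm n := by gcongr
        nlinarith
      refine hg1.trans (hg2.trans ?_)
      simp only [hc]
      gcongr
      rcases hn.2 with h0 | h0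
      · rw [h0]
        have : Real.exp (-(Real.pi * (y * Nm n))) ≤ 1 := Real.exp_le_one_iff.2 (by have := Nm_nn n; have : 0 ≤ Real.pi * (y * Nm n) := by positivity
                                                                                   linarith)
        simp; linarith
      · have h3 : (2 : ℝ) ^ i ≤ 2 * (y * Nm n) := by
          have h5 : y * (Z * 2 ^ i) ≤ y * (2 * Nm n) := by gcongr
          have h6 : (2 : ℝ) ^ i ≤ (y * Z) * 2 ^ i := le_mul_of_one_le_left (by positivity) hyZ
          linarith
        have h4 : Real.exp (-(Real.pi * (y * Nm n))) ≤ Real.exp (-(Real.pi / 2 * 2 ^ i)) := by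
          apply Real.exp_le_exp.2
          have := mul_le_mul_of_nonneg_left h3 (Real.pi_pos.le)
          linarith
        refine h4.trans ((h2 _ (by positivity)).trans ?_)
        have h5 : (1 + (2 : ℝ) ^ i) ^ (-(3 : ℝ)) ≤ ((2 : ℝ) ^ i)⁻¹ ^ 3 := by
          rw [Real.rpow_neg (by positivity), inv_pow]
          gcongr
          rw [show (3 : ℝ) = ((3 : ℕ) : ℝ) by norm_num, Real.rpow_natCast]
          gcongr
          linarith
        have h6 : C2 ≤ C2 + 1 := by linarith
        gcongr
    · rw [norm_zero]; exact (hc0 i).le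
  have hshell : ∀ i, ∑ r ∈ SF R, ‖∑ n ∈ nz (Z * 2 ^ i), b i n * chiC χ r n‖ ^ 2 ≤ (c i) ^ 2 * (C1 * (R * (Z * 2 ^ i)) ^ ε * (Z * 2 ^ i) * Lam R (Z * 2 ^ i)) := by
    intro i
    have h3 := h1 χ hχ μ hμ R (Z * 2 ^ i) hR (one_le_mul_of_one_le_of_one_le hZ (one_le_pow₀ (by norm_num))) (fun n => ((c i)⁻¹ : ℝ) * b i n) (by
      intro n
      rw [norm_mul, Complex.norm_real, norm_inv, Real.norm_of_nonneg (hc0 i).le, inv_mul_le_one₀ (hc0 i)]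
      exact hbc i n)
    have h4 : ∀ r ∈ SF R, ‖∑ n ∈ nz (Z * 2 ^ i), b i n * chiC χ r n‖ ^ 2 = (c i) ^ 2 * ‖∑ n ∈ nz (Z * 2 ^ i), (((c i)⁻¹ : ℝ) * b i n) * chiC χ r n‖ ^ 2 := by
      intro r _
      simp_rw [mul_assoc]
      rw [← Finset.mul_sum, norm_mul, Complex.norm_real, norm_inv, Real.norm_of_nonneg (hc0 i).le, ← mul_pow (c i)]
      rw [← mul_assoc, mul_inv_cancel₀ (hc0 i).ne', one_mul]
    rw [Finset.sum_congr rfl h4, ← Finset.mul_sum]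
    gcongr
  have hshell2 : ∀ i : ℕ, (2 : ℝ) ^ i * ((c i) ^ 2 * (C1 * (R * (Z * 2 ^ i)) ^ ε * (Z * 2 ^ i) * Lam R (Z * 2 ^ i))) ≤ (1 / 2 : ℝ) ^ i * (E ^ 2 * (C2 + 1) ^ 2 * C1 * (R * Z) ^ ε * Z * Lam R Z) := by
    intro i
    set t : ℝ := (2 : ℝ) ^ i with ht
    have ht1 : 1 ≤ t := one_le_pow₀ (by norm_num)
    have ht0 : 0 < t := by linarith
    have e1 : (R * (Z * t)) ^ ε ≤ t * (R * Z) ^ ε := by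
      rw [← mul_assoc, Real.mul_rpow (by positivity) ht0.le, mul_comm]
      gcongr
      calc t ^ ε ≤ t ^ (1 : ℝ) := Real.rpow_le_rpow_of_exponent_le ht1 hε1
        _ = t := Real.rpow_one t
    have e2 := Lam_scale hR0.le hZ0.le ht1
    have e3 : (1 / 2 : ℝ) ^ i = t⁻¹ := by rw [ht]; simp
    have e4 := Lam_nonneg (a := R) (b := Z * t) (by linarith) (by positivity)
    rw [e3]
    have e5 : t⁻¹ ≤ 1 := inv_le_one_of_one_le₀ ht1
    calc t * ((c i) ^ 2 * (C1 * (R * (Z * t)) ^ ε * (Z * t) * Lam R (Z * t))) ≤ t * ((c i) ^ 2 * (C1 * (t * (R * Z) ^ ε) * (Z * t) * (t * Lam R Z))) := by gcongr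
      _ = (t⁻¹ * t⁻¹) * (E ^ 2 * (C2 + 1) ^ 2 * C1 * (R * Z) ^ ε * Z * Lam R Z) := by
          simp only [hc, ← ht]
          field_simp
      _ ≤ (t⁻¹ * 1) * (E ^ 2 * (C2 + 1) ^ 2 * C1 * (R * Z) ^ ε * Z * Lam R Z) := by gcongr
      _ = _ := by rw [mul_one]
  have hgeo : ∀ k, ∑ i ∈ Finset.range k, (1 / 2 : ℝ) ^ i ≤ 2 := sum_geometric_two_le
  set B := E ^ 2 * (C2 + 1) ^ 2 * C1 * (R * Z) ^ ε * Z * Lam R Z with hB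
  have hB0 : 0 ≤ B := by positivity
  have hfin : ∀ k : ℕ, ∑ r ∈ SF R, ‖∑ n ∈ nz (Z * 2 ^ k), g n * chiC χ r n‖ ^ 2 ≤ 4 * B := by
    intro k
    have e1 : ∀ r ∈ SF R, ‖∑ n ∈ nz (Z * 2 ^ k), g n * chiC χ r n‖ ^ 2 ≤ 2 * ∑ i ∈ Finset.range (k + 1), (2 : ℝ) ^ i * ‖∑ n ∈ nz (Z * 2 ^ i), b i n * chiC χ r n‖ ^ 2 := by
      intro r hr
      have e2 : ∑ n ∈ nz (Z * 2 ^ k), g n * chiC χ r n = ∑ i ∈ Finset.range (k + 1), ∑ n ∈ nz (Z * 2 ^ i), b i n * chiC χ r n := by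
        rw [shell_dec Z hZ0]
        refine Finset.sum_congr rfl fun i _ => Finset.sum_congr rfl fun n hn => ?_
        have hn0 := (mem_nz.1 hn).2
        simp only [hb]
        by_cases h : i = 0 ∨ Z * 2 ^ i < 2 * Nm n
        · rw [if_pos h, if_pos ⟨hn0, h⟩]
        · rw [if_neg h, if_neg (fun h' => h h'.2), zero_mul]
      rw [e2]
      calc _ ≤ (∑ i ∈ Finset.range (k + 1), ‖∑ n ∈ nz (Z * 2 ^ i), b i n * chiC χ r n‖) ^ 2 := by
            gcongr; exact norm_sum_le _ _
        _ ≤ (∑ i ∈ Finset.range (k + 1), (1 / 2 : ℝ) ^ i) * ∑ i ∈ Finset.range (k + 1), (2 : ℝ) ^ i * ‖∑ n ∈ nz (Z * 2 ^ i), b i n * chiC χ r n‖ ^ 2 := by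
            apply Finset.sum_sq_le_sum_mul_sum_of_sq_le_mul
            · intro i _; positivity
            · intro i _; positivity
            · intro i _
              rw [← mul_assoc, ← mul_pow]; norm_num
        _ ≤ _ := by
            gcongr
            exact hgeo _
    calc _ ≤ ∑ r ∈ SF R, 2 * ∑ i ∈ Finset.range (k + 1), (2 : ℝ) ^ i * ‖∑ n ∈ nz (Z * 2 ^ i), b i n * chiC χ r n‖ ^ 2 := Finset.sum_le_sum e1
      _ = 2 * ∑ i ∈ Finset.range (k + 1), (2 : ℝ) ^ i * ∑ r ∈ SF R, ‖∑ n ∈ nz (Z * 2 ^ i), b i n * chiC χ r n‖ ^ 2 := by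
          rw [← Finset.mul_sum, Finset.sum_comm]
          simp only [Finset.mul_sum]
      _ ≤ 2 * ∑ i ∈ Finset.range (k + 1), (1 / 2 : ℝ) ^ i * B := by
          refine mul_le_mul_of_nonneg_left (Finset.sum_le_sum fun i hi => ?_) (by norm_num)
          exact (mul_le_mul_of_nonneg_left (hshell i) (by positivity)).trans (hshell2 i)
      _ = 2 * ((∑ i ∈ Finset.range (k + 1), (1 / 2 : ℝ) ^ i) * B) := by rw [Finset.sum_mul]
      _ ≤ 2 * (2 * B) := by gcongr; exact hgeo _
      _ = _ := by ring
  have hlim : ∀ r ∈ (SF R).filter (fun r => r * s ≠ 1), Filter.Tendsto (fun k : ℕ => ‖∑ n ∈ nz (Z * 2 ^ k), g n * chiC χ r n‖ ^ 2) Filter.atTop (nhds (‖Th (mixC χ r s) y‖ ^ 2)) := by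
    intro r hr
    obtain ⟨hr1, hr2⟩ := Finset.mem_filter.1 hr
    have hrp := (mem_SF.1 hr1).2.1
    apply Filter.Tendsto.pow
    apply Filter.Tendsto.norm
    have hsm : Summable fun m => mixC χ r s m * ((Real.exp (-(2 * Real.pi * y * Nm m)) : ℝ) : ℂ) := summable_Th (fun m => mixC_norm_le hχ hrp hs m) (by positivity)
    have ht : Filter.Tendsto (fun k : ℕ => insert (0 : Eis) (nz (Z * 2 ^ k))) Filter.atTop Filter.atTop := by
      apply Filter.tendsto_atTop_finset_of_monotone
      · intro i j hij
        apply Finset.insert_subset_insert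
        intro n hn
        rw [mem_nz] at hn ⊢
        refine ⟨hn.1.trans ?_, hn.2⟩
        gcongr
        norm_num
      · intro n
        obtain ⟨k, hk⟩ := pow_unbounded_of_one_lt (Nm n) (show (1 : ℝ) < 2 by norm_num)
        refine ⟨k, ?_⟩
        rw [Finset.mem_insert, mem_nz]
        by_cases hn : n = 0
        · exact Or.inl hn
        · refine Or.inr ⟨hk.le.trans (le_mul_of_one_le_left (by positivity) hZ), hn⟩
    have := hsm.hasSum.comp ht
    refine this.congr fun k => ?_
    have h0 : mixC χ r s 0 = 0 := by
      have : ¬ (IsCoprime 0 r ∧ IsCoprime 0 s) := by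
        rw [isCoprime_zero_left, isCoprime_zero_left]
        rintro ⟨ha, hb⟩
        exact hr2 (by rw [pri_unit_eq_one ha hrp, pri_unit_eq_one hb hs, mul_one])
      rw [not_and_or] at this
      unfold mixC chiC
      rcases this with h | h
      · rw [(chi_ne hχ hrp).2 h]; simp
      · rw [(chi_ne hχ hs).2 h]; simp
    rw [Function.comp_apply, Finset.sum_insert (by rw [mem_nz]; simp), h0, zero_mul, zero_add]
    refine Finset.sum_congr rfl fun n _ => ?_
    simp only [hg, mixC]; ring
  have hfinal : ∑ r ∈ (SF R).filter (fun r => r * s ≠ 1), ‖Th (mixC χ r s) y‖ ^ 2 ≤ 4 * B := by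
    refine le_of_tendsto (tendsto_finsetSum _ hlim) (Filter.Eventually.of_forall fun k => ?_)
    exact (Finset.sum_le_sum_of_subset_of_nonneg (Finset.filter_subset _ _) (fun _ _ _ => by positivity)).trans (hfin k)
  refine hfinal.trans (le_of_eq ?_)
  rw [hB, hE, ← Real.exp_nat_mul]
  rw [show ((2 : ℕ) : ℝ) * -(Real.pi * y) = -(2 * Real.pi * y) by push_cast; ring]
  ring

end P6f

section P6g
open scoped Classical
variable {χ : Eis → Eis → Eis}

open MeasureTheory in
lemma int_cs {f g : ℝ → ℝ} {w : ℝ} (hf : ∀ v ∈ Set.Ioi w, 0 ≤ f v) (hg : ∀ v ∈ Set.Ioi w, 0 ≤ g v)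
    (mf : AEStronglyMeasurable f (volume.restrict (Set.Ioi w))) (mg : AEStronglyMeasurable g (volume.restrict (Set.Ioi w)))
    (hf2 : IntegrableOn (fun v => f v ^ 2) (Set.Ioi w)) (hg2 : IntegrableOn (fun v => g v ^ 2) (Set.Ioi w)) :
    (∫ v in Set.Ioi w, f v * g v) ^ 2 ≤ (∫ v in Set.Ioi w, f v ^ 2) * ∫ v in Set.Ioi w, g v ^ 2 := by
  have hf' : 0 ≤ᵐ[volume.restrict (Set.Ioi w)] f := by
    filter_upwards [ae_restrict_mem measurableSet_Ioi] with v hv using hf v hv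
  have hg' : 0 ≤ᵐ[volume.restrict (Set.Ioi w)] g := by
    filter_upwards [ae_restrict_mem measurableSet_Ioi] with v hv using hg v hv
  have h := integral_mul_le_Lp_mul_Lq_of_nonneg (p := 2) (q := 2) (Real.HolderConjugate.two_two) hf' hg'
    (by simpa using (memLp_two_iff_integrable_sq mf).2 hf2) (by simpa using (memLp_two_iff_integrable_sq mg).2 hg2)
  have h0 : 0 ≤ ∫ v in Set.Ioi w, f v * g v := setIntegral_nonneg measurableSet_Ioi fun v hv => mul_nonneg (hf v hv) (hg v hv)
  simp only [Real.rpow_two] at h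
  have a1 : 0 ≤ ∫ v in Set.Ioi w, f v ^ 2 := integral_nonneg fun _ => sq_nonneg _
  have a2 : 0 ≤ ∫ v in Set.Ioi w, g v ^ 2 := integral_nonneg fun _ => sq_nonneg _
  calc _ ≤ _ := pow_le_pow_left₀ h0 h 2
    _ = _ := by
      rw [mul_pow, ← Real.sqrt_eq_rpow, ← Real.sqrt_eq_rpow, Real.sq_sqrt a1, Real.sq_sqrt a2]

open MeasureTheory in
lemma I_mean {ε : ℝ} (hε : 0 < ε) (hε1 : ε ≤ 1) : ∃ C : ℝ, 0 < C ∧ ∀ χ, IsCubicSymbol χ → ∀ μ, IsMoebius μ →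
    ∀ s : Eis, Pri s → ∀ R w : ℝ, 1 ≤ R → 0 < w → w ≤ 1 →
      ∑ r ∈ (SF R).filter (fun r => r * s ≠ 1), (∫ v in Set.Ioi w, v ^ (-(1 / 2) : ℝ) * ‖Th (mixC χ r s) v‖) ^ 2
        ≤ C * (R / w) ^ (2 * ε) * Lam R (1 / w) := by
  obtain ⟨C1, hC1, h1⟩ := Th_mean hε hε1
  obtain ⟨C2, hC2, h2⟩ := Th_decay (s := 3) (by norm_num)
  have G1 := Real.GammaIntegral_convergent (s := ε) hε
  have G2 := Real.GammaIntegral_convergent (s := ε + 1) (by linarith)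
  set K := ∫ v in Set.Ioi (0 : ℝ), (Real.exp (-v) * v ^ (ε - 1) + Real.exp (-v) * v ^ (ε + 1 - 1)) with hK
  have hK0 : 0 ≤ K := setIntegral_nonneg measurableSet_Ioi fun v hv => by
    have : (0 : ℝ) < v := hv
    positivity
  refine ⟨ε⁻¹ * (C1 * (K + 1)), by positivity, ?_⟩
  intro χ hχ μ hμ s hs R w hR hw hw1
  have hR0 : 0 < R := by linarith
  have hw1' : 1 ≤ 1 / w := by rw [le_div_iff₀ hw]; linarith
  have hL := Lam_nonneg (a := R) (b := 1 / w) (by linarith) (by positivity)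
  set S := (SF R).filter (fun r => r * s ≠ 1) with hS
  have hzero : ∀ r ∈ S, (∀ m, ‖mixC χ r s m‖ ≤ 1) ∧ mixC χ r s 0 = 0 := by
    intro r hr
    obtain ⟨hr1, hr2⟩ := Finset.mem_filter.1 hr
    have hrp := (mem_SF.1 hr1).2.1
    refine ⟨mixC_norm_le hχ hrp hs, ?_⟩
    have : ¬ (IsCoprime 0 r ∧ IsCoprime 0 s) := by
      rw [isCoprime_zero_left, isCoprime_zero_left]
      rintro ⟨ha, hb⟩
      exact hr2 (by rw [pri_unit_eq_one ha hrp, pri_unit_eq_one hb hs, mul_one])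
    rw [not_and_or] at this
    unfold mixC chiC
    rcases this with h | h
    · rw [(chi_ne hχ hrp).2 h]; simp
    · rw [(chi_ne hχ hs).2 h]; simp
  have hIntg : ∀ r ∈ S, IntegrableOn (fun v => (v ^ (ε / 2) * ‖Th (mixC χ r s) v‖) ^ 2) (Set.Ioi w) := by
    intro r hr
    obtain ⟨hb, h0⟩ := hzero r hr
    refine Integrable.mono' ((integrableOn_Ioi_rpow_of_lt (a := ε - 6) (by linarith) hw).const_mul (C2 ^ 2)) ((Th_meas hb hw.le _).pow 2) ?_
    filter_upwards [ae_restrict_mem measurableSet_Ioi] with v hv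
    have hv0 : 0 < v := hw.trans hv
    rw [Real.norm_of_nonneg (by positivity)]
    calc (v ^ (ε / 2) * ‖Th (mixC χ r s) v‖) ^ 2 ≤ (v ^ (ε / 2) * (C2 * v ^ (-(3 : ℝ)))) ^ 2 := by
          gcongr; exact h2 _ hb h0 v hv0
      _ = C2 ^ 2 * ((v ^ (ε / 2)) ^ 2 * (v ^ (-(3 : ℝ))) ^ 2) := by ring
      _ = _ := by
          rw [← Real.rpow_natCast (v ^ (ε / 2)), ← Real.rpow_natCast (v ^ (-(3 : ℝ))), ← Real.rpow_mul hv0.le, ← Real.rpow_mul hv0.le, ← Real.rpow_add hv0]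
          congr 2; push_cast; ring
  have hcs : ∀ r ∈ S, (∫ v in Set.Ioi w, v ^ (-(1 / 2) : ℝ) * ‖Th (mixC χ r s) v‖) ^ 2 ≤ (w ^ (-ε) / ε) * ∫ v in Set.Ioi w, (v ^ (ε / 2) * ‖Th (mixC χ r s) v‖) ^ 2 := by
    intro r hr
    obtain ⟨hb, h0⟩ := hzero r hr
    have e1 : ∀ v ∈ Set.Ioi w, v ^ (-(1 / 2) : ℝ) * ‖Th (mixC χ r s) v‖ = v ^ (-(1 / 2) - ε / 2 : ℝ) * (v ^ (ε / 2) * ‖Th (mixC χ r s) v‖) := by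
      intro v hv
      have hv0 : 0 < v := hw.trans hv
      rw [← mul_assoc, ← Real.rpow_add hv0]; congr 2; ring
    have e2 : ∀ v ∈ Set.Ioi w, (v ^ (-(1 / 2) - ε / 2 : ℝ)) ^ 2 = v ^ (-1 - ε) := by
      intro v hv
      have hv0 : 0 < v := hw.trans hv
      rw [← Real.rpow_natCast, ← Real.rpow_mul hv0.le]; congr 1; push_cast; ring
    have i1 : IntegrableOn (fun v : ℝ => v ^ (-1 - ε)) (Set.Ioi w) := integrableOn_Ioi_rpow_of_lt (by linarith) hw
    have e3 : ∫ v in Set.Ioi w, (v ^ (-(1 / 2) - ε / 2 : ℝ)) ^ 2 = w ^ (-ε) / ε := by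
      rw [setIntegral_congr_fun measurableSet_Ioi e2, integral_Ioi_rpow_of_lt (by linarith) hw]
      rw [show -1 - ε + 1 = -ε by ring, neg_div_neg_eq]
    rw [setIntegral_congr_fun measurableSet_Ioi e1, ← e3]
    apply int_cs
    · intro v hv
      have hv0 : 0 < v := hw.trans hv
      positivity
    · intro v hv
      have hv0 : 0 < v := hw.trans hv
      positivity
    · apply ContinuousOn.aestronglyMeasurable _ measurableSet_Ioi
      intro v hv
      exact (Real.continuousAt_rpow_const v _ (Or.inl (hw.trans hv).ne')).continuousWithinAt
    · exact Th_meas hb hw.le _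
    · exact i1.congr_fun (fun v hv => (e2 v hv).symm) measurableSet_Ioi
    · exact hIntg r hr
  have hsum : ∑ r ∈ S, ∫ v in Set.Ioi w, (v ^ (ε / 2) * ‖Th (mixC χ r s) v‖) ^ 2 ≤ (C1 * (R / w) ^ ε * Lam R (1 / w)) * K := by
    rw [← integral_finsetSum _ hIntg]
    have hsub : Set.Ioi w ⊆ Set.Ioi 0 := Set.Ioi_subset_Ioi hw.le
    have GG := G1.add G2
    calc _ ≤ ∫ v in Set.Ioi w, (C1 * (R / w) ^ ε * Lam R (1 / w)) * (Real.exp (-v) * v ^ (ε - 1) + Real.exp (-v) * v ^ (ε + 1 - 1)) := by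
          apply setIntegral_mono_on (integrable_finsetSum _ hIntg) _ measurableSet_Ioi
          · intro v hv
            have hv0 : 0 < v := hw.trans hv
            have hvw : w < v := hv
            set Z := max 1 (1 / v) with hZ
            have hZ1 : 1 ≤ Z := le_max_left _ _
            have hZv : 1 ≤ v * Z := by
              calc (1 : ℝ) = v * (1 / v) := by field_simp
                _ ≤ v * Z := by gcongr; exact le_max_right _ _
            have hZw : Z ≤ 1 / w := max_le hw1' (one_div_le_one_div_of_le hw hvw.le)
            have hZs : Z ≤ 1 + 1 / v := max_le (by have : 0 ≤ 1 / v := by positivity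
                                                   linarith) (by linarith)
            have hLZ := Lam_mono (a := R) (b := R) (c := Z) (d := 1 / w) hR0.le (by linarith) le_rfl hZw
            have hLZ0 := Lam_nonneg (a := R) (b := Z) hR0.le (by linarith)
            have e1 : ∀ r ∈ S, (v ^ (ε / 2) * ‖Th (mixC χ r s) v‖) ^ 2 = v ^ ε * ‖Th (mixC χ r s) v‖ ^ 2 := by
              intro r _
              rw [mul_pow, ← Real.rpow_natCast (v ^ (ε / 2)), ← Real.rpow_mul hv0.le]; congr 2; push_cast; ring
            rw [Finset.sum_congr rfl e1, ← Finset.mul_sum]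
            calc _ ≤ v ^ ε * (C1 * Real.exp (-(2 * Real.pi * v)) * (R * Z) ^ ε * Z * Lam R Z) := by
                  gcongr; exact h1 χ hχ μ hμ s hs R Z v hR hv0 hZ1 hZv
              _ ≤ v ^ ε * (C1 * Real.exp (-v) * (R / w) ^ ε * (1 + 1 / v) * Lam R (1 / w)) := by
                  have : Real.exp (-(2 * Real.pi * v)) ≤ Real.exp (-v) := by
                    apply Real.exp_le_exp.2
                    have := Real.pi_gt_three
                    nlinarith
                  have h3 : R * Z ≤ R / w := by
                    rw [div_eq_mul_one_div]; gcongr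
                  gcongr
              _ = (C1 * (R / w) ^ ε * Lam R (1 / w)) * (Real.exp (-v) * (v ^ ε * (1 / v)) + Real.exp (-v) * v ^ ε) := by ring
              _ = _ := by
                  rw [show ε + 1 - 1 = ε by ring, Real.rpow_sub_one hv0.ne' ε, div_eq_mul_one_div (v ^ ε)]
          · exact (GG.mono_set hsub).const_mul _
      _ = (C1 * (R / w) ^ ε * Lam R (1 / w)) * ∫ v in Set.Ioi w, (Real.exp (-v) * v ^ (ε - 1) + Real.exp (-v) * v ^ (ε + 1 - 1)) := integral_const_mul _ _
      _ ≤ _ := by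
          gcongr
          apply setIntegral_mono_set GG
          · filter_upwards [ae_restrict_mem measurableSet_Ioi] with v hv
            have hv0 : (0 : ℝ) < v := hv
            show (0 : ℝ) ≤ Real.exp (-v) * v ^ (ε - 1) + Real.exp (-v) * v ^ (ε + 1 - 1)
            positivity
          · exact hsub.eventuallyLE
  calc _ ≤ ∑ r ∈ S, (w ^ (-ε) / ε) * ∫ v in Set.Ioi w, (v ^ (ε / 2) * ‖Th (mixC χ r s) v‖) ^ 2 := Finset.sum_le_sum hcs
    _ = (w ^ (-ε) / ε) * ∑ r ∈ S, ∫ v in Set.Ioi w, (v ^ (ε / 2) * ‖Th (mixC χ r s) v‖) ^ 2 := by rw [Finset.mul_sum]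
    _ ≤ (w ^ (-ε) / ε) * ((C1 * (R / w) ^ ε * Lam R (1 / w)) * K) := by gcongr
    _ ≤ ((R / w) ^ ε / ε) * ((C1 * (R / w) ^ ε * Lam R (1 / w)) * (K + 1)) := by
        gcongr
        · rw [Real.rpow_neg hw.le, ← Real.inv_rpow hw.le]
          apply Real.rpow_le_rpow (by positivity) _ hε.le
          rw [inv_eq_one_div]; gcongr
        · linarith
    _ = ε⁻¹ * (C1 * (K + 1)) * ((R / w) ^ ε * (R / w) ^ ε) * Lam R (1 / w) := by ring
    _ = _ := by rw [← Real.rpow_add (by positivity)]; ring_nf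

end P6g

section P7a
open scoped Classical
variable {χ : Eis → Eis → Eis}

/-- admissible mollifier coefficients -/
def Adm (Cl : ℝ → ℝ) (M : ℝ) (lm : Eis → ℂ) : Prop :=
  (∀ b : Eis, lm b ≠ 0 → Rep b ∧ Squarefree b ∧ IsCoprime b 3 ∧ Nm b ≤ M) ∧
  (∀ ε' : ℝ, 0 < ε' → ∀ b : Eis, ‖lm b‖ ≤ Cl ε' * Nm b ^ (-1 + ε'))

lemma Adm.mem_SF {Cl : ℝ → ℝ} {M : ℝ} {lm : Eis → ℂ} (h : Adm Cl M lm) {b : Eis} (hb : lm b ≠ 0) : b ∈ SF M := by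
  obtain ⟨⟨k, c, hc, rfl⟩, hsq, hco, hM⟩ := h.1 b hb
  rw [CubicPaper.mem_SF]
  refine ⟨hM, ?_, hsq⟩
  rcases Nat.eq_zero_or_pos k with rfl | hk
  · simpa [Pri] using hc
  · exfalso
    have h1 : lam ∣ lam ^ k * c := (dvd_pow_self _ hk.ne').mul_right _
    exact prime_lam.not_isUnit (hco.isUnit_of_dvd' h1 lam_dvd_three)

lemma Moll_eq {Cl : ℝ → ℝ} {M : ℝ} {lm : Eis → ℂ} (h : Adm Cl M lm) (q : Eis) :
    Moll χ lm q = ∑ b ∈ SF M, lm b * (Real.sqrt (Nm b) : ℂ) * chiC χ q b := by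
  unfold Moll
  apply finsum_eq_sum_of_support_subset
  intro b hb
  rw [Function.mem_support] at hb
  apply h.mem_SF
  intro h0
  apply hb
  rw [h0]; simp

lemma coef_norm {Cl : ℝ → ℝ} {M : ℝ} {lm : Eis → ℂ} (h : Adm Cl M lm) {ε' : ℝ} (hε : 0 < ε') {b : Eis} (hb : b ∈ SF M) :
    ‖lm b * (Real.sqrt (Nm b) : ℂ)‖ ≤ |Cl ε'| * Nm b ^ (-(1 / 2) + ε') := by
  have hb0 := Nm_pos (mem_SF.1 hb).2.1.ne_zero
  rw [norm_mul, Complex.norm_real, Real.norm_of_nonneg (Real.sqrt_nonneg _), Real.sqrt_eq_rpow]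
  calc _ ≤ (|Cl ε'| * Nm b ^ (-1 + ε')) * Nm b ^ (1 / 2 : ℝ) := by
        gcongr
        refine (h.2 ε' hε b).trans ?_
        gcongr
        exact le_abs_self _
    _ = _ := by
        rw [mul_assoc, ← Real.rpow_add hb0]; congr 2; ring

lemma coef_sq {δ : ℝ} (hδ : 0 < δ) (Cl : ℝ → ℝ) : ∃ C : ℝ, 0 < C ∧ ∀ M : ℝ, 1 ≤ M → ∀ lm, Adm Cl M lm →
    ∑ b ∈ SF M, ‖lm b * (Real.sqrt (Nm b) : ℂ)‖ ^ 2 ≤ C * M ^ (3 * δ) := by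
  obtain ⟨C1, hC1, h1⟩ := sum_Nm_le (s := 1 + δ) (by linarith)
  refine ⟨(|Cl δ| + 1) ^ 2 * C1, by positivity, ?_⟩
  intro M hM lm h
  calc _ ≤ ∑ b ∈ SF M, ((|Cl δ| + 1) ^ 2 * M ^ (3 * δ)) * Nm b ^ (-(1 + δ)) := by
        refine Finset.sum_le_sum fun b hb => ?_
        have hb' := mem_SF.1 hb
        have hb0 := Nm_pos hb'.2.1.ne_zero
        calc _ ≤ ((|Cl δ| + 1) * Nm b ^ (-(1 / 2) + δ)) ^ 2 := by
              refine pow_le_pow_left₀ (norm_nonneg _) ((coef_norm h hδ hb).trans ?_) 2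
              gcongr
              linarith
          _ = (|Cl δ| + 1) ^ 2 * (Nm b ^ (3 * δ) * Nm b ^ (-(1 + δ))) := by
              rw [mul_pow, ← Real.rpow_natCast (Nm b ^ _), ← Real.rpow_mul hb0.le, ← Real.rpow_add hb0]
              congr 2; push_cast; ring
          _ ≤ (|Cl δ| + 1) ^ 2 * (M ^ (3 * δ) * Nm b ^ (-(1 + δ))) := by
              gcongr
              exact hb'.1
          _ = _ := by ring
    _ = ((|Cl δ| + 1) ^ 2 * M ^ (3 * δ)) * ∑ b ∈ SF M, Nm b ^ (-(1 + δ)) := by rw [Finset.mul_sum]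
    _ ≤ ((|Cl δ| + 1) ^ 2 * M ^ (3 * δ)) * C1 := by gcongr; exact h1 _
    _ = _ := by ring

lemma Moll_triv {δ : ℝ} (hδ : 0 < δ) (Cl : ℝ → ℝ) : ∃ C : ℝ, 0 < C ∧ ∀ χ, IsCubicSymbol χ → ∀ M : ℝ, 1 ≤ M → ∀ lm, Adm Cl M lm →
    ∀ q, Pri q → ‖Moll χ lm q‖ ≤ C * M ^ (1 / 2 + 2 * δ) := by
  obtain ⟨C1, hC1, h1⟩ := sum_Nm_le (s := 1 + δ) (by linarith)
  refine ⟨(|Cl δ| + 1) * C1, by positivity, ?_⟩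
  intro χ hχ M hM lm h q hq
  rw [Moll_eq h]
  calc _ ≤ ∑ b ∈ SF M, ((|Cl δ| + 1) * M ^ (1 / 2 + 2 * δ)) * Nm b ^ (-(1 + δ)) := by
        refine (norm_sum_le _ _).trans (Finset.sum_le_sum fun b hb => ?_)
        have hb' := mem_SF.1 hb
        have hb0 := Nm_pos hb'.2.1.ne_zero
        rw [norm_mul]
        calc _ ≤ ((|Cl δ| + 1) * Nm b ^ (-(1 / 2) + δ)) * 1 := by
              refine mul_le_mul ((coef_norm h hδ hb).trans ?_) (chiC_norm_le hχ hq _) (norm_nonneg _) (by positivity)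
              gcongr
              linarith
          _ = (|Cl δ| + 1) * (Nm b ^ (1 / 2 + 2 * δ) * Nm b ^ (-(1 + δ))) := by
              rw [← Real.rpow_add hb0, mul_one]; congr 2; ring
          _ ≤ (|Cl δ| + 1) * (M ^ (1 / 2 + 2 * δ) * Nm b ^ (-(1 + δ))) := by
              gcongr
              exact hb'.1
          _ = _ := by ring
    _ = ((|Cl δ| + 1) * M ^ (1 / 2 + 2 * δ)) * ∑ b ∈ SF M, Nm b ^ (-(1 + δ)) := by rw [Finset.mul_sum]
    _ ≤ ((|Cl δ| + 1) * M ^ (1 / 2 + 2 * δ)) * C1 := by gcongr; exact h1 _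
    _ = _ := by ring

lemma Moll_mean {δ : ℝ} (hδ : 0 < δ) (Cl : ℝ → ℝ) : ∃ C : ℝ, 0 < C ∧ ∀ χ, IsCubicSymbol χ → ∀ μ, IsMoebius μ →
    ∀ M R : ℝ, 1 ≤ M → 1 ≤ R → ∀ lm, Adm Cl M lm → ∀ p t : Eis, Pri p → Pri t → ∀ q : Eis → Eis,
    ((∀ x, q x = x * p ^ 2 * t ^ 3) ∨ (∀ x, q x = p * x ^ 2 * t ^ 3)) →
    ∑ x ∈ SF R, ‖Moll χ lm (q x)‖ ^ 2 ≤ C * (R * M) ^ δ * M ^ (3 * δ) * Lam R M := by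
  obtain ⟨C1, hC1, h1⟩ := large_sieve hδ
  obtain ⟨C2, hC2, h2⟩ := coef_sq hδ Cl
  refine ⟨C1 * C2, by positivity, ?_⟩
  intro χ hχ μ hμ M R hM hR lm h p t hp ht q hq
  have hL := Lam_nonneg (a := R) (b := M) (by linarith) (by linarith)
  have hG : 0 ≤ C1 * (R * M) ^ δ * Lam R M := by positivity
  have hls := h1 χ hχ μ hμ R M hR hM
  have hfin : (C1 * (R * M) ^ δ * Lam R M) * ∑ b ∈ SF M, ‖lm b * (Real.sqrt (Nm b) : ℂ)‖ ^ 2 ≤ C1 * C2 * (R * M) ^ δ * M ^ (3 * δ) * Lam R M := by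
    calc _ ≤ (C1 * (R * M) ^ δ * Lam R M) * (C2 * M ^ (3 * δ)) := by gcongr; exact h2 M hM lm h
      _ = _ := by ring
  refine le_trans ?_ hfin
  rcases hq with hq | hq
  · refine le_trans (le_of_eq ?_) (hls.weight hG (fun b => lm b * (Real.sqrt (Nm b) : ℂ)) (fun b => (if IsCoprime b t then 1 else 0) * (starRingEnd ℂ) (chiC χ p b)) ?_)
    · refine Finset.sum_congr rfl fun x hx => ?_
      have hx' := mem_SF.1 hx
      rw [Moll_eq h]
      congr 2
      refine Finset.sum_congr rfl fun b hb => ?_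
      rw [hq, chiC_q hχ hx'.2.1 hp ht, mixC, chiC_recip hχ hx'.2.1 (mem_SF.1 hb).2.1]; ring
    · intro b hb
      rw [norm_mul, RCLike.norm_conj]
      refine mul_le_one₀ ?_ (norm_nonneg _) (chiC_norm_le hχ hp _)
      split_ifs <;> simp
  · refine le_trans (le_of_eq ?_) (hls.weight_conj hG (fun b => lm b * (Real.sqrt (Nm b) : ℂ)) (fun b => (if IsCoprime b t then 1 else 0) * (chiC χ p b)) ?_)
    · refine Finset.sum_congr rfl fun x hx => ?_
      have hx' := mem_SF.1 hx
      rw [Moll_eq h]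
      congr 2
      refine Finset.sum_congr rfl fun b hb => ?_
      rw [hq, chiC_q hχ hp hx'.2.1 ht, mixC, chiC_recip hχ hx'.2.1 (mem_SF.1 hb).2.1]; ring
    · intro b hb
      rw [norm_mul]
      refine mul_le_one₀ ?_ (norm_nonneg _) (chiC_norm_le hχ hp _)
      split_ifs <;> simp

end P7a

section P7b
open scoped Classical
variable {χ : Eis → Eis → Eis}

open MeasureTheory in
lemma A1_int_le (hχ : IsCubicSymbol χ) {r s : Eis} (hr : Pri r) (hs : Pri s) (hsq : Squarefree (r * s)) (h1 : r * s ≠ 1)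
    {w : ℝ} (hw : 0 < w) (hwl : w ≤ 1 / Real.sqrt (3 * Nm (r * s))) :
    ∫ v in Set.Ioi (1 / Real.sqrt (3 * Nm (r * s))), v ^ (-(1 / 2) : ℝ) * ‖Th (mixC χ r s) v‖ ≤
    ∫ v in Set.Ioi w, v ^ (-(1 / 2) : ℝ) * ‖Th (mixC χ r s) v‖ := by
  have hi := (mix_int hχ hr hs hsq h1).1.mono_set (Set.Ioi_subset_Ioi hw.le)
  refine setIntegral_mono_set hi ?_ (Set.Ioi_subset_Ioi hwl).eventuallyLE
  filter_upwards [ae_restrict_mem measurableSet_Ioi] with v hv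
  have : 0 < v := hw.trans hv
  simp only [Pi.zero_apply]
  positivity

lemma mixC_swap (r s : Eis) (v : ℝ) : ‖Th (mixC χ r s) v‖ = ‖Th (mixC χ s r) v‖ := by
  have : mixC χ r s = fun k => (starRingEnd ℂ) (mixC χ s r k) := by
    funext k; simp [mixC, mul_comm]
  rw [this, Th_conj, RCLike.norm_conj]

lemma Lam_RP {R P : ℝ} (hP : 1 ≤ P) (hPR : P ≤ R) : Lam R (Real.sqrt (3 * (R * P))) ≤ 5 * (R * P ^ (1 / 3 : ℝ)) := by
  have hR : 1 ≤ R := hP.trans hPR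
  have hR0 : 0 < R := by linarith
  have hP0 : 0 < P := by linarith
  have hs3 : Real.sqrt (3 * (R * P)) ≤ 2 * (R ^ (1 / 2 : ℝ) * P ^ (1 / 2 : ℝ)) := by
    rw [Real.sqrt_le_left (by positivity), mul_pow, mul_pow, ← Real.rpow_natCast (R ^ _), ← Real.rpow_mul hR0.le,
      ← Real.rpow_natCast (P ^ _), ← Real.rpow_mul hP0.le]
    norm_num
    nlinarith [mul_pos hR0 hP0]
  have h1 : R ≤ R * P ^ (1 / 3 : ℝ) := le_mul_of_one_le_right hR0.le (Real.one_le_rpow hP (by norm_num))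
  have h2 : R ^ (1 / 2 : ℝ) * P ^ (1 / 2 : ℝ) ≤ R * P ^ (1 / 3 : ℝ) := by
    calc _ = R ^ (1 / 2 : ℝ) * (P ^ (1 / 6 : ℝ) * P ^ (1 / 3 : ℝ)) := by
          rw [← Real.rpow_add hP0]; norm_num
      _ ≤ R ^ (1 / 2 : ℝ) * (R ^ (1 / 2 : ℝ) * P ^ (1 / 3 : ℝ)) := by
          gcongr
          calc P ^ (1 / 6 : ℝ) ≤ R ^ (1 / 6 : ℝ) := by gcongr
            _ ≤ R ^ (1 / 2 : ℝ) := Real.rpow_le_rpow_of_exponent_le hR (by norm_num)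
      _ = _ := by rw [← mul_assoc, ← Real.rpow_add hR0]; norm_num
  have h3 : (R * Real.sqrt (3 * (R * P))) ^ (2 / 3 : ℝ) ≤ 2 * (R * P ^ (1 / 3 : ℝ)) := by
    calc _ ≤ (2 * (R ^ (3 / 2 : ℝ) * P ^ (1 / 2 : ℝ))) ^ (2 / 3 : ℝ) := by
          refine Real.rpow_le_rpow (by positivity) ?_ (by norm_num)
          calc _ ≤ R * (2 * (R ^ (1 / 2 : ℝ) * P ^ (1 / 2 : ℝ))) := by gcongr
            _ = 2 * ((R ^ (1 : ℝ) * R ^ (1 / 2 : ℝ)) * P ^ (1 / 2 : ℝ)) := by rw [Real.rpow_one]; ring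
            _ = _ := by rw [← Real.rpow_add hR0]; norm_num
      _ = 2 ^ (2 / 3 : ℝ) * (R * P ^ (1 / 3 : ℝ)) := by
          rw [Real.mul_rpow (by norm_num) (by positivity), Real.mul_rpow (by positivity) (by positivity),
            ← Real.rpow_mul hR0.le, ← Real.rpow_mul hP0.le]
          norm_num
      _ ≤ _ := by
          gcongr
          calc (2 : ℝ) ^ (2 / 3 : ℝ) ≤ 2 ^ (1 : ℝ) := Real.rpow_le_rpow_of_exponent_le (by norm_num) (by norm_num)
            _ = 2 := Real.rpow_one _
  unfold Lam
  linarith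

/-- the two shapes of the inner variable -/
def QForm (p t : Eis) (q : Eis → Eis) : Prop :=
  (∀ x, q x = x * p ^ 2 * t ^ 3) ∨ (∀ x, q x = p * x ^ 2 * t ^ 3)

lemma A1_mean {ε : ℝ} (hε : 0 < ε) (hε1 : ε ≤ 1) : ∃ C : ℝ, 0 < C ∧ ∀ χ, IsCubicSymbol χ → ∀ μ, IsMoebius μ →
    ∀ p t : Eis, Pri p → Pri t → ∀ q, QForm p t q → ∀ R : ℝ, Nm p ≤ R → ∀ S ⊆ SF R,
    (∀ x ∈ S, Squarefree (x * p) ∧ x * p ≠ 1 ∧ (9 : Eis) ∣ q x - 1) →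
    ∑ x ∈ S, ‖A₁ χ (q x)‖ ^ 2 ≤ C * ((pd t).card : ℝ) ^ 2 * (R * Real.sqrt (3 * (R * Nm p))) ^ (2 * ε) * (R * Nm p ^ (1 / 3 : ℝ)) := by
  obtain ⟨C1, hC1, h1⟩ := A1_bound
  obtain ⟨C2, hC2, h2⟩ := I_mean hε hε1
  refine ⟨C1 ^ 2 * C2 * 5, by positivity, ?_⟩
  intro χ hχ μ hμ p t hp ht q hq R hPR S hS hS'
  have hP1 := one_le_Nm hp.ne_zero
  have hR : 1 ≤ R := hP1.trans hPR
  set W := Real.sqrt (3 * (R * Nm p)) with hW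
  have hW1 : 1 ≤ W := Real.one_le_sqrt.2 (by nlinarith)
  have hw : 0 < 1 / W := by positivity
  have key : ∀ x ∈ S, ‖A₁ χ (q x)‖ ≤ C1 * (pd t).card * ∫ v in Set.Ioi (1 / W), v ^ (-(1 / 2) : ℝ) * ‖Th (mixC χ x p) v‖ := by
    intro x hx
    have hx1 := mem_SF.1 (hS hx)
    obtain ⟨hsq, hne, h9⟩ := hS' x hx
    have hxp : 0 < Nm (x * p) := Nm_pos (mul_ne_zero hx1.2.1.ne_zero hp.ne_zero)
    have hwl : 1 / W ≤ 1 / Real.sqrt (3 * Nm (x * p)) := by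
      apply one_div_le_one_div_of_le (by positivity)
      apply Real.sqrt_le_sqrt
      rw [Nm_mul]
      have := hx1.1
      gcongr
    rcases hq with hq | hq
    · rw [hq] at h9 ⊢
      refine (h1 χ hχ μ hμ x p t hx1.2.1 hp ht hsq hne h9).trans ?_
      refine mul_le_mul_of_nonneg_left ?_ (by positivity)
      exact A1_int_le hχ hx1.2.1 hp hsq hne hw hwl
    · rw [hq] at h9 ⊢
      rw [mul_comm x p] at hsq hne hwl
      refine (h1 χ hχ μ hμ p x t hp hx1.2.1 ht hsq hne h9).trans ?_
      simp only [mixC_swap x p]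
      refine mul_le_mul_of_nonneg_left ?_ (by positivity)
      exact A1_int_le hχ hp hx1.2.1 hsq hne hw hwl
  have hsub : S ⊆ (SF R).filter (fun r => r * p ≠ 1) := fun x hx => Finset.mem_filter.2 ⟨hS hx, (hS' x hx).2.1⟩
  have hI := h2 χ hχ μ hμ p hp R (1 / W) hR hw (by rw [div_le_one (by linarith)]; exact hW1)
  rw [one_div_one_div, div_div_eq_mul_div, div_one] at hI
  calc _ ≤ ∑ x ∈ S, (C1 * (pd t).card) ^ 2 * (∫ v in Set.Ioi (1 / W), v ^ (-(1 / 2) : ℝ) * ‖Th (mixC χ x p) v‖) ^ 2 := by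
        refine Finset.sum_le_sum fun x hx => ?_
        rw [← mul_pow]
        exact pow_le_pow_left₀ (norm_nonneg _) (key x hx) 2
    _ = (C1 * (pd t).card) ^ 2 * ∑ x ∈ S, (∫ v in Set.Ioi (1 / W), v ^ (-(1 / 2) : ℝ) * ‖Th (mixC χ x p) v‖) ^ 2 := by
        rw [Finset.mul_sum]
    _ ≤ (C1 * (pd t).card) ^ 2 * (C2 * (R * W) ^ (2 * ε) * (5 * (R * Nm p ^ (1 / 3 : ℝ)))) := by
        gcongr
        refine (Finset.sum_le_sum_of_subset_of_nonneg hsub fun _ _ _ => sq_nonneg _).trans (hI.trans ?_)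
        have := Lam_RP hP1 hPR
        gcongr
    _ = _ := by ring

end P7b

section P7c
open scoped Classical
variable {χ : Eis → Eis → Eis}

lemma pow_bd {X a k δ : ℝ} (hX : 2 ≤ X) (ha : 0 ≤ a) (h : a ≤ X ^ k) (hδ : 0 ≤ δ) : a ^ δ ≤ X ^ (k * δ) := by
  rw [Real.rpow_mul (by linarith)]
  exact Real.rpow_le_rpow ha h hδ

lemma Lam_le_sq {R M : ℝ} (hR : 1 ≤ R) (hM : 1 ≤ M) :
    Lam R M ≤ (R ^ (1 / 2 : ℝ) + M ^ (1 / 2 : ℝ) + R ^ (1 / 3 : ℝ) * M ^ (1 / 3 : ℝ)) ^ 2 := by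
  have hR0 : 0 < R := by linarith
  have hM0 : 0 < M := by linarith
  have e1 : R = (R ^ (1 / 2 : ℝ)) ^ 2 := by
    rw [← Real.rpow_natCast (R ^ _), ← Real.rpow_mul hR0.le]; norm_num
  have e2 : M = (M ^ (1 / 2 : ℝ)) ^ 2 := by
    rw [← Real.rpow_natCast (M ^ _), ← Real.rpow_mul hM0.le]; norm_num
  have e3 : (R * M) ^ (2 / 3 : ℝ) = (R ^ (1 / 3 : ℝ) * M ^ (1 / 3 : ℝ)) ^ 2 := by
    rw [← Real.mul_rpow hR0.le hM0.le, ← Real.rpow_natCast ((R * M) ^ _), ← Real.rpow_mul (by positivity)]; norm_num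
  have h1 : 0 ≤ R ^ (1 / 2 : ℝ) := by positivity
  have h2 : 0 ≤ M ^ (1 / 2 : ℝ) := by positivity
  have h3 : 0 ≤ R ^ (1 / 3 : ℝ) * M ^ (1 / 3 : ℝ) := by positivity
  unfold Lam
  rw [e3]
  nlinarith [mul_nonneg h1 h2, mul_nonneg h1 h3, mul_nonneg h2 h3]

lemma blockA {η : ℝ} (hη : 0 < η) (hη1 : η ≤ 1) (Cl : ℝ → ℝ) : ∃ C : ℝ, 0 < C ∧ ∀ χ, IsCubicSymbol χ → ∀ μ, IsMoebius μ →
    ∀ X M : ℝ, 2 ≤ X → 1 ≤ M → M ≤ X ^ (100 : ℝ) → ∀ lm, Adm Cl M lm →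
    ∀ p t : Eis, Pri p → Pri t → ∀ q, QForm p t q → ∀ R : ℝ, Nm p ≤ R → R ≤ X ^ (2 : ℝ) → Nm t ≤ X ^ (2 : ℝ) → ∀ S ⊆ SF R,
    (∀ x ∈ S, Squarefree (x * p) ∧ x * p ≠ 1 ∧ (9 : Eis) ∣ q x - 1) →
    ∑ x ∈ S, ‖Moll χ lm (q x)‖ * ‖A₁ χ (q x)‖ ≤
      C * X ^ η * ((R ^ (1 / 2 : ℝ) + M ^ (1 / 2 : ℝ) + R ^ (1 / 3 : ℝ) * M ^ (1 / 3 : ℝ)) * (R ^ (1 / 2 : ℝ) * Nm p ^ (1 / 6 : ℝ))) := by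
  set δ := η / 208 with hδd
  have hδ : 0 < δ := by positivity
  obtain ⟨C1, hC1, h1⟩ := Moll_mean hδ Cl
  obtain ⟨C2, hC2, h2⟩ := A1_mean hδ (by rw [hδd]; linarith)
  obtain ⟨C3, hC3, h3⟩ := divisor_bound δ hδ
  refine ⟨Real.sqrt (C1 * C2 * C3 ^ 2), by positivity, ?_⟩
  intro χ hχ μ hμ X M hX hM hMX lm hA p t hp ht q hq R hPR hRX hTX S hS hS'
  have hP1 := one_le_Nm hp.ne_zero
  have hT1 := one_le_Nm ht.ne_zero
  have hR : 1 ≤ R := hP1.trans hPR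
  have hX0 : 0 < X := by linarith
  have hX1 : 1 ≤ X := by linarith
  have hR0 : 0 < R := by linarith
  have hP0 : 0 < Nm p := by linarith
  have hM0 : 0 < M := by linarith
  have hT0 : 0 < Nm t := by linarith
  have b1 : ∑ x ∈ S, ‖Moll χ lm (q x)‖ ^ 2 ≤ C1 * (X ^ (102 * δ) * X ^ (300 * δ)) * (R ^ (1 / 2 : ℝ) + M ^ (1 / 2 : ℝ) + R ^ (1 / 3 : ℝ) * M ^ (1 / 3 : ℝ)) ^ 2 := by
    refine (Finset.sum_le_sum_of_subset_of_nonneg hS fun _ _ _ => sq_nonneg _).trans ((h1 χ hχ μ hμ M R hM hR lm hA p t hp ht q hq).trans ?_)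
    have c1 : (R * M) ^ δ ≤ X ^ (102 * δ) := by
      refine pow_bd hX (by positivity) ?_ hδ.le
      calc R * M ≤ X ^ (2 : ℝ) * X ^ (100 : ℝ) := by gcongr
        _ = _ := by rw [← Real.rpow_add hX0]; norm_num
    have c2 : M ^ (3 * δ) ≤ X ^ (300 * δ) := by
      refine (pow_bd hX hM0.le hMX (by positivity)).trans (le_of_eq ?_)
      congr 1; ring
    rw [mul_assoc C1]
    exact mul_le_mul (mul_le_mul_of_nonneg_left (mul_le_mul c1 c2 (by positivity) (by positivity)) hC1.le) (Lam_le_sq hR hM)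
      (Lam_nonneg hR0.le hM0.le) (by positivity)
  have b2 : ∑ x ∈ S, ‖A₁ χ (q x)‖ ^ 2 ≤ C2 * (C3 * X ^ (2 * δ)) ^ 2 * X ^ (10 * δ) * (R * Nm p ^ (1 / 3 : ℝ)) := by
    refine (h2 χ hχ μ hμ p t hp ht q hq R hPR S hS hS').trans ?_
    have c1 : ((pd t).card : ℝ) ≤ C3 * X ^ (2 * δ) := by
      refine (h3 t ht.ne_zero).trans ?_
      gcongr
      exact pow_bd hX hT0.le hTX hδ.le
    have c2 : (R * Real.sqrt (3 * (R * Nm p))) ^ (2 * δ) ≤ X ^ (10 * δ) := by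
      rw [show 10 * δ = 5 * (2 * δ) by ring]
      refine pow_bd hX (by positivity) ?_ (by positivity)
      have : Real.sqrt (3 * (R * Nm p)) ≤ X ^ (3 : ℝ) := by
        rw [Real.sqrt_le_left (by positivity), ← Real.rpow_natCast (X ^ _), ← Real.rpow_mul hX0.le]
        have e3 : (3 : ℝ) ≤ X ^ (2 : ℝ) := by rw [Real.rpow_two]; nlinarith
        calc _ ≤ X ^ (2 : ℝ) * (X ^ (2 : ℝ) * X ^ (2 : ℝ)) := by gcongr; exact hPR.trans hRX
          _ = _ := by rw [← Real.rpow_add hX0, ← Real.rpow_add hX0]; norm_num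
      calc _ ≤ X ^ (2 : ℝ) * X ^ (3 : ℝ) := by gcongr
        _ = _ := by rw [← Real.rpow_add hX0]; norm_num
    gcongr
  have e1 : R * Nm p ^ (1 / 3 : ℝ) = (R ^ (1 / 2 : ℝ) * Nm p ^ (1 / 6 : ℝ)) ^ 2 := by
    rw [mul_pow, ← Real.rpow_natCast (R ^ _), ← Real.rpow_mul hR0.le, ← Real.rpow_natCast (Nm p ^ _), ← Real.rpow_mul hP0.le]
    norm_num
  have e2 : (X ^ (102 * δ) * X ^ (300 * δ)) * ((X ^ (2 * δ)) ^ 2 * X ^ (10 * δ)) = (X ^ η) ^ 2 := by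
    rw [← Real.rpow_natCast (X ^ (2 * δ)), ← Real.rpow_mul hX0.le, ← Real.rpow_natCast (X ^ η), ← Real.rpow_mul hX0.le,
      ← Real.rpow_add hX0, ← Real.rpow_add hX0, ← Real.rpow_add hX0]
    congr 1
    rw [hδd]; push_cast; ring
  have hcs := Finset.sum_mul_sq_le_sq_mul_sq S (fun x => ‖Moll χ lm (q x)‖) (fun x => ‖A₁ χ (q x)‖)
  refine (pow_le_pow_iff_left₀ (Finset.sum_nonneg fun _ _ => by positivity) (by positivity) two_ne_zero).1 ?_
  refine hcs.trans ((mul_le_mul b1 b2 (Finset.sum_nonneg fun _ _ => sq_nonneg _) (by positivity)).trans (le_of_eq ?_))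
  rw [e1]
  simp only [mul_pow] at e2 ⊢
  rw [Real.sq_sqrt (by positivity), ← e2]
  ring

end P7c

section P7d
open scoped Classical
variable {χ : Eis → Eis → Eis}

lemma exists_exp {x : ℝ} (hx : 0 < x) : ∃ a, x = Real.exp a := ⟨Real.log x, (Real.exp_log hx).symm⟩

/-- the target expression -/
def Bd (X Y M : ℝ) : ℝ := X / Y ^ ((5:ℝ)/6) + X ^ ((13:ℝ)/18) + X ^ ((5:ℝ)/6) * M ^ ((1:ℝ)/3) / Y ^ ((1:ℝ)/2)
              + X ^ ((2:ℝ)/3) * M ^ ((1:ℝ)/3) + X ^ ((7:ℝ)/12) * M ^ ((1:ℝ)/2)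

lemma numA0 {Z S T Y M δ : ℝ} (hS : 1 ≤ S) (hT : 1 ≤ T) (hM : 1 ≤ M) (hY : 1 ≤ Y) (hδ : 0 < δ)
    (hZ : S ^ 3 * T ^ 3 ≤ Z) (hU : Y ≤ S * T) :
    ((Z / (S ^ 2 * T ^ 3)) ^ (1 / 2 : ℝ) + M ^ (1 / 2 : ℝ) + (Z / (S ^ 2 * T ^ 3)) ^ (1 / 3 : ℝ) * M ^ (1 / 3 : ℝ)) *
      ((Z / (S ^ 2 * T ^ 3)) ^ (1 / 2 : ℝ) * S ^ (1 / 6 : ℝ)) ≤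
    Z ^ δ * (S * T) ^ (-(1 + δ)) * (Z * Y ^ (-(5 / 6) : ℝ) + Z ^ (7 / 12 : ℝ) * M ^ (1 / 2 : ℝ) + Z ^ (5 / 6 : ℝ) * M ^ (1 / 3 : ℝ) * Y ^ (-(1 / 2) : ℝ)) := by
  have hZ0 : 0 < Z := lt_of_lt_of_le (by positivity) hZ
  obtain ⟨z, rfl⟩ := exists_exp hZ0
  obtain ⟨s, rfl⟩ := exists_exp (show 0 < S by linarith)
  obtain ⟨t, rfl⟩ := exists_exp (show 0 < T by linarith)
  obtain ⟨m, rfl⟩ := exists_exp (show 0 < M by linarith)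
  obtain ⟨y, rfl⟩ := exists_exp (show 0 < Y by linarith)
  simp only [← Real.exp_nat_mul, ← Real.exp_mul, ← Real.exp_add, ← Real.exp_sub, ← Real.exp_zero, Real.exp_le_exp, add_mul, mul_add] at *
  push_cast at *
  have hd : δ * (3 * s + 3 * t) ≤ δ * z := mul_le_mul_of_nonneg_left hZ hδ.le
  have hd1 : 0 ≤ δ * s := by positivity
  have hd2 : 0 ≤ δ * t := by positivity
  gcongr ?_ + ?_ + ?_
  all_goals rw [Real.exp_le_exp, Real.exp_zero]; nlinarith

lemma numB0 {Z S T M δ : ℝ} (hS : 1 ≤ S) (hT : 1 ≤ T) (hM : 1 ≤ M) (hδ : 0 < δ)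
    (hZ : S ^ 3 * T ^ 3 ≤ Z) :
    (((Z / (S * T ^ 3)) ^ (1 / 2 : ℝ)) ^ (1 / 2 : ℝ) + M ^ (1 / 2 : ℝ) + ((Z / (S * T ^ 3)) ^ (1 / 2 : ℝ)) ^ (1 / 3 : ℝ) * M ^ (1 / 3 : ℝ)) *
      (((Z / (S * T ^ 3)) ^ (1 / 2 : ℝ)) ^ (1 / 2 : ℝ) * S ^ (1 / 6 : ℝ)) ≤
    Z ^ δ * (S * T) ^ (-(1 + δ)) * (Z ^ (13 / 18 : ℝ) + Z ^ (7 / 12 : ℝ) * M ^ (1 / 2 : ℝ) + Z ^ (2 / 3 : ℝ) * M ^ (1 / 3 : ℝ)) := by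
  have hZ0 : 0 < Z := lt_of_lt_of_le (by positivity) hZ
  obtain ⟨z, rfl⟩ := exists_exp hZ0
  obtain ⟨s, rfl⟩ := exists_exp (show 0 < S by linarith)
  obtain ⟨t, rfl⟩ := exists_exp (show 0 < T by linarith)
  obtain ⟨m, rfl⟩ := exists_exp (show 0 < M by linarith)
  simp only [← Real.exp_nat_mul, ← Real.exp_mul, ← Real.exp_add, ← Real.exp_sub, ← Real.exp_zero, Real.exp_le_exp, add_mul, mul_add] at *
  push_cast at *
  have hd : δ * (3 * s + 3 * t) ≤ δ * z := mul_le_mul_of_nonneg_left hZ hδ.le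
  have hd1 : 0 ≤ δ * s := by positivity
  have hd2 : 0 ≤ δ * t := by positivity
  gcongr ?_ + ?_ + ?_
  all_goals rw [Real.exp_le_exp, Real.exp_zero]; nlinarith

lemma two_pow {X a : ℝ} (hX : 2 ≤ X) (ha : a ≤ 1) : (2 * X) ^ a ≤ 2 * X ^ a := by
  rw [Real.mul_rpow (by norm_num) (by linarith)]
  have : 0 ≤ X ^ a := Real.rpow_nonneg (by linarith) _
  gcongr
  calc (2 : ℝ) ^ a ≤ 2 ^ (1 : ℝ) := Real.rpow_le_rpow_of_exponent_le (by norm_num) ha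
    _ = 2 := Real.rpow_one _

lemma two_pow_d {X δ : ℝ} (hX : 2 ≤ X) (hδ : 0 < δ) : (2 * X) ^ δ ≤ X ^ (2 * δ) := by
  refine pow_bd hX (by linarith) ?_ hδ.le
  rw [Real.rpow_two]; nlinarith

lemma numA {X S T Y M δ : ℝ} (hX : 2 ≤ X) (hS : 1 ≤ S) (hT : 1 ≤ T) (hM : 1 ≤ M) (hY : 1 ≤ Y) (hδ : 0 < δ)
    (hZ : S ^ 3 * T ^ 3 ≤ 2 * X) (hU : Y ≤ S * T) :
    ((2 * X / (S ^ 2 * T ^ 3)) ^ (1 / 2 : ℝ) + M ^ (1 / 2 : ℝ) + (2 * X / (S ^ 2 * T ^ 3)) ^ (1 / 3 : ℝ) * M ^ (1 / 3 : ℝ)) *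
      ((2 * X / (S ^ 2 * T ^ 3)) ^ (1 / 2 : ℝ) * S ^ (1 / 6 : ℝ)) ≤
    X ^ (2 * δ) * (S * T) ^ (-(1 + δ)) * (2 * Bd X Y M) := by
  have hX0 : 0 < X := by linarith
  have hY0 : 0 < Y := by linarith
  have hM0 : 0 < M := by linarith
  refine (numA0 hS hT hM hY hδ hZ hU).trans ?_
  have c1 := two_pow_d hX hδ
  have c2 := two_pow hX (show (7 / 12 : ℝ) ≤ 1 by norm_num)
  have c3 := two_pow hX (show (5 / 6 : ℝ) ≤ 1 by norm_num)
  refine mul_le_mul (mul_le_mul_of_nonneg_right c1 (by positivity)) ?_ (by positivity) (by positivity)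
  calc _ ≤ (2 * X) * Y ^ (-(5 / 6) : ℝ) + (2 * X ^ (7 / 12 : ℝ)) * M ^ (1 / 2 : ℝ) + (2 * X ^ (5 / 6 : ℝ)) * M ^ (1 / 3 : ℝ) * Y ^ (-(1 / 2) : ℝ) := by
        gcongr
    _ = 2 * (X / Y ^ ((5:ℝ)/6) + X ^ ((5:ℝ)/6) * M ^ ((1:ℝ)/3) / Y ^ ((1:ℝ)/2) + X ^ ((7:ℝ)/12) * M ^ ((1:ℝ)/2)) := by
        rw [Real.rpow_neg hY0.le, Real.rpow_neg hY0.le]; ring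
    _ ≤ _ := by
        have : 0 ≤ X ^ ((13:ℝ)/18) := by positivity
        have : 0 ≤ X ^ ((2:ℝ)/3) * M ^ ((1:ℝ)/3) := by positivity
        unfold Bd; linarith

lemma numB {X S T Y M δ : ℝ} (hX : 2 ≤ X) (hS : 1 ≤ S) (hT : 1 ≤ T) (hM : 1 ≤ M) (hY : 1 ≤ Y) (hδ : 0 < δ)
    (hZ : S ^ 3 * T ^ 3 ≤ 2 * X) :
    (((2 * X / (S * T ^ 3)) ^ (1 / 2 : ℝ)) ^ (1 / 2 : ℝ) + M ^ (1 / 2 : ℝ) + ((2 * X / (S * T ^ 3)) ^ (1 / 2 : ℝ)) ^ (1 / 3 : ℝ) * M ^ (1 / 3 : ℝ)) *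
      (((2 * X / (S * T ^ 3)) ^ (1 / 2 : ℝ)) ^ (1 / 2 : ℝ) * S ^ (1 / 6 : ℝ)) ≤
    X ^ (2 * δ) * (S * T) ^ (-(1 + δ)) * (2 * Bd X Y M) := by
  have hX0 : 0 < X := by linarith
  have hY0 : 0 < Y := by linarith
  have hM0 : 0 < M := by linarith
  refine (numB0 hS hT hM hδ hZ).trans ?_
  have c1 := two_pow_d hX hδ
  have c2 := two_pow hX (show (7 / 12 : ℝ) ≤ 1 by norm_num)
  have c3 := two_pow hX (show (13 / 18 : ℝ) ≤ 1 by norm_num)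
  have c4 := two_pow hX (show (2 / 3 : ℝ) ≤ 1 by norm_num)
  refine mul_le_mul (mul_le_mul_of_nonneg_right c1 (by positivity)) ?_ (by positivity) (by positivity)
  calc _ ≤ 2 * X ^ (13 / 18 : ℝ) + (2 * X ^ (7 / 12 : ℝ)) * M ^ (1 / 2 : ℝ) + (2 * X ^ (2 / 3 : ℝ)) * M ^ (1 / 3 : ℝ) := by
        gcongr
    _ ≤ _ := by
        have : 0 ≤ X / Y ^ ((5:ℝ)/6) := by positivity
        have : 0 ≤ X ^ ((5:ℝ)/6) * M ^ ((1:ℝ)/3) / Y ^ ((1:ℝ)/2) := by positivity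
        unfold Bd; linarith

end P7d

section P7e
open scoped Classical
variable {χ : Eis → Eis → Eis}

lemma fibre {δ : ℝ} (hδ : 0 < δ) (hδ1 : δ ≤ 1) (Cl : ℝ → ℝ) : ∃ C : ℝ, 0 < C ∧ ∀ χ, IsCubicSymbol χ → ∀ μ, IsMoebius μ →
    ∀ X M : ℝ, 2 ≤ X → 1 ≤ M → M ≤ X ^ (100 : ℝ) → ∀ lm, Adm Cl M lm →
    ∀ G : Eis → Eis → Eis → Eis, (∀ p t, QForm p t (G p t)) → ∀ (Q : Finset Eis) (x p t : Eis → Eis) (R : Eis → Eis → ℝ) (B : ℝ), 0 ≤ B →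
    (∀ q ∈ Q, Pri (x q) ∧ Pri (p q) ∧ Pri (t q) ∧ Squarefree (x q * p q) ∧ x q * p q ≠ 1 ∧ (9 : Eis) ∣ q - 1 ∧ q = G (p q) (t q) (x q)) →
    (∀ q ∈ Q, Nm (x q) ≤ R (p q) (t q) ∧ Nm (p q) ≤ R (p q) (t q) ∧ R (p q) (t q) ≤ X ^ (2 : ℝ) ∧ Nm (t q) ≤ X ^ (2 : ℝ) ∧
      ((R (p q) (t q)) ^ (1 / 2 : ℝ) + M ^ (1 / 2 : ℝ) + (R (p q) (t q)) ^ (1 / 3 : ℝ) * M ^ (1 / 3 : ℝ)) *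
        ((R (p q) (t q)) ^ (1 / 2 : ℝ) * Nm (p q) ^ (1 / 6 : ℝ)) ≤ X ^ (2 * δ) * (Nm (p q) * Nm (t q)) ^ (-(1 + δ)) * B) →
    ∑ q ∈ Q, ‖Moll χ lm q‖ * ‖A₁ χ q‖ ≤ C * X ^ (3 * δ) * B := by
  obtain ⟨C1, hC1, h1⟩ := blockA hδ hδ1 Cl
  obtain ⟨C2, hC2, h2⟩ := sum_Nm_le (s := 1 + δ) (by linarith)
  refine ⟨C1 * (C2 * C2), by positivity, ?_⟩
  intro χ hχ μ hμ X M hX hM hMX lm hA G hG Q x p t R B hB hQ1 hQ2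
  have hX0 : 0 < X := by linarith
  set I := Q.image fun q => (p q, t q) with hI
  have key : ∀ y ∈ I, ∑ q ∈ Q with (p q, t q) = y, ‖Moll χ lm q‖ * ‖A₁ χ q‖ ≤
      C1 * X ^ (3 * δ) * B * (Nm y.1 ^ (-(1 + δ)) * Nm y.2 ^ (-(1 + δ))) := by
    intro y hy
    obtain ⟨q0, hq0, rfl⟩ := Finset.mem_image.1 hy
    set p0 := p q0
    set t0 := t q0
    obtain ⟨-, hp0, ht0, -, -, -, -⟩ := hQ1 q0 hq0
    obtain ⟨-, g1, g2, g3, g4⟩ := hQ2 q0 hq0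
    set Qy := Q.filter fun q => (p q, t q) = (p0, t0) with hQy
    have hmem : ∀ q ∈ Qy, q ∈ Q ∧ p q = p0 ∧ t q = t0 := by
      intro q hq
      rw [hQy, Finset.mem_filter, Prod.mk.injEq] at hq
      exact hq
    have hform : ∀ q ∈ Qy, q = G p0 t0 (x q) := by
      intro q hq
      obtain ⟨a, b, c⟩ := hmem q hq
      have := (hQ1 q a).2.2.2.2.2.2
      rwa [b, c] at this
    have hb := h1 χ hχ μ hμ X M hX hM hMX lm hA p0 t0 hp0 ht0 (G p0 t0) (hG p0 t0) (R p0 t0) g1 g2 g3 (Qy.image x) (by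
      intro z hz
      obtain ⟨q, hq, rfl⟩ := Finset.mem_image.1 hz
      obtain ⟨a, b, c⟩ := hmem q hq
      have k1 := hQ1 q a
      have k2 := (hQ2 q a).1
      rw [b, c] at k2
      exact mem_SF.2 ⟨k2, k1.1, k1.2.2.2.1.of_mul_left⟩) (by
      intro z hz
      obtain ⟨q, hq, rfl⟩ := Finset.mem_image.1 hz
      obtain ⟨a, b, c⟩ := hmem q hq
      obtain ⟨-, -, -, k4, k5, k6, -⟩ := hQ1 q a
      rw [b] at k4 k5
      rw [← hform q hq]
      exact ⟨k4, k5, k6⟩)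
    rw [Finset.sum_image (by
      intro q hq q' hq' e
      rw [hform q hq, hform q' hq', e])] at hb
    have e1 : ∑ q ∈ Qy, ‖Moll χ lm q‖ * ‖A₁ χ q‖ = ∑ q ∈ Qy, ‖Moll χ lm (G p0 t0 (x q))‖ * ‖A₁ χ (G p0 t0 (x q))‖ :=
      Finset.sum_congr rfl fun q hq => by rw [← hform q hq]
    rw [e1]
    refine hb.trans ?_
    calc _ ≤ C1 * X ^ δ * (X ^ (2 * δ) * (Nm p0 * Nm t0) ^ (-(1 + δ)) * B) :=
          mul_le_mul_of_nonneg_left g4 (by positivity)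
      _ = C1 * (X ^ δ * X ^ (2 * δ)) * B * (Nm p0 ^ (-(1 + δ)) * Nm t0 ^ (-(1 + δ))) := by
          rw [Real.mul_rpow (Nm_nn _) (Nm_nn _)]; ring
      _ = _ := by
          rw [← Real.rpow_add hX0]; congr 4; ring
  have hn : ∀ y : Eis × Eis, 0 ≤ Nm y.1 ^ (-(1 + δ)) * Nm y.2 ^ (-(1 + δ)) := fun y =>
    mul_nonneg (Real.rpow_nonneg (Nm_nn _) _) (Real.rpow_nonneg (Nm_nn _) _)
  rw [← Finset.sum_fiberwise_of_maps_to (s := Q) (t := I) (g := fun q => (p q, t q)) (fun q hq => Finset.mem_image_of_mem _ hq)]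
  calc _ ≤ ∑ y ∈ I, C1 * X ^ (3 * δ) * B * (Nm y.1 ^ (-(1 + δ)) * Nm y.2 ^ (-(1 + δ))) := Finset.sum_le_sum key
    _ = C1 * X ^ (3 * δ) * B * ∑ y ∈ I, (Nm y.1 ^ (-(1 + δ)) * Nm y.2 ^ (-(1 + δ))) := by rw [Finset.mul_sum]
    _ ≤ C1 * X ^ (3 * δ) * B * (C2 * C2) := by
        gcongr
        calc _ ≤ ∑ y ∈ (I.image Prod.fst) ×ˢ (I.image Prod.snd), (Nm y.1 ^ (-(1 + δ)) * Nm y.2 ^ (-(1 + δ))) := by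
              refine Finset.sum_le_sum_of_subset_of_nonneg ?_ fun y _ _ => hn y
              intro y hy
              exact Finset.mem_product.2 ⟨Finset.mem_image_of_mem _ hy, Finset.mem_image_of_mem _ hy⟩
          _ = (∑ y ∈ I.image Prod.fst, Nm y ^ (-(1 + δ))) * ∑ y ∈ I.image Prod.snd, Nm y ^ (-(1 + δ)) := by
              rw [Finset.sum_mul_sum, Finset.sum_product]
          _ ≤ C2 * C2 := mul_le_mul (h2 _) (h2 _) (Finset.sum_nonneg fun y _ => Real.rpow_nonneg (Nm_nn _) _) hC2.le
    _ = _ := by ring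

end P7e

section P7f
open scoped Classical
variable {χ : Eis → Eis → Eis}

lemma sq_dvd_st {r s t l : Eis} (hr : Squarefree r) (hl : Squarefree l) (h : l ^ 2 ∣ r * s ^ 2 * t ^ 3) : l ∣ s * t := by
  have h1 : l ∣ r * (s * t) := by
    refine hl.isRadical 3 _ (((dvd_pow_self l two_ne_zero).trans h).trans ⟨r ^ 2 * s, by ring⟩)
  obtain ⟨a, b, ha, hb, rfl⟩ := exists_dvd_and_dvd_of_dvd_mul h1
  refine (IsRelPrime.of_squarefree_mul hl).mul_dvd ?_ hb
  obtain ⟨c, rfl⟩ := ha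
  have ha0 : a ≠ 0 := by
    rintro rfl
    exact hr.ne_zero (by simp)
  have h2 : a * a ∣ a * (c * (s ^ 2 * t ^ 3)) := by
    refine (dvd_trans ⟨b ^ 2, by ring⟩ h).trans (dvd_of_eq (by ring))
  have h3 := (IsRelPrime.of_squarefree_mul hr).dvd_of_dvd_mul_left ((mul_dvd_mul_iff_left ha0).1 h2)
  exact (hl.of_mul_left).isRadical 3 _ (h3.trans ⟨s, by ring⟩)

lemma Bd_nonneg {X Y M : ℝ} (hX : 2 ≤ X) (hY : 1 ≤ Y) (hM : 1 ≤ M) : 0 ≤ Bd X Y M := by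
  have : 0 < X := by linarith
  have : 0 < Y := by linarith
  have : 0 < M := by linarith
  unfold Bd; positivity

/-- the decomposition data for `q = r s² t³` -/
def Dec (X : ℝ) (r s t q : Eis) : Prop :=
  Pri r ∧ Pri s ∧ Pri t ∧ Squarefree (r * s) ∧ q = r * s ^ 2 * t ^ 3 ∧ (9 : Eis) ∣ q - 1 ∧ Nm q ≤ 2 * X

lemma two_X_le {X : ℝ} (hX : 2 ≤ X) : 2 * X ≤ X ^ (2 : ℝ) := by
  rw [Real.rpow_two]; nlinarith

lemma Dec.Nm_eq {X : ℝ} {r s t q : Eis} (h : Dec X r s t q) : Nm r * Nm s ^ 2 * Nm t ^ 3 ≤ 2 * X := by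
  have := h.2.2.2.2.2.2
  rwa [h.2.2.2.2.1, Nm_mul, Nm_mul, Nm_pow, Nm_pow] at this

lemma Dec.t_le {X : ℝ} (hX : 2 ≤ X) {r s t q : Eis} (h : Dec X r s t q) : Nm t ≤ X ^ (2 : ℝ) := by
  have h1 := h.Nm_eq
  have hr := one_le_Nm h.1.ne_zero
  have hs := one_le_Nm h.2.1.ne_zero
  have ht := one_le_Nm h.2.2.1.ne_zero
  refine le_trans ?_ (h1.trans (two_X_le hX))
  calc Nm t ≤ Nm t ^ 3 := le_self_pow₀ ht (by norm_num)
    _ = 1 * 1 ^ 2 * Nm t ^ 3 := by ring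
    _ ≤ _ := by gcongr

lemma sumA {δ : ℝ} (hδ : 0 < δ) (hδ1 : δ ≤ 1) (Cl : ℝ → ℝ) : ∃ C : ℝ, 0 < C ∧ ∀ χ, IsCubicSymbol χ → ∀ μ, IsMoebius μ →
    ∀ X Y M : ℝ, 2 ≤ X → 1 ≤ Y → 1 ≤ M → M ≤ X ^ (100 : ℝ) → ∀ lm, Adm Cl M lm → ∀ (r s t : Eis → Eis) (Q : Finset Eis),
    (∀ q ∈ Q, Dec X (r q) (s q) (t q) q) → (∀ q ∈ Q, r q * s q ≠ 1 ∧ Y ≤ Nm (s q) * Nm (t q) ∧ Nm (s q) ≤ Nm (r q)) →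
    ∑ q ∈ Q, ‖Moll χ lm q‖ * ‖A₁ χ q‖ ≤ C * X ^ (3 * δ) * Bd X Y M := by
  obtain ⟨C, hC, h⟩ := fibre hδ hδ1 Cl
  refine ⟨C * 2, by positivity, ?_⟩
  intro χ hχ μ hμ X Y M hX hY hM hMX lm hA r s t Q hQ hQ'
  have := h χ hχ μ hμ X M hX hM hMX lm hA (fun p t x => x * p ^ 2 * t ^ 3) (fun p t => Or.inl fun x => rfl) Q r s t
    (fun p t => 2 * X / (Nm p ^ 2 * Nm t ^ 3)) (2 * Bd X Y M) (by have := Bd_nonneg hX hY hM; positivity) (by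
    intro q hq
    obtain ⟨a1, a2, a3, a4, a5, a6, -⟩ := hQ q hq
    exact ⟨a1, a2, a3, a4, (hQ' q hq).1, a6, a5⟩) (by
    intro q hq
    have hD := hQ q hq
    obtain ⟨-, hUY, hsr⟩ := hQ' q hq
    have hr := one_le_Nm hD.1.ne_zero
    have hs := one_le_Nm hD.2.1.ne_zero
    have ht := one_le_Nm hD.2.2.1.ne_zero
    have h1 := hD.Nm_eq
    have hs2 : 1 ≤ Nm (s q) ^ 2 := one_le_pow₀ hs
    have ht3 : 1 ≤ Nm (t q) ^ 3 := one_le_pow₀ ht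
    have k1 : Nm (r q) ≤ 2 * X / (Nm (s q) ^ 2 * Nm (t q) ^ 3) := by
      rw [le_div_iff₀ (by positivity)]; linarith
    refine ⟨k1, hsr.trans k1, ?_, hD.t_le hX, numA hX hs ht hM hY hδ ?_ hUY⟩
    · refine (div_le_self (by linarith) ?_).trans (two_X_le hX)
      exact one_le_mul_of_one_le_of_one_le hs2 ht3
    · refine le_trans ?_ h1
      calc _ = Nm (s q) * Nm (s q) ^ 2 * Nm (t q) ^ 3 := by ring
        _ ≤ _ := by gcongr)
  linarith

lemma sumB {δ : ℝ} (hδ : 0 < δ) (hδ1 : δ ≤ 1) (Cl : ℝ → ℝ) : ∃ C : ℝ, 0 < C ∧ ∀ χ, IsCubicSymbol χ → ∀ μ, IsMoebius μ →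
    ∀ X Y M : ℝ, 2 ≤ X → 1 ≤ Y → 1 ≤ M → M ≤ X ^ (100 : ℝ) → ∀ lm, Adm Cl M lm → ∀ (r s t : Eis → Eis) (Q : Finset Eis),
    (∀ q ∈ Q, Dec X (r q) (s q) (t q) q) → (∀ q ∈ Q, r q * s q ≠ 1 ∧ Nm (r q) ≤ Nm (s q)) →
    ∑ q ∈ Q, ‖Moll χ lm q‖ * ‖A₁ χ q‖ ≤ C * X ^ (3 * δ) * Bd X Y M := by
  obtain ⟨C, hC, h⟩ := fibre hδ hδ1 Cl
  refine ⟨C * 2, by positivity, ?_⟩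
  intro χ hχ μ hμ X Y M hX hY hM hMX lm hA r s t Q hQ hQ'
  have := h χ hχ μ hμ X M hX hM hMX lm hA (fun p t x => p * x ^ 2 * t ^ 3) (fun p t => Or.inr fun x => rfl) Q s r t
    (fun p t => (2 * X / (Nm p * Nm t ^ 3)) ^ (1 / 2 : ℝ)) (2 * Bd X Y M) (by have := Bd_nonneg hX hY hM; positivity) (by
    intro q hq
    obtain ⟨a1, a2, a3, a4, a5, a6, -⟩ := hQ q hq
    exact ⟨a2, a1, a3, by rwa [mul_comm], by rw [mul_comm]; exact (hQ' q hq).1, a6, a5⟩) (by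
    intro q hq
    have hD := hQ q hq
    obtain ⟨-, hsr⟩ := hQ' q hq
    have hr := one_le_Nm hD.1.ne_zero
    have hs := one_le_Nm hD.2.1.ne_zero
    have ht := one_le_Nm hD.2.2.1.ne_zero
    have h1 := hD.Nm_eq
    have ht3 : 1 ≤ Nm (t q) ^ 3 := one_le_pow₀ ht
    have k1 : Nm (s q) ≤ (2 * X / (Nm (r q) * Nm (t q) ^ 3)) ^ (1 / 2 : ℝ) := by
      rw [← Real.sqrt_eq_rpow]
      apply Real.le_sqrt_of_sq_le
      rw [le_div_iff₀ (by positivity)]; linarith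
    refine ⟨k1, hsr.trans k1, ?_, hD.t_le hX, numB hX hr ht hM hY hδ ?_⟩
    · rw [← Real.sqrt_eq_rpow]
      calc _ ≤ Real.sqrt (2 * X) := by
            apply Real.sqrt_le_sqrt
            exact div_le_self (by linarith) (one_le_mul_of_one_le_of_one_le hr ht3)
        _ ≤ 2 * X := by
            rw [Real.sqrt_le_left (by linarith)]; nlinarith
        _ ≤ _ := two_X_le hX
    · refine le_trans ?_ h1
      calc _ = Nm (r q) * Nm (r q) ^ 2 * Nm (t q) ^ 3 := by ring
        _ ≤ _ := by gcongr)
  linarith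

lemma sumC {δ : ℝ} (hδ : 0 < δ) (Cl : ℝ → ℝ) : ∃ C : ℝ, 0 < C ∧ ∀ χ, IsCubicSymbol χ → ∀ μ, IsMoebius μ →
    ∀ X Y M : ℝ, 2 ≤ X → 1 ≤ Y → 1 ≤ M → M ≤ X ^ (100 : ℝ) → ∀ lm, Adm Cl M lm → ∀ (r s t : Eis → Eis) (Q : Finset Eis),
    (∀ q ∈ Q, Dec X (r q) (s q) (t q) q) → (∀ q ∈ Q, r q * s q = 1) →
    ∑ q ∈ Q, ‖Moll χ lm q‖ * ‖A₁ χ q‖ ≤ C * X ^ (202 * δ) * Bd X Y M := by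
  obtain ⟨C1, hC1, h1⟩ := Moll_triv hδ Cl
  obtain ⟨C2, hC2, h2⟩ := A1_triv hδ
  refine ⟨100 * C1 * C2, by positivity, ?_⟩
  intro χ hχ μ hμ X Y M hX hY hM hMX lm hA r s t Q hQ hQ'
  have hX0 : 0 < X := by linarith
  have hY0 : 0 < Y := by linarith
  have hM0 : 0 < M := by linarith
  have hq3 : ∀ q ∈ Q, q = t q ^ 3 := by
    intro q hq
    have hD := hQ q hq
    have e1 : r q = 1 := pri_unit_eq_one (IsUnit.of_mul_eq_one _ (hQ' q hq)) hD.1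
    have e2 : s q = 1 := by simpa [e1] using hQ' q hq
    have := hD.2.2.2.2.1
    rw [e1, e2] at this
    simpa using this
  have hcard : (Q.card : ℝ) ≤ 25 * (2 * X ^ (1 / 3 : ℝ)) := by
    have hle : Q.card ≤ (ball ((2 * X) ^ (1 / 3 : ℝ))).card := by
      refine Finset.card_le_card_of_injOn t ?_ ?_
      · intro q hq
        rw [Finset.mem_coe, mem_ball]
        have hN := (hQ q hq).2.2.2.2.2.2
        rw [hq3 q hq, Nm_pow] at hN
        calc Nm (t q) = (Nm (t q) ^ 3) ^ (1 / 3 : ℝ) := by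
              rw [← Real.rpow_natCast (Nm (t q)), ← Real.rpow_mul (Nm_nn _)]; norm_num
          _ ≤ _ := Real.rpow_le_rpow (pow_nonneg (Nm_nn _) _) hN (by norm_num)
      · intro a ha b hb e
        rw [hq3 a ha, hq3 b hb, e]
    calc (Q.card : ℝ) ≤ ((ball ((2 * X) ^ (1 / 3 : ℝ))).card : ℝ) := by exact_mod_cast hle
      _ ≤ 25 * (2 * X) ^ (1 / 3 : ℝ) := card_ball (Real.one_le_rpow (by linarith) (by norm_num))
      _ ≤ _ := by gcongr; exact two_pow hX (by norm_num)
  have hterm : ∀ q ∈ Q, ‖Moll χ lm q‖ * ‖A₁ χ q‖ ≤ (C1 * (M ^ (1 / 2 : ℝ) * X ^ (200 * δ))) * (C2 * (2 * X ^ (1 / 4 : ℝ) * X ^ (2 * δ))) := by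
    intro q hq
    have hD := hQ q hq
    have hPq := Pri.ofNine hD.2.2.2.2.2.1
    have c1 : M ^ (1 / 2 + 2 * δ) ≤ M ^ (1 / 2 : ℝ) * X ^ (200 * δ) := by
      rw [Real.rpow_add hM0]
      gcongr
      refine (pow_bd hX hM0.le hMX (by positivity)).trans (le_of_eq ?_)
      congr 1; ring
    have c2 : Nm q ^ (1 / 4 + δ) ≤ 2 * X ^ (1 / 4 : ℝ) * X ^ (2 * δ) := by
      calc _ ≤ (2 * X) ^ (1 / 4 + δ) := Real.rpow_le_rpow (Nm_nn _) hD.2.2.2.2.2.2 (by positivity)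
        _ = (2 * X) ^ (1 / 4 : ℝ) * (2 * X) ^ δ := Real.rpow_add (by positivity) _ _
        _ ≤ _ := mul_le_mul (two_pow hX (by norm_num)) (two_pow_d hX hδ) (by positivity) (by positivity)
    refine mul_le_mul ((h1 χ hχ M hM lm hA q hPq).trans ?_) ((h2 χ hχ q hPq).trans ?_) (norm_nonneg _) (by positivity)
    · gcongr
    · gcongr
  calc _ ≤ Q.card • ((C1 * (M ^ (1 / 2 : ℝ) * X ^ (200 * δ))) * (C2 * (2 * X ^ (1 / 4 : ℝ) * X ^ (2 * δ)))) := Finset.sum_le_card_nsmul _ _ _ hterm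
    _ = (Q.card : ℝ) * ((C1 * (M ^ (1 / 2 : ℝ) * X ^ (200 * δ))) * (C2 * (2 * X ^ (1 / 4 : ℝ) * X ^ (2 * δ)))) := by rw [nsmul_eq_mul]
    _ ≤ (25 * (2 * X ^ (1 / 3 : ℝ))) * ((C1 * (M ^ (1 / 2 : ℝ) * X ^ (200 * δ))) * (C2 * (2 * X ^ (1 / 4 : ℝ) * X ^ (2 * δ)))) := by gcongr
    _ = 100 * C1 * C2 * (X ^ (200 * δ) * X ^ (2 * δ)) * ((X ^ (1 / 3 : ℝ) * X ^ (1 / 4 : ℝ)) * M ^ (1 / 2 : ℝ)) := by ring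
    _ = 100 * C1 * C2 * X ^ (202 * δ) * (X ^ (7 / 12 : ℝ) * M ^ (1 / 2 : ℝ)) := by
        rw [← Real.rpow_add hX0, ← Real.rpow_add hX0]; norm_num; left; left; congr 1; ring
    _ ≤ _ := by
        gcongr
        have : 0 ≤ X / Y ^ ((5:ℝ)/6) + X ^ ((13:ℝ)/18) + X ^ ((5:ℝ)/6) * M ^ ((1:ℝ)/3) / Y ^ ((1:ℝ)/2)
              + X ^ ((2:ℝ)/3) * M ^ ((1:ℝ)/3) := by positivity
        unfold Bd; linarith

end P7f

section P7g
open scoped Classical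
variable {χ : Eis → Eis → Eis}

lemma RY_eq (μ : Eis → ℤ) (Y : ℝ) {q : Eis} (hq : Pri q) :
    RY μ Y q = ∑ l ∈ (pd q).filter (fun l => l ^ 2 ∣ q ∧ Y < Nm l), μ l := by
  unfold RY
  apply finsum_mem_eq_sum_of_inter_support_eq
  congr 1
  ext l
  simp only [Set.mem_setOf_eq, Finset.coe_filter, mem_pd hq.ne_zero]
  constructor
  · rintro ⟨⟨k, c, hc, rfl⟩, h2, h3⟩
    have hd := (dvd_pow_self (lam ^ k * c) two_ne_zero).trans h2
    refine ⟨⟨?_, hd⟩, h2, h3⟩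
    rcases Nat.eq_zero_or_pos k with rfl | hk
    · simpa [Pri] using hc
    · exact absurd (((dvd_pow_self lam hk.ne').mul_right c).trans hd) hq.not_lam_dvd
  · rintro ⟨⟨h1, -⟩, h2, h3⟩
    exact ⟨⟨0, l, h1, by simp⟩, h2, h3⟩

lemma RY_abs {μ : Eis → ℤ} (hμ : IsMoebius μ) (Y : ℝ) {q : Eis} (hq : Pri q) : |(RY μ Y q : ℝ)| ≤ (pd q).card := by
  rw [RY_eq μ Y hq]
  push_cast
  refine (Finset.abs_sum_le_sum_abs _ _).trans ?_
  calc _ ≤ ∑ l ∈ (pd q).filter (fun l => l ^ 2 ∣ q ∧ Y < Nm l), (1 : ℝ) := by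
        refine Finset.sum_le_sum fun l hl => ?_
        have := moebius_abs hμ ((mem_pd hq.ne_zero).1 (Finset.mem_filter.1 hl).1).1
        exact_mod_cast this
    _ ≤ _ := by
        rw [Finset.sum_const, nsmul_eq_mul, mul_one]
        exact_mod_cast Finset.card_filter_le _ _

lemma RY_ne {μ : Eis → ℤ} (hμ : IsMoebius μ) {Y : ℝ} {q : Eis} (hq : Pri q) (h : RY μ Y q ≠ 0) :
    ∃ l, Squarefree l ∧ l ^ 2 ∣ q ∧ Y < Nm l := by
  rw [RY_eq μ Y hq] at h
  obtain ⟨l, hl, hl0⟩ := Finset.exists_ne_zero_of_sum_ne_zero h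
  have := (Finset.mem_filter.1 hl).2
  refine ⟨l, ?_, this⟩
  by_contra hns
  exact hl0 (hμ.eq_zero l hns)

lemma Qsum {δ : ℝ} (hδ : 0 < δ) (hδ1 : δ ≤ 1) (Cl : ℝ → ℝ) : ∃ C : ℝ, 0 < C ∧ ∀ χ, IsCubicSymbol χ → ∀ μ, IsMoebius μ →
    ∀ X Y M : ℝ, 2 ≤ X → 1 ≤ Y → 1 ≤ M → M ≤ X ^ (100 : ℝ) → ∀ lm, Adm Cl M lm → ∀ (Q : Finset Eis),
    (∀ q ∈ Q, (9 : Eis) ∣ q - 1 ∧ Nm q ≤ 2 * X ∧ RY μ Y q ≠ 0) →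
    ∑ q ∈ Q, ‖Moll χ lm q‖ * ‖A₁ χ q‖ ≤ C * X ^ (202 * δ) * Bd X Y M := by
  obtain ⟨C1, hC1, h1⟩ := sumA hδ hδ1 Cl
  obtain ⟨C2, hC2, h2⟩ := sumB hδ hδ1 Cl
  obtain ⟨C3, hC3, h3⟩ := sumC hδ Cl
  refine ⟨C1 + C2 + C3, by positivity, ?_⟩
  intro χ hχ μ hμ X Y M hX hY hM hMX lm hA Q hQ
  choose! r s t hrst using exists_abc
  have hD : ∀ q ∈ Q, Dec X (r q) (s q) (t q) q := by
    intro q hq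
    obtain ⟨a, b, c⟩ := hQ q hq
    obtain ⟨d1, d2, d3, d4, d5⟩ := hrst q (Pri.ofNine a)
    exact ⟨d1, d2, d3, d4, d5, a, b⟩
  have hU : ∀ q ∈ Q, Y ≤ Nm (s q) * Nm (t q) := by
    intro q hq
    obtain ⟨a, b, c⟩ := hQ q hq
    obtain ⟨l, l1, l2, l3⟩ := RY_ne hμ (Pri.ofNine a) c
    obtain ⟨d1, d2, d3, d4, d5, -, -⟩ := hD q hq
    rw [d5] at l2
    have hst := sq_dvd_st d4.of_mul_left l1 l2
    have := Nm_le_of_dvd (mul_ne_zero d2.ne_zero d3.ne_zero) hst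
    rw [Nm_mul] at this
    linarith
  have hBd := Bd_nonneg hX hY hM
  have hXp : X ^ (3 * δ) ≤ X ^ (202 * δ) := Real.rpow_le_rpow_of_exponent_le (by linarith) (by linarith)
  have k1 := h1 χ hχ μ hμ X Y M hX hY hM hMX lm hA r s t (((Q.filter fun q => ¬ r q * s q = 1)).filter fun q => Nm (s q) ≤ Nm (r q))
    (fun q hq => hD q (Finset.mem_filter.1 (Finset.mem_filter.1 hq).1).1) (fun q hq => by
      rw [Finset.mem_filter, Finset.mem_filter] at hq
      exact ⟨hq.1.2, hU q hq.1.1, hq.2⟩)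
  have k2 := h2 χ hχ μ hμ X Y M hX hY hM hMX lm hA r s t (((Q.filter fun q => ¬ r q * s q = 1)).filter fun q => ¬ Nm (s q) ≤ Nm (r q))
    (fun q hq => hD q (Finset.mem_filter.1 (Finset.mem_filter.1 hq).1).1) (fun q hq => by
      rw [Finset.mem_filter, Finset.mem_filter] at hq
      exact ⟨hq.1.2, (not_le.1 hq.2).le⟩)
  have k3 := h3 χ hχ μ hμ X Y M hX hY hM hMX lm hA r s t (Q.filter fun q => r q * s q = 1)
    (fun q hq => hD q (Finset.mem_filter.1 hq).1) (fun q hq => (Finset.mem_filter.1 hq).2)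
  rw [← Finset.sum_filter_add_sum_filter_not Q (fun q => r q * s q = 1),
    ← Finset.sum_filter_add_sum_filter_not (Q.filter fun q => ¬ r q * s q = 1) (fun q => Nm (s q) ≤ Nm (r q))]
  have k1' : C1 * X ^ (3 * δ) * Bd X Y M ≤ C1 * X ^ (202 * δ) * Bd X Y M := by gcongr
  have k2' : C2 * X ^ (3 * δ) * Bd X Y M ≤ C2 * X ^ (202 * δ) * Bd X Y M := by gcongr
  linarith

lemma SR_final {δ : ℝ} (hδ : 0 < δ) (hδ1 : δ ≤ 1) {F : ℝ → ℝ} (hF : IsTestFn F) (Cl : ℝ → ℝ) : ∃ C : ℝ, 0 < C ∧ ∀ χ, IsCubicSymbol χ → ∀ μ, IsMoebius μ →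
    ∀ X Y M : ℝ, 2 ≤ X → 1 ≤ Y → 1 ≤ M → M ≤ X ^ (100 : ℝ) → ∀ lm, Adm Cl M lm →
    SR μ Y X F (fun q => Moll χ lm q * A₁ χ q) ≤ C * X ^ (204 * δ) * Bd X Y M := by
  obtain ⟨C1, hC1, h1⟩ := Qsum hδ hδ1 Cl
  obtain ⟨C2, hC2, h2⟩ := divisor_bound δ hδ
  refine ⟨C2 * C1, by positivity, ?_⟩
  intro χ hχ μ hμ X Y M hX hY hM hMX lm hA
  have hX0 : 0 < X := by linarith
  set Q := (ball (2 * X)).filter (fun q => (9 : Eis) ∣ q - 1 ∧ RY μ Y q ≠ 0) with hQ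
  have e : SR μ Y X F (fun q => Moll χ lm q * A₁ χ q) =
      ∑ q ∈ Q, |(RY μ Y q : ℝ)| * ‖Moll χ lm q * A₁ χ q‖ * F (Nm q / X) := by
    unfold SR
    apply finsum_mem_eq_sum_of_inter_support_eq
    ext q
    simp only [Set.mem_inter_iff, Set.mem_setOf_eq, Function.mem_support, Finset.mem_coe, hQ, Finset.mem_filter, mem_ball]
    constructor
    · rintro ⟨h9, hne⟩
      refine ⟨⟨?_, h9, ?_⟩, hne⟩
      · have := (hF.supp _ (right_ne_zero_of_mul hne)).2
        rw [div_lt_iff₀ hX0] at this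
        exact this.le
      · intro h0
        apply hne
        rw [h0]; simp
    · rintro ⟨⟨-, h9, -⟩, hne⟩
      exact ⟨h9, hne⟩
  rw [e]
  have hmem : ∀ q ∈ Q, (9 : Eis) ∣ q - 1 ∧ Nm q ≤ 2 * X ∧ RY μ Y q ≠ 0 := by
    intro q hq
    rw [hQ, Finset.mem_filter, mem_ball] at hq
    exact ⟨hq.2.1, hq.1, hq.2.2⟩
  calc _ ≤ ∑ q ∈ Q, (C2 * X ^ (2 * δ)) * (‖Moll χ lm q‖ * ‖A₁ χ q‖) := by
        refine Finset.sum_le_sum fun q hq => ?_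
        obtain ⟨a, b, -⟩ := hmem q hq
        have hP := Pri.ofNine a
        have c1 : |(RY μ Y q : ℝ)| ≤ C2 * X ^ (2 * δ) := by
          refine (RY_abs hμ Y hP).trans ((h2 q hP.ne_zero).trans ?_)
          gcongr
          exact (Real.rpow_le_rpow (Nm_nn _) b hδ.le).trans (two_pow_d hX hδ)
        rw [norm_mul]
        refine (mul_le_of_le_one_right (by positivity) (hF.le_one _)).trans ?_
        gcongr
    _ = (C2 * X ^ (2 * δ)) * ∑ q ∈ Q, ‖Moll χ lm q‖ * ‖A₁ χ q‖ := by rw [Finset.mul_sum]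
    _ ≤ (C2 * X ^ (2 * δ)) * (C1 * X ^ (202 * δ) * Bd X Y M) := by
        gcongr
        exact h1 χ hχ μ hμ X Y M hX hY hM hMX lm hA Q hmem
    _ = C2 * C1 * (X ^ (2 * δ) * X ^ (202 * δ)) * Bd X Y M := by ring
    _ = _ := by
        rw [← Real.rpow_add hX0]; congr 3; ring

end P7g

/-- Proposition 1.2: the bound
`𝒮_R(|𝓜(q) A₁(q)|; F) ≪ X^ε (X/Y^{5/6} + X^{13/18} + X^{5/6}M^{1/3}/Y^{1/2}
  + X^{2/3}M^{1/3} + X^{7/12}M^{1/2})`,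
the implied constant depending only on `ε`, `F`, and the constants `Cl` in the bound
on the mollifier coefficients. -/
theorem SR_first_moment_bound
    (ε : ℝ) (hε : 0 < ε) (F : ℝ → ℝ) (hF : IsTestFn F) (Cl : ℝ → ℝ) :
    ∃ C : ℝ, ∀ (χ : Eis → Eis → Eis), IsCubicSymbol χ →
      ∀ (μ : Eis → ℤ), IsMoebius μ →
      ∀ (X Y M : ℝ), 2 ≤ X → 1 ≤ Y → Y ≤ X ^ (100 : ℝ) → 1 ≤ M → M ≤ X ^ (100 : ℝ) →
      ∀ lm : Eis → ℂ,
        (∀ b : Eis, lm b ≠ 0 → Rep b ∧ Squarefree b ∧ IsCoprime b 3 ∧ Nm b ≤ M) →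
        (∀ ε' : ℝ, 0 < ε' → ∀ b : Eis, ‖lm b‖ ≤ Cl ε' * Nm b ^ (-1 + ε')) →
        SR μ Y X F (fun q => Moll χ lm q * A₁ χ q)
          ≤ C * X ^ ε *
            (X / Y ^ ((5:ℝ)/6) + X ^ ((13:ℝ)/18) + X ^ ((5:ℝ)/6) * M ^ ((1:ℝ)/3) / Y ^ ((1:ℝ)/2)
              + X ^ ((2:ℝ)/3) * M ^ ((1:ℝ)/3) + X ^ ((7:ℝ)/12) * M ^ ((1:ℝ)/2)) := by
  set δ : ℝ := min (ε / 204) 1 with hδd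
  have hδ : 0 < δ := lt_min (by positivity) one_pos
  obtain ⟨C, hC, h⟩ := SR_final hδ (min_le_right _ _) hF Cl
  refine ⟨C, ?_⟩
  intro χ hχ μ hμ X Y M hX hY _ hM hMX lm hl1 hl2
  refine (h χ hχ μ hμ X Y M hX hY hM hMX lm ⟨hl1, hl2⟩).trans ?_
  have hBd := Bd_nonneg hX hY hM
  have hexp : 204 * δ ≤ ε := by
    have := min_le_left (ε / 204) 1
    rw [← hδd] at this
    linarith
  change C * X ^ (204 * δ) * Bd X Y M ≤ C * X ^ ε * Bd X Y M
  have : X ^ (204 * δ) ≤ X ^ ε := Real.rpow_le_rpow_of_exponent_le (by linarith) hexp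
  gcongr

end CubicPaper
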